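/- Let U ∈ 𝔖_F(𝕊_1^+) with F satisfying, for some ℓ ≥ 4 and C_ℓ > 0: |F(X,t)| ≤ C_ℓ |(X,t)|^{ℓ−2} on 𝕊_1^+, |∇_X F(X,t)| ≤ C_ℓ |(X,t)|^{ℓ−3} and |∂_t F(X,t)| ≤ C_ℓ |(X,t)|^{ℓ−4} on (𝔹_{1/2} ∩ ℝ^{n+1}_+) × (−1/4, 0]. Fix σ ∈ (0,1), suppose κ = Φ_{ℓ,σ}(U,0⁺) < ℓ − 1 + σ, and set s = (1−a)/2. Then either κ = 1 + s or κ ≥ 2. -/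

import Mathlib

/- Formalization of results from "The structure of the singular set in the thin obstacle
problem for degenerate parabolic equations" by Banerjee, Danielli, Garofalo, Petrosyan.

Points of ℝ^{n+1} are written X = (x,y) with x : Fin n → ℝ and y : ℝ; functions of
space-time are `U : (Fin n → ℝ) → ℝ → ℝ → ℝ`, with `U x y t`. -/

noncomputable section

open MeasureTheory Filter Topology

/-- Functions on ℝⁿ × ℝ × ℝ, written `U x y t` for `X = (x,y)` and time `t`. -/
abbrev Fn (n : ℕ) := (Fin n → ℝ) → ℝ → ℝ → ℝ

/-- Space-time points `(x, y, t)`. -/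
abbrev Pt (n : ℕ) := (Fin n → ℝ) × ℝ × ℝ

/-- Partial derivative in the direction of the i-th thin coordinate. -/
def pdx {n : ℕ} (i : Fin n) (U : Fn n) (x : Fin n → ℝ) (y t : ℝ) : ℝ :=
  fderiv ℝ (fun x' => U x' y t) x (Pi.single i 1)

/-- Partial derivative in the extension variable y. -/
def pdy {n : ℕ} (U : Fn n) (x : Fin n → ℝ) (y t : ℝ) : ℝ :=
  deriv (fun y' => U x y' t) y

/-- Time derivative. -/
def pdt {n : ℕ} (U : Fn n) (x : Fin n → ℝ) (y t : ℝ) : ℝ :=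
  deriv (fun t' => U x y t') t

/-- Squared norm |∇U|² of the full spatial gradient. -/
def gradSq {n : ℕ} (U : Fn n) (x : Fin n → ℝ) (y t : ℝ) : ℝ :=
  (∑ i, (pdx i U x y t) ^ 2) + (pdy U x y t) ^ 2

/-- |∇V − ∇W|². -/
def gradDiffSq {n : ℕ} (V W : Fn n) (x : Fin n → ℝ) (y t : ℝ) : ℝ :=
  (∑ i, (pdx i V x y t - pdx i W x y t) ^ 2) + (pdy V x y t - pdy W x y t) ^ 2

/-- The generator Z f = ⟨X, ∇f⟩ + 2 t ∂ₜ f of the parabolic dilations. -/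
def Zop {n : ℕ} (U : Fn n) (x : Fin n → ℝ) (y t : ℝ) : ℝ :=
  (∑ i, x i * pdx i U x y t) + y * pdy U x y t + 2 * t * pdt U x y t

/-- Laplacian in the x variables only. -/
def lapx {n : ℕ} (U : Fn n) (x : Fin n → ℝ) (y t : ℝ) : ℝ :=
  ∑ i, pdx i (fun x' y' t' => pdx i U x' y' t') x y t

/-- Second derivative in y. -/
def pdyy {n : ℕ} (U : Fn n) (x : Fin n → ℝ) (y t : ℝ) : ℝ :=
  pdy (fun x' y' t' => pdy U x' y' t') x y t

/-- Full spatial Laplacian in the variables X = (x,y). -/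
def lapFull {n : ℕ} (U : Fn n) (x : Fin n → ℝ) (y t : ℝ) : ℝ :=
  lapx U x y t + pdyy U x y t

/-- |X|² for X = (x,y). -/
def nsq {n : ℕ} (x : Fin n → ℝ) (y : ℝ) : ℝ := (∑ i, (x i) ^ 2) + y ^ 2

/-- The backward Neumann fundamental solution Ḡ_a(X,t), for t < 0. -/
def Gbar (n : ℕ) (a : ℝ) (x : Fin n → ℝ) (y t : ℝ) : ℝ :=
  (4 * Real.pi) ^ (-(n : ℝ) / 2) / ((2:ℝ) ^ a * Real.Gamma ((a + 1) / 2)) *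
    |t| ^ (-((n : ℝ) + a + 1) / 2) * Real.exp (-(nsq x y) / (4 * |t|))

/-- The half-strip 𝕊_r⁺ = ℝ^{n+1}_+ × (−r², 0]. -/
def Splus (n : ℕ) (r : ℝ) : Set (Pt n) :=
  {p | 0 < p.2.1 ∧ p.2.2 ∈ Set.Ioc (-(r ^ 2)) 0}

/-- The Gaussian weight Ḡ_a(X,t) yᵃ. -/
def wgt (n : ℕ) (a : ℝ) (p : Pt n) : ℝ :=
  Gbar n a p.1 p.2.1 p.2.2 * p.2.1 ^ a

/-- The height function H(U,r). -/
def Hfn (n : ℕ) (a : ℝ) (U : Fn n) (r : ℝ) : ℝ :=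
  (1 / r ^ 2) * ∫ p in Splus n r, (U p.1 p.2.1 p.2.2) ^ 2 * wgt n a p

/-- The energy D(U,r). -/
def Dfn (n : ℕ) (a : ℝ) (U : Fn n) (r : ℝ) : ℝ :=
  (1 / r ^ 2) * ∫ p in Splus n r, |p.2.2| * gradSq U p.1 p.2.1 p.2.2 * wgt n a p

/-- The total energy I(U,r). -/
def Ifn (n : ℕ) (a : ℝ) (U : Fn n) (r : ℝ) : ℝ :=
  (1 / (2 * r ^ 2)) * ∫ p in Splus n r, U p.1 p.2.1 p.2.2 * Zop U p.1 p.2.1 p.2.2 * wgt n a p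

/-- The set of thin points in S₁ where both U and its weighted normal derivative
∂_yᵃ U vanish.  The extended free boundary Γ_*(U) is its boundary in S₁. -/
def ZeroSet (n : ℕ) (a : ℝ) (U : Fn n) : Set ((Fin n → ℝ) × ℝ) :=
  {q | q.2 ∈ Set.Ioc (-1 : ℝ) 0 ∧ U q.1 0 q.2 = 0 ∧
    Tendsto (fun y => y ^ a * pdy U q.1 y q.2) (𝓝[>] (0 : ℝ)) (𝓝 0)}

/-- The Signorini class 𝔖_F(𝕊₁⁺). -/
structure SignoriniMem (n : ℕ) (a : ℝ) (F U : Fn n) : Prop where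
  /-- continuity up to the thin space -/
  cont : ContinuousOn (fun p : Pt n => U p.1 p.2.1 p.2.2)
    {p : Pt n | 0 ≤ p.2.1 ∧ p.2.2 ∈ Set.Ioc (-1 : ℝ) 0}
  /-- bounded support in the space variables -/
  bddSupp : ∃ R > (0:ℝ), ∀ x y t, R ^ 2 ≤ nsq x y → U x y t = 0
  /-- smoothness in {y > 0} -/
  smooth : ∀ x y t, 0 < y → t ∈ Set.Ioc (-1 : ℝ) 0 →
    ContDiffAt ℝ (⊤ : ℕ∞) (fun p : Pt n => U p.1 p.2.1 p.2.2) (x, y, t)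
  /-- the equation yᵃ ∂ₜU = div(yᵃ ∇U) + yᵃ F holds classically in {y > 0} -/
  pde : ∀ x y t, 0 < y → t ∈ Set.Ioc (-1 : ℝ) 0 →
    pdt U x y t = lapFull U x y t + (a / y) * pdy U x y t + F x y t
  /-- ∇ₓU extends parabolically Hölder continuously up to {y = 0} -/
  holderX : ∃ α > (0:ℝ), ∃ C : ℝ, ∀ i : Fin n, ∀ x y t x' y' t',
    0 < y → 0 < y' → t ∈ Set.Ioc (-1 : ℝ) 0 → t' ∈ Set.Ioc (-1 : ℝ) 0 →
    |pdx i U x y t - pdx i U x' y' t'| ≤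
      C * ((∑ j, (x j - x' j) ^ 2) + (y - y') ^ 2 + |t - t'|) ^ (α / 2)
  /-- yᵃ ∂_y U extends parabolically Hölder continuously up to {y = 0} -/
  holderY : ∃ α > (0:ℝ), ∃ C : ℝ, ∀ x y t x' y' t',
    0 < y → 0 < y' → t ∈ Set.Ioc (-1 : ℝ) 0 → t' ∈ Set.Ioc (-1 : ℝ) 0 →
    |y ^ a * pdy U x y t - y' ^ a * pdy U x' y' t'| ≤
      C * ((∑ j, (x j - x' j) ^ 2) + (y - y') ^ 2 + |t - t'|) ^ (α / 2)
  /-- ∂ₜU ∈ L^∞(𝕊₁⁺) -/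
  bddTime : ∃ M : ℝ, ∀ x y t, 0 < y → t ∈ Set.Ioc (-1 : ℝ) 0 → |pdt U x y t| ≤ M
  /-- yᵃ |∇ ∂ₓᵢ U|² integrable on 𝕊₁⁺ -/
  intXX : ∀ i : Fin n, IntegrableOn
    (fun p : Pt n => p.2.1 ^ a * gradSq (fun x y t => pdx i U x y t) p.1 p.2.1 p.2.2)
    (Splus n 1)
  /-- y^{−a} (∂_y(yᵃ ∂_y U))² integrable on 𝕊₁⁺ -/
  intYY : IntegrableOn
    (fun p : Pt n => p.2.1 ^ (-a) *
      (pdy (fun x y t => y ^ a * pdy U x y t) p.1 p.2.1 p.2.2) ^ 2) (Splus n 1)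
  /-- U ≥ 0 on the thin space -/
  nonneg : ∀ x, ∀ t ∈ Set.Ioc (-1 : ℝ) 0, 0 ≤ U x 0 t
  /-- the Signorini complementarity conditions on the thin space -/
  signorini : ∀ x, ∀ t ∈ Set.Ioc (-1 : ℝ) 0, ∃ L ≤ (0:ℝ),
    Tendsto (fun y => y ^ a * pdy U x y t) (𝓝[>] (0 : ℝ)) (𝓝 L) ∧ U x 0 t * L = 0
  /-- (0,0) belongs to the extended free boundary Γ_*(U) -/
  originFB : (0, 0) ∈ closure (ZeroSet n a U) ∧
    (0, 0) ∈ closure ({q : (Fin n → ℝ) × ℝ | q.2 ∈ Set.Ioc (-1 : ℝ) 0} \ ZeroSet n a U)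

/-- The growth bound |F(X,t)| ≤ C_ℓ |(X,t)|^{ℓ−2} on 𝕊₁⁺. -/
def FGrowth (n : ℕ) (F : Fn n) (l Cl : ℝ) : Prop :=
  ∀ x y t, 0 < y → t ∈ Set.Ioc (-1 : ℝ) 0 →
    |F x y t| ≤ Cl * (nsq x y + |t|) ^ ((l - 2) / 2)

/-- The growth bound |∇_X F(X,t)| ≤ C_ℓ |(X,t)|^{ℓ−3} on 𝔹_{1/2}⁺ × (−1/4, 0]. -/
def FGradGrowth (n : ℕ) (F : Fn n) (l Cl : ℝ) : Prop :=
  ∀ x y t, 0 < y → nsq x y < (1/2 : ℝ) ^ 2 → t ∈ Set.Ioc (-(1/4 : ℝ)) 0 →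
    Real.sqrt (gradSq F x y t) ≤ Cl * (nsq x y + |t|) ^ ((l - 3) / 2)

/-- The growth bound |∂ₜF(X,t)| ≤ C_ℓ |(X,t)|^{ℓ−4} on 𝔹_{1/2}⁺ × (−1/4, 0]. -/
def FTimeGrowth (n : ℕ) (F : Fn n) (l Cl : ℝ) : Prop :=
  ∀ x y t, 0 < y → nsq x y < (1/2 : ℝ) ^ 2 → t ∈ Set.Ioc (-(1/4 : ℝ)) 0 →
    |pdt F x y t| ≤ Cl * (nsq x y + |t|) ^ ((l - 4) / 2)

/-- r ↦ log max{H(U,r), r^{2ℓ−2+2σ}}. -/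
def logMaxH (n : ℕ) (a : ℝ) (U : Fn n) (l σ : ℝ) (r : ℝ) : ℝ :=
  Real.log (max (Hfn n a U r) (r ^ (2 * l - 2 + 2 * σ)))

/-- The set of radii in (0,1) where `logMaxH` is differentiable (it is locally
Lipschitz, hence this set has full measure). -/
def diffSet (n : ℕ) (a : ℝ) (U : Fn n) (l σ : ℝ) : Set ℝ :=
  {r | r ∈ Set.Ioo (0 : ℝ) 1 ∧ DifferentiableAt ℝ (logMaxH n a U l σ) r}

/-- The truncated Almgren–Poon frequency Φ_{ℓ,σ}(U,·), with constant C. -/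
def Phi (n : ℕ) (a : ℝ) (U : Fn n) (l σ C : ℝ) (r : ℝ) : ℝ :=
  (1/2) * r * Real.exp (C * r ^ (1 - σ)) * deriv (logMaxH n a U l σ) r
    + 2 * (Real.exp (C * r ^ (1 - σ)) - 1)

/-- The parabolic Almgren rescalings U_r. -/
def rescale (n : ℕ) (a : ℝ) (U : Fn n) (r : ℝ) : Fn n :=
  fun x y t => U (r • x) (r * y) (r ^ 2 * t) / Real.sqrt (Hfn n a U r)

/-- The Weiss functional 𝒲_κ(U,r). -/
def Wfn (n : ℕ) (a : ℝ) (U : Fn n) (κ r : ℝ) : ℝ :=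
  r ^ (-(2 * κ)) * (Dfn n a U r - κ / 2 * Hfn n a U r)

/-- The Monneau functional M_κ(U,p_κ,r). -/
def Mfn (n : ℕ) (a : ℝ) (U pk : Fn n) (κ r : ℝ) : ℝ :=
  r ^ (-(2 * κ + 2)) *
    ∫ p in Splus n r, (U p.1 p.2.1 p.2.2 - pk p.1 p.2.1 p.2.2) ^ 2 * wgt n a p

/-- Polynomial functions of (x,t). -/
def IsPolyFun2 (n : ℕ) (q : (Fin n → ℝ) → ℝ → ℝ) : Prop :=
  ∃ P : MvPolynomial (Fin (n + 1)) ℝ, ∀ x t, q x t = MvPolynomial.eval (Fin.snoc x t) P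

/-- Polynomial functions of (x,y,t). -/
def IsPolyFun3 (n : ℕ) (q : Fn n) : Prop :=
  ∃ P : MvPolynomial (Fin (n + 2)) ℝ, ∀ x y t,
    q x y t = MvPolynomial.eval (Fin.snoc (Fin.snoc x y) t) P

/-- The class 𝒫_κ⁺ of parabolically κ-homogeneous, even in y, a-caloric polynomials
which are nonnegative on the thin space. -/
def Pkappa (n : ℕ) (a κ : ℝ) (p : Fn n) : Prop :=
  IsPolyFun3 n p ∧
  (∀ lam > (0:ℝ), ∀ x y t, p (lam • x) (lam * y) (lam ^ 2 * t) = lam ^ κ * p x y t) ∧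
  (∀ x y t, p x (-y) t = p x y t) ∧
  (∀ x t, 0 ≤ p x 0 t) ∧
  (∀ x y t, y ≠ 0 →
    pdt p x y t - lapx p x y t - pdyy p x y t - (a / y) * pdy p x y t = 0)

/-- The coincidence set Λ(U) ⊆ S₁. -/
def Lam (n : ℕ) (U : Fn n) : Set ((Fin n → ℝ) × ℝ) :=
  {q | q.2 ∈ Set.Ioc (-1 : ℝ) 0 ∧ U q.1 0 q.2 = 0}

/-- The thin parabolic cylinder Q_r = B_r × (−r²,0]. -/
def Qthin (n : ℕ) (r : ℝ) : Set ((Fin n → ℝ) × ℝ) :=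
  {q | (∑ i, (q.1 i) ^ 2) < r ^ 2 ∧ q.2 ∈ Set.Ioc (-(r ^ 2)) 0}

/-- The modified Bessel function of the first kind I_ν(z). -/
def besselI (ν z : ℝ) : ℝ :=
  ∑' k : ℕ, (z / 2) ^ (ν + 2 * (k : ℝ)) /
    (Real.Gamma ((k : ℝ) + 1) * Real.Gamma ((k : ℝ) + ν + 1))

/-- The Bessel heat kernel p^{(a)}(y,η,t). -/
def pker (a y η t : ℝ) : ℝ :=
  (2 * t) ^ (-(a + 1) / 2) * (y * η / (2 * t)) ^ ((1 - a) / 2) *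
    besselI ((a - 1) / 2) (y * η / (2 * t)) * Real.exp (-(y ^ 2 + η ^ 2) / (4 * t))

namespace FG

open Real
open Set (Ioi Ioc Ioo Icc Iic Ici univ indicator_of_mem indicator_of_notMem Ioc_subset_Ioi_self right_mem_Icc left_mem_Icc)
open Finset (mul_sum sum_nonneg sum_congr sum_add_distrib sum_le_sum mem_univ sum_mul sum_sub_distrib card_univ sum_ite_eq sum_eq_single sum_div prod_nonneg abs_sum_le_sum_abs)

lemma mulL {a b c : ℝ} (h : b ≤ c) (ha : 0 ≤ a) : a * b ≤ a * c := mul_le_mul_of_nonneg_left h ha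

lemma mulR {a b c : ℝ} (h : b ≤ c) (ha : 0 ≤ a) : b * a ≤ c * a := mul_le_mul_of_nonneg_right h ha

/-- `f` grows slower than every Gaussian `exp (θ q)` on `S`. -/
def GR {X : Type*} (S : Set X) (q f : X → ℝ) : Prop := ∀ θ > (0:ℝ), ∃ C, ∀ x ∈ S, |f x| ≤ C * exp (θ * q x)

namespace GR
variable {X : Type*} {S : Set X} {q f g : X → ℝ}

lemma bound (hf : GR S q f) {θ : ℝ} (hθ : 0 < θ) :
    ∃ C, 0 ≤ C ∧ ∀ x ∈ S, |f x| ≤ C * exp (θ * q x) := by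
  obtain ⟨C, hC⟩ := hf θ hθ
  refine ⟨|C|, abs_nonneg _, fun x hx => (hC x hx).trans ?_⟩
  gcongr
  exact le_abs_self C

lemma mono (hg : GR S q g) (h : ∀ x ∈ S, |f x| ≤ |g x|) : GR S q f := by
  intro θ hθ
  obtain ⟨C, hC⟩ := hg θ hθ
  exact ⟨C, fun x hx => (h x hx).trans (hC x hx)⟩

lemma congr (hg : GR S q g) (h : ∀ x ∈ S, f x = g x) : GR S q f := hg.mono fun x hx => by rw [h x hx]

lemma subset {S' : Set X} (hf : GR S q f) (h : S' ⊆ S) : GR S' q f := by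
  intro θ hθ
  obtain ⟨C, hC⟩ := hf θ hθ
  exact ⟨C, fun x hx => hC x (h hx)⟩

lemma add (hf : GR S q f) (hg : GR S q g) : GR S q (fun x => f x + g x) := by
  intro θ hθ
  obtain ⟨C, hC⟩ := hf θ hθ
  obtain ⟨D, hD⟩ := hg θ hθ
  refine ⟨C + D, fun x hx => (abs_add_le _ _).trans ?_⟩
  grind

lemma mul (hf : GR S q f) (hg : GR S q g) : GR S q (fun x => f x * g x) := by
  intro θ hθ
  obtain ⟨C, hC0, hC⟩ := hf.bound (half_pos hθ)
  obtain ⟨D, hD0, hD⟩ := hg.bound (half_pos hθ)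
  refine ⟨C * D, fun x hx => ?_⟩
  rw [abs_mul]
  calc |f x| * |g x| ≤ (C * exp (θ / 2 * q x)) * (D * exp (θ / 2 * q x)) :=
    mul_le_mul (hC x hx) (hD x hx) (abs_nonneg _) (by positivity)
    _ = C * D * (exp (θ / 2 * q x) * exp (θ / 2 * q x)) := by ring
    _ = C * D * exp (θ * q x) := by rw [← exp_add]; ring_nf

lemma of_bdd (hq : ∀ x ∈ S, 0 ≤ q x) {C : ℝ} (h : ∀ x ∈ S, |f x| ≤ C) : GR S q f := by
  intro θ hθ
  refine ⟨|C|, fun x hx => ((h x hx).trans (le_abs_self C)).trans ?_⟩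
  have := one_le_exp (mul_nonneg hθ.le (hq x hx))
  nlinarith [abs_nonneg C]

lemma const (hq : ∀ x ∈ S, 0 ≤ q x) (c : ℝ) : GR S q (fun _ => c) := of_bdd hq fun _ _ => le_rfl

lemma neg (hf : GR S q f) : GR S q (fun x => - f x) := hf.mono fun x _ => by rw [abs_neg]

lemma sub (hf : GR S q f) (hg : GR S q g) : GR S q (fun x => f x - g x) := by
  simpa [sub_eq_add_neg] using hf.add hg.neg

lemma const_mul (hf : GR S q f) (c : ℝ) : GR S q (fun x => c * f x) := by
  intro θ hθ
  obtain ⟨C, hC⟩ := hf θ hθ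
  refine ⟨|c| * C, fun x hx => ?_⟩
  rw [abs_mul, mul_assoc]
  exact mulL (hC x hx) (abs_nonneg c)

lemma sum {ι : Type*} (s : Finset ι) {F : ι → X → ℝ} (hF : ∀ i ∈ s, GR S q (F i)) :
    GR S q (fun x => ∑ i ∈ s, F i x) := by
  classical
  induction s using Finset.induction_on with
  | empty => intro θ _; exact ⟨0, fun x _ => by simp⟩
  | insert i s hi ih =>
    simp only [Finset.sum_insert hi]
    exact (hF i (by simp)).add (ih fun j hj => hF j (by simp [hj]))

lemma self (hq : ∀ x ∈ S, 0 ≤ q x) : GR S q q := by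
  intro θ hθ
  refine ⟨1 / θ, fun x hx => ?_⟩
  have h1 := add_one_le_exp (θ * q x)
  rw [abs_of_nonneg (hq x hx), div_mul_eq_mul_div, one_mul, le_div_iff₀ hθ]
  linarith

lemma pow (hq : ∀ x ∈ S, 0 ≤ q x) (hf : GR S q f) (N : ℕ) : GR S q (fun x => f x ^ N) := by
  induction N with
  | zero => simpa using const hq 1
  | succ k ih => simpa [pow_succ] using ih.mul hf

/-- A function bounded by a real power of `1 + q`. -/
lemma of_rpow (hq : ∀ x ∈ S, 0 ≤ q x) {C : ℝ} (hC : 0 ≤ C) (p : ℝ)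
    (h : ∀ x ∈ S, |f x| ≤ C * (1 + q x) ^ p) : GR S q f := by
  obtain ⟨N, hN⟩ := exists_nat_ge p
  have h1 := (((const hq 1).add (self hq)).pow hq N).const_mul C
  refine h1.mono fun x hx => (h x hx).trans (le_trans ?_ (le_abs_self _))
  have h2 : 1 ≤ 1 + q x := by grind
  rw [← rpow_natCast]
  gcongr

lemma of_sq_le (hq : ∀ x ∈ S, 0 ≤ q x) (h : ∀ x ∈ S, f x ^ 2 ≤ q x) : GR S q f := by
  refine of_rpow hq zero_le_one 1 fun x hx => ?_
  rw [rpow_one, one_mul]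
  have := h x hx
  nlinarith [sq_abs (f x), sq_nonneg (|f x| - 1)]

end GR

lemma integral_sq {X : Type*} [MeasurableSpace X] {m : Measure X} (f : X → ℝ) : 0 ≤ ∫ x, f x ^ 2 ∂m :=
  integral_nonneg fun _ => sq_nonneg _

/-- The fundamental theorem of calculus for functions vanishing at both ends of `I`. -/
def EndFTC (I : Set ℝ) (la lb : Filter ℝ) : Prop :=
  ∀ F F' : ℝ → ℝ, (∀ y ∈ I, HasDerivAt F (F' y) y) → IntegrableOn F' I →
    Tendsto F la (𝓝 0) → Tendsto F lb (𝓝 0) → ∫ y in I, F' y = 0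

lemma endFTC_univ : EndFTC univ atBot atTop := by
  intro F F' h hi h1 h2
  rw [setIntegral_univ, integral_of_hasDerivAt_of_tendsto (fun x => h x trivial)
    (integrableOn_univ.1 hi) h1 h2, sub_zero]

lemma endFTC_Ioi : EndFTC (Ioi 0) (𝓝[>] 0) atTop := by
  intro F F' h hi h1 h2
  have hc : ContinuousWithinAt (Function.update F 0 0) (Ici 0) 0 := by
    rw [continuousWithinAt_update_same, Set.Ici_sdiff_left]
    exact h1
  rw [integral_Ioi_of_hasDerivAt_of_tendsto hc (fun y hy => ?_) hi (h2.congr' ?_)]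
  · simp
  · filter_upwards [eventually_gt_atTop 0] with z hz
    rw [Function.update_of_ne (ne_of_gt hz)]
  · refine (h y hy).congr_of_eventuallyEq ?_
    filter_upwards [eventually_ne_nhds (ne_of_gt hy)] with z hz
    rw [Function.update_of_ne hz]

section dual
variable {I : Set ℝ} {la lb : Filter ℝ} {W b c c' b' f f' g : ℝ → ℝ} {lam : ℝ}

/-- `∫ f² W ≥ λ ∫ g² W` when `f W = (g W)'`. -/
lemma dual_identity (hI : EndFTC I la lb) (hW : ∀ y ∈ I, HasDerivAt W (-(b y * W y)) y)
    (hb : ∀ y ∈ I, HasDerivAt b (b' y) y) (hc : ∀ y ∈ I, HasDerivAt c (c' y) y)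
    (hlam : ∀ y ∈ I, -(c y) ^ 2 + b y * c y - c' y + b' y = lam)
    (hg : ∀ y ∈ I, HasDerivAt g (f y + b y * g y) y)
    (if2 : IntegrableOn (fun y => f y ^ 2 * W y) I)
    (ig2 : IntegrableOn (fun y => g y ^ 2 * W y) I)
    (igc : IntegrableOn (fun y => (f y + b y * g y - c y * g y) ^ 2 * W y) I)
    (e1 : Tendsto (fun y => (c y - b y) * g y ^ 2 * W y) la (𝓝 0))
    (e2 : Tendsto (fun y => (c y - b y) * g y ^ 2 * W y) lb (𝓝 0)) :
    ∫ y in I, f y ^ 2 * W y = (∫ y in I, (f y + b y * g y - c y * g y) ^ 2 * W y) + lam * ∫ y in I, g y ^ 2 * W y := by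
  have key : ∫ y in I, (f y ^ 2 * W y - (f y + b y * g y - c y * g y) ^ 2 * W y - lam * (g y ^ 2 * W y)) = 0 := by
    refine hI (fun y => (c y - b y) * g y ^ 2 * W y) _ (fun y hy => ?_) ((if2.sub igc).sub (ig2.const_mul lam)) e1 e2
    have := (((hc y hy).sub (hb y hy)).mul ((hg y hy).pow 2)).mul (hW y hy)
    refine this.congr_deriv ?_
    simp only [Pi.mul_apply, Pi.sub_apply, Pi.pow_apply]
    rw [← hlam y hy]
    ring
  have i3 := ig2.const_mul lam
  have h3 := integral_sub (if2.sub igc) i3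
  have h2 := integral_sub if2 igc
  simp only [Pi.sub_apply] at h3 h2
  rw [h3, h2, integral_const_mul] at key
  linarith

lemma dual_ibp (hI : EndFTC I la lb) (hW : ∀ y ∈ I, HasDerivAt W (-(b y * W y)) y) (hf : ∀ y ∈ I, HasDerivAt f (f' y) y)
    (hg : ∀ y ∈ I, HasDerivAt g (f y + b y * g y) y)
    (if2 : IntegrableOn (fun y => f y ^ 2 * W y) I)
    (ifg : IntegrableOn (fun y => f' y * g y * W y) I)
    (e1 : Tendsto (fun y => f y * g y * W y) la (𝓝 0))
    (e2 : Tendsto (fun y => f y * g y * W y) lb (𝓝 0)) :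
    ∫ y in I, f y ^ 2 * W y = - ∫ y in I, f' y * g y * W y := by
  have key : ∫ y in I, (f y ^ 2 * W y + f' y * g y * W y) = 0 := by
    refine hI (fun y => f y * g y * W y) _ (fun y hy => ?_) (if2.add ifg) e1 e2
    refine (((hf y hy).mul (hg y hy)).mul (hW y hy)).congr_deriv ?_
    simp only [Pi.mul_apply]
    ring
  rw [integral_add if2 ifg] at key
  linarith

/-- If `∫ f² W ≥ λ ∫ g² W`, then `λ ∫ f² W ≤ ∫ f'² W`. -/
lemma dual_poincare (hIm : MeasurableSet I) (hlam : 0 < lam) (hWp : ∀ y ∈ I, 0 ≤ W y)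
    (hfg : ∫ y in I, f y ^ 2 * W y = - ∫ y in I, f' y * g y * W y)
    (hle : lam * ∫ y in I, g y ^ 2 * W y ≤ ∫ y in I, f y ^ 2 * W y)
    (ifg : IntegrableOn (fun y => f' y * g y * W y) I)
    (if2 : IntegrableOn (fun y => f' y ^ 2 * W y) I)
    (ig2 : IntegrableOn (fun y => g y ^ 2 * W y) I) :
    lam * ∫ y in I, f y ^ 2 * W y ≤ ∫ y in I, f' y ^ 2 * W y := by
  have h1 : - ∫ y in I, f' y * g y * W y ≤
      (1 / (2 * lam)) * (∫ y in I, f' y ^ 2 * W y) + lam / 2 * ∫ y in I, g y ^ 2 * W y := by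
    rw [← integral_neg, ← integral_const_mul, ← integral_const_mul, ← integral_add (if2.const_mul _) (ig2.const_mul _)]
    refine setIntegral_mono_on ifg.neg ((if2.const_mul _).add (ig2.const_mul _)) hIm fun y hy => ?_
    have h2 : -(f' y * g y) ≤ 1 / (2 * lam) * f' y ^ 2 + lam / 2 * g y ^ 2 := by
      have : 1 / (2 * lam) * f' y ^ 2 + lam / 2 * g y ^ 2 + f' y * g y
          = 1 / (2 * lam) * (f' y + lam * g y) ^ 2 := by grind
      have : 0 ≤ 1 / (2 * lam) * (f' y + lam * g y) ^ 2 := by positivity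
      linarith
    have h3 := mulR h2 (hWp y hy)
    calc -(f' y * g y * W y) = -(f' y * g y) * W y := by ring
      _ ≤ _ := h3
      _ = _ := by ring
  have h4 : (1 / (2 * lam)) * (∫ y in I, f' y ^ 2 * W y) * (2 * lam) = ∫ y in I, f' y ^ 2 * W y := by grind
  nlinarith
end dual

/-- The unnormalized Gaussian weight of variance two. -/
def gE (t : ℝ) : ℝ := exp (-t ^ 2 / 4)

lemma gE_pos (t : ℝ) : 0 < gE t := exp_pos _

lemma continuous_gE : Continuous gE := by unfold gE; fun_prop

lemma hasDerivAt_gE (t : ℝ) : HasDerivAt gE (-(t / 2 * gE t)) t := by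
  have : HasDerivAt (fun t => -t ^ 2 / 4) (-(2 * t) / 4) t := by
    have := ((hasDerivAt_pow 2 t).neg.div_const 4)
    simpa using this
  refine this.exp.congr_deriv ?_
  unfold gE
  ring

/-- Subgaussian growth on the line. -/
abbrev SG1 (f : ℝ → ℝ) : Prop := GR univ (fun t : ℝ => t ^ 2) f

lemma sq_nonneg_on {S : Set ℝ} : ∀ x ∈ S, 0 ≤ (fun t : ℝ => t ^ 2) x := fun x _ => sq_nonneg x

lemma SG1.id : SG1 (fun t => t) := GR.of_sq_le sq_nonneg_on fun _ _ => le_rfl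

lemma SG1.bound_gE {f : ℝ → ℝ} (hf : SG1 f) {θ : ℝ} (hθ : 0 < θ) :
    ∃ C, 0 ≤ C ∧ ∀ t, |f t * gE t| ≤ C * exp (-(1 / 4 - θ) * t ^ 2) := by
  obtain ⟨C, hC0, hC⟩ := hf.bound hθ
  refine ⟨C, hC0, fun t => ?_⟩
  rw [abs_mul, abs_of_pos (gE_pos t)]
  calc |f t| * gE t ≤ C * exp (θ * t ^ 2) * gE t := by
        gcongr
        · exact (gE_pos t).le
        · grind
    _ = _ := by
      rw [gE, mul_assoc, ← exp_add]; ring_nf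

lemma SG1.integrable {f : ℝ → ℝ} (hf : SG1 f) (hm : AEStronglyMeasurable f) :
    Integrable (fun t => f t * gE t) := by
  obtain ⟨C, _, hC⟩ := hf.bound_gE (θ := 1 / 8) (by norm_num)
  refine ((integrable_exp_neg_mul_sq (b := 1 / 8) (by norm_num)).const_mul C).mono'
    (hm.mul continuous_gE.aestronglyMeasurable) (ae_of_all _ fun t => ?_)
  refine (hC t).trans (le_of_eq ?_)
  norm_num

lemma tendsto_exp_neg_sq_cocompact {c : ℝ} (hc : 0 < c) :
    Tendsto (fun t : ℝ => exp (-c * t ^ 2)) (atBot ⊔ atTop) (𝓝 0) := by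
  have h : Tendsto (fun t => -c * t ^ 2) (atBot ⊔ atTop) atBot := by
    rw [tendsto_sup]
    have h0 : Tendsto (fun t : ℝ => t ^ 2) atTop atTop := tendsto_pow_atTop two_ne_zero
    have h1 : Tendsto (fun t : ℝ => t ^ 2) atBot atTop := by
      have := h0.comp tendsto_neg_atBot_atTop
      refine this.congr fun t => by simp
    exact ⟨h1.const_mul_atTop_of_neg (by linarith), h0.const_mul_atTop_of_neg (by linarith)⟩
  exact tendsto_exp_atBot.comp h

lemma SG1.tendsto {f : ℝ → ℝ} (hf : SG1 f) :
    Tendsto (fun t => f t * gE t) (atBot ⊔ atTop) (𝓝 0) := by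
  obtain ⟨C, _, hC⟩ := hf.bound_gE (θ := 1 / 8) (by norm_num)
  have := (tendsto_exp_neg_sq_cocompact (c := 1 / 8) (by norm_num)).const_mul C
  rw [mul_zero] at this
  refine squeeze_zero_norm (fun t => ?_) this
  refine (hC t).trans (le_of_eq ?_)
  norm_num

/-- Gaussian integration by parts on the line. -/
lemma gauss_ibp {f f' : ℝ → ℝ} (hd : ∀ t, HasDerivAt f (f' t) t) (hf : SG1 f) (hf' : SG1 f')
    (hm : AEStronglyMeasurable f') : ∫ t, f' t * gE t = ∫ t, t / 2 * f t * gE t := by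
  have hfm : AEStronglyMeasurable f := (continuous_iff_continuousAt.2 fun t => (hd t).continuousAt).aestronglyMeasurable
  have h1 := hf'.integrable hm
  have h2 : Integrable (fun t => t / 2 * f t * gE t) := by
    refine SG1.integrable ?_ ?_
    · simpa [div_eq_inv_mul] using (SG1.id.const_mul 2⁻¹).mul hf
    · fun_prop
  have ht := tendsto_sup.1 hf.tendsto
  have := endFTC_univ (fun t => f t * gE t) (fun t => f' t * gE t - t / 2 * f t * gE t)
    (fun t _ => ((hd t).mul (hasDerivAt_gE t)).congr_deriv (by ring))
    (h1.sub h2).integrableOn ht.1 ht.2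
  rw [setIntegral_univ, integral_sub h1 h2] at this
  linarith

/-- `g` with `(g W)' = f W`. -/
def gprim (f : ℝ → ℝ) (t : ℝ) : ℝ := (∫ s in Iic t, f s * gE s) / gE t

lemma hasDerivAt_integral_Iic {f : ℝ → ℝ} (hf : Continuous f) (hi : Integrable f) (t : ℝ) :
    HasDerivAt (fun t => ∫ s in Iic t, f s) (f t) t := by
  have h : (fun t => ∫ s in Iic t, f s) = fun t => (∫ s in Iic 0, f s) + ∫ s in 0..t, f s := by
    funext t
    rw [← intervalIntegral.integral_Iic_sub_Iic hi.integrableOn hi.integrableOn]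
    ring
  rw [h]
  exact (intervalIntegral.integral_hasDerivAt_right (hf.intervalIntegrable _ _)
    hf.aestronglyMeasurable.stronglyMeasurableAtFilter hf.continuousAt).const_add _

lemma hasDerivAt_gprim {f : ℝ → ℝ} (hf : Continuous f) (hg : SG1 f) (t : ℝ) :
    HasDerivAt (gprim f) (f t + t / 2 * gprim f t) t := by
  have h := (hasDerivAt_integral_Iic (hf.mul continuous_gE)
    (hg.integrable hf.aestronglyMeasurable) t).div (hasDerivAt_gE t) (gE_pos t).ne'
  refine h.congr_deriv ?_
  unfold gprim
  have := (gE_pos t).ne'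
  simp only [Pi.mul_apply]
  grind

lemma integral_exp_neg_sq_Ioi_le {c t : ℝ} (hc : 0 < c) (ht : 0 ≤ t) :
    ∫ s in Ioi t, exp (-c * s ^ 2) ≤ exp (-c * t ^ 2) * ∫ u, exp (-c * u ^ 2) := by
  have hi := integrable_exp_neg_mul_sq hc
  have h1 : ∫ s in Ioi t, exp (-c * s ^ 2) ≤ ∫ s in Ioi t, exp (-c * t ^ 2) * exp (-c * (s - t) ^ 2) := by
    refine setIntegral_mono_on hi.integrableOn ?_ measurableSet_Ioi fun s hs => ?_
    · exact ((hi.comp_sub_right t).const_mul _).integrableOn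
    · rw [← exp_add]
      refine exp_le_exp.2 ?_
      have := mul_nonneg hc.le (mul_nonneg ht (sub_nonneg.2 (le_of_lt hs)))
      nlinarith
  refine h1.trans ?_
  rw [integral_const_mul]
  gcongr
  rw [← integral_sub_right_eq_self (fun u => exp (-c * u ^ 2)) t]
  exact setIntegral_le_integral (hi.comp_sub_right t) (ae_of_all _ fun _ => (exp_pos _).le)

lemma SG1.gprim {f : ℝ → ℝ} (hf : Continuous f) (hg : SG1 f) (h0 : ∫ t, f t * gE t = 0) :
    SG1 (gprim f) := by
  suffices H : ∀ θ > 0, θ < 1 / 4 → ∃ C, ∀ t, |FG.gprim f t| ≤ C * exp (θ * t ^ 2) by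
    intro θ hθ
    obtain ⟨C, hC⟩ := H (min θ (1 / 8)) (by positivity) (by
      have := min_le_right θ (1 / 8 : ℝ); linarith)
    refine ⟨|C|, fun t _ => (hC t).trans ?_⟩
    have := min_le_left θ (1 / 8 : ℝ)
    gcongr
    exact le_abs_self C
  intro θ hθ hθ'
  obtain ⟨C, hC0, hC⟩ := hg.bound_gE hθ
  have hi := hg.integrable hf.aestronglyMeasurable
  have hc : 0 < 1 / 4 - θ := by linarith
  have hei := integrable_exp_neg_mul_sq hc
  set K := ∫ u, exp (-(1 / 4 - θ) * u ^ 2)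
  have main : ∀ t, |∫ s in Iic t, f s * gE s| ≤ C * K * exp (-(1 / 4 - θ) * t ^ 2) := by
    intro t
    rcases le_total 0 t with ht | ht
    · have e : ∫ s in Iic t, f s * gE s = - ∫ s in Ioi t, f s * gE s := by
        have := intervalIntegral.integral_Iic_add_Ioi (b := t) hi.integrableOn hi.integrableOn
        linarith
      rw [e, abs_neg]
      calc |∫ s in Ioi t, f s * gE s| ≤ ∫ s in Ioi t, |f s * gE s| := abs_integral_le_integral_abs
        _ ≤ ∫ s in Ioi t, C * exp (-(1 / 4 - θ) * s ^ 2) :=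
            integral_mono hi.abs.integrableOn (hei.const_mul C).integrableOn hC
        _ ≤ C * (exp (-(1 / 4 - θ) * t ^ 2) * K) := by
            rw [integral_const_mul]
            exact mulL (integral_exp_neg_sq_Ioi_le hc ht) hC0
        _ = _ := by ring
    · calc |∫ s in Iic t, f s * gE s| ≤ ∫ s in Iic t, |f s * gE s| := abs_integral_le_integral_abs
        _ ≤ ∫ s in Iic t, C * exp (-(1 / 4 - θ) * s ^ 2) :=
            integral_mono hi.abs.integrableOn (hei.const_mul C).integrableOn hC
        _ = C * ∫ s in Ioi (-t), exp (-(1 / 4 - θ) * s ^ 2) := by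
            rw [integral_const_mul, ← integral_comp_neg_Iic]
            simp
        _ ≤ C * (exp (-(1 / 4 - θ) * (-t) ^ 2) * K) := mulL (integral_exp_neg_sq_Ioi_le hc (by linarith)) hC0
        _ = _ := by ring_nf
  refine ⟨C * K, fun t => ?_⟩
  rw [FG.gprim, abs_div, abs_of_pos (gE_pos t), div_le_iff₀ (gE_pos t)]
  refine (main t).trans (le_of_eq ?_)
  rw [gE, mul_assoc (C * K), ← exp_add]
  ring_nf

/-- `f W = (g W)'` with its consequences, for `f` of mean zero. -/
lemma gauss_dual {f f' : ℝ → ℝ} (hd : ∀ t, HasDerivAt f (f' t) t) (hf : SG1 f) (hf' : SG1 f')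
    (hm : AEStronglyMeasurable f') (h0 : ∫ t, f t * gE t = 0) :
    (∫ t, f t ^ 2 * gE t = (∫ t, (f t + t / 2 * gprim f t) ^ 2 * gE t) + 1 / 2 * ∫ t, gprim f t ^ 2 * gE t) ∧
    (∀ lam > 0, lam * ∫ t, gprim f t ^ 2 * gE t ≤ ∫ t, f t ^ 2 * gE t →
      lam * ∫ t, f t ^ 2 * gE t ≤ ∫ t, f' t ^ 2 * gE t) := by
  have hfc := continuous_iff_continuousAt.2 fun t => (hd t).continuousAt
  have hgd := hasDerivAt_gprim hfc hf
  have hgc := continuous_iff_continuousAt.2 fun t => (hgd t).continuousAt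
  have hg := SG1.gprim hfc hf h0
  have iS : ∀ {F : ℝ → ℝ}, SG1 F → AEStronglyMeasurable F → IntegrableOn (fun t => F t * gE t) univ := fun h1 h2 =>
    integrableOn_univ.2 (h1.integrable h2)
  have pw : ∀ {F : ℝ → ℝ}, SG1 F → SG1 (fun t => F t ^ 2) := fun h => h.pow sq_nonneg_on 2
  have i1 := iS (pw hf) (by fun_prop)
  have i2 := iS (pw hg) (by fun_prop)
  have hh : SG1 (fun t => t / 2 * gprim f t) := by
    simpa [div_eq_inv_mul] using (SG1.id.const_mul 2⁻¹).mul hg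
  have i3 := iS (pw (hf.add hh)) (by fun_prop)
  have i4 := iS (hf'.mul hg) (hm.mul hgc.aestronglyMeasurable)
  have i5 := iS (pw hf') (hm.pow 2)
  have t1 := tendsto_sup.1 (SG1.tendsto (hh.mul hg).neg)
  have t2 := tendsto_sup.1 (SG1.tendsto (hf.mul hg))
  constructor
  · have := dual_identity (c' := fun _ => 0) (b' := fun _ => 1 / 2) (lam := 1 / 2) endFTC_univ
      (fun t _ => hasDerivAt_gE t) (fun t _ => (hasDerivAt_id t).div_const 2)
      (fun t _ => hasDerivAt_const t 0) (fun t _ => by ring) (fun t _ => hgd t) i1 i2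
      (by simpa using i3)
      (t1.1.congr fun t => by ring) (t1.2.congr fun t => by ring)
    simpa [setIntegral_univ] using this
  · intro lam hlam hle
    have h := dual_ibp (f' := f')
      endFTC_univ (fun t _ => hasDerivAt_gE t) (fun t _ => hd t)
      (fun t _ => hgd t) i1 i4 t2.1 t2.2
    have := dual_poincare (f' := f')
      MeasurableSet.univ hlam (fun t _ => (gE_pos t).le) h
      (by simpa [setIntegral_univ] using hle) i4 i5 i2
    simpa [setIntegral_univ] using this

/-- Gaussian Poincaré inequality on the line for functions of mean zero. -/
lemma gauss_P1 {f f' : ℝ → ℝ} (hd : ∀ t, HasDerivAt f (f' t) t) (hf : SG1 f) (hf' : SG1 f')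
    (hm : AEStronglyMeasurable f') (h0 : ∫ t, f t * gE t = 0) :
    1 / 2 * ∫ t, f t ^ 2 * gE t ≤ ∫ t, f' t ^ 2 * gE t := by
  obtain ⟨h1, h2⟩ := gauss_dual hd hf hf' hm h0
  refine h2 _ (by norm_num) ?_
  have : 0 ≤ ∫ t, (f t + t / 2 * gprim f t) ^ 2 * gE t :=
    integral_nonneg fun t => mul_nonneg (sq_nonneg _) (gE_pos t).le
  linarith

/-- Second Gaussian Poincaré inequality on the line. -/
lemma gauss_P2 {f f' : ℝ → ℝ} (hd : ∀ t, HasDerivAt f (f' t) t) (hf : SG1 f) (hf' : SG1 f')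
    (hm : AEStronglyMeasurable f') (h0 : ∫ t, f t * gE t = 0) (h1 : ∫ t, t * f t * gE t = 0) :
    ∫ t, f t ^ 2 * gE t ≤ ∫ t, f' t ^ 2 * gE t := by
  obtain ⟨e1, e2⟩ := gauss_dual hd hf hf' hm h0
  have hfc := continuous_iff_continuousAt.2 fun t => (hd t).continuousAt
  have hgd := hasDerivAt_gprim hfc hf
  have hgc := continuous_iff_continuousAt.2 fun t => (hgd t).continuousAt
  have hg := SG1.gprim hfc hf h0
  have hh : SG1 (fun t => t / 2 * gprim f t) := by
    simpa [div_eq_inv_mul] using (SG1.id.const_mul 2⁻¹).mul hg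
  have hmean : ∫ t, gprim f t * gE t = 0 := by
    have i1 := hg.integrable hgc.aestronglyMeasurable
    have i2 := SG1.integrable (SG1.id.mul hf) (by fun_prop)
    have ht := tendsto_sup.1 (SG1.tendsto (SG1.id.mul hg))
    have := endFTC_univ (fun t => t * gprim f t * gE t) (fun t => gprim f t * gE t + t * f t * gE t)
      (fun t _ => (((hasDerivAt_id t).mul (hgd t)).mul (hasDerivAt_gE t)).congr_deriv
        (by simp only [Pi.mul_apply, id]; ring))
      (i1.add i2).integrableOn ht.1 ht.2
    rw [setIntegral_univ, integral_add i1 i2] at this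
    linarith
  have := gauss_P1 hgd hg (hf.add hh) (by fun_prop) hmean
  have := e2 1 one_pos (by grind)
  linarith

/-- The unnormalized weight in the extension variable. -/
def wY (a y : ℝ) : ℝ := y ^ a * exp (-y ^ 2 / 4)

lemma wY_pos (a : ℝ) {y : ℝ} (hy : 0 < y) : 0 < wY a y := mul_pos (by positivity) (exp_pos _)

lemma measurable_wY (a : ℝ) : Measurable (wY a) := by unfold wY; fun_prop

lemma continuousOn_wY (a : ℝ) : ContinuousOn (wY a) (Ioi 0) := by
  refine ContinuousOn.mul (fun y hy => ?_) (by fun_prop)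
  exact (continuousAt_rpow_const y a (Or.inl (ne_of_gt hy))).continuousWithinAt

lemma hasDerivAt_wY (a : ℝ) {y : ℝ} (hy : 0 < y) :
    HasDerivAt (wY a) (-((y / 2 - a / y) * wY a y)) y := by
  have h1 := hasDerivAt_rpow_const (p := a) (Or.inl hy.ne')
  have h2 := hasDerivAt_gE y
  refine (h1.mul h2).congr_deriv ?_
  unfold wY gE
  rw [rpow_sub_one hy.ne']
  ring

/-- Subgaussian growth on the half line. -/
abbrev SGY (f : ℝ → ℝ) : Prop := GR (Ioi 0) (fun t : ℝ => t ^ 2) f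

lemma integrableOn_wY_exp {a θ : ℝ} (ha : -1 < a) (hθ : θ < 1 / 4) :
    IntegrableOn (fun y => wY a y * exp (θ * y ^ 2)) (Ioi 0) := by
  refine (integrableOn_rpow_mul_exp_neg_mul_sq (b := 1 / 4 - θ) (by linarith) ha).congr_fun
    (fun y _ => ?_) measurableSet_Ioi
  simp only [wY]
  rw [mul_assoc, ← exp_add]
  ring_nf

lemma SGY.integrableOn {a : ℝ} (ha : -1 < a) {f : ℝ → ℝ} (hf : SGY f)
    (hm : AEStronglyMeasurable f (volume.restrict (Ioi 0))) :
    IntegrableOn (fun y => f y * wY a y) (Ioi 0) := by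
  obtain ⟨C, _, hC⟩ := hf.bound (θ := 1 / 8) (by norm_num)
  refine ((integrableOn_wY_exp ha (θ := 1 / 8) (by norm_num)).const_mul C).mono'
    (hm.mul (measurable_wY a).aestronglyMeasurable) ?_
  filter_upwards [ae_restrict_mem measurableSet_Ioi] with y hy
  rw [norm_eq_abs, abs_mul, abs_of_pos (wY_pos a hy)]
  calc |f y| * wY a y ≤ C * exp (1 / 8 * y ^ 2) * wY a y := mulR (hC y hy) (wY_pos a hy).le
    _ = _ := by ring

lemma tendsto_wY_of_le {a : ℝ} (ha : -1 < a) {F : ℝ → ℝ} {C : ℝ} (h : ∀ y > 0, |F y| ≤ C * (y * exp (1 / 8 * y ^ 2))) :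
    Tendsto (fun y => F y * wY a y) (𝓝[>] 0) (𝓝 0) ∧ Tendsto (fun y => F y * wY a y) atTop (𝓝 0) := by
  have hb : ∀ y > 0, ‖F y * wY a y‖ ≤ C * (y ^ (1 + a) * exp (-(1 / 8) * y ^ 2)) := by
    intro y hy
    rw [norm_eq_abs, abs_mul, abs_of_pos (wY_pos a hy)]
    refine (mulR (h y hy) (wY_pos a hy).le).trans (le_of_eq ?_)
    rw [wY, rpow_add hy, rpow_one]
    have : exp (-(1 / 8) * y ^ 2) = exp (1 / 8 * y ^ 2) * exp (-y ^ 2 / 4) := by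
      rw [← exp_add]; ring_nf
    rw [this]; ring
  constructor
  · have hc : ContinuousAt (fun y => C * (y ^ (1 + a) * exp (-(1 / 8) * y ^ 2))) 0 := by
      refine ContinuousAt.mul continuousAt_const (ContinuousAt.mul ?_ (by fun_prop))
      exact continuousAt_rpow_const 0 _ (Or.inr (by linarith))
    have h0 : Tendsto (fun y => C * (y ^ (1 + a) * exp (-(1 / 8) * y ^ 2))) (𝓝[>] 0) (𝓝 0) := by
      have := hc.tendsto.mono_left (nhdsWithin_le_nhds (s := Ioi 0))
      simpa [zero_rpow (by linarith : 1 + a ≠ 0)] using this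
    refine squeeze_zero_norm' ?_ h0
    filter_upwards [self_mem_nhdsWithin] with y hy using hb y hy
  · have h0 : Tendsto (fun y => C * (y ^ (1 + a) * exp (-(1 / 8) * y ^ 2))) atTop (𝓝 0) := by
      have h1 := rpow_mul_exp_neg_mul_sq_isLittleO_exp_neg (b := 1 / 8) (by norm_num) (1 + a)
      have h2 : Tendsto (fun x => exp (-(1 / 2) * x)) atTop (𝓝 0) :=
        tendsto_exp_atBot.comp (tendsto_id.const_mul_atTop_of_neg (by norm_num))
      simpa using (h1.trans_tendsto h2).const_mul C
    refine squeeze_zero_norm' ?_ h0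
    filter_upwards [eventually_gt_atTop 0] with y hy using hb y hy

/-- `g` with `(g W)' = f W` on the half line. -/
def yprim (a : ℝ) (f : ℝ → ℝ) (y : ℝ) : ℝ := (∫ s in Ioc 0 y, f s * wY a s) / wY a y

lemma hasDerivAt_yprim {a : ℝ} (ha : -1 < a) {f : ℝ → ℝ} (hf : ContinuousOn f (Ioi 0))
    (hg : SGY f) {y : ℝ} (hy : 0 < y) :
    HasDerivAt (yprim a f) (f y + (y / 2 - a / y) * yprim a f y) y := by
  have hi := SGY.integrableOn ha hg (hf.aestronglyMeasurable measurableSet_Ioi)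
  have hc := hf.mul (continuousOn_wY a)
  have h0 : HasDerivAt (fun y => ∫ s in 0..y, f s * wY a s) (f y * wY a y) y := by
    refine intervalIntegral.integral_hasDerivAt_right ?_ ?_ (hc.continuousAt (Ioi_mem_nhds hy))
    · rw [intervalIntegrable_iff_integrableOn_Ioc_of_le hy.le]
      exact hi.mono_set Ioc_subset_Ioi_self
    · exact hc.stronglyMeasurableAtFilter isOpen_Ioi y hy
  have h1 : HasDerivAt (fun y => ∫ s in Ioc 0 y, f s * wY a s) (f y * wY a y) y := by
    refine h0.congr_of_eventuallyEq ?_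
    filter_upwards [Ioi_mem_nhds hy] with z hz
    rw [intervalIntegral.integral_of_le (le_of_lt hz)]
  refine (h1.div (hasDerivAt_wY a hy) (wY_pos a hy).ne').congr_deriv ?_
  unfold yprim
  have := (wY_pos a hy).ne'
  grind

lemma yprim_bound_near {a : ℝ} (ha : -1 < a) {f : ℝ → ℝ} (hg : SGY f) :
    ∃ C, 0 ≤ C ∧ ∀ y, 0 < y → y ≤ 1 → |yprim a f y| ≤ C * y := by
  obtain ⟨C, hC0, hC⟩ := hg.bound (θ := 1 / 4) (by norm_num)
  refine ⟨C * exp (1 / 4) / (1 + a), div_nonneg (by positivity) (by linarith), fun y hy hy1 => ?_⟩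
  have hnt : IntervalIntegrable (fun s => s ^ a) volume 0 y := intervalIntegral.intervalIntegrable_rpow' ha
  have h1 : |∫ s in Ioc 0 y, f s * wY a s| ≤ C * (y ^ (1 + a) / (1 + a)) := by
    have e : ∫ s in Ioc 0 y, s ^ a = y ^ (1 + a) / (1 + a) := by
      rw [← intervalIntegral.integral_of_le hy.le, integral_rpow (Or.inl ha),
        zero_rpow (by linarith), sub_zero, add_comm]
    rw [← e, ← integral_const_mul]
    rw [← norm_eq_abs]
    refine norm_integral_le_of_norm_le (((intervalIntegrable_iff_integrableOn_Ioc_of_le hy.le).1 hnt).const_mul C) ?_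
    filter_upwards [ae_restrict_mem measurableSet_Ioc] with s hs
    rw [norm_eq_abs, abs_mul, abs_of_pos (wY_pos a hs.1)]
    refine (mulR (hC s hs.1) (wY_pos a hs.1).le).trans (le_of_eq ?_)
    have : exp (1 / 4 * s ^ 2) * exp (-s ^ 2 / 4) = 1 := by
      rw [← exp_add]; ring_nf; simp
    calc C * exp (1 / 4 * s ^ 2) * (s ^ a * exp (-s ^ 2 / 4))
        = C * s ^ a * (exp (1 / 4 * s ^ 2) * exp (-s ^ 2 / 4)) := by ring
      _ = _ := by rw [this, mul_one]
  rw [yprim, abs_div, abs_of_pos (wY_pos a hy), div_le_iff₀ (wY_pos a hy)]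
  refine h1.trans ?_
  have h2 : 1 ≤ exp (1 / 4) * exp (-y ^ 2 / 4) := by
    rw [← exp_add]
    exact one_le_exp (by nlinarith)
  have h3 : y ^ (1 + a) = y * y ^ a := by rw [rpow_add hy, rpow_one]
  have h4 : 0 ≤ C * (y * y ^ a / (1 + a)) := mul_nonneg hC0 (div_nonneg (by positivity) (by linarith))
  rw [h3, wY]
  calc C * (y * y ^ a / (1 + a)) ≤ C * (y * y ^ a / (1 + a)) *
    (exp (1 / 4) * exp (-y ^ 2 / 4)) := le_mul_of_one_le_right h4 h2
    _ = _ := by ring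

lemma yprim_bound_far {a : ℝ} (ha : -1 < a) (ha' : a < 1) {f : ℝ → ℝ} (hf : ContinuousOn f (Ioi 0)) (hg : SGY f)
    (h0 : ∫ y in Ioi 0, f y * wY a y = 0) {θ : ℝ} (hθ : 0 < θ) (hθ' : θ < 1 / 8) :
    ∃ C, 0 ≤ C ∧ ∀ y, 1 ≤ y → |yprim a f y| ≤ C * exp (3 * θ * y ^ 2) := by
  obtain ⟨C, hC0, hC⟩ := hg.bound hθ
  have hid : SGY (fun y => y) := GR.of_sq_le sq_nonneg_on fun _ _ => le_rfl
  obtain ⟨D, hD0, hD⟩ := hid.bound hθ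
  have hi := SGY.integrableOn ha hg (hf.aestronglyMeasurable measurableSet_Ioi)
  have hc : 0 < 1 / 4 - 2 * θ := by linarith
  have hei := integrable_exp_neg_mul_sq hc
  set K := ∫ u, exp (-(1 / 4 - 2 * θ) * u ^ 2)
  refine ⟨C * D * K * D, by positivity, fun y hy => ?_⟩
  have hy0 : 0 < y := by linarith
  have e : ∫ s in Ioc 0 y, f s * wY a s = - ∫ s in Ioi y, f s * wY a s := by
    have := setIntegral_union (Set.Ioc_disjoint_Ioi_same) measurableSet_Ioi
      (hi.mono_set Ioc_subset_Ioi_self) (hi.mono_set (Set.Ioi_subset_Ioi hy0.le))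
    rw [Set.Ioc_union_Ioi_eq_Ioi hy0.le, h0] at this
    linarith
  have hrp : ∀ s : ℝ, 1 ≤ s → s ^ a ≤ D * exp (θ * s ^ 2) := fun s hs => by
    refine le_trans ?_ ((le_abs_self s).trans (hD s (by simp; linarith)))
    calc s ^ a ≤ s ^ 1 := rpow_le_rpow_of_exponent_le hs ha'.le
      _ = s := rpow_one s
  have h1 : |∫ s in Ioc 0 y, f s * wY a s| ≤ C * D * (exp (-(1 / 4 - 2 * θ) * y ^ 2) * K) := by
    rw [e, abs_neg]
    refine le_trans ?_ (mulL (integral_exp_neg_sq_Ioi_le hc hy0.le) (mul_nonneg hC0 hD0))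
    rw [← integral_const_mul]
    rw [← norm_eq_abs]
    refine norm_integral_le_of_norm_le (hei.const_mul _).integrableOn ?_
    filter_upwards [ae_restrict_mem measurableSet_Ioi] with s hs
    have hs1 := hy.trans (le_of_lt hs)
    have hs0 : 0 < s := by linarith
    rw [norm_eq_abs, abs_mul, abs_of_pos (wY_pos a hs0), wY]
    have h2 := hC s hs0
    have h3 := hrp s hs1
    have e2 : exp (-(1 / 4 - 2 * θ) * s ^ 2) = exp (θ * s ^ 2) * exp (θ * s ^ 2) * exp (-s ^ 2 / 4) := by
      rw [← exp_add, ← exp_add]; ring_nf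
    calc |f s| * (s ^ a * exp (-s ^ 2 / 4)) ≤ (C * exp (θ * s ^ 2)) *
      ((D * exp (θ * s ^ 2)) * exp (-s ^ 2 / 4)) := by gcongr
      _ = _ := by rw [e2]; ring
  rw [yprim, abs_div, abs_of_pos (wY_pos a hy0), div_le_iff₀ (wY_pos a hy0)]
  refine h1.trans ?_
  have h5 : 1 ≤ D * exp (θ * y ^ 2) * y ^ a := by
    have h6 : 1 ≤ y ^ (1 + a) := one_le_rpow hy (by linarith)
    rw [rpow_add hy0, rpow_one] at h6
    refine h6.trans (mulR ?_ (rpow_nonneg hy0.le _))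
    exact (le_abs_self y).trans (hD y hy0)
  have e3 : exp (-(1 / 4 - 2 * θ) * y ^ 2) * exp (θ * y ^ 2) = exp (3 * θ * y ^ 2) * exp (-y ^ 2 / 4) := by
    rw [← exp_add, ← exp_add]; ring_nf
  calc C * D * (exp (-(1 / 4 - 2 * θ) * y ^ 2) * K) ≤ C * D * (exp (-(1 / 4 - 2 * θ) * y ^ 2) * K) *
        (D * exp (θ * y ^ 2) * y ^ a) := le_mul_of_one_le_right (by positivity) h5
    _ = C * D * K * D * (exp (-(1 / 4 - 2 * θ) * y ^ 2) * exp (θ * y ^ 2)) * y ^ a := by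
        ring
    _ = _ := by rw [e3, wY]; ring

lemma yprim_growth {a : ℝ} (ha : -1 < a) (ha' : a < 1) {f : ℝ → ℝ} (hf : ContinuousOn f (Ioi 0)) (hg : SGY f)
    (h0 : ∫ y in Ioi 0, f y * wY a y = 0) : SGY (fun y => yprim a f y / y) := by
  intro θ hθ
  obtain ⟨C, hC0, hC⟩ := yprim_bound_near ha hg
  set η := min (θ / 3) (1 / 16)
  have hη : 0 < η := by positivity
  obtain ⟨D, hD0, hD⟩ := yprim_bound_far ha ha' hf hg h0 hη
    (by have := min_le_right (θ / 3) (1 / 16 : ℝ); change min _ _ < _; linarith)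
  refine ⟨C + D, fun y hy => ?_⟩
  have hy : 0 < y := hy
  have h1 : 1 ≤ exp (θ * y ^ 2) := one_le_exp (by positivity)
  rw [abs_div, abs_of_pos hy, div_le_iff₀ hy]
  rcases le_total y 1 with h | h
  · refine (hC y hy h).trans ?_
    gcongr
    nlinarith
  · refine (hD y h).trans ?_
    have h2 : exp (3 * η * y ^ 2) ≤ exp (θ * y ^ 2) := by
      have := min_le_left (θ / 3) (1 / 16 : ℝ)
      gcongr
      grind
    calc D * exp (3 * η * y ^ 2) ≤ (C + D) * exp (θ * y ^ 2) := by gcongr; linarith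
      _ ≤ _ := le_mul_of_one_le_right (by positivity) h

/-- Poincaré inequality for the weight `y ^ a e ^ {-y² / 4}`, for functions of mean zero. -/
lemma wY_poincare_zero {a : ℝ} (ha : -1 < a) (ha' : a < 1) {f f' : ℝ → ℝ}
    (hd : ∀ y > 0, HasDerivAt f (f' y) y) (hf : SGY f)
    (hm : AEStronglyMeasurable f' (volume.restrict (Ioi 0)))
    (i' : IntegrableOn (fun y => f' y ^ 2 * wY a y) (Ioi 0))
    (h0 : ∫ y in Ioi 0, f y * wY a y = 0) :
    ∫ y in Ioi 0, f y ^ 2 * wY a y ≤ ∫ y in Ioi 0, f' y ^ 2 * wY a y := by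
  have hfc : ContinuousOn f (Ioi 0) := fun y hy => (hd y hy).continuousAt.continuousWithinAt
  have hgd := fun (y : ℝ) (hy : y ∈ Ioi 0) => hasDerivAt_yprim ha hfc hf hy
  have hgc : ContinuousOn (yprim a f) (Ioi 0) := fun y hy => (hgd y hy).continuousAt.continuousWithinAt
  have hq := yprim_growth ha ha' hfc hf h0
  have hid : SGY (fun y => y) := GR.of_sq_le sq_nonneg_on fun _ _ => le_rfl
  have hone : SGY (fun _ => 1) := GR.const sq_nonneg_on 1
  have hg : SGY (yprim a f) := (hid.mul hq).congr fun y hy => by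
    have : y ≠ 0 := ne_of_gt hy
    field_simp
  have pw : ∀ {F : ℝ → ℝ}, SGY F → SGY (fun t => F t ^ 2) := fun h => h.pow sq_nonneg_on 2
  have hmm : ∀ {F : ℝ → ℝ}, ContinuousOn F (Ioi 0) → AEStronglyMeasurable F (volume.restrict (Ioi 0)) :=
    fun h => h.aestronglyMeasurable measurableSet_Ioi
  have i1 := SGY.integrableOn ha (pw hf) (hmm (hfc.pow 2))
  have i2 := SGY.integrableOn ha (pw hg) (hmm (hgc.pow 2))
  have hbc : SGY (fun y => f y + (y / 2 - a / y) * yprim a f y - 1 / y * yprim a f y) := by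
    refine ((hf.add ((((hid.mul hid).const_mul 2⁻¹).sub (hone.const_mul (a + 1))).mul hq))).congr
      fun y hy => ?_
    have : y ≠ 0 := ne_of_gt hy
    field_simp
    ring
  have hcont : ContinuousOn (fun y => f y + (y / 2 - a / y) * yprim a f y - 1 / y * yprim a f y) (Ioi 0) := by
    have h1 : ContinuousOn (fun y : ℝ => y⁻¹) (Ioi 0) := continuousOn_id.inv₀ fun y hy => ne_of_gt hy
    have : ContinuousOn (fun y => f y + (y / 2 - a * y⁻¹) * yprim a f y - y⁻¹ * yprim a f y) (Ioi 0) := by fun_prop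
    refine this.congr fun y _ => ?_
    simp only [div_eq_mul_inv, one_mul]
  have i3 := SGY.integrableOn ha (pw hbc) (hmm (hcont.pow 2))
  have i4 : IntegrableOn (fun y => f' y * yprim a f y * wY a y) (Ioi 0) := by
    refine (i'.add i2).mono' ((hm.mul (hmm hgc)).mul (measurable_wY a).aestronglyMeasurable) ?_
    filter_upwards [ae_restrict_mem measurableSet_Ioi] with y hy
    rw [norm_eq_abs, abs_mul, abs_of_pos (wY_pos a hy), Pi.add_apply, ← add_mul]
    refine mulR ?_ (wY_pos a hy).le
    rw [abs_le]
    constructor <;> nlinarith [ sq_nonneg (f' y - yprim a f y)]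
  have tend : ∀ {F : ℝ → ℝ}, SGY (fun y => F y / y) → Tendsto (fun y => F y * wY a y) (𝓝[>] 0) (𝓝 0) ∧
      Tendsto (fun y => F y * wY a y) atTop (𝓝 0) := fun {F} hF => by
    obtain ⟨C, _, hC⟩ := hF.bound (θ := 1 / 8) (by norm_num)
    refine tendsto_wY_of_le (C := C) ha fun y hy => ?_
    have := hC y hy
    rw [abs_div, abs_of_pos hy, div_le_iff₀ hy] at this
    linarith
  have t1 := tend (F := fun y => (1 / y - (y / 2 - a / y)) * yprim a f y ^ 2) <| by
    refine (((hone.const_mul (1 + a)).sub ((hid.mul hid).const_mul 2⁻¹)).mul (pw hq)).congr fun y hy => ?_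
    have : y ≠ 0 := ne_of_gt hy
    field_simp
    ring
  have t2 := tend (F := fun y => f y * yprim a f y) <| (hf.mul hq).congr fun y hy => by ring
  have e1 := dual_identity (c' := fun y => -1 / y ^ 2) (b' := fun y => 1 / 2 + a / y ^ 2)
    (lam := 1) endFTC_Ioi (fun y hy => hasDerivAt_wY a hy)
    (fun y hy => by
      have h := (((hasDerivAt_id y).div_const 2).sub ((hasDerivAt_const y a).div (hasDerivAt_id y) (ne_of_gt hy)))
      refine h.congr_deriv ?_
      have : y ≠ 0 := ne_of_gt hy
      simp only [id]
      field_simp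
      ring)
    (fun y hy => by
      have h := (hasDerivAt_const y 1).div (hasDerivAt_id y) (ne_of_gt hy)
      refine h.congr_deriv ?_
      simp)
    (fun y hy => by
      have : y ≠ 0 := ne_of_gt hy
      field_simp
      ring)
    hgd i1 i2 i3 t1.1 t1.2
  have e2 := dual_ibp (f' := f') endFTC_Ioi (fun y hy => hasDerivAt_wY a hy) hd hgd i1 i4 t2.1 t2.2
  have := dual_poincare (f' := f')
    measurableSet_Ioi one_pos (fun y hy => (wY_pos a hy).le) e2 (by
      rw [e1]
      have : 0 ≤ ∫ y in Ioi 0, (f y + (y / 2 - a / y) * yprim a f y - 1 / y * yprim a f y) ^ 2 * wY a y :=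
        setIntegral_nonneg measurableSet_Ioi fun y hy =>
          mul_nonneg (sq_nonneg _) (wY_pos a hy).le
      linarith) i4 i' i2
  linarith

/-- Gaussian measure of variance two on the line. -/
def gam : Measure ℝ := ProbabilityTheory.gaussianReal 0 2

instance : IsProbabilityMeasure gam := by unfold gam; infer_instance

/-- The normalizing constant of `gE`. -/
def cG : ℝ := (sqrt (4 * π))⁻¹

lemma cG_pos : 0 < cG := by unfold cG; positivity

lemma gaussianPDFReal_eq (t : ℝ) : ProbabilityTheory.gaussianPDFReal 0 2 t = cG * gE t := by
  unfold ProbabilityTheory.gaussianPDFReal cG gE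
  congr 2
  · push_cast; ring_nf
  · push_cast; ring_nf

lemma gam_eq : gam = volume.withDensity (fun t => ENNReal.ofReal (cG * gE t)) := by
  rw [gam, ProbabilityTheory.gaussianReal_of_var_ne_zero 0 two_ne_zero]
  congr 1
  funext t
  rw [ProbabilityTheory.gaussianPDF, gaussianPDFReal_eq]

lemma integral_withDensity_ofReal {X : Type*} [MeasurableSpace X] {m : Measure X} {w : X → ℝ}
    (hw : Measurable w) (h0 : ∀ᵐ x ∂m, 0 ≤ w x) (f : X → ℝ) :
    ∫ x, f x ∂(m.withDensity fun x => ENNReal.ofReal (w x)) = ∫ x, f x * w x ∂m := by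
  rw [integral_withDensity_eq_integral_toReal_smul hw.ennreal_ofReal (ae_of_all _ fun _ => ENNReal.ofReal_lt_top)]
  refine integral_congr_ae ?_
  filter_upwards [h0] with x hx
  rw [ENNReal.toReal_ofReal hx, smul_eq_mul, mul_comm]

lemma integrable_withDensity_ofReal {X : Type*} [MeasurableSpace X] {m : Measure X} {w : X → ℝ}
    (hw : Measurable w) (h0 : ∀ᵐ x ∂m, 0 ≤ w x) (f : X → ℝ) :
    Integrable f (m.withDensity fun x => ENNReal.ofReal (w x)) ↔ Integrable (fun x => f x * w x) m := by
  rw [integrable_withDensity_iff_integrable_smul' hw.ennreal_ofReal (ae_of_all _ fun _ => ENNReal.ofReal_lt_top)]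
  refine integrable_congr ?_
  filter_upwards [h0] with x hx
  rw [ENNReal.toReal_ofReal hx, smul_eq_mul, mul_comm]

lemma integral_gam (f : ℝ → ℝ) : ∫ t, f t ∂gam = cG * ∫ t, f t * gE t := by
  rw [gam_eq, integral_withDensity_ofReal (continuous_gE.measurable.const_mul cG)
    (ae_of_all _ fun t => (mul_pos cG_pos (gE_pos t)).le), ← integral_const_mul]
  congr 1; funext t; ring

lemma integrable_gam {f : ℝ → ℝ} : Integrable f gam ↔ Integrable (fun t => f t * gE t) := by
  rw [gam_eq, integrable_withDensity_ofReal (continuous_gE.measurable.const_mul cG)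
    (ae_of_all _ fun t => (mul_pos cG_pos (gE_pos t)).le),
    ← integrable_const_mul_iff (IsUnit.mk0 _ cG_pos.ne') (fun t => f t * gE t)]
  grind

/-- The total mass of `wY a`. -/
def mY (a : ℝ) : ℝ := ∫ y in Ioi 0, wY a y

lemma integrableOn_wY {a : ℝ} (ha : -1 < a) : IntegrableOn (wY a) (Ioi 0) := by
  simpa using integrableOn_wY_exp ha (θ := 0) (by norm_num)

lemma mY_pos {a : ℝ} (ha : -1 < a) : 0 < mY a := by
  unfold mY
  rw [setIntegral_pos_iff_support_of_nonneg_ae _ (integrableOn_wY ha)]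
  · have : Function.support (wY a) ∩ Ioi 0 = Ioi 0 := by
      refine Set.inter_eq_right.2 fun y hy => (wY_pos a hy).ne'
    rw [this]; simp
  · filter_upwards [ae_restrict_mem measurableSet_Ioi] with y hy using (wY_pos a hy).le

/-- The normalizing constant of `wY a`. -/
def cY (a : ℝ) : ℝ := (mY a)⁻¹

lemma cY_pos {a : ℝ} (ha : -1 < a) : 0 < cY a := inv_pos.2 (mY_pos ha)

/-- The probability measure with density proportional to `wY a` on the half line. -/
def nu (a : ℝ) : Measure ℝ := (volume.restrict (Ioi 0)).withDensity fun y => ENNReal.ofReal (cY a * wY a y)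

instance (a : ℝ) : SFinite (nu a) := by unfold nu; infer_instance

lemma wY_nonneg_ae {a : ℝ} (ha : -1 < a) :
    ∀ᵐ y ∂(volume.restrict (Ioi 0)), 0 ≤ cY a * wY a y := by
  filter_upwards [ae_restrict_mem measurableSet_Ioi] with y hy
  exact (mul_pos (cY_pos ha) (wY_pos a hy)).le

lemma integral_nu {a : ℝ} (ha : -1 < a) (f : ℝ → ℝ) :
    ∫ y, f y ∂(nu a) = cY a * ∫ y in Ioi 0, f y * wY a y := by
  rw [nu, integral_withDensity_ofReal ((measurable_wY a).const_mul _) (wY_nonneg_ae ha), ← integral_const_mul]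
  congr 1; funext t; ring

lemma integrable_nu {a : ℝ} (ha : -1 < a) {f : ℝ → ℝ} :
    Integrable f (nu a) ↔ IntegrableOn (fun y => f y * wY a y) (Ioi 0) := by
  rw [nu, integrable_withDensity_ofReal ((measurable_wY a).const_mul _) (wY_nonneg_ae ha),
    IntegrableOn, ← integrable_const_mul_iff (IsUnit.mk0 _ (cY_pos ha).ne') (fun y => f y * wY a y)]
  grind

lemma isProbabilityMeasure_nu {a : ℝ} (ha : -1 < a) : IsProbabilityMeasure (nu a) := by
  constructor
  rw [nu, withDensity_apply _ MeasurableSet.univ, Measure.restrict_univ,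
    ← ofReal_integral_eq_lintegral_ofReal ((integrableOn_wY ha).const_mul _) (wY_nonneg_ae ha),
    integral_const_mul, cY, ← mY, inv_mul_cancel₀ (mY_pos ha).ne', ENNReal.ofReal_one]

/-- The half space of dimension `n + 1`. -/
abbrev E (n : ℕ) := (Fin n → ℝ) × ℝ

/-- The thin space. -/
abbrev V (n : ℕ) := Fin n → ℝ

notation:max "𝔟" s:max => 1 - 2 * s

/-- The Gaussian measure on `n` copies of the line. -/
def gamn (n : ℕ) : Measure (Fin n → ℝ) := Measure.pi fun _ => gam

instance (n : ℕ) : IsProbabilityMeasure (gamn n) := by unfold gamn; infer_instance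

/-- The weighted Gaussian probability measure on the half space. -/
def mu {n : ℕ} (a : ℝ) : Measure (E n) := (gamn n).prod (nu a)

lemma prob_mu (n : ℕ) {a : ℝ} (ha : -1 < a) : IsProbabilityMeasure (mu a : Measure (E n)) := by
  have := isProbabilityMeasure_nu ha
  unfold mu; infer_instance

notation:max "N₂" a:max f:max => ∫ z, f z ^ 2 ∂mu a
notation:max "I₂" a:max f:max g:max => ∫ z, f z * g z ∂mu a

/-- The open half space. -/
def Hs (n : ℕ) : Set (E n) := {z | 0 < z.2}

lemma isOpen_Hs (n : ℕ) : IsOpen (Hs n) := isOpen_lt continuous_const continuous_snd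

lemma measurableSet_Hs (n : ℕ) : MeasurableSet (Hs n) := (isOpen_Hs n).measurableSet

/-- The squared norm on the half space. -/
def nq {n : ℕ} (z : E n) : ℝ := nsq z.1 z.2

lemma nq_nonneg {n : ℕ} (z : E n) : 0 ≤ nq z := add_nonneg (by positivity) (sq_nonneg _)

lemma nq_nonneg_on {n : ℕ} {S : Set (E n)} : ∀ z ∈ S, 0 ≤ nq z := fun z _ => nq_nonneg z

lemma continuous_nq {n : ℕ} : Continuous (nq : E n → ℝ) := by unfold nq nsq; fun_prop

lemma sq_le_nq {n : ℕ} (z : E n) (i : Fin n) : z.1 i ^ 2 ≤ nq z := by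
  unfold nq nsq
  have := Finset.single_le_sum (f := fun i => z.1 i ^ 2) (fun _ _ => sq_nonneg _) (mem_univ i)
  nlinarith

lemma snd_sq_le_nq {n : ℕ} (z : E n) : z.2 ^ 2 ≤ nq z := by
  unfold nq nsq
  have : 0 ≤ ∑ i, z.1 i ^ 2 := by positivity
  linarith

lemma nu_ae_pos (a : ℝ) : ∀ᵐ y ∂(nu a), 0 < y :=
  (withDensity_absolutelyContinuous _ _).ae_le (ae_restrict_mem measurableSet_Ioi)

lemma mu_ae_mem (n : ℕ) (a : ℝ) : ∀ᵐ z ∂mu a, z ∈ Hs n := by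
  have : Measure.QuasiMeasurePreserving (Prod.snd : E n → ℝ) ((gamn n).prod (nu a)) (nu a) :=
    Measure.quasiMeasurePreserving_snd
  exact this.ae (nu_ae_pos a)

lemma gamn_eq (n : ℕ) : gamn n = volume.withDensity fun x => ENNReal.ofReal (∏ i, (cG * gE (x i))) := by
  have hi : Integrable (fun t => cG * gE t) := by
    have := (integrable_gam (f := fun _ => 1)).1 (integrable_const _)
    simpa using this.const_mul cG
  refine Measure.pi_eq fun s hs => ?_
  have hp : Integrable (fun x : Fin n → ℝ => ∏ i, (cG * gE (x i))) (volume.restrict (univ.pi s)) := by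
    rw [volume_pi, Measure.restrict_pi_pi]
    exact Integrable.fintype_prod fun i => hi.restrict
  rw [withDensity_apply _ (MeasurableSet.univ_pi hs), ← ofReal_integral_eq_lintegral_ofReal hp
    (ae_of_all _ fun x => prod_nonneg fun i _ => (mul_pos cG_pos (gE_pos _)).le),
    volume_pi, Measure.restrict_pi_pi,
    integral_fintype_prod_eq_prod (fun _ t => cG * gE t),
    ENNReal.ofReal_prod_of_nonneg fun i _ => integral_nonneg fun t =>
      (mul_pos cG_pos (gE_pos _)).le]
  refine Finset.prod_congr rfl fun i _ => ?_
  rw [gam_eq, withDensity_apply _ (hs i), ofReal_integral_eq_lintegral_ofReal hi.restrict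
    (ae_of_all _ fun t => (mul_pos cG_pos (gE_pos _)).le)]

/-- The density of `mu`. -/
def dens {n : ℕ} (a : ℝ) (z : E n) : ℝ := cG ^ n * cY a * (z.2 ^ a * exp (-nq z / 4))

lemma dens_eq {n : ℕ} (a : ℝ) (z : E n) :
    dens a z = (∏ i, (cG * gE (z.1 i))) * (cY a * wY a z.2) := by
  unfold dens wY gE nq nsq
  rw [Finset.prod_mul_distrib, Finset.prod_const, ← exp_sum, card_univ, Fintype.card_fin]
  have : -(∑ i, z.1 i ^ 2 + z.2 ^ 2) / 4 = (∑ i, -z.1 i ^ 2 / 4) + -z.2 ^ 2 / 4 := by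
    rw [neg_add, add_div, ← Finset.sum_neg_distrib, sum_div]
  rw [this, exp_add]
  ring

lemma dens_pos {n : ℕ} {a : ℝ} (ha : -1 < a) {z : E n} (hz : z ∈ Hs n) : 0 < dens a z := by
  have := cG_pos
  have := cY_pos ha
  have := rpow_pos_of_pos (show 0 < z.2 from hz) a
  unfold dens; positivity

lemma measurable_dens {n : ℕ} (a : ℝ) : Measurable (dens a : E n → ℝ) := by
  have := (continuous_nq (n := n)).measurable
  unfold dens; fun_prop

lemma restrict_Hs (n : ℕ) : (volume : Measure (E n)).restrict (Hs n) =
    (volume : Measure (Fin n → ℝ)).prod (volume.restrict (Ioi 0)) := by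
  have : Hs n = univ ×ˢ Ioi 0 := by ext z; simp [Hs]
  rw [this, Measure.volume_eq_prod, ← Measure.prod_restrict, Measure.restrict_univ]

lemma mu_eq {n : ℕ} {a : ℝ} :
    mu a = (volume.restrict (Hs n)).withDensity fun z => ENNReal.ofReal (dens a z) := by
  have h : Measurable fun x : Fin n → ℝ => ENNReal.ofReal (∏ i, (cG * gE (x i))) := by
    have := continuous_gE
    exact (by fun_prop : Continuous fun x : Fin n → ℝ => ∏ i, (cG * gE (x i))).measurable.ennreal_ofReal
  rw [mu, gamn_eq, nu, prod_withDensity h ((measurable_wY a).const_mul _).ennreal_ofReal, restrict_Hs]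
  congr 1
  funext z
  rw [dens_eq, ENNReal.ofReal_mul (prod_nonneg fun i _ => (mul_pos cG_pos (gE_pos _)).le)]

lemma dens_nonneg_ae {n : ℕ} {a : ℝ} (ha : -1 < a) :
    ∀ᵐ z ∂((volume : Measure (E n)).restrict (Hs n)), 0 ≤ dens a z := by
  filter_upwards [ae_restrict_mem (measurableSet_Hs n)] with z hz using (dens_pos ha hz).le

lemma integral_mu {n : ℕ} {a : ℝ} (ha : -1 < a) (f : E n → ℝ) :
    ∫ z, f z ∂mu a = ∫ z in Hs n, f z * dens a z := by
  rw [mu_eq, integral_withDensity_ofReal (measurable_dens a) (dens_nonneg_ae ha)]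

lemma integrable_mu {n : ℕ} {a : ℝ} (ha : -1 < a) {f : E n → ℝ} :
    Integrable f (mu a) ↔ IntegrableOn (fun z => f z * dens a z) (Hs n) := by
  rw [mu_eq, integrable_withDensity_ofReal (measurable_dens a) (dens_nonneg_ae ha), IntegrableOn]

lemma integrable_exp_gam {θ : ℝ} (hθ : θ < 1 / 4) :
    Integrable (fun t => exp (θ * t ^ 2)) gam := by
  rw [integrable_gam]
  refine (integrable_exp_neg_mul_sq (b := 1 / 4 - θ) (by linarith)).congr (ae_of_all _ fun t => ?_)
  simp only [gE]
  rw [← exp_add]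
  ring_nf

lemma integrable_rpow_exp_nu {a : ℝ} (ha : -1 < a) {b θ : ℝ} (hb : b < 1 + a) (hθ : θ < 1 / 4) :
    Integrable (fun y => y ^ (-b) * exp (θ * y ^ 2)) (nu a) := by
  rw [integrable_nu ha]
  refine (integrableOn_wY_exp (a := a - b) (by linarith) hθ).congr_fun (fun y hy => ?_)
    measurableSet_Ioi
  simp only [wY]
  rw [sub_eq_add_neg, rpow_add hy]
  ring

lemma exp_nq {n : ℕ} (θ : ℝ) (z : E n) :
    exp (θ * nq z) = (∏ i, exp (θ * z.1 i ^ 2)) * exp (θ * z.2 ^ 2) := by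
  rw [← exp_sum, ← exp_add, nq, nsq, mul_add, mul_sum]

lemma integrable_exp_gamn (n : ℕ) {θ : ℝ} (hθ : θ < 1 / 4) :
    Integrable (fun x : Fin n → ℝ => ∏ i, exp (θ * x i ^ 2)) (gamn n) :=
  Integrable.fintype_prod fun _ => integrable_exp_gam hθ

lemma integrable_exp_mu {n : ℕ} {a : ℝ} (ha : -1 < a) {b θ : ℝ} (hb : b < 1 + a) (hθ : θ < 1 / 4) :
    Integrable (fun z : E n => z.2 ^ (-b) * exp (θ * nq z)) (mu a) := by
  have h := (integrable_exp_gamn n hθ).mul_prod (integrable_rpow_exp_nu ha hb hθ)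
  refine h.congr (ae_of_all _ fun z => ?_)
  simp only
  rw [exp_nq]
  ring

/-- Growth slower than any Gaussian, with a singularity of order at most `b` at the thin space. -/
abbrev SG {n : ℕ} (b : ℝ) (f : E n → ℝ) : Prop := GR (Hs n) nq fun z => f z * z.2 ^ b

lemma SG.integrable {n : ℕ} {a b : ℝ} (ha : -1 < a) (hb : b < 1 + a) {f : E n → ℝ}
    (hf : SG b f) (hm : AEStronglyMeasurable f (mu a)) : Integrable f (mu a) := by
  obtain ⟨C, _, hC⟩ := GR.bound hf (θ := 1 / 8) (by norm_num)
  refine ((integrable_exp_mu ha hb (θ := 1 / 8) (by norm_num)).const_mul C).mono' hm ?_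
  filter_upwards [mu_ae_mem n a] with z hz
  have hz := hz
  have h := hC z hz
  have hp := rpow_pos_of_pos hz b
  rw [abs_mul, abs_of_pos hp] at h
  rw [norm_eq_abs, rpow_neg hz.le]
  calc |f z| = |f z| * z.2 ^ b * (z.2 ^ b)⁻¹ := by field_simp
    _ ≤ C * exp (1 / 8 * nq z) * (z.2 ^ b)⁻¹ := by gcongr
    _ = _ := by ring

lemma SG.memLp {n : ℕ} {a b : ℝ} (ha : -1 < a) (hb : 2 * b < 1 + a) {f : E n → ℝ}
    (hf : SG b f) (hm : AEStronglyMeasurable f (mu a)) : MemLp f 2 (mu a) := by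
  refine (memLp_two_iff_integrable_sq hm).2 (SG.integrable ha hb ?_ (hm.pow 2))
  refine (GR.mul hf hf).congr fun z hz => ?_
  rw [two_mul, rpow_add hz]
  ring

lemma _root_.ContinuousOn.aesm_mu {n : ℕ} {a : ℝ} {f : E n → ℝ}
    (hf : ContinuousOn f (Hs n)) : AEStronglyMeasurable f (mu a) := by
  rw [mu_eq]
  exact (hf.aestronglyMeasurable (measurableSet_Hs n)).mono_ac (withDensity_absolutelyContinuous _ _)

/-- Cauchy–Schwarz. -/
lemma cauchy_schwarz {X : Type*} [MeasurableSpace X] {m : Measure X} {f g : X → ℝ}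
    (hf : MemLp f 2 m) (hg : MemLp g 2 m) :
    (∫ x, f x * g x ∂m) ^ 2 ≤ (∫ x, f x ^ 2 ∂m) * ∫ x, g x ^ 2 ∂m := by
  have hfg : Integrable (fun x => f x * g x) m := hf.integrable_mul hg
  have hf2 := hf.integrable_sq
  have hg2 := hg.integrable_sq
  have h : ∀ t : ℝ, 0 ≤ (∫ x, g x ^ 2 ∂m) * (t * t) + (2 * ∫ x, f x * g x ∂m) * t + ∫ x, f x ^ 2 ∂m := by
    intro t
    have : ∫ x, (f x + t * g x) ^ 2 ∂m = (∫ x, g x ^ 2 ∂m) * (t * t)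
        + (2 * ∫ x, f x * g x ∂m) * t + ∫ x, f x ^ 2 ∂m := by
      have e : (fun x => (f x + t * g x) ^ 2) = fun x => (f x ^ 2 + (2 * t) * (f x * g x))
          + (t * t) * (g x ^ 2) := by grind
      rw [e, integral_add (by fun_prop) (by fun_prop), integral_add (by fun_prop) (by fun_prop), integral_const_mul, integral_const_mul]
      ring
    rw [← this]
    exact integral_sq _
  have := discrim_le_zero h
  rw [discrim] at this
  nlinarith

/-- `f'` is the partial derivative of `f` in the `i`-th thin direction. -/
def HasDx {n : ℕ} (i : Fin n) (f f' : E n → ℝ) : Prop :=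
  ∀ z ∈ Hs n, HasDerivAt (fun τ => f (Function.update z.1 i τ, z.2)) (f' z) (z.1 i)

/-- `f'` is the partial derivative of `f` in the extension variable. -/
def HasDy {n : ℕ} (f f' : E n → ℝ) : Prop := ∀ z ∈ Hs n, HasDerivAt (fun y => f (z.1, y)) (f' z) z.2

variable {n : ℕ} {a : ℝ}

namespace HasDx
variable {i : Fin n} {f f' g g' : E n → ℝ}

lemma congr_deriv (hf : HasDx i f f') (h : ∀ z ∈ Hs n, f' z = g' z) : HasDx i f g' :=
  fun z hz => (hf z hz).congr_deriv (h z hz)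

lemma add (hf : HasDx i f f') (hg : HasDx i g g') :
    HasDx i (fun z => f z + g z) (fun z => f' z + g' z) := fun z hz => (hf z hz).add (hg z hz)

lemma sub (hf : HasDx i f f') (hg : HasDx i g g') :
    HasDx i (fun z => f z - g z) (fun z => f' z - g' z) := fun z hz => (hf z hz).sub (hg z hz)

lemma const_mul (hf : HasDx i f f') (c : ℝ) :
    HasDx i (fun z => c * f z) (fun z => c * f' z) := fun z hz => (hf z hz).const_mul c

lemma mul (hf : HasDx i f f') (hg : HasDx i g g') :
    HasDx i (fun z => f z * g z) (fun z => f' z * g z + f z * g' z) := by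
  intro z hz
  have := (hf z hz).mul (hg z hz)
  refine this.congr_deriv ?_
  simp only [Function.update_eq_self]

lemma of_snd (p : ℝ → ℝ) : HasDx i (fun z => p z.2) (fun _ => 0) := fun z _ => hasDerivAt_const (z.1 i) (p z.2)
end HasDx

namespace HasDy
variable {f f' g g' : E n → ℝ}

lemma congr_deriv (hf : HasDy f f') (h : ∀ z ∈ Hs n, f' z = g' z) : HasDy f g' :=
  fun z hz => (hf z hz).congr_deriv (h z hz)

lemma add (hf : HasDy f f') (hg : HasDy g g') :
    HasDy (fun z => f z + g z) (fun z => f' z + g' z) := fun z hz => (hf z hz).add (hg z hz)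

lemma sub (hf : HasDy f f') (hg : HasDy g g') :
    HasDy (fun z => f z - g z) (fun z => f' z - g' z) := fun z hz => (hf z hz).sub (hg z hz)

lemma const_mul (hf : HasDy f f') (c : ℝ) :
    HasDy (fun z => c * f z) (fun z => c * f' z) := fun z hz => (hf z hz).const_mul c

lemma mul (hf : HasDy f f') (hg : HasDy g g') :
    HasDy (fun z => f z * g z) (fun z => f' z * g z + f z * g' z) :=
  fun z hz => (hf z hz).mul (hg z hz)

lemma of_snd {p p' : ℝ → ℝ} (hp : ∀ y > 0, HasDerivAt p (p' y) y) :
    HasDy (n := n) (fun z => p z.2) (fun z => p' z.2) := fun z hz => hp z.2 hz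
end HasDy

lemma nq_update (z : E n) (i : Fin n) (τ : ℝ) :
    nq (Function.update z.1 i τ, z.2) = nq z - z.1 i ^ 2 + τ ^ 2 := by
  unfold nq nsq
  have h1 := Finset.add_sum_erase Finset.univ (fun j => Function.update z.1 i τ j ^ 2) (mem_univ i)
  have h2 := Finset.add_sum_erase Finset.univ (fun j => z.1 j ^ 2) (mem_univ i)
  have h3 : ∑ x ∈ Finset.univ.erase i, (fun j => Function.update z.1 i τ j ^ 2) x
      = ∑ x ∈ Finset.univ.erase i, (fun j => z.1 j ^ 2) x := by
    refine sum_congr rfl fun j hj => ?_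
    simp only [Function.update_of_ne (Finset.ne_of_mem_erase hj)]
  grind

lemma hasDx_dens (i : Fin n) : HasDx i (dens a) fun z => -(z.1 i / 2 * dens a z) := by
  intro z hz
  have h : HasDerivAt (fun τ => -(nq z - z.1 i ^ 2 + τ ^ 2) / 4) (-(z.1 i / 2)) (z.1 i) := by
    have := (((hasDerivAt_pow 2 (z.1 i)).const_add (nq z - z.1 i ^ 2)).neg).div_const 4
    refine this.congr_deriv ?_
    simp; ring
  have := (h.exp.const_mul (z.2 ^ a)).const_mul (cG ^ n * cY a)
  simp only [dens, nq_update]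
  refine this.congr_deriv ?_
  ring

lemma hasDy_dens : HasDy (dens (n := n) a) fun z => -((z.2 / 2 - a / z.2) * dens a z) := by
  intro z hz
  have h1 : ∀ y, dens a (z.1, y) = (∏ i, (cG * gE (z.1 i))) * (cY a * wY a y) := fun y => dens_eq a (z.1, y)
  simp only [h1]
  refine (((hasDerivAt_wY a hz).const_mul (cY a)).const_mul _).congr_deriv ?_
  ring

lemma HasDx.hasLineDerivAt {i : Fin n} {f f' : E n → ℝ} (hf : HasDx i f f') (z : E n) :
    HasLineDerivAt ℝ ((Hs n).indicator f) ((Hs n).indicator f' z) z (Pi.single i 1, 0) := by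
  have hl : ∀ t : ℝ, z + t • ((Pi.single i 1, 0) : E n) = (Function.update z.1 i (z.1 i + t), z.2) := by
    intro t
    ext j
    · by_cases h : j = i
      · subst h; simp
      · simp [h]
    · simp
  unfold HasLineDerivAt
  simp only [hl]
  by_cases hz : z ∈ Hs n
  · have : (fun t => (Hs n).indicator f (Function.update z.1 i (z.1 i + t), z.2)) =
    fun t => f (Function.update z.1 i (z.1 i + t), z.2) := by
      funext t
      exact indicator_of_mem (show (Function.update z.1 i (z.1 i + t), z.2) ∈ Hs n from hz) _
    rw [this, indicator_of_mem hz]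
    have h := hf z hz
    rw [← add_zero (z.1 i)] at h
    exact h.comp_const_add _ _
  · have : (fun t => (Hs n).indicator f (Function.update z.1 i (z.1 i + t), z.2)) = fun t => 0 := by
      funext t
      exact indicator_of_notMem (show (Function.update z.1 i (z.1 i + t), z.2) ∉ Hs n from hz) _
    rw [this, indicator_of_notMem hz]
    exact hasDerivAt_const _ _

lemma HasDy.hasLineDerivAt {f f' : E n → ℝ} (hf : HasDy f f') {ε : ℝ} (hε : 0 < ε)
    (h0 : ∀ z ∈ Hs n, z.2 ≤ ε → f z = 0) (z : E n) :
    HasLineDerivAt ℝ ((Hs n).indicator f) ((Hs n).indicator f' z) z ((0, 1) : E n) := by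
  have hl : ∀ t : ℝ, z + t • ((0, 1) : E n) = (z.1, z.2 + t) := by
    intro t; ext j <;> simp
  unfold HasLineDerivAt
  simp only [hl]
  by_cases hz : z ∈ Hs n
  · have hz2 : 0 < z.2 := hz
    rw [indicator_of_mem hz]
    have h := hf z hz
    rw [← add_zero z.2] at h
    refine (h.comp_const_add _ _).congr_of_eventuallyEq ?_
    filter_upwards [Ioi_mem_nhds (show -z.2 < 0 by linarith)] with t ht
    exact indicator_of_mem (show (z.1, z.2 + t) ∈ Hs n from by
      have : -z.2 < t := ht
      show 0 < z.2 + t; linarith) _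
  · have hz2 : z.2 ≤ 0 := not_lt.1 hz
    rw [indicator_of_notMem hz]
    refine (hasDerivAt_const 0 0).congr_of_eventuallyEq ?_
    filter_upwards [Iio_mem_nhds hε] with t ht
    have ht : t < ε := ht
    by_cases h : (z.1, z.2 + t) ∈ Hs n
    · rw [indicator_of_mem h]
      exact h0 _ h (by grind)
    · exact indicator_of_notMem h _

lemma integral_lineDeriv_eq_zero {f f' : E n → ℝ} {v : E n} (hf : Integrable f)
    (hf' : Integrable f') (h : ∀ z, HasLineDerivAt ℝ f (f' z) z v) : ∫ z, f' z = 0 := by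
  have : (volume : Measure (E n)).IsAddHaarMeasure := by
    rw [Measure.volume_eq_prod]; infer_instance
  have := integral_bilinear_hasLineDerivAt_right_eq_neg_left_of_integrable (μ := (volume : Measure (E n)))
    (B := ContinuousLinearMap.mul ℝ ℝ) (f := fun _ => 1) (f' := fun _ => 0)
    (g' := f') (by simp) (by simpa using hf') (by simpa using hf)
    (fun x _ => by
      exact hasDerivAt_const _ _) (fun x _ => h x)
  simpa using this

/-- Gaussian integration by parts in a thin direction. -/
lemma ibp_x (ha : -1 < a) {i : Fin n} {f f' : E n → ℝ} (hf : HasDx i f f')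
    (h1 : Integrable f (mu a)) (h2 : Integrable f' (mu a))
    (h3 : Integrable (fun z => z.1 i * f z) (mu a)) :
    ∫ z, f' z ∂mu a = 1 / 2 * ∫ z, z.1 i * f z ∂mu a := by
  have hd := hf.mul (hasDx_dens (a := a) i)
  have i1 := (integrable_mu ha).1 h1
  have i2 := (integrable_mu ha).1 (h2.sub (h3.const_mul (1 / 2)))
  have e : ∀ z, f' z * dens a z + f z * -(z.1 i / 2 * dens a z) = (f' z - 1 / 2 * (z.1 i * f z)) * dens a z := by grind
  simp only [e] at hd
  have := integral_lineDeriv_eq_zero (i1.integrable_indicator (measurableSet_Hs n))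
    (i2.integrable_indicator (measurableSet_Hs n)) hd.hasLineDerivAt
  rw [integral_indicator (measurableSet_Hs n)] at this
  have h4 : ∫ z, (f' z - 1 / 2 * (z.1 i * f z)) ∂mu a = 0 := by
    rw [integral_mu ha, ← this]; rfl
  rw [integral_sub h2 (h3.const_mul _), integral_const_mul] at h4
  linarith

/-- Gaussian integration by parts in the extension direction, away from the thin space. -/
lemma ibp_y (ha : -1 < a) {f f' : E n → ℝ} (hf : HasDy f f') {ε : ℝ} (hε : 0 < ε) (h0 : ∀ z ∈ Hs n, z.2 ≤ ε → f z = 0)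
    (h1 : Integrable f (mu a))
    (h3 : Integrable (fun z => f' z - (z.2 / 2 - a / z.2) * f z) (mu a)) :
    ∫ z, (f' z - (z.2 / 2 - a / z.2) * f z) ∂mu a = 0 := by
  have hd := hf.mul (hasDy_dens (a := a))
  have i1 := (integrable_mu ha).1 h1
  have i2 := (integrable_mu ha).1 h3
  have e : ∀ z : E n, f' z * dens a z + f z * -((z.2 / 2 - a / z.2) * dens a z)
      = (f' z - (z.2 / 2 - a / z.2) * f z) * dens a z := by grind
  simp only [e] at hd
  have := integral_lineDeriv_eq_zero (i1.integrable_indicator (measurableSet_Hs n))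
    (i2.integrable_indicator (measurableSet_Hs n))
    (hd.hasLineDerivAt hε fun z hz hz' => by rw [h0 z hz hz', zero_mul])
  rw [integral_indicator (measurableSet_Hs n)] at this
  rw [integral_mu ha, ← this]

/-- Adding a thin coordinate. -/
def consE (n : ℕ) : E n × ℝ ≃ᵐ E (n + 1) := MeasurableEquiv.prodComm.trans ((MeasurableEquiv.prodAssoc.symm).trans
    ((MeasurableEquiv.piFinSuccAbove (fun _ => ℝ) 0).symm.prodCongr (MeasurableEquiv.refl ℝ)))

lemma consE_apply (z : E n) (t : ℝ) : consE n (z, t) = (Fin.cons t z.1, z.2) := by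
  simp [consE, MeasurableEquiv.prodComm, MeasurableEquiv.prodCongr]
  rfl

lemma measurePreserving_consE (ha : -1 < a) :
    MeasurePreserving (consE n) ((mu a).prod gam) (mu a) := by
  have := prob_mu n ha
  have h1 : MeasurePreserving (MeasurableEquiv.prodComm (α := E n) (β := ℝ))
      ((mu a).prod gam) (gam.prod (mu a)) := Measure.measurePreserving_swap
  have h2 := (measurePreserving_prodAssoc gam (gamn n) (nu a)).symm _
  have h3 := (measurePreserving_piFinSuccAbove (fun _ : Fin (n+1) => gam) 0).symm _
  have h4 := h3.prod (MeasurePreserving.id (nu a))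
  exact h4.comp (h2.comp h1)

lemma integral_consE (ha : -1 < a) {f : E (n + 1) → ℝ} (hf : Integrable f (mu a)) :
    ∫ z, f z ∂mu a = ∫ z, ∫ t, f (Fin.cons t z.1, z.2) ∂gam ∂mu a := by
  have := prob_mu n ha
  have h := measurePreserving_consE (n := n) ha
  rw [← h.integral_comp (consE n).measurableEmbedding]
  have h2 : Integrable (fun p => f (consE n p)) ((mu a).prod gam) :=
    (h.integrable_comp_emb (consE n).measurableEmbedding).2 hf
  rw [integral_prod _ h2]
  simp only [consE_apply]

lemma integrable_consE (ha : -1 < a) {f : E (n + 1) → ℝ} (hf : Integrable f (mu a)) :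
    Integrable (fun z => ∫ t, f (Fin.cons t z.1, z.2) ∂gam) (mu a) := by
  have := prob_mu n ha
  have h := measurePreserving_consE (n := n) ha
  have h2 : Integrable (fun p => f (consE n p)) ((mu a).prod gam) :=
    (h.integrable_comp_emb (consE n).measurableEmbedding).2 hf
  have := h2.integral_prod_left
  simpa only [consE_apply] using this

lemma nq_cons (z : E n) (t : ℝ) : nq ((Fin.cons t z.1, z.2) : E (n + 1)) = t ^ 2 + nq z := by
  simp [nq, nsq, Fin.sum_univ_succ, add_assoc]

namespace SG
variable {b c : ℝ} {f g : E n → ℝ}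

lemma of_GR (hf : GR (Hs n) nq f) : SG 0 f := hf.congr fun z _ => by simp

lemma to_GR (hf : SG 0 f) : GR (Hs n) nq f := hf.congr fun z _ => by simp

lemma mul (hf : SG b f) (hg : SG c g) : SG (b + c) fun z => f z * g z := by
  refine (GR.mul hf hg).congr fun z hz => ?_
  rw [rpow_add hz]; ring

lemma add (hf : SG b f) (hg : SG b g) : SG b fun z => f z + g z := by
  refine (GR.add hf hg).congr fun z hz => ?_
  ring

lemma sub (hf : SG b f) (hg : SG b g) : SG b fun z => f z - g z := by
  refine (GR.sub hf hg).congr fun z hz => ?_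
  ring

lemma const_mul (hf : SG b f) (k : ℝ) : SG b fun z => k * f z := by
  refine (GR.const_mul hf k).congr fun z hz => ?_
  ring

lemma pow2 (hf : SG b f) : SG (2 * b) fun z => f z ^ 2 := by
  refine GR.congr (mul hf hf) fun z hz => ?_
  rw [two_mul]; ring

lemma sum {ι : Type*} (s : Finset ι) {F : ι → E n → ℝ} (hF : ∀ i ∈ s, SG b (F i)) :
    SG b fun z => ∑ i ∈ s, F i z := by
  refine (GR.sum s hF).congr fun z hz => ?_
  rw [sum_mul]

lemma rpow (b : ℝ) (hb : 0 ≤ b) : SG 0 fun z : E n => z.2 ^ b := by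
  refine of_GR (GR.of_rpow nq_nonneg_on zero_le_one b fun z hz => ?_)
  have hz := hz
  have h2 := snd_sq_le_nq z
  rw [one_mul, abs_of_pos (rpow_pos_of_pos hz _)]
  exact rpow_le_rpow hz.le (by nlinarith) hb

lemma mono_exp (hf : SG b f) (h : b ≤ c) : SG c f := by
  refine (GR.mul hf (to_GR (rpow (c - b) (by linarith)))).congr fun z hz => ?_
  rw [mul_assoc, ← rpow_add hz]; ring_nf

lemma const (k : ℝ) : SG 0 fun _ : E n => k := of_GR (GR.const nq_nonneg_on k)

lemma coord (i : Fin n) : SG 0 fun z : E n => z.1 i := of_GR (GR.of_sq_le nq_nonneg_on fun z _ => sq_le_nq z i)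

lemma snd : SG 0 fun z : E n => z.2 := of_GR (GR.of_sq_le nq_nonneg_on fun z _ => snd_sq_le_nq z)

lemma of_bdd {C : ℝ} (h : ∀ z ∈ Hs n, |f z| ≤ C) : SG 0 f := of_GR (GR.of_bdd nq_nonneg_on h)

lemma mul0 (hf : SG b f) (hg : SG 0 g) : SG b fun z => f z * g z := by
  simpa using mul hf hg

end SG

/-- Continuously differentiable functions on the half space with subgaussian growth. -/
structure PC (n : ℕ) (a : ℝ) (f : E n → ℝ) (fx : Fin n → E n → ℝ) (fy : E n → ℝ) : Prop where
  cont : ContinuousOn f (Hs n)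
  contx : ∀ i, ContinuousOn (fx i) (Hs n)
  conty : ContinuousOn fy (Hs n)
  dx : ∀ i, HasDx i f (fx i)
  dy : HasDy f fy
  sg : SG 0 f
  sgx : ∀ i, SG 0 (fx i)
  sgy : SG a fy

namespace PC
variable {f g : E n → ℝ} {fx gx : Fin n → E n → ℝ} {fy gy : E n → ℝ}

lemma add (hf : PC n a f fx fy) (hg : PC n a g gx gy) :
    PC n a (fun z => f z + g z) (fun i z => fx i z + gx i z) (fun z => fy z + gy z) :=
  ⟨hf.cont.add hg.cont, fun i => (hf.contx i).add (hg.contx i), hf.conty.add hg.conty,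
    fun i => (hf.dx i).add (hg.dx i), hf.dy.add hg.dy, SG.add hf.sg hg.sg,
    fun i => SG.add (hf.sgx i) (hg.sgx i), SG.add hf.sgy hg.sgy⟩

lemma sub (hf : PC n a f fx fy) (hg : PC n a g gx gy) :
    PC n a (fun z => f z - g z) (fun i z => fx i z - gx i z) (fun z => fy z - gy z) :=
  ⟨hf.cont.sub hg.cont, fun i => (hf.contx i).sub (hg.contx i), hf.conty.sub hg.conty,
    fun i => (hf.dx i).sub (hg.dx i), hf.dy.sub hg.dy, SG.sub hf.sg hg.sg,
    fun i => SG.sub (hf.sgx i) (hg.sgx i), SG.sub hf.sgy hg.sgy⟩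

lemma const_mul (hf : PC n a f fx fy) (c : ℝ) :
    PC n a (fun z => c * f z) (fun i z => c * fx i z) (fun z => c * fy z) :=
  ⟨continuousOn_const.mul hf.cont, fun i => continuousOn_const.mul (hf.contx i),
    continuousOn_const.mul hf.conty, fun i => (hf.dx i).const_mul c, hf.dy.const_mul c,
    SG.const_mul hf.sg c, fun i => SG.const_mul (hf.sgx i) c, SG.const_mul hf.sgy c⟩

lemma const (c : ℝ) : PC n a (fun _ => c) (fun _ _ => 0) (fun _ => 0) :=
  ⟨continuousOn_const, fun _ => continuousOn_const, continuousOn_const,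
    fun _ _ _ => hasDerivAt_const _ _, fun _ _ => hasDerivAt_const _ _, SG.const c,
    fun _ => SG.const 0, (SG.const 0).congr fun _ _ => by simp⟩

lemma memLp (ha : -1 < a) (hf : PC n a f fx fy) : MemLp f 2 (mu a) := SG.memLp ha (by linarith) hf.sg hf.cont.aesm_mu

lemma memLpx (ha : -1 < a) (hf : PC n a f fx fy) (i : Fin n) : MemLp (fx i) 2 (mu a) :=
  SG.memLp ha (by linarith) (hf.sgx i) (hf.contx i).aesm_mu

lemma memLpy (ha : -1 < a) (ha' : a < 1) (hf : PC n a f fx fy) : MemLp fy 2 (mu a) :=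
  SG.memLp ha (by linarith) hf.sgy hf.conty.aesm_mu

end PC

/-- The `p`-moment of `f` in the first thin coordinate. -/
def marg (p : ℝ → ℝ) (f : E (n + 1) → ℝ) (z : E n) : ℝ := ∫ t, f (Fin.cons t z.1, z.2) * p t ∂gam

lemma SG1.integrable_gam' {f : ℝ → ℝ} (hf : SG1 f) (hm : Continuous f) : Integrable f gam :=
  integrable_gam.2 (SG1.integrable hf hm.aestronglyMeasurable)

lemma continuous_slice {f : E (n + 1) → ℝ} (hf : ContinuousOn f (Hs (n + 1))) {z : E n}
    (hz : z ∈ Hs n) : Continuous fun t => f (Fin.cons t z.1, z.2) := by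
  refine hf.comp_continuous (f := fun t => ((Fin.cons t z.1, z.2) : E (n + 1))) ?_ fun t => hz
  refine Continuous.prodMk ?_ continuous_const
  exact Continuous.finCons continuous_id continuous_const

/-- Locally uniform domination of slices. -/
lemma SG.slice_bound {b : ℝ} {f : E (n + 1) → ℝ} (hf : SG b f) {z : E n} (hz : z ∈ Hs n)
    {θ : ℝ} (hθ : 0 < θ) :
    ∃ C, ∀ᶠ w in 𝓝 z, w ∈ Hs n ∧ ∀ t, |f (Fin.cons t w.1, w.2)| ≤ C * exp (θ * t ^ 2) := by
  obtain ⟨C, hC0, hC⟩ := GR.bound hf hθ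
  have hz' := hz
  have hc : ContinuousAt (fun w => C * exp (θ * nq w) * w.2 ^ (-b)) z := by
    have h1 : ContinuousAt (fun w => w.2 ^ (-b)) z := continuousAt_snd.rpow_const (Or.inl hz'.ne')
    have h2 : Continuous (fun w : E n => C * exp (θ * nq w)) := by
      have := continuous_nq (n := n); fun_prop
    exact h2.continuousAt.mul h1
  have h3 := hc.eventually (Iio_mem_nhds (lt_add_one (C * exp (θ * nq z) * z.2 ^ (-b))))
  refine ⟨C * exp (θ * nq z) * z.2 ^ (-b) + 1, ?_⟩
  filter_upwards [h3, (isOpen_Hs n).mem_nhds hz] with w hw hwH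
  refine ⟨hwH, fun t => ?_⟩
  have hw2 := hwH
  have h := hC (Fin.cons t w.1, w.2) hwH
  have hp := rpow_pos_of_pos hw2 b
  rw [nq_cons, mul_add, exp_add, abs_mul, abs_of_pos hp] at h
  have h5 : |f (Fin.cons t w.1, w.2)| ≤ C * exp (θ * nq w) * w.2 ^ (-b) * exp (θ * t ^ 2) := by
    rw [rpow_neg hw2.le]
    calc _ = |f (Fin.cons t w.1, w.2)| * w.2 ^ b * (w.2 ^ b)⁻¹ := by field_simp
      _ ≤ C * (exp (θ * t ^ 2) * exp (θ * nq w)) * (w.2 ^ b)⁻¹ := by gcongr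
      _ = _ := by ring
  refine h5.trans ?_
  gcongr

lemma SG.slice {b : ℝ} {f : E (n + 1) → ℝ} (hf : SG b f) {z : E n} (hz : z ∈ Hs n) :
    SG1 fun t => f (Fin.cons t z.1, z.2) := by
  intro θ hθ
  obtain ⟨C, hC⟩ := hf.slice_bound hz hθ
  exact ⟨C, fun t _ => hC.self_of_nhds.2 t⟩

lemma integrable_exp_mul_gam {p : ℝ → ℝ} (hp : SG1 p) (hpc : Continuous p) (C : ℝ) :
    Integrable (fun t => C * exp (1 / 8 * t ^ 2) * |p t|) gam := by
  obtain ⟨D, hD0, hD⟩ := GR.bound hp (θ := 1 / 16) (by norm_num)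
  refine ((integrable_exp_gam (θ := 3 / 16) (by norm_num)).const_mul (|C| * D)).mono'
    (by fun_prop) (ae_of_all _ fun t => ?_)
  rw [norm_eq_abs, abs_mul, abs_mul, abs_abs, abs_exp]
  calc |C| * exp (1 / 8 * t ^ 2) * |p t| ≤
      |C| * exp (1 / 8 * t ^ 2) * (D * exp (1 / 16 * t ^ 2)) := by
        gcongr; exact hD t trivial
    _ = |C| * D * (exp (1 / 8 * t ^ 2) * exp (1 / 16 * t ^ 2)) := by ring
    _ = _ := by rw [← exp_add]; ring_nf

lemma continuousOn_marg {b : ℝ} {p : ℝ → ℝ} (hp : SG1 p) (hpc : Continuous p)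
    {f : E (n + 1) → ℝ} (hf : SG b f) (hc : ContinuousOn f (Hs (n + 1))) :
    ContinuousOn (marg p f) (Hs n) := by
  intro z hz
  refine ContinuousAt.continuousWithinAt ?_
  obtain ⟨C, hC⟩ := hf.slice_bound hz (θ := 1 / 8) (by norm_num)
  refine continuousAt_of_dominated ?_ ?_ (integrable_exp_mul_gam hp hpc C) ?_
  · filter_upwards [hC] with w hw
    exact ((continuous_slice hc hw.1).mul hpc).aestronglyMeasurable
  · filter_upwards [hC] with w hw
    refine ae_of_all _ fun t => ?_
    rw [norm_mul, norm_eq_abs, norm_eq_abs]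
    exact mulR (hw.2 t) (abs_nonneg _)
  · refine ae_of_all _ fun t => ?_
    refine ContinuousAt.mul ?_ continuousAt_const
    have hm : ContinuousAt f ((Fin.cons t z.1, z.2) : E (n + 1)) := hc.continuousAt ((isOpen_Hs _).mem_nhds hz)
    refine ContinuousAt.comp (f := fun w => ((Fin.cons t w.1, w.2) : E (n + 1))) (x := z) hm ?_
    refine (Continuous.prodMk ?_ continuous_snd).continuousAt
    exact Continuous.finCons continuous_const continuous_fst

lemma SG.marg {b : ℝ} {p : ℝ → ℝ} (hp : SG1 p) (hpc : Continuous p)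
    {f : E (n + 1) → ℝ} (hf : SG b f) : SG b (marg p f) := by
  suffices H : ∀ θ > 0, θ ≤ 1 / 8 → ∃ C, ∀ z ∈ Hs n, |FG.marg p f z * z.2 ^ b| ≤ C * exp (θ * nq z) by
    intro θ hθ
    obtain ⟨C, hC⟩ := H (min θ (1 / 8)) (by positivity) (by grind)
    refine ⟨|C|, fun z hz => (hC z hz).trans ?_⟩
    have := nq_nonneg z
    gcongr
    · grind
    · simp
  intro θ hθ hθ8
  obtain ⟨C, hC0, hC⟩ := GR.bound hf hθ
  refine ⟨∫ t, C * exp (1 / 8 * t ^ 2) * |p t| ∂gam, fun z hz => ?_⟩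
  have hz2 := hz
  unfold FG.marg
  rw [← integral_mul_const, ← integral_mul_const, ← norm_eq_abs]
  refine norm_integral_le_of_norm_le ((integrable_exp_mul_gam hp hpc C).mul_const _) (ae_of_all _ fun t => ?_)
  have h := hC (Fin.cons t z.1, z.2) hz
  rw [nq_cons, mul_add, exp_add] at h
  rw [mul_right_comm, norm_mul, norm_eq_abs, norm_eq_abs]
  calc _ ≤ C * (exp (θ * t ^ 2) * exp (θ * nq z)) * |p t| := by gcongr
    _ ≤ C * (exp (1 / 8 * t ^ 2) * exp (θ * nq z)) * |p t| := by gcongr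
    _ = _ := by ring

/-- Differentiation of a marginal along a curve. -/
lemma hasDerivAt_marg {b : ℝ} {p : ℝ → ℝ} (hp : SG1 p) (hpc : Continuous p)
    {f f' : E (n + 1) → ℝ} (hc : ContinuousOn f (Hs (n + 1))) (hc' : ContinuousOn f' (Hs (n + 1)))
    (hf : SG 0 f) (hf' : SG b f') {w : ℝ → E n} (hw : Continuous w) {τ₀ : ℝ} (h0 : w τ₀ ∈ Hs n)
    (hd : ∀ t τ, w τ ∈ Hs n → HasDerivAt (fun τ => f (Fin.cons t (w τ).1, (w τ).2))
      (f' (Fin.cons t (w τ).1, (w τ).2)) τ) :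
    HasDerivAt (fun τ => marg p f (w τ)) (marg p f' (w τ₀)) τ₀ := by
  obtain ⟨C, hC⟩ := hf'.slice_bound h0 (θ := 1 / 8) (by norm_num)
  have hC := hw.continuousAt.eventually hC
  refine (hasDerivAt_integral_of_dominated_loc_of_deriv_le (F := fun τ t => f (Fin.cons t (w τ).1, (w τ).2) * p t)
    (F' := fun τ t => f' (Fin.cons t (w τ).1, (w τ).2) * p t) hC
    (bound := fun t => C * exp (1 / 8 * t ^ 2) * |p t|) ?_ ?_ ?_ ?_
    (integrable_exp_mul_gam hp hpc C) ?_).2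
  · filter_upwards [hC] with τ hτ
    exact ((continuous_slice hc hτ.1).mul hpc).aestronglyMeasurable
  · exact SG1.integrable_gam' (GR.mul (hf.slice h0) hp) ((continuous_slice hc h0).mul hpc)
  · exact ((continuous_slice hc' h0).mul hpc).aestronglyMeasurable
  · refine ae_of_all _ fun t τ hτ => ?_
    rw [norm_mul, norm_eq_abs, norm_eq_abs]
    exact mulR (hτ.2 t) (abs_nonneg _)
  · exact ae_of_all _ fun t τ hτ => (hd t τ hτ.1).mul_const _

lemma PC.marg {f : E (n + 1) → ℝ} {fx : Fin (n + 1) → E (n + 1) → ℝ} {fy : E (n + 1) → ℝ}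
    (hf : PC (n + 1) a f fx fy) {p : ℝ → ℝ} (hp : SG1 p) (hpc : Continuous p) :
    PC n a (marg p f) (fun i => marg p (fx i.succ)) (marg p fy) := by
  refine ⟨continuousOn_marg hp hpc hf.sg hf.cont, fun i => continuousOn_marg hp hpc (hf.sgx _) (hf.contx _),
    continuousOn_marg hp hpc hf.sgy hf.conty, fun i z hz => ?_, fun z hz => ?_,
    hf.sg.marg hp hpc, fun i => (hf.sgx _).marg hp hpc, hf.sgy.marg hp hpc⟩
  · have := hasDerivAt_marg hp hpc hf.cont (hf.contx i.succ) hf.sg (hf.sgx i.succ)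
      (w := fun τ => (Function.update z.1 i τ, z.2)) (τ₀ := z.1 i)
      (by fun_prop) (by simpa using hz) (fun t τ hτ => by
        have := hf.dx i.succ (Fin.cons t (Function.update z.1 i τ), z.2) hτ
        simpa [← Fin.cons_update] using this)
    simpa using this
  · exact hasDerivAt_marg hp hpc hf.cont hf.conty hf.sg hf.sgy (w := fun y => (z.1, y)) (τ₀ := z.2)
      (by fun_prop) hz (fun t y hy => hf.dy (Fin.cons t z.1, y) hy)

lemma integral_sq_gam : ∫ t, t ^ 2 ∂gam = 2 := by
  have h := gauss_ibp (f := fun t => t) (f' := fun _ => 1) (fun t => hasDerivAt_id t) SG1.id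
    (GR.const sq_nonneg_on 1) aestronglyMeasurable_const
  have h1 : ∫ t, (1:ℝ) ∂gam = 1 := by simp
  rw [integral_gam] at h1 ⊢
  have : (fun t => t / 2 * t * gE t) = fun t => 1 / 2 * (t ^ 2 * gE t) := by ring
  rw [this, integral_const_mul (1 / 2 : ℝ)] at h
  grind

lemma integral_id_gam : ∫ t, t ∂gam = 0 := by
  have h := gauss_ibp (f' := fun _ => 0) (fun t => hasDerivAt_const t 1)
    (GR.const sq_nonneg_on 1) (GR.const sq_nonneg_on 0) aestronglyMeasurable_const
  have : (fun t => t / 2 * 1 * gE t) = fun t => 1 / 2 * (t * gE t) := by ring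
  rw [this, integral_const_mul (1 / 2 : ℝ)] at h
  simp only [zero_mul, integral_zero] at h
  rw [integral_gam]
  rw [show ∫ t : ℝ, t * gE t = 0 by linarith, mul_zero]

/-- Expansion of the energy of `f` minus its affine part. -/
lemma gam_affine {f : ℝ → ℝ} (hf : SG1 f) (hc : Continuous f) (m b : ℝ) :
    ∫ t, (f t - m - b * t) ^ 2 ∂gam = ∫ t, f t ^ 2 ∂gam + m ^ 2 + 2 * b ^ 2
      - 2 * m * ∫ t, f t ∂gam - 2 * b * ∫ t, f t * t ∂gam := by
  have i1 := SG1.integrable_gam' (GR.pow sq_nonneg_on hf 2) (hc.pow 2)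
  have i2 := SG1.integrable_gam' hf hc
  have i3 := SG1.integrable_gam' (GR.mul hf SG1.id) (by fun_prop)
  have i4 : ∀ c : ℝ, Integrable (fun t => c * t) gam := fun c =>
    (SG1.integrable_gam' SG1.id continuous_id).const_mul c
  have i5 : Integrable (fun t => t ^ 2) gam := SG1.integrable_gam' (GR.pow sq_nonneg_on SG1.id 2) (by fun_prop)
  have e : (fun t => (f t - m - b * t) ^ 2) = fun t => (f t ^ 2 + (-2 * m) * f t)
      + ((-2 * b) * (f t * t) + ((2 * m * b) * t + (b ^ 2 * t ^ 2 + m ^ 2))) := by grind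
  have k1 : Integrable (fun t => b ^ 2 * t ^ 2 + m ^ 2) gam := by fun_prop
  have k2 : Integrable (fun t => (2 * m * b) * t + (b ^ 2 * t ^ 2 + m ^ 2)) gam := (i4 _).add k1
  have k3 : Integrable (fun t => (-2 * b) * (f t * t)
      + ((2 * m * b) * t + (b ^ 2 * t ^ 2 + m ^ 2))) gam := (i3.const_mul _).add k2
  have k4 : ∫ t : ℝ, (2 * m * b) * t ∂gam = 0 := by
    rw [integral_const_mul, integral_id_gam, mul_zero]
  rw [e, integral_add (by fun_prop) k3, integral_add (by fun_prop) (by fun_prop),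
    integral_add (by fun_prop) k2, integral_add (i4 _) k1, k4,
    integral_add (by fun_prop) (by fun_prop)]
  simp only [integral_const_mul, integral_sq_gam]
  simp
  ring

lemma gam_bessel {f : ℝ → ℝ} (hf : SG1 f) (hc : Continuous f) :
    (∫ t, f t ∂gam) ^ 2 + 1 / 2 * (∫ t, f t * t ∂gam) ^ 2 ≤ ∫ t, f t ^ 2 ∂gam := by
  have h := gam_affine hf hc (∫ t, f t ∂gam) (1 / 2 * ∫ t, f t * t ∂gam)
  have : 0 ≤ ∫ t, (f t - (∫ t, f t ∂gam) - (1 / 2 * ∫ t, f t * t ∂gam) * t) ^ 2 ∂gam := by positivity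
  nlinarith

lemma gam_P {f f' : ℝ → ℝ} (hd : ∀ t, HasDerivAt f (f' t) t) (hf : SG1 f) (hf' : SG1 f') (hc' : Continuous f') :
    1 / 2 * (∫ t, f t ^ 2 ∂gam - (∫ t, f t ∂gam) ^ 2) ≤ ∫ t, f' t ^ 2 ∂gam ∧
    ∫ t, f t ^ 2 ∂gam - (∫ t, f t ∂gam) ^ 2 - 1 / 4 * (∫ t, f t * t ∂gam) ^ 2 ≤ ∫ t, f' t ^ 2 ∂gam := by
  have hc := continuous_iff_continuousAt.2 fun t => (hd t).continuousAt
  have hG : ∀ F : ℝ → ℝ, ∫ t, F t ∂gam = 0 → ∫ t, F t * gE t = 0 := by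
    intro F hF
    rw [integral_gam] at hF
    exact (mul_eq_zero.1 hF).resolve_left cG_pos.ne'
  have hm : ∀ b : ℝ, SG1 fun t => f t - (∫ t, f t ∂gam) - b * t := fun b =>
    GR.sub (GR.sub hf (GR.const sq_nonneg_on _)) (GR.const_mul SG1.id b)
  have hdd : ∀ b t : ℝ, HasDerivAt (fun t => f t - (∫ t, f t ∂gam) - b * t) (f' t - b) t := by
    intro b t
    exact (((hd t).sub_const (∫ t, f t ∂gam)).sub ((hasDerivAt_id t).const_mul b)).congr_deriv (by simp)
  have hmd : ∀ b : ℝ, SG1 fun t => f' t - b := fun b => GR.sub hf' (GR.const sq_nonneg_on b)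
  have i2 := SG1.integrable_gam' hf hc
  have i3 := SG1.integrable_gam' (GR.mul hf SG1.id) (hc.mul continuous_id)
  have i4 : ∀ c : ℝ, Integrable (fun t => c * t) gam := fun c =>
    (SG1.integrable_gam' SG1.id continuous_id).const_mul c
  have i5 : Integrable (fun t => t ^ 2) gam := SG1.integrable_gam' (GR.pow sq_nonneg_on SG1.id 2) (continuous_id.pow 2)
  have z0 : ∀ b : ℝ, ∫ t, (f t - (∫ t, f t ∂gam) - b * t) ∂gam = 0 := by
    intro b
    rw [integral_sub (by fun_prop) (i4 b), integral_sub (by fun_prop) (by fun_prop),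
      integral_const_mul, integral_id_gam]
    simp
  constructor
  · have h := gauss_P1 (hdd 0) (hm 0) (hmd 0) (by fun_prop) (hG _ (z0 0))
    have h2 := gam_affine hf hc (∫ t, f t ∂gam) 0
    rw [integral_gam] at h2
    rw [integral_gam (fun t => f' t ^ 2)]
    simp only [sub_zero] at h
    have := mulL h cG_pos.le
    linarith
  · set b := 1 / 2 * ∫ t, f t * t ∂gam with hb
    have z1 : ∫ t, t * (f t - (∫ t, f t ∂gam) - b * t) ∂gam = 0 := by
      have e : (fun t => t * (f t - (∫ t, f t ∂gam) - b * t)) = fun t => f t * t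
          - (∫ t, f t ∂gam) * t - b * t ^ 2 := by funext t; ring
      have k : Integrable (fun t => f t * t - (∫ t, f t ∂gam) * t) gam := i3.sub (i4 _)
      rw [e, integral_sub k (by fun_prop), integral_sub i3 (i4 _),
        integral_const_mul, integral_const_mul, integral_id_gam, integral_sq_gam, hb]
      ring
    have h := gauss_P2 (hdd b) (hm b) (hmd b) (by fun_prop) (hG _ (z0 b)) (hG _ z1)
    have h2 := gam_affine hf hc (∫ t, f t ∂gam) b
    rw [integral_gam] at h2
    have hfb : ∫ t, f' t ∂gam = b := by
      rw [integral_gam, gauss_ibp hd hf hf' hc'.aestronglyMeasurable, hb, integral_gam]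
      have : (fun t => t / 2 * f t * gE t) = fun t => 1 / 2 * (f t * t * gE t) := by
        funext t; ring
      rw [this, integral_const_mul]; ring
    have h3 := gam_affine hf' hc' b 0
    rw [integral_gam] at h3
    simp only [zero_mul, sub_zero] at h3
    have := mulL h cG_pos.le
    have h4 : ∫ t, f t * t ∂gam = 2 * b := by rw [hb]; ring
    rw [h4] at h2 ⊢
    rw [hfb] at h3
    rw [integral_gam (fun t => f' t ^ 2)]
    rw [integral_gam (fun t => f' t ^ 2)] at h3
    rw [h3] at this
    rw [h2] at this
    nlinarith

/-- The Dirichlet form of a function with partial derivatives `fx`, `fy`. -/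
def dirich (a : ℝ) (fx : Fin n → E n → ℝ) (fy : E n → ℝ) : ℝ := (∑ i, N₂ a (fx i)) + N₂ a fy

lemma poincare_base (ha : -1 < a) (ha' : a < 1) {f : E 0 → ℝ} {fx fy} (hf : PC 0 a f fx fy) :
    N₂ a f - (∫ z, f z ∂mu a) ^ 2 ≤ dirich a fx fy := by
  have hprob := isProbabilityMeasure_nu ha
  have hpm := prob_mu 0 ha
  set x0 : Fin 0 → ℝ := finZeroElim with hx0
  have hi : ∀ F : E 0 → ℝ, Integrable F (mu a) → ∫ z, F z ∂mu a = ∫ y, F (x0, y) ∂(nu a) := by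
    intro F hF
    rw [mu, integral_prod_symm _ hF]
    refine integral_congr_ae (ae_of_all _ fun y => ?_)
    have : ∀ x : Fin 0 → ℝ, F (x, y) = F (x0, y) := fun x => by rw [Subsingleton.elim x x0]
    simp only [this]
    simp
  have i1 := (hf.memLp ha).integrable_sq
  have i2 := (hf.memLp ha).integrable (by norm_num)
  have i3 := (hf.memLpy ha ha').integrable_sq
  unfold dirich
  rw [Finset.univ_eq_empty, Finset.sum_empty, zero_add, hi _ i1, hi _ i2, hi _ i3]
  set m := ∫ y, f (x0, y) ∂(nu a) with hm
  have hnq : ∀ y : ℝ, nq ((x0, y) : E 0) = y ^ 2 := fun y => by simp [nq, nsq]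
  have hcs : ∀ F : E 0 → ℝ, ContinuousOn F (Hs 0) → ContinuousOn (fun y => F (x0, y)) (Ioi 0) := fun F hF =>
    hF.comp (f := fun y => ((x0, y) : E 0)) (by fun_prop) fun y hy => hy
  have s1 : SGY fun y => f (x0, y) := by
    intro θ hθ
    obtain ⟨C, hC⟩ := SG.to_GR hf.sg θ hθ
    refine ⟨C, fun y hy => ?_⟩
    have := hC (x0, y) hy
    rwa [hnq] at this
  have s2 := GR.sub s1 (GR.const sq_nonneg_on m)
  have hmf := (hcs _ hf.cont).aestronglyMeasurable (μ := volume) measurableSet_Ioi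
  have hmd := (hcs _ hf.conty).aestronglyMeasurable (μ := volume) measurableSet_Ioi
  have j1 := (integrable_nu ha).2 (SGY.integrableOn ha s1 hmf)
  have j2 := (integrable_nu ha).2 (SGY.integrableOn ha (GR.pow sq_nonneg_on s1 2) (hmf.pow 2))
  have j3 : IntegrableOn (fun y => fy (x0, y) ^ 2 * wY a y) (Ioi 0) := by
    refine (integrable_nu ha).1 ?_
    have := (integrable_prod_iff' i3.1).1 i3
    refine this.2.congr (ae_of_all _ fun y => ?_)
    have : ∀ x : Fin 0 → ℝ, fy (x, y) = fy (x0, y) := fun x => by rw [Subsingleton.elim x x0]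
    simp [this]
  have h := wY_poincare_zero ha ha' (f := fun y => f (x0, y) - m)
    (f' := fun y => fy (x0, y)) (fun y hy => (hf.dy (x0, y) hy).sub_const m) s2 hmd j3 (by
      have h0 : ∫ y, (f (x0, y) - m) ∂(nu a) = 0 := by
        rw [integral_sub j1 (integrable_const _), ← hm]; simp
      rw [integral_nu ha] at h0
      exact (mul_eq_zero.1 h0).resolve_left (cY_pos ha).ne')
  have h2 : ∫ y, (f (x0, y) - m) ^ 2 ∂(nu a) = ∫ y, f (x0, y) ^ 2 ∂(nu a) - m ^ 2 := by
    have e : (fun y => (f (x0, y) - m) ^ 2) = fun y => f (x0, y) ^ 2 - (2 * m * f (x0, y) - m ^ 2) := by grind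
    have k : Integrable (fun y => 2 * m * f (x0, y) - m ^ 2) (nu a) := (j1.const_mul _).sub (integrable_const _)
    rw [e, integral_sub j2 k, integral_sub (j1.const_mul _) (by fun_prop), integral_const_mul, ← hm]
    simp; ring
  rw [← h2, integral_nu ha, integral_nu ha]
  exact mulL h (cY_pos ha).le

lemma SG.integrable_sq (ha : -1 < a) (ha' : a < 1) {f : E n → ℝ} (hf : SG a f)
    (hc : ContinuousOn f (Hs n)) : Integrable (fun z => f z ^ 2) (mu a) :=
  (SG.memLp ha (by linarith) hf hc.aesm_mu).integrable_sq

lemma integral_mono_mu {f g : E n → ℝ} (hf : Integrable f (mu a))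
    (hg : Integrable g (mu a)) (h : ∀ z ∈ Hs n, f z ≤ g z) :
    ∫ z, f z ∂mu a ≤ ∫ z, g z ∂mu a :=
  integral_mono_ae hf hg (by filter_upwards [mu_ae_mem n a] with z hz using h z hz)

/-- The Poincaré inequality and its refinement modulo linear functions. -/
theorem poincare (ha : -1 < a) (ha' : a < 1) : ∀ {n : ℕ} {f : E n → ℝ} {fx fy}, PC n a f fx fy →
    1 / 2 * (N₂ a f - (∫ z, f z ∂mu a) ^ 2) ≤ dirich a fx fy ∧
    N₂ a f - (∫ z, f z ∂mu a) ^ 2 - 1 / 4 * ∑ i, (∫ z, f z * z.1 i ∂mu a) ^ 2 ≤ dirich a fx fy := by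
  intro n
  induction n with
  | zero =>
    intro f fx fy hf
    have h := poincare_base ha ha' hf
    have h0 : 0 ≤ dirich a fx fy := by
      unfold dirich
      exact add_nonneg (sum_nonneg fun i _ => integral_sq _) (integral_sq _)
    refine ⟨by linarith, ?_⟩
    simpa using h
  | succ n ih =>
    intro f fx fy hf
    have hpm := prob_mu n ha
    have hpm' := prob_mu (n + 1) ha
    have c1 : Continuous fun _ : ℝ => (1:ℝ) := continuous_const
    have g1 : SG1 fun _ => 1 := GR.const sq_nonneg_on 1
    have hA := hf.marg g1 c1
    have hB := hf.marg SG1.id continuous_id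
    have hpA := ih hA
    have hpB := (ih hB).1
    have iB := (hB.memLp ha).integrable_sq
    have iA := (hA.memLp ha).integrable_sq
    -- slices
    have L2 : ∀ {F : E (n + 1) → ℝ}, SG a F → ContinuousOn F (Hs (n + 1)) → N₂ a (marg (fun _ => 1) F)
          + 1 / 2 * N₂ a (marg (fun t => t) F) ≤ N₂ a F := by
      intro F hF hFc
      have k1 := SG.integrable_sq ha ha' (SG.marg g1 c1 hF) (continuousOn_marg g1 c1 hF hFc)
      have k2 := SG.integrable_sq ha ha' (SG.marg SG1.id continuous_id hF)
        (continuousOn_marg SG1.id continuous_id hF hFc)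
      have k3 := SG.integrable_sq ha ha' hF hFc
      rw [integral_consE ha k3, ← integral_const_mul, ← integral_add k1 (k2.const_mul _)]
      refine integral_mono_mu (k1.add (k2.const_mul _)) (integrable_consE ha k3) fun z hz => ?_
      have := gam_bessel (hF.slice hz) (continuous_slice hFc hz)
      simpa [marg] using this
    have a0 : ∀ {F : E (n + 1) → ℝ}, SG 0 F → SG 1 F := fun h => SG.mono_exp h zero_le_one
    have k0 := (hf.memLp ha).integrable_sq
    have k3 := (hf.memLpx ha 0).integrable_sq
    have S1 : ∀ z ∈ Hs n, 1 / 2 * (∫ t, f (Fin.cons t z.1, z.2) ^ 2 ∂gam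
      - (marg (fun _ => 1) f z) ^ 2) ≤ ∫ t, fx 0 (Fin.cons t z.1, z.2) ^ 2 ∂gam ∧
        ∫ t, f (Fin.cons t z.1, z.2) ^ 2 ∂gam - (marg (fun _ => 1) f z) ^ 2
          - 1 / 4 * (marg (fun t => t) f z) ^ 2 ≤ ∫ t, fx 0 (Fin.cons t z.1, z.2) ^ 2 ∂gam := by
      intro z hz
      have := gam_P (f := fun t => f (Fin.cons t z.1, z.2)) (f' := fun t => fx 0 (Fin.cons t z.1, z.2)) (fun t => by
          have := hf.dx 0 (Fin.cons t z.1, z.2) hz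
          simpa using this) (hf.sg.slice hz) ((hf.sgx 0).slice hz)
        (continuous_slice (hf.contx 0) hz)
      simpa [marg] using this
    have m0 : ∫ z, marg (fun _ => 1) f z ∂mu a = ∫ z, f z ∂mu a := by
      rw [integral_consE ha ((hf.memLp ha).integrable (by norm_num))]
      simp [marg]
    have mlin : ∀ i : Fin (n + 1), Integrable (fun z => f z * z.1 i) (mu a) := by
      intro i
      refine SG.integrable ha (by linarith) (SG.mul hf.sg (SG.coord i)) ?_
      exact (hf.cont.mul (by fun_prop : Continuous fun z : E (n+1) => z.1 i).continuousOn).aesm_mu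
    have mB : ∫ z, marg (fun t => t) f z ∂mu a = ∫ z, f z * z.1 0 ∂mu a := by
      rw [integral_consE ha (mlin 0)]
      simp [marg]
    have mi : ∀ i : Fin n, ∫ z, marg (fun _ => 1) f z * z.1 i ∂mu a = ∫ z, f z * z.1 i.succ ∂mu a := by
      intro i
      rw [integral_consE ha (mlin i.succ)]
      simp [marg, integral_mul_const]
    have T1 : 1 / 2 * (N₂ a f - N₂ a (marg (fun _ => 1) f)) ≤ N₂ a (fx 0) := by
      rw [integral_consE ha k0, integral_consE ha k3, ← integral_sub (integrable_consE ha k0) iA, ← integral_const_mul]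
      exact integral_mono_mu (((integrable_consE ha k0).sub iA).const_mul _)
        (integrable_consE ha k3) fun z hz => (S1 z hz).1
    have T2 : N₂ a f - N₂ a (marg (fun _ => 1) f) - 1 / 4 * N₂ a (marg (fun t => t) f) ≤ N₂ a (fx 0) := by
      have k : Integrable (fun z => ∫ t, f (Fin.cons t z.1, z.2) ^ 2 ∂gam
          - (marg (fun _ => 1) f z) ^ 2) (mu a) := (integrable_consE ha k0).sub iA
      rw [integral_consE ha k0, integral_consE ha k3, ← integral_const_mul,
        ← integral_sub (integrable_consE ha k0) iA, ← integral_sub k (iB.const_mul _)]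
      exact integral_mono_mu (((integrable_consE ha k0).sub iA).sub (iB.const_mul _))
        (integrable_consE ha k3) fun z hz => (S1 z hz).2
    have Lx : ∀ i : Fin n, N₂ a (marg (fun _ => 1) (fx i.succ)) + 1 / 2 * N₂ a (marg (fun t => t) (fx i.succ))
          ≤ ∫ z, fx i.succ z ^ 2 ∂mu a := by
      intro i
      have k1 := ((hA.memLpx ha i)).integrable_sq
      have k2 := ((hB.memLpx ha i)).integrable_sq
      have k3 := ((hf.memLpx ha i.succ)).integrable_sq
      rw [integral_consE ha k3, ← integral_const_mul, ← integral_add k1 (k2.const_mul _)]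
      refine integral_mono_mu (k1.add (k2.const_mul _)) (integrable_consE ha k3) fun z hz => ?_
      have := gam_bessel ((hf.sgx i.succ).slice hz) (continuous_slice (hf.contx i.succ) hz)
      simpa [marg] using this
    have Ly := L2 hf.sgy hf.conty
    have Ls := sum_le_sum fun i (_ : i ∈ Finset.univ) => Lx i
    rw [sum_add_distrib, ← mul_sum] at Ls
    have n1 : 0 ≤ ∑ i : Fin n, N₂ a (marg (fun t => t) (fx i.succ)) := sum_nonneg fun i _ => integral_sq _
    have n2 : 0 ≤ N₂ a (marg (fun t => t) fy) := integral_sq _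
    unfold dirich at hpA hpB ⊢
    rw [Fin.sum_univ_succ, Fin.sum_univ_succ, ← mB, ← m0]
    simp only [← mi]
    constructor <;> linarith [ hpA.2]

/-- The derivative of the smooth transition function. -/
def stD (t : ℝ) : ℝ := deriv smoothTransition t

lemma hasDerivAt_st (t : ℝ) : HasDerivAt smoothTransition (stD t) t :=
  ((smoothTransition.contDiff (n := 1)).differentiable (by norm_num) t).hasDerivAt

lemma continuous_stD : Continuous stD := (smoothTransition.contDiff (n := 1)).continuous_deriv (by norm_num)

lemma stD_of_lt {t : ℝ} (h : t < 0) : stD t = 0 := by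
  have : smoothTransition =ᶠ[𝓝 t] fun _ => 0 := by
    filter_upwards [Iio_mem_nhds h] with s hs using smoothTransition.zero_of_nonpos (le_of_lt hs)
  rw [stD, this.deriv_eq]; simp

lemma stD_of_gt {t : ℝ} (h : 1 < t) : stD t = 0 := by
  have : smoothTransition =ᶠ[𝓝 t] fun _ => 1 := by
    filter_upwards [Ioi_mem_nhds h] with s hs using smoothTransition.one_of_one_le (le_of_lt hs)
  rw [stD, this.deriv_eq]; simp

lemma stD_bdd : ∃ K, 0 ≤ K ∧ ∀ t, |stD t| ≤ K := by
  obtain ⟨K, hK⟩ := (isCompact_Icc (a := 0) (b := 1)).exists_bound_of_continuousOn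
    continuous_stD.continuousOn
  refine ⟨K, (abs_nonneg _).trans (hK 0 (by simp)), fun t => ?_⟩
  have hK0 := (abs_nonneg _).trans (hK 0 (by simp))
  by_cases h0 : t < 0
  · simpa [stD_of_lt h0] using hK0
  by_cases h1 : 1 < t
  · simpa [stD_of_gt h1] using hK0
  exact hK t ⟨not_lt.1 h0, not_lt.1 h1⟩

lemma integral_stD : ∫ η in Ioi (0:ℝ), stD (η - 1) = 1 := by
  have hz : ∀ η ∉ Ioc 0 3, stD (η - 1) = 0 := by
    intro η hη
    by_cases h : η ≤ 0
    · exact stD_of_lt (by linarith)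
    · exact stD_of_gt (by grind)
  have h1 : ∫ η in Ioi 0, stD (η - 1) = ∫ η in Ioc 0 3, stD (η - 1) :=
    (setIntegral_eq_of_subset_of_forall_sdiff_eq_zero measurableSet_Ioi
      Ioc_subset_Ioi_self fun x hx => hz x hx.2)
  rw [h1, ← intervalIntegral.integral_of_le (by norm_num),
    intervalIntegral.integral_eq_sub_of_hasDerivAt (f := fun η => smoothTransition (η - 1))
      (f' := fun η => stD (η - 1))]
  · rw [smoothTransition.one_of_one_le (by norm_num), smoothTransition.zero_of_nonpos (by norm_num)]; norm_num
  · intro x _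
    have h := (hasDerivAt_st (x - 1)).comp x ((hasDerivAt_id x).sub_const 1)
    rw [mul_one] at h
    exact h
  · exact (continuous_stD.comp (by fun_prop)).intervalIntegrable _ _

/-- Cutoff away from the thin space. -/
def chi (ε : ℝ) (z : E n) : ℝ := smoothTransition (z.2 / ε - 1)
/-- Derivative of `chi`. -/
def chi' (ε : ℝ) (z : E n) : ℝ := stD (z.2 / ε - 1) / ε
/-- Cutoff away from infinity. -/
def tht (ε : ℝ) (z : E n) : ℝ := 1 - smoothTransition (ε * nq z - 1)
/-- Radial derivative factor of `tht`. -/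
def tht' (ε : ℝ) (z : E n) : ℝ := -(stD (ε * nq z - 1) * (2 * ε))

lemma hasDx_nq (i : Fin n) : HasDx i nq fun z => 2 * z.1 i := by
  intro z _
  simp only [nq_update]
  exact ((hasDerivAt_pow 2 (z.1 i)).const_add _).congr_deriv (by simp)

lemma hasDy_nq : HasDy (n := n) nq fun z => 2 * z.2 := by
  intro z _
  exact ((hasDerivAt_pow 2 z.2).const_add (∑ i, z.1 i ^ 2)).congr_deriv (by simp)

lemma hasDx_tht (ε : ℝ) (i : Fin n) : HasDx i (tht ε) fun z => tht' ε z * z.1 i := by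
  intro z hz
  have h := ((hasDx_nq i z hz).const_mul ε).sub_const 1
  have e : nq (Function.update z.1 i (z.1 i), z.2) = nq z := by simp
  have h2 := HasDerivAt.comp (h₂' := stD (ε * nq z - 1)) (z.1 i) (by simpa [e] using hasDerivAt_st (ε * nq z - 1)) h
  exact (h2.const_sub 1).congr_deriv (by unfold tht'; ring)

lemma hasDy_tht (ε : ℝ) : HasDy (n := n) (tht ε) fun z => tht' ε z * z.2 := by
  intro z hz
  have h := ((hasDy_nq z hz).const_mul ε).sub_const 1
  have h2 := HasDerivAt.comp (h₂' := stD (ε * nq z - 1)) z.2 (hasDerivAt_st (ε * nq z - 1)) h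
  exact (h2.const_sub 1).congr_deriv (by unfold tht'; ring)

lemma hasDy_chi (ε : ℝ) : HasDy (n := n) (chi ε) (chi' ε) := by
  refine HasDy.of_snd (p := fun y => smoothTransition (y / ε - 1)) (p' := fun y => stD (y / ε - 1) / ε) fun y _ => ?_
  have h := (hasDerivAt_st (y / ε - 1)).comp y (((hasDerivAt_id y).div_const ε).sub_const 1)
  rw [mul_one_div] at h
  exact h

lemma hasDx_chi (ε : ℝ) (i : Fin n) : HasDx i (chi ε) fun _ => 0 := HasDx.of_snd fun y => smoothTransition (y / ε - 1)

lemma continuous_chi (ε : ℝ) : Continuous (chi (n := n) ε) := smoothTransition.continuous.comp (by fun_prop)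
lemma continuous_chi' (ε : ℝ) : Continuous (chi' (n := n) ε) := (continuous_stD.comp (by fun_prop)).div_const ε
lemma continuous_tht (ε : ℝ) : Continuous (tht (n := n) ε) := by
  have := continuous_nq (n := n)
  exact continuous_const.sub (smoothTransition.continuous.comp (by fun_prop))
lemma continuous_tht' (ε : ℝ) : Continuous (tht' (n := n) ε) := by
  have := continuous_nq (n := n)
  exact ((continuous_stD.comp (by fun_prop)).mul continuous_const).neg

lemma chi_abs_le (ε : ℝ) (z : E n) : |chi ε z| ≤ 1 := by
  have h1 := smoothTransition.nonneg (z.2 / ε - 1)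
  have h2 := smoothTransition.le_one (z.2 / ε - 1)
  unfold chi
  exact abs_le.2 ⟨by linarith, by linarith⟩

lemma tht_abs_le (ε : ℝ) (z : E n) : |tht ε z| ≤ 1 := by
  have h1 := smoothTransition.nonneg (ε * nq z - 1)
  have h2 := smoothTransition.le_one (ε * nq z - 1)
  unfold tht
  exact abs_le.2 ⟨by linarith, by linarith⟩

lemma chi_zero {ε : ℝ} (hε : 0 < ε) {z : E n} (h : z.2 ≤ ε) : chi ε z = 0 := smoothTransition.zero_of_nonpos (by
    have := (div_le_one hε).2 h
    linarith)

lemma chi'_zero {ε : ℝ} (hε : 0 < ε) {z : E n} (h : z.2 < ε) : chi' ε z = 0 := by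
  have := (div_lt_one hε).2 h
  unfold chi'
  rw [stD_of_lt (by linarith), zero_div]

lemma tht_zero {ε : ℝ} (hε : 0 < ε) {z : E n} (h : 2 / ε < nq z) : tht ε z = 0 := by
  have : 2 < ε * nq z := by rwa [div_lt_iff₀' hε] at h
  unfold tht
  rw [smoothTransition.one_of_one_le (by linarith), sub_self]

lemma tht'_zero {ε : ℝ} (hε : 0 < ε) {z : E n} (h : 2 / ε < nq z) : tht' ε z = 0 := by
  have : 2 < ε * nq z := by rwa [div_lt_iff₀' hε] at h
  unfold tht'
  rw [stD_of_gt (by linarith), zero_mul, neg_zero]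

lemma isCompact_slab (ε R : ℝ) : IsCompact {z : E n | ε ≤ z.2 ∧ nq z ≤ R} := by
  refine Metric.isCompact_of_isClosed_isBounded
    ((isClosed_le continuous_const continuous_snd).inter (isClosed_le continuous_nq continuous_const)) ?_
  refine (Metric.isBounded_closedBall (x := (0 : E n)) (r := sqrt R)).subset fun z hz => ?_
  rw [mem_closedBall_zero_iff, Prod.norm_def]
  refine max_le ((pi_norm_le_iff_of_nonneg (sqrt_nonneg _)).2 fun i => ?_) ?_
  · exact abs_le_sqrt ((sq_le_nq z i).trans hz.2)
  · exact abs_le_sqrt ((snd_sq_le_nq z).trans hz.2)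

lemma integrable_of_slab (ha : -1 < a) {f : E n → ℝ} (hf : ContinuousOn f (Hs n)) {ε R : ℝ}
    (hε : 0 < ε) (h : ∀ z ∈ Hs n, z.2 < ε ∨ R < nq z → f z = 0) : Integrable f (mu a) := by
  obtain ⟨C, hC⟩ := (isCompact_slab ε R).exists_bound_of_continuousOn (hf.mono fun z hz => lt_of_lt_of_le hε hz.1)
  refine SG.integrable ha (by linarith) (SG.of_bdd (C := |C|) fun z hz => ?_) hf.aesm_mu
  by_cases hz' : z.2 < ε ∨ R < nq z
  · grind
  · rw [not_or] at hz'
    exact (hC z ⟨not_lt.1 hz'.1, not_lt.1 hz'.2⟩).trans (le_abs_self C)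

/-- A function whose weighted Ornstein–Uhlenbeck operator equals `g`. -/
structure PG (n : ℕ) (a : ℝ) (f : E n → ℝ) (fx : Fin n → E n → ℝ) (fy g : E n → ℝ) : Prop where
  pc : PC n a f fx fy
  sgg : SG 0 g
  sec : ∃ (fxx : Fin n → E n → ℝ) (fyy : E n → ℝ), (∀ i, HasDx i (fx i) (fxx i) ∧ ContinuousOn (fxx i) (Hs n)) ∧
    HasDy fy fyy ∧ ContinuousOn fyy (Hs n) ∧
    ∀ z ∈ Hs n, (∑ i, fxx i z) + fyy z + a / z.2 * fy z - 1 / 2 * ((∑ i, z.1 i * fx i z) + z.2 * fy z) = g z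

/-- The polarized Dirichlet form. -/
def dir2 (a : ℝ) (fx : Fin n → E n → ℝ) (fy : E n → ℝ) (gx : Fin n → E n → ℝ) (gy : E n → ℝ) : ℝ :=
  (∑ i, I₂ a (fx i) (gx i)) + I₂ a fy gy

lemma PG.contg {f : E n → ℝ} {fx fy g} (h : PG n a f fx fy g) : ContinuousOn g (Hs n) := by
  obtain ⟨fxx, fyy, h1, h2, h3, h4⟩ := h.sec
  have e1 := h.pc.contx
  have e2 := h.pc.conty
  have e3 : ∀ i, ContinuousOn (fxx i) (Hs n) := fun i => (h1 i).2
  have e4 : ContinuousOn (fun z => a / z.2) (Hs n) := continuousOn_const.div continuousOn_snd fun z hz => ne_of_gt hz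
  refine ContinuousOn.congr (f := fun z => (∑ i, fxx i z) + fyy z + a / z.2 * fy z
      - 1 / 2 * ((∑ i, z.1 i * fx i z) + z.2 * fy z)) ?_ fun z hz => (h4 z hz).symm
  have e5 : ∀ i : Fin n, ContinuousOn (fun z => z.1 i * fx i z) (Hs n) := by fun_prop
  exact (((continuousOn_finsetSum _ fun i _ => e3 i).add h3).add (e4.mul e2)).sub (by fun_prop)

lemma integral_add_sub {X : Type*} [MeasurableSpace X] {m : Measure X} {f g h : X → ℝ}
    (hf : Integrable f m) (hg : Integrable g m) (hh : Integrable h m) :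
    ∫ x, (f x + g x - h x) ∂m = ∫ x, f x ∂m + ∫ x, g x ∂m - ∫ x, h x ∂m := by
  have k : Integrable (fun x => f x + g x) m := hf.add hg
  rw [integral_sub k hh, integral_add hf hg]

lemma green_cutoff (ha : -1 < a) {α ζ : E n → ℝ} {αx αy g ζx ζy} (hα : PG n a α αx αy g)
    (hζ : PC n a ζ ζx ζy) {ε : ℝ} (hε : 0 < ε) :
    ∫ z, (((∑ i, αx i z * ζx i z) + αy z * ζy z + g z * ζ z) * (chi ε z * tht ε z)
      + ζ z * ((∑ i, αx i z * z.1 i) + αy z * z.2) * tht' ε z * chi ε z) ∂mu a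
      = -∫ z, αy z * ζ z * tht ε z * chi' ε z ∂mu a := by
  obtain ⟨αxx, αyy, h1, h2, h3, h4⟩ := hα.sec
  have c1 := hα.pc.contx
  have c2 := hα.pc.conty
  have c3 := hζ.cont
  have c4 := hζ.contx
  have c5 := hζ.conty
  have c6 := (continuous_chi ε).continuousOn (s := Hs n)
  have c7 := (continuous_chi' ε).continuousOn (s := Hs n)
  have c8 := (continuous_tht ε).continuousOn (s := Hs n)
  have c9 := (continuous_tht' ε).continuousOn (s := Hs n)
  have cx : ∀ i : Fin n, ContinuousOn (fun z => z.1 i) (Hs n) := fun i =>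
    (by fun_prop : Continuous fun z : E n => z.1 i).continuousOn
  have cy : ContinuousOn (fun z => z.2 / 2 - a / z.2) (Hs n) := (continuousOn_snd.div_const 2).sub
      (continuousOn_const.div continuousOn_snd fun z hz => ne_of_gt hz)
  have key : ∀ {f : E n → ℝ}, ContinuousOn f (Hs n) →
      (∀ z, chi ε z = 0 → chi' ε z = 0 → f z = 0) → (∀ z, tht ε z = 0 → tht' ε z = 0 → f z = 0) →
      Integrable f (mu a) := by
    intro f hf k1 k2
    refine integrable_of_slab ha hf hε (R := 2 / ε) fun z _ hz' => ?_
    rcases hz' with h | h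
    · exact k1 z (chi_zero hε h.le) (chi'_zero hε h)
    · exact k2 z (tht_zero hε h) (tht'_zero hε h)
  have dX : ∀ i, HasDx i (fun z => αx i z * ζ z * (chi ε z * tht ε z)) fun z =>
      (αxx i z * ζ z + αx i z * ζx i z) * (chi ε z * tht ε z)
        + αx i z * ζ z * (chi ε z * (tht' ε z * z.1 i)) := fun i =>
    (((h1 i).1.mul (hζ.dx i)).mul ((hasDx_chi ε i).mul (hasDx_tht ε i))).congr_deriv
      fun z _ => by ring
  have dY := (h2.mul hζ.dy).mul ((hasDy_chi ε).mul (hasDy_tht ε))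
  have IX : ∀ i, Integrable (fun z => ((αxx i z * ζ z + αx i z * ζx i z) * (chi ε z * tht ε z)
    + αx i z * ζ z * (chi ε z * (tht' ε z * z.1 i))) - 1 / 2 * (z.1 i * (αx i z * ζ z * (chi ε z * tht ε z)))) (mu a) ∧
      ∫ z, (((αxx i z * ζ z + αx i z * ζx i z) * (chi ε z * tht ε z) + αx i z * ζ z * (chi ε z * (tht' ε z * z.1 i)))
        - 1 / 2 * (z.1 i * (αx i z * ζ z * (chi ε z * tht ε z)))) ∂mu a = 0 := by
    intro i
    have d1 := (h1 i).2
    have d2 := c1 i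
    have d3 := c4 i
    have d4 := cx i
    have i1 : Integrable (fun z => αx i z * ζ z * (chi ε z * tht ε z)) (mu a) :=
      key (by fun_prop) (fun z h _ => by rw [h]; ring) (fun z h _ => by rw [h]; ring)
    have i2 : Integrable (fun z => (αxx i z * ζ z + αx i z * ζx i z) * (chi ε z * tht ε z)
        + αx i z * ζ z * (chi ε z * (tht' ε z * z.1 i))) (mu a) :=
      key (by fun_prop) (fun z h _ => by rw [h]; ring) (fun z h h' => by rw [h, h']; ring)
    have i3 : Integrable (fun z => z.1 i * (αx i z * ζ z * (chi ε z * tht ε z))) (mu a) :=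
      key (by fun_prop) (fun z h _ => by rw [h]; ring) (fun z h _ => by rw [h]; ring)
    refine ⟨i2.sub (i3.const_mul _), ?_⟩
    rw [integral_sub i2 (i3.const_mul _), ibp_x ha (dX i) i1 i2 i3, integral_const_mul, sub_self]
  have iy1 : Integrable (fun z => αy z * ζ z * (chi ε z * tht ε z)) (mu a) :=
    key (by fun_prop) (fun z h _ => by rw [h]; ring) (fun z h _ => by rw [h]; ring)
  have iy3 : Integrable (fun z => ((αyy z * ζ z + αy z * ζy z) * (chi ε z * tht ε z)
    + αy z * ζ z * (chi' ε z * tht ε z + chi ε z * (tht' ε z * z.2)))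
        - (z.2 / 2 - a / z.2) * (αy z * ζ z * (chi ε z * tht ε z))) (mu a) :=
    key (by fun_prop) (fun z h h' => by rw [h, h']; ring) (fun z h h' => by rw [h, h']; ring)
  have IY := ibp_y ha dY hε (fun z _ hz => by rw [chi_zero hε hz]; ring) iy1 iy3
  have it : Integrable (fun z => αy z * ζ z * tht ε z * chi' ε z) (mu a) :=
    key (by fun_prop) (fun z _ h => by rw [h]; ring) (fun z h _ => by rw [h]; ring)
  have hsum : Integrable (fun z => ∑ i, (((αxx i z * ζ z + αx i z * ζx i z) * (chi ε z * tht ε z)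
    + αx i z * ζ z * (chi ε z * (tht' ε z * z.1 i)))
        - 1 / 2 * (z.1 i * (αx i z * ζ z * (chi ε z * tht ε z))))) (mu a) :=
    integrable_finsetSum _ fun i _ => (IX i).1
  have tot : ∫ z, ((∑ i, (((αxx i z * ζ z + αx i z * ζx i z) * (chi ε z * tht ε z)
    + αx i z * ζ z * (chi ε z * (tht' ε z * z.1 i))) - 1 / 2 * (z.1 i * (αx i z * ζ z * (chi ε z * tht ε z)))))
      + (((αyy z * ζ z + αy z * ζy z) * (chi ε z * tht ε z)
        + αy z * ζ z * (chi' ε z * tht ε z + chi ε z * (tht' ε z * z.2)))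
        - (z.2 / 2 - a / z.2) * (αy z * ζ z * (chi ε z * tht ε z)))
      - αy z * ζ z * tht ε z * chi' ε z) ∂mu a
      = -∫ z, αy z * ζ z * tht ε z * chi' ε z ∂mu a := by
    rw [integral_add_sub hsum iy3 it, integral_finsetSum _ fun i _ => (IX i).1,
      IY, Finset.sum_eq_zero fun i _ => (IX i).2]
    ring
  rw [← tot]
  refine integral_congr_ae ?_
  filter_upwards [mu_ae_mem n a] with z hz
  rw [← h4 z hz]
  have e : ∑ i, (((αxx i z * ζ z + αx i z * ζx i z) * (chi ε z * tht ε z)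
    + αx i z * ζ z * (chi ε z * (tht' ε z * z.1 i))) - 1 / 2 * (z.1 i * (αx i z * ζ z * (chi ε z * tht ε z))))
      = (∑ i, αxx i z) * (ζ z * (chi ε z * tht ε z)) + (∑ i, αx i z * ζx i z) * (chi ε z * tht ε z)
        + (∑ i, αx i z * z.1 i) * (ζ z * chi ε z * tht' ε z)
        - (∑ i, z.1 i * αx i z) * (1 / 2 * (ζ z * (chi ε z * tht ε z))) := by
    simp only [sum_mul, ← sum_add_distrib, ← sum_sub_distrib]
    exact sum_congr rfl fun i _ => by ring
  rw [e]
  ring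

lemma PC.integrable_xx {f g : E n → ℝ} {fx fy gx gy} (ha : -1 < a) (hf : PC n a f fx fy)
    (hg : PC n a g gx gy) (i : Fin n) : Integrable (fun z => fx i z * gx i z) (mu a) :=
  (hf.memLpx ha i).integrable_mul (hg.memLpx ha i)

lemma PC.integrable_yy {f g : E n → ℝ} {fx fy gx gy} (ha : -1 < a) (ha' : a < 1)
    (hf : PC n a f fx fy) (hg : PC n a g gx gy) : Integrable (fun z => fy z * gy z) (mu a) :=
  (hf.memLpy ha ha').integrable_mul (hg.memLpy ha ha')

lemma PG.memLp {f : E n → ℝ} {fx fy g} (ha : -1 < a) (h : PG n a f fx fy g) :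
    MemLp g 2 (mu a) := SG.memLp ha (by linarith) h.sgg h.contg.aesm_mu

lemma green_interior (ha : -1 < a) (ha' : a < 1) {α ζ : E n → ℝ} {αx αy g ζx ζy}
    (hα : PG n a α αx αy g) (hζ : PC n a ζ ζx ζy) :
    Tendsto (fun ε : ℝ => ∫ z, (((∑ i, αx i z * ζx i z) + αy z * ζy z + g z * ζ z) * (chi ε z * tht ε z)
      + ζ z * ((∑ i, αx i z * z.1 i) + αy z * z.2) * tht' ε z * chi ε z) ∂mu a) (𝓝[>] 0)
      (𝓝 (dir2 a αx αy ζx ζy + I₂ a g ζ)) := by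
  have c1 := hα.pc.contx
  have c2 := hα.pc.conty
  have c3 := hζ.cont
  have c4 := hζ.contx
  have c5 := hζ.conty
  have c10 := hα.contg
  have cx : ∀ i : Fin n, ContinuousOn (fun z => z.1 i) (Hs n) := fun i =>
    (by fun_prop : Continuous fun z : E n => z.1 i).continuousOn
  have cs1 : ContinuousOn (fun z => ∑ i, αx i z * ζx i z) (Hs n) :=
    continuousOn_finsetSum _ fun i _ => (c1 i).mul (c4 i)
  have cs2 : ContinuousOn (fun z => ∑ i, αx i z * z.1 i) (Hs n) := continuousOn_finsetSum _ fun i _ => (c1 i).mul (cx i)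
  have is : Integrable (fun z => ∑ i, αx i z * ζx i z) (mu a) :=
    integrable_finsetSum _ fun i _ => hα.pc.integrable_xx ha hζ i
  have iy := hα.pc.integrable_yy ha ha' hζ
  have ig : Integrable (fun z => g z * ζ z) (mu a) := (hα.memLp ha).integrable_mul (hζ.memLp ha)
  have iG := (is.add iy).add ig
  have ir : Integrable (fun z => ζ z * ((∑ i, αx i z * z.1 i) + αy z * z.2)) (mu a) := by
    have j1 := SG.integrable ha (b := 0 + 0) (by linarith) (SG.mul hζ.sg (SG.sum _ fun i _ => by
        simpa using SG.mul0 (hα.pc.sgx i) (SG.coord i))) (c3.mul cs2).aesm_mu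
    have j2 := SG.integrable ha (by linarith) (SG.mul0 (SG.mul0 hα.pc.sgy SG.snd) hζ.sg)
        ((c2.mul continuousOn_snd).mul c3).aesm_mu
    exact (j1.add j2).congr (Eventually.of_forall fun z => by simp only [Pi.add_apply]; ring)
  have tot : dir2 a αx αy ζx ζy + I₂ a g ζ = ∫ z, ((∑ i, αx i z * ζx i z) + αy z * ζy z + g z * ζ z) ∂mu a := by
    have k : Integrable (fun z => (∑ i, αx i z * ζx i z) + αy z * ζy z) (mu a) := is.add iy
    rw [integral_add k ig, integral_add is iy, dir2, integral_finsetSum _ fun i _ => hα.pc.integrable_xx ha hζ i]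
  rw [tot]
  obtain ⟨K, hK0, hK⟩ := stD_bdd
  refine tendsto_integral_filter_of_dominated_convergence (fun z => |(∑ i, αx i z * ζx i z) + αy z * ζy z + g z * ζ z|
      + |ζ z * ((∑ i, αx i z * z.1 i) + αy z * z.2)| * (2 * K)) ?_ ?_ ?_ ?_
  · refine Eventually.of_forall fun ε => ContinuousOn.aesm_mu ?_
    have c6 := (continuous_chi ε).continuousOn (s := Hs n)
    have c8 := (continuous_tht ε).continuousOn (s := Hs n)
    have c9 := (continuous_tht' ε).continuousOn (s := Hs n)
    fun_prop
  · filter_upwards [Ioo_mem_nhdsGT (zero_lt_one' ℝ)] with ε hε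
    refine Eventually.of_forall fun z => ?_
    rw [norm_eq_abs]
    refine (abs_add_le _ _).trans (add_le_add ?_ ?_)
    · rw [abs_mul, abs_mul]
      exact mul_le_of_le_one_right (abs_nonneg _) (mul_le_one₀ (chi_abs_le ε z) (abs_nonneg _) (tht_abs_le ε z))
    · rw [mul_assoc, abs_mul]
      gcongr
      rw [abs_mul, tht', abs_neg, abs_mul, abs_of_pos (show 0 < 2 * ε by linarith [hε.1])]
      have h1 := hK (ε * nq z - 1)
      have h2 := chi_abs_le ε z
      have h3 : |stD (ε * nq z - 1)| * (2 * ε) ≤ K * 2 := mul_le_mul h1 (by linarith [hε.2]) (by linarith [hε.1]) hK0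
      calc _ ≤ (K * 2) * 1 := mul_le_mul h3 h2 (abs_nonneg _) (by positivity)
        _ = 2 * K := by ring
  · exact iG.abs.add (ir.abs.mul_const _)
  · filter_upwards [mu_ae_mem n a] with z hz
    have hz : 0 < z.2 := hz
    refine tendsto_const_nhds.congr' ?_
    have hm : 0 < min (z.2 / 2) (1 / (nq z + 1)) := lt_min (by linarith) (by have := nq_nonneg z; positivity)
    filter_upwards [Ioo_mem_nhdsGT hm] with ε hε
    have h1 := hε.2.trans_le (min_le_left _ _)
    have h2 := hε.2.trans_le (min_le_right _ _)
    have hq := nq_nonneg z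
    rw [lt_div_iff₀ (by linarith)] at h2
    have h3 : 2 < z.2 / ε := by rw [lt_div_iff₀ hε.1]; linarith
    have e1 : chi ε z = 1 := smoothTransition.one_of_one_le (by linarith)
    have hlt : ε * nq z - 1 < 0 := by nlinarith [hε.1]
    have e2 : tht ε z = 1 := by
      unfold tht; rw [smoothTransition.zero_of_nonpos hlt.le, sub_zero]
    have e3 : tht' ε z = 0 := by unfold tht'; rw [stD_of_lt hlt]; ring
    rw [e1, e2, e3]; ring

/-- The integrand of the boundary layer after rescaling. -/
def layer (a ε : ℝ) (f : E n → ℝ) (p : E n) : ℝ :=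
  ε ^ a * p.2 ^ a * f (p.1, ε * p.2) * gE (ε * p.2) * tht ε (p.1, ε * p.2) * stD (p.2 - 1)

lemma layer_eq {ε : ℝ} (hε : 0 < ε) (ha : -1 < a) {f : E n → ℝ} (hf : ContinuousOn f (Hs n))
    (hi : Integrable (layer a ε f) ((gamn n).prod (volume.restrict (Ioc 0 3)))) :
    ∫ z, f z * tht ε z * chi' ε z ∂mu a = cY a * ∫ p, layer a ε f p ∂((gamn n).prod (volume.restrict (Ioc 0 3))) := by
  have hI : Integrable (fun z => f z * tht ε z * chi' ε z) (mu a) := by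
    refine integrable_of_slab ha ?_ hε (R := 2 / ε) fun z _ hz => ?_
    · exact (hf.mul (continuous_tht ε).continuousOn).mul (continuous_chi' ε).continuousOn
    · rcases hz with h | h
      · rw [chi'_zero hε h, mul_zero]
      · rw [tht_zero hε h, mul_zero, zero_mul]
  rw [mu, integral_prod _ hI, integral_prod _ hi, ← integral_const_mul]
  congr 1
  funext x
  rw [integral_nu ha]
  congr 1
  have h := integral_comp_mul_left_Ioi (fun y => f (x, y) * tht ε (x, y) * chi' ε (x, y) * wY a y) 0 hε
  rw [mul_zero, smul_eq_mul, eq_inv_mul_iff_mul_eq₀ hε.ne'] at h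
  rw [← h, ← integral_const_mul]
  refine (setIntegral_eq_of_subset_of_forall_sdiff_eq_zero (s := Ioc 0 3) measurableSet_Ioi
    Ioc_subset_Ioi_self fun η hη => ?_).trans ?_
  · have := not_le.1 fun h => hη.2 ⟨hη.1, h⟩
    unfold chi'
    rw [mul_div_cancel_left₀ _ hε.ne', stD_of_gt (by linarith)]; ring
  · refine setIntegral_congr_fun measurableSet_Ioc fun η hη => ?_
    have h0 := hη.1
    simp only [layer, chi', wY, gE]
    rw [mul_div_cancel_left₀ _ hε.ne', mul_rpow hε.le h0.le]
    field_simp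

/-- Green's identity with the conormal derivative as boundary term. -/
theorem green (ha : -1 < a) (ha' : a < 1) {α ζ : E n → ℝ} {αx αy g ζx ζy}
    (hα : PG n a α αx αy g) (hζ : PC n a ζ ζx ζy) {L : V n → ℝ}
    (hL : ∀ x, Tendsto (fun y => y ^ a * αy (x, y) * ζ (x, y)) (𝓝[>] 0) (𝓝 (L x))) :
    dir2 a αx αy ζx ζy + I₂ a g ζ = -(cY a * ∫ x, L x ∂(gamn n)) := by
  set P : Measure (E n) := (gamn n).prod (volume.restrict (Ioc 0 3)) with hP
  have hc : ContinuousOn (fun z => αy z * ζ z) (Hs n) := hα.pc.conty.mul hζ.cont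
  have aeP : ∀ᵐ p ∂P, p.2 ∈ Ioc 0 3 := by
    have : Measure.QuasiMeasurePreserving (Prod.snd : E n → ℝ) P (volume.restrict (Ioc 0 3)) :=
      Measure.quasiMeasurePreserving_snd
    exact this.ae (ae_restrict_mem measurableSet_Ioc)
  have meas : ∀ ε : ℝ, 0 < ε → AEStronglyMeasurable (layer a ε fun z => αy z * ζ z) P := by
    intro ε hε
    have h1 : ContinuousOn (layer a ε fun z => αy z * ζ z) (Hs n) := by
      have m : Set.MapsTo (fun p => (p.1, ε * p.2)) (Hs n) (Hs n) := fun p hp =>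
        mul_pos hε hp
      have c0 : Continuous fun p : E n => (p.1, ε * p.2) := by fun_prop
      have c1 : ContinuousOn (fun p => αy (p.1, ε * p.2) * ζ (p.1, ε * p.2)) (Hs n) := hc.comp c0.continuousOn m
      have c2 := (continuous_tht ε).comp c0
      have c3 : Continuous fun p : E n => gE (ε * p.2) := continuous_gE.comp (by fun_prop)
      have c4 : Continuous fun p : E n => stD (p.2 - 1) := continuous_stD.comp (by fun_prop)
      have c5 : ContinuousOn (fun p => ε ^ a * p.2 ^ a) (Hs n) :=
        continuousOn_const.mul (continuousOn_snd.rpow_const fun p hp => Or.inl (ne_of_gt hp))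
      exact (((c5.mul c1).mul c3.continuousOn).mul c2.continuousOn).mul c4.continuousOn
    have h2 := h1.aestronglyMeasurable (μ := P) (measurableSet_Hs n)
    rwa [Measure.restrict_eq_self_of_ae_mem (show ∀ᵐ p ∂P, p ∈ Hs n from aeP.mono fun p hp => hp.1)] at h2
  obtain ⟨C, hC0, hC⟩ := GR.bound (SG.mul0 hα.pc.sgy hζ.sg) (θ := 1 / 8) (by norm_num)
  obtain ⟨K, hK0, hK⟩ := stD_bdd
  set B : E n → ℝ := fun p => C * exp (9 / 8) * K * ∏ i, exp (1 / 8 * p.1 i ^ 2) with hB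
  have bd : ∀ ε : ℝ, 0 < ε → ε < 1 → ∀ p : E n, p.2 ∈ Ioc 0 3 → ‖layer a ε (fun z => αy z * ζ z) p‖ ≤ B p := by
    intro ε hε hε1 p hp
    have hp0 := mul_pos hε hp.1
    have h1 := hC (p.1, ε * p.2) hp0
    simp only at h1
    rw [mul_rpow hε.le hp.1.le] at h1
    have h2 : exp (1 / 8 * nq (p.1, ε * p.2)) ≤ exp (9 / 8) * ∏ i, exp (1 / 8 * p.1 i ^ 2) := by
      rw [exp_nq, mul_comm]
      refine mulR (exp_le_exp.2 ?_) (prod_nonneg fun _ _ =>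
        (exp_pos _).le)
      have : ε * p.2 ≤ 3 := by nlinarith [ hp.2]
      simp only; nlinarith
    have h3 : |gE (ε * p.2)| ≤ 1 := by
      rw [abs_of_pos (gE_pos _)]
      exact exp_le_one_iff.2 (by have := sq_nonneg (ε * p.2); linarith)
    have h4 := tht_abs_le ε (p.1, ε * p.2)
    have h5 := hK (p.2 - 1)
    have e : layer a ε (fun z => αy z * ζ z) p
        = (αy (p.1, ε * p.2) * ζ (p.1, ε * p.2) * (ε ^ a * p.2 ^ a)) * gE (ε * p.2)
          * tht ε (p.1, ε * p.2) * stD (p.2 - 1) := by unfold layer; ring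
    rw [e, norm_eq_abs, abs_mul, abs_mul, abs_mul]
    have h6 := h1.trans (mulL h2 hC0)
    have hA : 0 ≤ |αy (p.1, ε * p.2) * ζ (p.1, ε * p.2) * (ε ^ a * p.2 ^ a)| := abs_nonneg _
    calc _ ≤ |αy (p.1, ε * p.2) * ζ (p.1, ε * p.2) * (ε ^ a * p.2 ^ a)| * 1 * 1 * K := by
          gcongr
      _ ≤ (C * (exp (9 / 8) * ∏ i, exp (1 / 8 * p.1 i ^ 2))) * 1 * 1 * K := by
          gcongr
      _ = B p := by rw [hB]; ring
  have iB : Integrable B P := by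
    have h1 : Integrable (fun x : Fin n → ℝ => ∏ i, exp (1 / 8 * x i ^ 2)) (gamn n) :=
      integrable_exp_gamn n (by norm_num)
    have h2 : Integrable (fun _ => (1 : ℝ)) (volume.restrict (Ioc (0:ℝ) 3)) := integrable_const _
    exact ((h1.mul_prod h2).const_mul (C * exp (9 / 8) * K)).congr (Eventually.of_forall fun p => by simp [hB])
  have lim1 := green_interior ha ha' hα hζ
  have lim2 : Tendsto (fun ε => ∫ p, layer a ε (fun z => αy z * ζ z) p ∂P) (𝓝[>] 0)
      (𝓝 (∫ p, L p.1 * stD (p.2 - 1) ∂P)) := by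
    refine tendsto_integral_filter_of_dominated_convergence B ?_ ?_ iB ?_
    · filter_upwards [self_mem_nhdsWithin] with ε hε using meas ε hε
    · filter_upwards [Ioo_mem_nhdsGT (zero_lt_one' ℝ)] with ε hε
      filter_upwards [aeP] with p hp using bd ε hε.1 hε.2 p hp
    · filter_upwards [aeP] with p hp
      have hp0 := hp.1
      have t1 : Tendsto (fun ε => ε * p.2) (𝓝[>] 0) (𝓝[>] 0) := by
        refine tendsto_nhdsWithin_iff.2 ⟨?_, ?_⟩
        · have : Tendsto (fun ε => ε * p.2) (𝓝 0) (𝓝 (0 * p.2)) := (continuous_id.mul continuous_const).tendsto 0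
          rw [zero_mul] at this
          exact this.mono_left nhdsWithin_le_nhds
        · filter_upwards [self_mem_nhdsWithin] with ε hε using mul_pos hε hp0
      have t2 := (hL p.1).comp t1
      have t3 : Tendsto (fun ε => gE (ε * p.2)) (𝓝[>] 0) (𝓝 1) := by
        have := (continuous_gE.tendsto 0).comp (t1.mono_right nhdsWithin_le_nhds)
        have e : gE 0 = 1 := by simp [gE]
        rwa [e] at this
      have t4 : Tendsto (fun ε => tht ε (p.1, ε * p.2)) (𝓝[>] 0) (𝓝 1) := by
        have hcc : Continuous fun ε => tht ε (p.1, ε * p.2) := by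
          have := continuous_nq (n := n)
          unfold tht
          exact continuous_const.sub (smoothTransition.continuous.comp (by fun_prop))
        have := (hcc.tendsto 0).mono_left (nhdsWithin_le_nhds (s := Ioi 0))
        have e : tht 0 (p.1, 0 * p.2) = 1 := by
          unfold tht; rw [smoothTransition.zero_of_nonpos (by norm_num), sub_zero]
        rwa [e] at this
      have t5 := ((t2.mul t3).mul t4).mul_const (stD (p.2 - 1))
      rw [mul_one, mul_one] at t5
      refine t5.congr' ?_
      filter_upwards [self_mem_nhdsWithin] with ε hε
      have hε : 0 < ε := hε
      simp only [Function.comp, layer]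
      rw [mul_rpow hε.le hp0.le]
      ring
  have e2 : ∫ p, L p.1 * stD (p.2 - 1) ∂P = ∫ x, L x ∂(gamn n) := by
    rw [hP, integral_prod_mul (fun x => L x) (fun y => stD (y - 1))]
    have : ∫ y in Ioc 0 3, stD (y - 1) = 1 := by
      refine Eq.trans ?_ integral_stD
      refine (setIntegral_eq_of_subset_of_forall_sdiff_eq_zero measurableSet_Ioi
        Ioc_subset_Ioi_self fun η hη => ?_).symm
      exact stD_of_gt (by have : 3 < η := not_le.1 fun h => hη.2 ⟨hη.1, h⟩
                          linarith)
    rw [this, mul_one]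
  rw [e2] at lim2
  refine tendsto_nhds_unique lim1 ((lim2.const_mul (cY a)).neg.congr' ?_)
  filter_upwards [Ioo_mem_nhdsGT (zero_lt_one' ℝ)] with ε hε
  have hi : Integrable (layer a ε fun z => αy z * ζ z) P :=
    iB.mono' (meas ε hε.1) (aeP.mono fun p hp => bd ε hε.1 hε.2 p hp)
  rw [green_cutoff ha hα hζ hε.1, layer_eq hε.1 ha hc hi]

/-- Partial derivative in a thin direction. -/
def Dx (i : Fin n) (f : E n → ℝ) (z : E n) : ℝ := fderiv ℝ f z (Pi.single i 1, 0)
/-- Partial derivative in the normal direction. -/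
def Dy (f : E n → ℝ) (z : E n) : ℝ := fderiv ℝ f z (0, 1)
/-- The generator of dilations. -/
def Zv (f : E n → ℝ) (z : E n) : ℝ := (∑ i, z.1 i * Dx i f z) + z.2 * Dy f z
/-- The operator `Δ + (a / y) ∂_y`. -/
def lapa (a : ℝ) (f : E n → ℝ) (z : E n) : ℝ := (∑ i, Dx i (Dx i f) z) + Dy (Dy f) z + a / z.2 * Dy f z
/-- Smoothness in the open half space. -/
def Sm (f : E n → ℝ) : Prop := ∀ z ∈ Hs n, ContDiffAt ℝ (⊤ : ℕ∞) f z

namespace Sm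
variable {f : E n → ℝ}

lemma differentiableAt (hf : Sm f) {z : E n} (hz : z ∈ Hs n) : DifferentiableAt ℝ f z :=
  (hf z hz).differentiableAt (by simp)

lemma hasDx (hf : Sm f) (i : Fin n) : HasDx i f (Dx i f) := by
  intro z hz
  have h1 : HasDerivAt (fun τ => ((Function.update z.1 i τ, z.2) : E n)) (Pi.single i 1, 0) (z.1 i) :=
    (hasDerivAt_update z.1 i (z.1 i)).prodMk (hasDerivAt_const _ _)
  have h2 : HasFDerivAt f (fderiv ℝ f z) (Function.update z.1 i (z.1 i), z.2) := by
    rw [Function.update_eq_self]; exact (hf.differentiableAt hz).hasFDerivAt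
  exact h2.comp_hasDerivAt (f := fun τ => ((Function.update z.1 i τ, z.2) : E n)) (z.1 i) h1

lemma hasDy (hf : Sm f) : HasDy f (Dy f) := by
  intro z hz
  have h1 : HasDerivAt (fun τ => ((z.1, τ) : E n)) (0, 1) z.2 := (hasDerivAt_const _ _).prodMk (hasDerivAt_id _)
  exact (hf.differentiableAt hz).hasFDerivAt.comp_hasDerivAt _ h1

lemma fderiv_apply (hf : Sm f) (d : E n) : Sm fun z => fderiv ℝ f z d := fun _ hz =>
  ((hf _ hz).fderiv_right (m := (⊤ : ℕ∞)) (by simp)).clm_apply contDiffAt_const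

lemma Dx (hf : Sm f) (i : Fin n) : Sm (Dx i f) := hf.fderiv_apply _
lemma Dy (hf : Sm f) : Sm (Dy f) := hf.fderiv_apply _

lemma contOn (hf : Sm f) : ContinuousOn f (Hs n) := fun z hz =>
  (hf.differentiableAt hz).continuousAt.continuousWithinAt

lemma contOn_lapa (hf : Sm f) : ContinuousOn (lapa a f) (Hs n) := by
  have e4 : ContinuousOn (fun z => a / z.2) (Hs n) := continuousOn_const.div continuousOn_snd fun z hz => ne_of_gt hz
  exact ((continuousOn_finsetSum _ fun i _ => ((hf.Dx i).Dx i).contOn).add hf.Dy.Dy.contOn).add (e4.mul hf.Dy.contOn)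

lemma contOn_Zv (hf : Sm f) : ContinuousOn (Zv f) (Hs n) :=
  (continuousOn_finsetSum _ fun i _ => ((by fun_prop : Continuous fun z => z.1 i).continuousOn).mul
    (hf.Dx i).contOn).add (continuousOn_snd.mul hf.Dy.contOn)

end Sm

lemma fderiv_eq_sum (f : E n → ℝ) (z d : E n) :
    fderiv ℝ f z d = (∑ i, d.1 i * Dx i f z) + d.2 * Dy f z := by
  have e : d = (∑ i, d.1 i • ((Pi.single i 1, 0) : E n)) + d.2 • ((0, 1) : E n) := by
    ext i
    · simp [Prod.fst_sum, Pi.single_apply]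
    · simp [Prod.snd_sum]
  conv_lhs => rw [e]
  rw [map_add, map_sum]
  simp only [map_smul, smul_eq_mul, Dx, Dy]

lemma Zv_eq (f : E n → ℝ) (z : E n) : Zv f z = fderiv ℝ f z z := (fderiv_eq_sum f z z).symm

/-- Functions on the half space with bounded gradient, bounded weighted Laplacian and compact
support, whose conormal derivative on the thin space is `-T`. -/
structure Reg (a : ℝ) (f : E n → ℝ) (T : V n → ℝ) : Prop where
  sm : Sm f
  cont : ContinuousOn f {z | 0 ≤ z.2}
  supp : ∃ R, ∀ z, R ≤ nq z → f z = 0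
  bx : ∃ C, ∀ i, ∀ z ∈ Hs n, |Dx i f z| ≤ C
  bY : ∃ C, ∀ z ∈ Hs n, |z.2 ^ a * Dy f z| ≤ C
  blap : ∃ C, ∀ z ∈ Hs n, |lapa a f z| ≤ C
  flux : ∀ x, Tendsto (fun y => y ^ a * Dy f (x, y)) (𝓝[>] 0) (𝓝 (-T x))

namespace Reg
variable {f : E n → ℝ} {T : V n → ℝ}

lemma bdd (hf : Reg a f T) : ∃ C, ∀ z, 0 ≤ z.2 → |f z| ≤ C := by
  obtain ⟨R, hR⟩ := hf.supp
  have hc : IsCompact {z : E n | 0 ≤ z.2 ∧ nq z ≤ R} := isCompact_slab 0 R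
  obtain ⟨C, hC⟩ := hc.exists_bound_of_continuousOn (hf.cont.mono fun z hz => hz.1)
  refine ⟨|C|, fun z hz => ?_⟩
  by_cases h : nq z ≤ R
  · exact (hC z ⟨hz, h⟩).trans (le_abs_self C)
  · grind

lemma supp_ev (hf : Reg a f T) : ∃ R, 0 < R ∧ ∀ z, R ≤ nq z → f =ᶠ[𝓝 z] 0 := by
  obtain ⟨R, hR⟩ := hf.supp
  refine ⟨|R| + 1, by positivity, fun z hz => ?_⟩
  have : ∀ᶠ w in 𝓝 z, R < nq w := continuous_nq.continuousAt.eventually_const_lt (by linarith [le_abs_self R])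
  filter_upwards [this] with w hw using hR w hw.le

lemma pc (hf : Reg a f T) : PC n a f (fun i => Dx i f) (Dy f) where
  cont := hf.sm.contOn
  contx i := (hf.sm.Dx i).contOn
  conty := hf.sm.Dy.contOn
  dx i := hf.sm.hasDx i
  dy := hf.sm.hasDy
  sg := by
    obtain ⟨C, hC⟩ := hf.bdd
    exact SG.of_bdd fun z hz => hC z (le_of_lt hz)
  sgx i := by
    obtain ⟨C, hC⟩ := hf.bx
    exact SG.of_bdd fun z hz => hC i z hz
  sgy := by
    obtain ⟨C, hC⟩ := hf.bY
    refine GR.congr (GR.of_bdd nq_nonneg_on hC) fun z _ => mul_comm _ _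

lemma sg_ydy (ha' : a < 1) {f : E n → ℝ} (h : SG a f) : SG 0 fun z => z.2 * f z := by
  refine SG.of_GR ?_
  have h1a : 0 ≤ 1 - a := by linarith
  refine GR.congr (GR.mul (SG.to_GR (SG.rpow (1 - a) h1a)) h) fun z hz => ?_
  have hz := hz
  rw [rpow_sub hz, rpow_one]
  have := (rpow_pos_of_pos hz a).ne'
  field_simp

lemma sgZ (ha' : a < 1) (hf : Reg a f T) : SG 0 (Zv f) :=
  SG.add (SG.sum _ fun i _ => SG.mul0 (SG.coord i) (hf.pc.sgx i)) (sg_ydy ha' hf.pc.sgy)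

lemma pg (ha' : a < 1) (hf : Reg a f T) :
    PG n a f (fun i => Dx i f) (Dy f) (fun z => lapa a f z - 1 / 2 * Zv f z) where
  pc := hf.pc
  sgg := by
    obtain ⟨C, hC⟩ := hf.blap
    exact SG.sub (SG.of_bdd hC) (SG.const_mul (hf.sgZ ha') _)
  sec := ⟨fun i => Dx i (Dx i f), Dy (Dy f), fun i => ⟨(hf.sm.Dx i).hasDx i, ((hf.sm.Dx i).Dx i).contOn⟩,
    hf.sm.Dy.hasDy, hf.sm.Dy.Dy.contOn, fun z _ => rfl⟩

lemma lim_thin (hf : Reg a f T) (x : V n) :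
    Tendsto (fun y => f (x, y)) (𝓝[>] 0) (𝓝 (f (x, 0))) := by
  have h := hf.cont (x, 0) (by grind)
  have h2 : Tendsto (fun y => ((x, y) : E n)) (𝓝[>] 0) (𝓝[{z | 0 ≤ z.2}] (x, 0)) := by
    refine tendsto_nhdsWithin_iff.2 ⟨?_, ?_⟩
    · exact ((by fun_prop : Continuous fun y => ((x, y) : E n)).tendsto 0).mono_left
        nhdsWithin_le_nhds
    · filter_upwards [self_mem_nhdsWithin] with y hy using le_of_lt hy
  exact h.tendsto.comp h2

/-- Green's identity for a regular function against a form-domain function with a trace. -/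
lemma green (ha : -1 < a) (ha' : a < 1) (hf : Reg a f T) {ζ ζx ζy} (hζ : PC n a ζ ζx ζy)
    {Z : V n → ℝ} (hZ : ∀ x, Tendsto (fun y => ζ (x, y)) (𝓝[>] 0) (𝓝 (Z x))) :
    dir2 a (fun i => Dx i f) (Dy f) ζx ζy + ∫ z, (lapa a f z - 1 / 2 * Zv f z) * ζ z ∂mu a
      = cY a * ∫ x, T x * Z x ∂(gamn n) := by
  rw [FG.green ha ha' (hf.pg ha') hζ (L := fun x => -(T x * Z x)) fun x => by
    simpa using (hf.flux x).mul (hZ x), integral_neg]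
  ring

end Reg

section Scale
variable {f : E n → ℝ}

/-- Dilation. -/
def scl (r : ℝ) (f : E n → ℝ) (z : E n) : ℝ := f (r • z)

lemma Dx_scl (r : ℝ) (i : Fin n) (f : E n → ℝ) : Dx i (scl r f) = fun z => r * scl r (Dx i f) z := by
  funext z
  unfold Dx scl
  rw [fderiv_comp_smul]; rfl

lemma Dy_scl (r : ℝ) (f : E n → ℝ) : Dy (scl r f) = fun z => r * scl r (Dy f) z := by
  funext z
  unfold Dy scl
  rw [fderiv_comp_smul]; rfl

lemma fderiv_mul_const_left (c : ℝ) (f : E n → ℝ) (z : E n) :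
    fderiv ℝ (fun z => c * f z) z = c • fderiv ℝ f z := by
  have := fderiv_const_smul_field (𝕜 := ℝ) (f := f) c
  exact congrFun this z

lemma Dx_mul_left (c : ℝ) (i : Fin n) (f : E n → ℝ) :
    Dx i (fun z => c * f z) = fun z => c * Dx i f z := by
  funext z; unfold Dx; rw [fderiv_mul_const_left]; rfl

lemma Dy_mul_left (c : ℝ) (f : E n → ℝ) : Dy (fun z => c * f z) = fun z => c * Dy f z := by
  funext z; unfold Dy; rw [fderiv_mul_const_left]; rfl

lemma lapa_scl {r : ℝ} (hr : 0 < r) (f : E n → ℝ) (z : E n) :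
    lapa a (scl r f) z = r ^ 2 * lapa a f (r • z) := by
  unfold lapa
  simp only [Dx_scl, Dy_scl, Dx_mul_left, Dy_mul_left]
  simp only [scl, Prod.smul_snd, smul_eq_mul]
  have : a / (r * z.2) = r⁻¹ * (a / z.2) := by ring
  rw [this, mul_add, mul_add, mul_sum]
  have h2 : r ^ 2 * (r⁻¹ * (a / z.2) * Dy f (r • z)) = a / z.2 * (r * Dy f (r • z)) := by
    field_simp
  rw [h2]
  congr 2
  · exact sum_congr rfl fun i _ => by ring
  · ring

lemma Zv_scl (r : ℝ) (f : E n → ℝ) (z : E n) : Zv (scl r f) z = Zv f (r • z) := by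
  rw [Zv_eq, Zv_eq]
  unfold scl
  rw [fderiv_comp_smul, map_smul]; rfl

lemma smul_mem_Hs {r : ℝ} (hr : 0 < r) {z : E n} (hz : z ∈ Hs n) : r • z ∈ Hs n := mul_pos hr hz

lemma nq_smul (r : ℝ) (z : E n) : nq (r • z) = r ^ 2 * nq z := by
  simp only [nq, nsq, Prod.smul_fst, Prod.smul_snd, Pi.smul_apply, smul_eq_mul, mul_pow, mul_add, mul_sum]

lemma Reg.scl {T : V n → ℝ} (hf : Reg a f T) {r : ℝ} (hr : 0 < r) :
    Reg a (scl r f) fun x => r ^ (1 - a) * T (r • x) where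
  sm z hz := by
    have h := hf.sm (r • z) (smul_mem_Hs hr hz)
    exact h.comp z (contDiffAt_id.const_smul r)
  cont := hf.cont.comp (by fun_prop) fun z hz => mul_nonneg hr.le hz
  supp := by
    obtain ⟨R, hR⟩ := hf.supp
    refine ⟨R / r ^ 2, fun z hz => hR _ ?_⟩
    rwa [nq_smul, ← div_le_iff₀' (by positivity)]
  bx := by
    obtain ⟨C, hC⟩ := hf.bx
    refine ⟨r * C, fun i z hz => ?_⟩
    rw [Dx_scl, abs_mul, abs_of_pos hr]
    exact mulL (hC i _ (smul_mem_Hs hr hz)) hr.le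
  bY := by
    obtain ⟨C, hC⟩ := hf.bY
    refine ⟨r ^ (1 - a) * C, fun z hz => ?_⟩
    have h := hC _ (smul_mem_Hs hr hz)
    have hz := hz
    have e : z.2 ^ a * Dy (FG.scl r f) z = r ^ (1 - a) * ((r • z).2 ^ a * Dy f (r • z)) := by
      simp only [Dy_scl, FG.scl, Prod.smul_snd, smul_eq_mul]
      rw [mul_rpow hr.le hz.le, rpow_sub hr, rpow_one]
      have := (rpow_pos_of_pos hr a).ne'
      field_simp
    rw [e, abs_mul, abs_of_pos (rpow_pos_of_pos hr _)]
    exact mulL h (rpow_pos_of_pos hr _).le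
  blap := by
    obtain ⟨C, hC⟩ := hf.blap
    refine ⟨r ^ 2 * C, fun z hz => ?_⟩
    rw [lapa_scl hr, abs_mul, abs_of_pos (by positivity)]
    exact mulL (hC _ (smul_mem_Hs hr hz)) (by positivity)
  flux x := by
    have h := hf.flux (r • x)
    have h2 : Tendsto (fun y => r * y) (𝓝[>] 0) (𝓝[>] 0) := by
      refine tendsto_nhdsWithin_iff.2 ⟨?_, ?_⟩
      · have := (by fun_prop : Continuous fun y => r * y).tendsto 0
        rw [mul_zero] at this
        exact this.mono_left nhdsWithin_le_nhds
      · filter_upwards [self_mem_nhdsWithin] with y hy using mul_pos hr hy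
    have h3 := (h.comp h2).const_mul (r ^ (1 - a))
    rw [mul_neg] at h3
    refine h3.congr' ?_
    filter_upwards [self_mem_nhdsWithin] with y hy
    have hy := hy
    simp only [Function.comp, Dy_scl, FG.scl, Prod.smul_mk, smul_eq_mul]
    rw [mul_rpow hr.le hy.le, rpow_sub hr, rpow_one]
    have := (rpow_pos_of_pos hr a).ne'
    field_simp

end Scale

/-- Regular functions satisfying the Signorini conditions on the thin space. -/
structure Prof (a : ℝ) (f : E n → ℝ) (T : V n → ℝ) : Prop extends Reg a f T where
  Tnn : ∀ x, 0 ≤ T x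
  fnn : ∀ x, 0 ≤ f (x, 0)
  compl : ∀ x, T x * f (x, 0) = 0

lemma Prof.scl {f : E n → ℝ} {T : V n → ℝ} (hf : Prof a f T) {r : ℝ} (hr : 0 < r) :
    Prof a (scl r f) fun x => r ^ (1 - a) * T (r • x) where
  toReg := hf.toReg.scl hr
  Tnn x := mul_nonneg (by positivity) (hf.Tnn _)
  fnn x := by simpa [FG.scl] using hf.fnn (r • x)
  compl x := by
    have := hf.compl (r • x)
    simp only [FG.scl, Prod.smul_mk, smul_zero]
    rw [mul_assoc, this, mul_zero]

/-- Distance to the origin after raising the squared normal variable by `D`. -/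
def rho (D ξ y : ℝ) : ℝ := √(ξ ^ 2 + y ^ 2 + D)
/-- Twice the square of the real part of the complex square root. -/
def mm (D ξ y : ℝ) : ℝ := rho D ξ y + ξ

section rho
variable {D ξ y : ℝ}

lemma rho_sq (hD : 0 ≤ D) : rho D ξ y ^ 2 = ξ ^ 2 + y ^ 2 + D := sq_sqrt (by positivity)

lemma rho_pos (hD : 0 ≤ D) (hy : 0 < y) : 0 < rho D ξ y := sqrt_pos.2 (by positivity)

lemma rho_nonneg : 0 ≤ rho D ξ y := sqrt_nonneg _

lemma abs_lt_rho (hD : 0 ≤ D) (hy : 0 < y) : |ξ| < rho D ξ y := by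
  refine lt_sqrt_of_sq_lt ?_
  rw [sq_abs]; nlinarith

lemma le_rho : y ≤ rho 0 ξ y := le_sqrt_of_sq_le (by nlinarith)

lemma mm_pos (hD : 0 ≤ D) (hy : 0 < y) : 0 < mm D ξ y := by
  have := abs_lt_rho (ξ := ξ) hD hy
  unfold mm; linarith [neg_abs_le ξ]

lemma mm_mul (hD : 0 ≤ D) : mm D ξ y * (rho D ξ y - ξ) = y ^ 2 + D := by
  have := rho_sq (ξ := ξ) (y := y) hD
  unfold mm; nlinarith

lemma mm_le (hD : 0 ≤ D) (hy : 0 < y) : mm D ξ y ≤ 2 * rho D ξ y := by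
  have := abs_lt_rho (ξ := ξ) hD hy
  unfold mm; linarith [le_abs_self ξ]

lemma hasDerivAt_rho_fst (hD : 0 ≤ D) (hy : 0 < y) :
    HasDerivAt (fun τ => rho D τ y) (ξ / rho D ξ y) ξ := by
  have h1 : HasDerivAt (fun τ => τ ^ 2 + y ^ 2 + D) (2 * ξ) ξ := by
    simpa using ((hasDerivAt_pow 2 ξ).add_const (y ^ 2)).add_const D
  have h2 := h1.sqrt (by positivity)
  refine h2.congr_deriv ?_
  rw [mul_div_mul_left _ _ two_ne_zero]; rfl

lemma hasDerivAt_rho_snd (hD : 0 ≤ D) (hy : 0 < y) :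
    HasDerivAt (fun τ => rho D ξ τ) (y / rho D ξ y) y := by
  have h1 : HasDerivAt (fun τ => ξ ^ 2 + τ ^ 2 + D) (2 * y) y := by
    simpa using ((hasDerivAt_pow 2 y).const_add (ξ ^ 2)).add_const D
  have h2 := h1.sqrt (by positivity)
  refine h2.congr_deriv ?_
  rw [mul_div_mul_left _ _ two_ne_zero]; rfl

lemma hasDerivAt_mm_fst (hD : 0 ≤ D) (hy : 0 < y) :
    HasDerivAt (fun τ => mm D τ y) (mm D ξ y / rho D ξ y) ξ := by
  refine ((hasDerivAt_rho_fst hD hy).add (hasDerivAt_id ξ)).congr_deriv ?_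
  have := (rho_pos (ξ := ξ) hD hy).ne'
  unfold mm; field_simp; ring

lemma hasDerivAt_mm_snd (hD : 0 ≤ D) (hy : 0 < y) :
    HasDerivAt (fun τ => mm D ξ τ) (y / rho D ξ y) y :=
  (hasDerivAt_rho_snd hD hy).add_const ξ

lemma hasDerivAt_mmp_fst (hD : 0 ≤ D) (hy : 0 < y) (p : ℝ) :
    HasDerivAt (fun τ => mm D τ y ^ p) (p * mm D ξ y ^ p / rho D ξ y) ξ := by
  have hm := mm_pos (ξ := ξ) hD hy
  refine ((hasDerivAt_mm_fst hD hy).rpow_const (Or.inl hm.ne')).congr_deriv ?_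
  rw [rpow_sub_one hm.ne']
  field_simp

lemma hasDerivAt_mmp_snd (hD : 0 ≤ D) (hy : 0 < y) (p : ℝ) :
    HasDerivAt (fun τ => mm D ξ τ ^ p) (p * y * mm D ξ y ^ (p - 1) / rho D ξ y) y := by
  have hm := mm_pos (ξ := ξ) hD hy
  refine ((hasDerivAt_mm_snd hD hy).rpow_const (Or.inl hm.ne')).congr_deriv ?_
  ring

lemma continuous_rho : Continuous fun w : ℝ × ℝ => rho D w.1 w.2 := by unfold rho; fun_prop

lemma continuous_mm : Continuous fun w : ℝ × ℝ => mm D w.1 w.2 := by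
  unfold mm; exact continuous_rho.add continuous_fst

lemma continuousOn_mmp (hD : 0 ≤ D) (p : ℝ) :
    ContinuousOn (fun w : ℝ × ℝ => mm D w.1 w.2 ^ p) {w | 0 < w.2} :=
  continuous_mm.continuousOn.rpow_const fun _ hw => Or.inl (mm_pos hD hw).ne'

lemma continuousOn_div_rho (hD : 0 ≤ D) {f : ℝ × ℝ → ℝ} (hf : ContinuousOn f {w | 0 < w.2}) :
    ContinuousOn (fun w : ℝ × ℝ => f w / rho D w.1 w.2) {w | 0 < w.2} :=
  hf.div continuous_rho.continuousOn fun _ hw => (rho_pos hD hw).ne'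

end rho

/-- Polynomial growth on the open half plane. -/
def PB (G : ℝ → ℝ → ℝ) : Prop := ∃ C p, 0 ≤ C ∧ ∀ ξ y, 0 < y → |G ξ y| ≤ C * (1 + (ξ ^ 2 + y ^ 2)) ^ (p : ℝ)

/-- A function of one thin variable and the normal variable. -/
def lift (e : V n) (F : ℝ → ℝ → ℝ) (z : E n) : ℝ := F (∑ i, e i * z.1 i) z.2

lemma dot_sq_le (e x : V n) (he : ∑ i, e i ^ 2 = 1) : (∑ i, e i * x i) ^ 2 ≤ ∑ i, x i ^ 2 := by
  have := Finset.sum_mul_sq_le_sq_mul_sq Finset.univ e x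
  rwa [he, one_mul] at this

section lift
variable {e : V n} {F F1 F2 F11 F22 : ℝ → ℝ → ℝ}

lemma lift_sg (he : ∑ i, e i ^ 2 = 1) (h : PB F) : SG 0 (lift e F) := by
  obtain ⟨C, p, hC, h⟩ := h
  refine SG.of_GR (GR.of_rpow nq_nonneg_on hC |p| fun z hz => (h _ _ hz).trans ?_)
  gcongr
  have h0 : (∑ i, e i * z.1 i) ^ 2 + z.2 ^ 2 ≤ nq z := by
    have := dot_sq_le e z.1 he
    unfold nq nsq; linarith
  refine (rpow_le_rpow_of_exponent_le (by nlinarith) (le_abs_self p)).trans ?_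
  exact rpow_le_rpow (by positivity) (by linarith) (abs_nonneg p)

lemma lift_cont (hF : ContinuousOn (fun w : ℝ × ℝ => F w.1 w.2) {w | 0 < w.2}) :
    ContinuousOn (lift e F) (Hs n) :=
  hF.comp (f := fun z : E n => (∑ i, e i * z.1 i, z.2)) (by fun_prop) fun z hz => hz

lemma lift_dx (hF : ∀ ξ y, 0 < y → HasDerivAt (fun τ => F τ y) (F1 ξ y) ξ) (i : Fin n) :
    HasDx i (lift e F) fun z => e i * lift e F1 z := by
  intro z hz
  have h1 : HasDerivAt (fun τ => ∑ j, e j * Function.update z.1 i τ j) (e i) (z.1 i) := by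
    have := HasDerivAt.fun_sum (u := Finset.univ) (A' := fun j => e j * (Pi.single i 1 : V n) j) fun j _ =>
        ((hasDerivAt_pi.1 (hasDerivAt_update z.1 i (z.1 i))) j).const_mul (e j)
    refine this.congr_deriv ?_
    simp [Pi.single_apply]
  have h2 : HasDerivAt (fun τ => F τ z.2) (lift e F1 z) (∑ j, e j * Function.update z.1 i (z.1 i) j) := by
    rw [Function.update_eq_self]; exact hF _ _ hz
  refine (h2.comp (z.1 i) h1).congr_deriv (mul_comm _ _)

lemma lift_dy (hF : ∀ ξ y, 0 < y → HasDerivAt (fun τ => F ξ τ) (F2 ξ y) y) :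
    HasDy (lift e F) (lift e F2) :=
  fun z hz => hF (∑ i, e i * z.1 i) z.2 hz

/-- A function of two variables with the derivatives and growth required for lifting. -/
structure TD (a : ℝ) (F F1 F2 F11 F22 G : ℝ → ℝ → ℝ) : Prop where
  d1 : ∀ ξ y, 0 < y → HasDerivAt (fun τ => F τ y) (F1 ξ y) ξ
  d2 : ∀ ξ y, 0 < y → HasDerivAt (fun τ => F ξ τ) (F2 ξ y) y
  d11 : ∀ ξ y, 0 < y → HasDerivAt (fun τ => F1 τ y) (F11 ξ y) ξ
  d22 : ∀ ξ y, 0 < y → HasDerivAt (fun τ => F2 ξ τ) (F22 ξ y) y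
  c : ContinuousOn (fun w : ℝ × ℝ => F w.1 w.2) {w | 0 < w.2}
  c1 : ContinuousOn (fun w : ℝ × ℝ => F1 w.1 w.2) {w | 0 < w.2}
  c2 : ContinuousOn (fun w : ℝ × ℝ => F2 w.1 w.2) {w | 0 < w.2}
  c11 : ContinuousOn (fun w : ℝ × ℝ => F11 w.1 w.2) {w | 0 < w.2}
  c22 : ContinuousOn (fun w : ℝ × ℝ => F22 w.1 w.2) {w | 0 < w.2}
  b : PB F
  b1 : PB F1
  b2 : PB fun ξ y => F2 ξ y * y ^ a
  bg : PB G
  eq : ∀ ξ y, 0 < y → F11 ξ y + F22 ξ y + a / y * F2 ξ y - 1 / 2 * (ξ * F1 ξ y + y * F2 ξ y) = G ξ y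

lemma TD.pg {G} (h : TD a F F1 F2 F11 F22 G) (he : ∑ i, e i ^ 2 = 1) :
    PG n a (lift e F) (fun i z => e i * lift e F1 z) (lift e F2) (lift e G) where
  pc :=
  { cont := lift_cont h.c
    contx i := continuousOn_const.mul (lift_cont h.c1)
    conty := lift_cont h.c2
    dx i := lift_dx h.d1 i
    dy := lift_dy h.d2
    sg := lift_sg he h.b
    sgx i := SG.const_mul (lift_sg he h.b1) _
    sgy := SG.to_GR (lift_sg he h.b2) }
  sgg := lift_sg he h.bg
  sec := by
    refine ⟨fun i z => e i * (e i * lift e F11 z), lift e F22, fun i => ⟨(lift_dx h.d11 i).const_mul _,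
      continuousOn_const.mul (continuousOn_const.mul (lift_cont h.c11))⟩, lift_dy h.d22,
      lift_cont h.c22, fun z hz => ?_⟩
    have h1 : ∑ i, e i * (e i * lift e F11 z) = lift e F11 z := by
      simp only [← mul_assoc, ← pow_two]
      rw [← sum_mul, he, one_mul]
    have h2 : ∑ i, z.1 i * (e i * lift e F1 z) = (∑ i, e i * z.1 i) * lift e F1 z := by
      rw [sum_mul]; exact sum_congr rfl fun i _ => by ring
    rw [h1, h2]
    exact h.eq _ _ hz

end lift

lemma PB.of_rho {F : ℝ → ℝ → ℝ} {D C : ℝ} (hD : 0 ≤ D) (hC : 0 ≤ C) {p : ℝ} (hp : 0 ≤ p)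
    (h : ∀ ξ y, 0 < y → |F ξ y| ≤ C * rho D ξ y ^ p) : PB F := by
  refine ⟨C * (1 + D) ^ p, p, by positivity, fun ξ y hy => (h ξ y hy).trans ?_⟩
  rw [mul_assoc, ← mul_rpow (by positivity) (by positivity)]
  refine mulL (rpow_le_rpow rho_nonneg ?_ hp) hC
  refine sqrt_le_iff.2 ⟨by positivity, ?_⟩
  have : 0 ≤ ξ ^ 2 + y ^ 2 := by positivity
  nlinarith [mul_nonneg hD this, mul_nonneg (mul_nonneg hD hD) this]

section homog
variable {s : ℝ}

/-- The homogeneous Signorini profile of degree `1 + s`. -/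
def hF (s ξ y : ℝ) : ℝ := mm 0 ξ y ^ s * (ξ - s * rho 0 ξ y)

lemma hF_d1 (s ξ y : ℝ) (hy : 0 < y) :
    HasDerivAt (fun τ => hF s τ y) ((1 - s ^ 2) * mm 0 ξ y ^ s) ξ := by
  refine ((hasDerivAt_mmp_fst le_rfl hy s).mul ((hasDerivAt_id ξ).sub
    ((hasDerivAt_rho_fst le_rfl hy).const_mul s))).congr_deriv ?_
  have := (rho_pos (ξ := ξ) le_rfl hy).ne'
  simp only [Pi.sub_apply, id]; field_simp; ring

lemma hF_d2 (s ξ y : ℝ) (hy : 0 < y) :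
    HasDerivAt (fun τ => hF s ξ τ) (-(s * (1 + s)) * (y * mm 0 ξ y ^ (s - 1))) y := by
  refine ((hasDerivAt_mmp_snd le_rfl hy s).mul
    (((hasDerivAt_rho_snd le_rfl hy).const_mul s).const_sub ξ)).congr_deriv ?_
  have := (rho_pos (ξ := ξ) le_rfl hy).ne'
  have hm := mm_pos (ξ := ξ) le_rfl hy
  have e : mm 0 ξ y ^ s = mm 0 ξ y ^ (s - 1) * mm 0 ξ y := by
    rw [rpow_sub_one hm.ne']; field_simp
  have e2 : mm 0 ξ y = rho 0 ξ y + ξ := rfl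
  grind

lemma hF_flux (hs' : s < 1) (ξ : ℝ) {y : ℝ} (hy : 0 < y) : y * mm 0 ξ y ^ (s - 1) * y ^ 𝔟 s =
    (rho 0 ξ y - ξ) ^ (1 - s) := by
  have h1 := mm_mul (ξ := ξ) (y := y) (le_refl 0)
  have hm := mm_pos (ξ := ξ) le_rfl hy
  have h2 : rho 0 ξ y - ξ = y ^ 2 / mm 0 ξ y := by grind
  rw [h2, div_rpow (by positivity) hm.le, div_eq_mul_inv, ← rpow_neg hm.le, neg_sub, ← rpow_natCast, ← rpow_mul hy.le]
  have : y * y ^ 𝔟 s = y ^ ((2:ℕ) * (1 - s)) := by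
    rw [← rpow_one_add' hy.le (by linarith)]; congr 1; push_cast; ring
  rw [← this]; ring

lemma hF_bd (hs : 0 < s) (hs' : s < 1) {ξ y : ℝ} (hy : 0 < y) : |hF s ξ y| ≤ 4 * rho 0 ξ y ^ (1 + s) := by
  have hr := rho_pos (ξ := ξ) le_rfl hy
  have hm := mm_pos (ξ := ξ) le_rfl hy
  have h1 : mm 0 ξ y ^ s ≤ 2 * rho 0 ξ y ^ s := by
    refine (rpow_le_rpow hm.le (mm_le le_rfl hy) hs.le).trans ?_
    rw [mul_rpow zero_le_two hr.le]
    gcongr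
    exact (rpow_le_rpow_of_exponent_le one_le_two hs'.le).trans (by simp)
  have h2 : |ξ - s * rho 0 ξ y| ≤ 2 * rho 0 ξ y := by
    have := abs_lt_rho (ξ := ξ) le_rfl hy
    have h3 := abs_lt.1 this
    rw [abs_le]; constructor <;> nlinarith
  unfold hF
  rw [abs_mul, abs_of_pos (by positivity), rpow_add hr, rpow_one]
  calc _ ≤ (2 * rho 0 ξ y ^ s) * (2 * rho 0 ξ y) := by gcongr
    _ = _ := by ring

lemma hF_td (hs : 0 < s) (hs' : s < 1) : TD 𝔟 s (hF s) (fun ξ y => (1 - s ^ 2) * mm 0 ξ y ^ s)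
    (fun ξ y => -(s * (1 + s)) * (y * mm 0 ξ y ^ (s - 1)))
    (fun ξ y => (1 - s ^ 2) * (s * mm 0 ξ y ^ s / rho 0 ξ y))
    (fun ξ y => -(s * (1 + s)) * (1 * mm 0 ξ y ^ (s - 1) + y * ((s - 1) * y * mm 0 ξ y ^ (s - 1 - 1) / rho 0 ξ y)))
    (fun ξ y => -((1 + s) / 2) * hF s ξ y) where
  d1 := hF_d1 s
  d2 := hF_d2 s
  d11 ξ y hy := (hasDerivAt_mmp_fst le_rfl hy s).const_mul _
  d22 ξ y hy := ((hasDerivAt_id y).mul (hasDerivAt_mmp_snd le_rfl hy (s - 1))).const_mul _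
  c := (continuousOn_mmp le_rfl s).mul (continuousOn_fst.sub (continuous_rho.continuousOn.const_mul s))
  c1 := (continuousOn_mmp le_rfl s).const_mul _
  c2 := (continuousOn_snd.mul (continuousOn_mmp le_rfl (s - 1))).const_mul _
  c11 := (continuousOn_div_rho le_rfl ((continuousOn_mmp le_rfl s).const_mul s)).const_mul _
  c22 := ((((continuousOn_mmp le_rfl (s - 1)).const_mul 1).add (continuousOn_snd.mul
    (continuousOn_div_rho le_rfl ((continuousOn_snd.const_mul (s - 1)).mul
      (continuousOn_mmp le_rfl (s - 1 - 1))))))).const_mul _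
  b := PB.of_rho le_rfl (by norm_num) (by linarith) fun ξ y hy => hF_bd hs hs' hy
  b1 := by
    refine PB.of_rho le_rfl zero_le_two hs.le fun ξ y hy => ?_
    have hr := rho_pos (ξ := ξ) le_rfl hy
    have hm := mm_pos (ξ := ξ) le_rfl hy
    have h1 : mm 0 ξ y ^ s ≤ 2 * rho 0 ξ y ^ s := by
      refine (rpow_le_rpow hm.le (mm_le le_rfl hy) hs.le).trans ?_
      rw [mul_rpow zero_le_two hr.le]
      gcongr
      exact (rpow_le_rpow_of_exponent_le one_le_two hs'.le).trans (by simp)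
    have h0 := rpow_pos_of_pos hm s
    rw [abs_of_nonneg (mul_nonneg (by nlinarith) h0.le)]
    nlinarith [mul_pos (pow_pos hs 2) h0]
  b2 := by
    refine PB.of_rho le_rfl (by norm_num : (0:ℝ) ≤ 4) (by linarith : 0 ≤ 1 - s) fun ξ y hy => ?_
    have hr := rho_pos (ξ := ξ) le_rfl hy
    have hx := abs_lt_rho (ξ := ξ) le_rfl hy
    have h3 := abs_lt.1 hx
    rw [mul_assoc, hF_flux hs' ξ hy, abs_mul, abs_of_nonneg (rpow_nonneg (by linarith) _), abs_neg,
      abs_of_pos (by positivity)]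
    have h1 : (rho 0 ξ y - ξ) ^ (1 - s) ≤ 2 * rho 0 ξ y ^ (1 - s) := by
      refine (rpow_le_rpow (by linarith) (by linarith : _ ≤ 2 * rho 0 ξ y) (by linarith)).trans ?_
      rw [mul_rpow zero_le_two hr.le]
      gcongr
      exact (rpow_le_rpow_of_exponent_le one_le_two (by linarith : 1 - s ≤ 1)).trans (by simp)
    calc s * (1 + s) * (rho 0 ξ y - ξ) ^ (1 - s) ≤ 2 * (2 * rho 0 ξ y ^ (1 - s)) :=
      mul_le_mul (by nlinarith) h1 (rpow_nonneg (by linarith) _) (by norm_num)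
      _ = _ := by ring
  bg := by
    refine PB.of_rho le_rfl (by norm_num : (0:ℝ) ≤ 4) (by linarith : 0 ≤ 1 + s) fun ξ y hy => ?_
    have := hF_bd (ξ := ξ) hs hs' hy
    rw [abs_mul, abs_neg, abs_of_pos (by positivity)]
    nlinarith [abs_nonneg (hF s ξ y)]
  eq ξ y hy := by
    have hr := (rho_pos (ξ := ξ) le_rfl hy).ne'
    have hm := mm_pos (ξ := ξ) le_rfl hy
    have hy' := hy.ne'
    have e : mm 0 ξ y ^ s = mm 0 ξ y ^ (s - 1 - 1) * mm 0 ξ y ^ 2 := by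
      rw [← rpow_add_natCast hm.ne']; congr 1; push_cast; ring
    have e1 : mm 0 ξ y ^ (s - 1) = mm 0 ξ y ^ (s - 1 - 1) * mm 0 ξ y := by
      rw [← rpow_add_one hm.ne']; congr 1; ring
    have e2 : mm 0 ξ y = rho 0 ξ y + ξ := rfl
    have e3 : y ^ 2 = rho 0 ξ y ^ 2 - ξ ^ 2 := by rw [rho_sq le_rfl]; ring
    unfold hF
    rw [e, e1]
    generalize mm 0 ξ y ^ (s - 1 - 1) = A
    rw [e2]
    grind

lemma uF_td (hs : 0 < s) : TD 𝔟 s (fun _ y => y ^ (2 * s)) (fun _ _ => 0)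
    (fun _ y => 2 * s * y ^ (2 * s - 1)) (fun _ _ => 0)
    (fun _ y => 2 * s * ((2 * s - 1) * y ^ (2 * s - 1 - 1))) (fun _ y => -s * y ^ (2 * s)) where
  d1 _ _ _ := hasDerivAt_const _ _
  d2 _ y hy := hasDerivAt_rpow_const (Or.inl hy.ne')
  d11 _ _ _ := hasDerivAt_const _ _
  d22 _ y hy := (hasDerivAt_rpow_const (Or.inl hy.ne')).const_mul _
  c := continuousOn_snd.rpow_const fun _ hw => Or.inl (ne_of_gt hw)
  c1 := continuousOn_const
  c2 := (continuousOn_snd.rpow_const fun _ hw => Or.inl (ne_of_gt hw)).const_mul _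
  c11 := continuousOn_const
  c22 := ((continuousOn_snd.rpow_const fun _ hw => Or.inl (ne_of_gt hw)).const_mul _).const_mul _
  b := by
    refine PB.of_rho le_rfl zero_le_one (by linarith : 0 ≤ 2 * s) fun ξ y hy => ?_
    rw [abs_of_pos (by positivity), one_mul]
    exact rpow_le_rpow hy.le (le_rho) (by linarith)
  b1 := ⟨0, 0, le_rfl, by simp⟩
  b2 := by
    refine ⟨2 * s, 0, by linarith, fun ξ y hy => ?_⟩
    simp only []
    rw [mul_assoc, ← rpow_add hy]
    simp [abs_of_pos hs]
  bg := by
    refine PB.of_rho le_rfl hs.le (by linarith : 0 ≤ 2 * s) fun ξ y hy => ?_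
    rw [abs_mul, abs_neg, abs_of_pos hs, abs_of_pos (by positivity)]
    exact mulL (rpow_le_rpow hy.le (le_rho) (by linarith)) hs.le
  eq _ y hy := by
    have e : y ^ (2 * s) = y ^ (2 * s - 1) * y := by rw [← rpow_add_one hy.ne']; congr 1; ring
    rw [e, rpow_sub_one hy.ne']
    ring

end homog

lemma coord_pg (j : Fin n) :
    PG n a (fun z => z.1 j) (fun i _ => if i = j then 1 else 0) (fun _ => 0) (fun z => -(1 / 2) * z.1 j) where
  pc :=
  { cont := by fun_prop
    contx i := continuousOn_const
    conty := continuousOn_const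
    dx i z hz := by
      refine ((hasDerivAt_pi.1 (hasDerivAt_update z.1 i (z.1 i))) j).congr_deriv ?_
      simp [Pi.single_apply, eq_comm]
    dy z hz := hasDerivAt_const _ _
    sg := SG.coord j
    sgx i := SG.const _
    sgy := (GR.const nq_nonneg_on 0).congr fun z _ => by simp }
  sgg := SG.const_mul (SG.coord j) _
  sec := ⟨fun _ _ => 0, fun _ => 0, fun i => ⟨fun _ _ => hasDerivAt_const _ _, continuousOn_const⟩,
    fun _ _ => hasDerivAt_const _ _, continuousOn_const, fun z hz => by simp⟩

section bilinear
variable {f g h : E n → ℝ} {fx gx hx : Fin n → E n → ℝ} {fy gy hy : E n → ℝ}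

lemma dirich_eq : dirich a fx fy = dir2 a fx fy fx fy := by
  simp only [dirich, dir2, pow_two]

lemma dir2_comm : dir2 a fx fy gx gy = dir2 a gx gy fx fy := by
  simp only [dir2, mul_comm]

lemma dir2_const_mul (c : ℝ) :
    dir2 a (fun i z => c * fx i z) (fun z => c * fy z) gx gy = c * dir2 a fx fy gx gy := by
  simp only [dir2, mul_assoc, integral_const_mul, mul_add, mul_sum]

lemma dir2_add (ha : -1 < a) (ha' : a < 1) (hf : PC n a f fx fy) (hg : PC n a g gx gy) (hh : PC n a h hx hy) :
    dir2 a (fun i z => fx i z + gx i z) (fun z => fy z + gy z) hx hy = dir2 a fx fy hx hy + dir2 a gx gy hx hy := by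
  have e1 : ∀ i, ∫ z, (fx i z + gx i z) * hx i z ∂mu a = I₂ a (fx i) (hx i) + I₂ a (gx i) (hx i) := fun i => by
    rw [← integral_add (hf.integrable_xx ha hh i) (hg.integrable_xx ha hh i)]
    simp only [add_mul]
  have e2 : ∫ z, (fy z + gy z) * hy z ∂mu a = I₂ a fy hy + I₂ a gy hy := by
    rw [← integral_add (hf.integrable_yy ha ha' hh) (hg.integrable_yy ha ha' hh)]
    simp only [add_mul]
  simp only [dir2, e1, e2, sum_add_distrib]
  ring

lemma dir2_sub (ha : -1 < a) (ha' : a < 1) (hf : PC n a f fx fy) (hg : PC n a g gx gy) (hh : PC n a h hx hy) :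
    dir2 a (fun i z => fx i z - gx i z) (fun z => fy z - gy z) hx hy = dir2 a fx fy hx hy - dir2 a gx gy hx hy := by
  have := dir2_add ha ha' hf (hg.const_mul (-1)) hh
  rw [dir2_const_mul] at this
  grind

lemma dirich_sub (ha : -1 < a) (ha' : a < 1) (hf : PC n a f fx fy) (hg : PC n a g gx gy) :
    dirich a (fun i z => fx i z - gx i z) (fun z => fy z - gy z)
      = dirich a fx fy - 2 * dir2 a fx fy gx gy + dirich a gx gy := by
  rw [dirich_eq, dir2_sub ha ha' hf hg (hf.sub hg), dir2_comm, dir2_comm (fx := gx),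
    dir2_sub ha ha' hf hg hf, dir2_sub ha ha' hf hg hg, dirich_eq, dirich_eq, dir2_comm (fx := gx)]
  ring

lemma dirich_add (ha : -1 < a) (ha' : a < 1) (hf : PC n a f fx fy) (hg : PC n a g gx gy) :
    dirich a (fun i z => fx i z + gx i z) (fun z => fy z + gy z)
      = dirich a fx fy + 2 * dir2 a fx fy gx gy + dirich a gx gy := by
  rw [dirich_eq, dir2_add ha ha' hf hg (hf.add hg), dir2_comm, dir2_comm (fx := gx),
    dir2_add ha ha' hf hg hf, dir2_add ha ha' hf hg hg, dirich_eq, dirich_eq, dir2_comm (fx := gx)]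
  ring

lemma dirich_const_mul (c : ℝ) :
    dirich a (fun i z => c * fx i z) (fun z => c * fy z) = c ^ 2 * dirich a fx fy := by
  rw [dirich_eq, dir2_const_mul, dir2_comm, dir2_const_mul, dirich_eq]; ring

end bilinear

lemma young {f g : E n → ℝ} (hf : MemLp f 2 (mu a)) (hg : MemLp g 2 (mu a)) {c : ℝ} (hc : 0 < c) :
    |I₂ a f g| ≤ 1 / (2 * c) * N₂ a f + c / 2 * N₂ a g := by
  have h := cauchy_schwarz hf hg
  have h1 := integral_sq (m := mu a) f
  have h2 := integral_sq (m := mu a) g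
  generalize I₂ a f g = I at *
  generalize N₂ a f = F at *
  generalize N₂ a g = G at *
  refine abs_le_of_sq_le_sq (h.trans ?_) (by positivity)
  have e : 1 / (2 * c) * F = F / c / 2 := by ring
  have e2 : F * G = (F / c) * (c * G) := by grind
  rw [e, e2]
  nlinarith [sq_nonneg (F / c - c * G)]

section trace
variable {s : ℝ}

lemma rho_tendsto (ξ : ℝ) : Tendsto (fun y => rho 0 ξ y) (𝓝[>] 0) (𝓝 |ξ|) := by
  have h : Continuous fun y => rho 0 ξ y := by unfold rho; fun_prop
  have := (h.tendsto 0).mono_left (nhdsWithin_le_nhds (s := Ioi 0))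
  have e : rho 0 ξ 0 = |ξ| := by unfold rho; simp [sqrt_sq_eq_abs]
  rwa [e] at this

/-- Trace of `hF` on the thin space. -/
def hT (s ξ : ℝ) : ℝ := (|ξ| + ξ) ^ s * (ξ - s * |ξ|)

lemma hF_tr (hs : 0 < s) (ξ : ℝ) : Tendsto (fun y => hF s ξ y) (𝓝[>] 0) (𝓝 (hT s ξ)) := by
  have h := rho_tendsto ξ
  exact ((h.add_const ξ).rpow_const (Or.inr hs.le)).mul ((h.const_mul s).const_sub ξ)

lemma hF_flux_tr (hs' : s < 1) (ξ : ℝ) :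
    Tendsto (fun y => y ^ 𝔟 s * (-(s * (1 + s)) * (y * mm 0 ξ y ^ (s - 1)))) (𝓝[>] 0)
      (𝓝 (-(s * (1 + s)) * (|ξ| - ξ) ^ (1 - s))) := by
  have h : Tendsto (fun y => -(s * (1 + s)) * (rho 0 ξ y - ξ) ^ (1 - s)) (𝓝[>] 0)
      (𝓝 (-(s * (1 + s)) * (|ξ| - ξ) ^ (1 - s))) :=
    (((rho_tendsto ξ).sub_const ξ).rpow_const (Or.inr (by linarith))).const_mul _
  refine h.congr' ?_
  filter_upwards [self_mem_nhdsWithin] with y hy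
  rw [← hF_flux hs' ξ hy]; ring

lemma hT_nonneg (hs : 0 < s) (hs' : s < 1) (ξ : ℝ) : 0 ≤ hT s ξ := by
  unfold hT
  rcases le_total 0 ξ with h | h
  · rw [abs_of_nonneg h]
    exact mul_nonneg (by positivity) (by nlinarith)
  · rw [abs_of_nonpos h]; simp [zero_rpow hs.ne']

lemma hT_compl (hs : 0 < s) (hs' : s < 1) (ξ : ℝ) :
    -(s * (1 + s)) * (|ξ| - ξ) ^ (1 - s) * hT s ξ = 0 := by
  unfold hT
  rcases le_total 0 ξ with h | h
  · rw [abs_of_nonneg h]; simp [zero_rpow (by linarith : 1 - s ≠ 0)]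
  · rw [abs_of_nonpos h]; simp [zero_rpow hs.ne']

lemma uF_tr (hs : 0 < s) : Tendsto (fun y : ℝ => y ^ (2 * s)) (𝓝[>] 0) (𝓝 0) := by
  have h : Tendsto (fun y : ℝ => y) (𝓝[>] 0) (𝓝 0) := nhdsWithin_le_nhds
  have := h.rpow_const (p := 2 * s) (Or.inr (by linarith))
  rwa [zero_rpow (by linarith)] at this

end trace

section explicit
variable {s : ℝ} {e : V n}

/-- Derivative data of `hF`. -/
def hF1 (s ξ y : ℝ) : ℝ := (1 - s ^ 2) * mm 0 ξ y ^ s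
def hF2 (s ξ y : ℝ) : ℝ := -(s * (1 + s)) * (y * mm 0 ξ y ^ (s - 1))
def uF (s : ℝ) (_ y : ℝ) : ℝ := y ^ (2 * s)
def uF2 (s : ℝ) (_ y : ℝ) : ℝ := 2 * s * y ^ (2 * s - 1)

lemma h_pg (hs : 0 < s) (hs' : s < 1) (he : ∑ i, e i ^ 2 = 1) :
    PG n 𝔟 s (lift e (hF s)) (fun i z => e i * lift e (hF1 s) z) (lift e (hF2 s))
      (fun z => -((1 + s) / 2) * lift e (hF s) z) := (hF_td hs hs').pg he

lemma u_pg (hs : 0 < s) (he : ∑ i, e i ^ 2 = 1) :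
    PG n 𝔟 s (lift e (uF s)) (fun i _ => e i * 0) (lift e (uF2 s)) (fun z => -s * lift e (uF s) z) := (uF_td hs).pg he

variable (hs : 0 < s) (hs' : s < 1) (he : ∑ i, e i ^ 2 = 1)
include hs hs' he

lemma dir_hh : dirich 𝔟 s (fun i z => e i * lift e (hF1 s) z) (lift e (hF2 s))
    = (1 + s) / 2 * N₂ 𝔟 s (lift e (hF s)) := by
  have hp := h_pg hs hs' he
  have := FG.green (by linarith) (by linarith) hp hp.pc fun x => by
    have := (hF_flux_tr hs' (∑ i, e i * x i)).mul (hF_tr hs (∑ i, e i * x i))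
    rw [hT_compl hs hs'] at this
    exact this
  rw [← dirich_eq] at this
  simp only [mul_assoc, ← pow_two, integral_const_mul, integral_zero] at this
  linarith

lemma dir_hu : dir2 𝔟 s (fun i z => e i * lift e (hF1 s) z) (lift e (hF2 s)) (fun i _ => e i * 0) (lift e (uF2 s))
    = (1 + s) / 2 * I₂ 𝔟 s (lift e (hF s)) (lift e (uF s)) := by
  have hp := h_pg hs hs' he
  have := FG.green (by linarith) (by linarith) hp (u_pg hs he).pc fun x => by
    have := (hF_flux_tr hs' (∑ i, e i * x i)).mul (uF_tr hs)
    rw [mul_zero] at this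
    exact this
  simp only [mul_assoc, integral_const_mul, integral_zero] at this ⊢
  linarith

lemma dir_uu : dirich 𝔟 s (fun i _ => e i * 0) (lift e (uF2 s)) = s * N₂ 𝔟 s (lift e (uF s)) := by
  have hp := u_pg hs he
  have := FG.green (by linarith) (by linarith) hp hp.pc fun x => by
    have h1 : Tendsto (fun y => 2 * s * y ^ (2 * s)) (𝓝[>] 0) (𝓝 0) := by
      simpa using (uF_tr hs).const_mul (2 * s)
    refine h1.congr' ?_
    filter_upwards [self_mem_nhdsWithin] with y hy
    have hy := hy
    have : y ^ 𝔟 s * y ^ (2 * s - 1) = 1 := by rw [← rpow_add hy]; simp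
    simp only [lift, uF, uF2]
    linear_combination (-(2 * s * y ^ (2 * s))) * this
  rw [← dirich_eq] at this
  simp only [mul_assoc, ← pow_two, integral_const_mul, integral_zero] at this ⊢
  linarith

lemma h_coord (j : Fin n) : ∫ z, lift e (hF s) z * z.1 j ∂mu 𝔟 s = 2 * e j * ∫ z, lift e (hF1 s) z ∂mu 𝔟 s := by
  have := FG.green (by linarith) (by linarith) (coord_pg j) (h_pg hs hs' he).pc (L := fun _ => 0)
    fun x => by simp
  simp only [dir2, ite_mul, one_mul, zero_mul, integral_zero, mul_assoc, integral_const_mul] at this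
  have e1 : ∑ i, ∫ z, (if i = j then e i * lift e (hF1 s) z else 0) ∂mu 𝔟 s = e j * ∫ z, lift e (hF1 s) z ∂mu 𝔟 s := by
    rw [sum_eq_single j]
    · simp [integral_const_mul]
    · intro b _ hb; simp [hb]
    · simp
  grind

lemma u_coord (j : Fin n) : ∫ z, lift e (uF s) z * z.1 j ∂mu 𝔟 s = 0 := by
  have := FG.green (by linarith) (by linarith) (coord_pg j) (u_pg hs he).pc (L := fun _ => 0)
    fun x => by simp
  simp only [dir2, integral_zero, mul_zero, mul_assoc, integral_const_mul, Finset.sum_const_zero] at this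
  grind

end explicit

lemma integrable_mul2 {f g : E n → ℝ} (hf : MemLp f 2 (mu a)) (hg : MemLp g 2 (mu a)) :
    Integrable (fun z => f z * g z) (mu a) := hf.integrable_mul hg

lemma integral_sq_sub {f g : E n → ℝ} (hf : MemLp f 2 (mu a)) (hg : MemLp g 2 (mu a)) :
    ∫ z, (f z - g z) ^ 2 ∂mu a = N₂ a f - 2 * I₂ a f g + N₂ a g := by
  have e : ∀ z, (f z - g z) ^ 2 = (f z ^ 2 - 2 * (f z * g z)) + g z ^ 2 := by grind
  simp only [e]
  have i1 : Integrable (fun z => f z ^ 2 - 2 * (f z * g z)) (mu a) :=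
    hf.integrable_sq.sub ((integrable_mul2 hf hg).const_mul 2)
  rw [integral_add i1 hg.integrable_sq, integral_sub hf.integrable_sq
    ((integrable_mul2 hf hg).const_mul 2), integral_const_mul]

lemma integral_sq_add {f g : E n → ℝ} (hf : MemLp f 2 (mu a)) (hg : MemLp g 2 (mu a)) :
    ∫ z, (f z + g z) ^ 2 ∂mu a = N₂ a f + 2 * I₂ a f g + N₂ a g := by
  have e : ∀ z, (f z + g z) ^ 2 = (f z ^ 2 + 2 * (f z * g z)) + g z ^ 2 := by grind
  simp only [e]
  have i1 : Integrable (fun z => f z ^ 2 + 2 * (f z * g z)) (mu a) :=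
    hf.integrable_sq.add ((integrable_mul2 hf hg).const_mul 2)
  rw [integral_add i1 hg.integrable_sq, integral_add hf.integrable_sq
    ((integrable_mul2 hf hg).const_mul 2), integral_const_mul]

/-- The defect of `f` from being a homogeneous solution of degree `κ`. -/
def defect (a κ : ℝ) (f : E n → ℝ) (z : E n) : ℝ := lapa a f z - 1 / 2 * Zv f z + κ / 2 * f z

lemma Reg.sg_defect (ha' : a < 1) {f : E n → ℝ} {T} (hf : Reg a f T) (κ : ℝ) : SG 0 (defect a κ f) :=
  SG.add (hf.pg ha').sgg (SG.const_mul hf.pc.sg _)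

lemma Reg.memLp_defect (ha : -1 < a) (ha' : a < 1) {f : E n → ℝ} {T} (hf : Reg a f T) (κ : ℝ) :
    MemLp (defect a κ f) 2 (mu a) :=
  SG.memLp ha (by linarith) (hf.sg_defect ha' κ) (ContinuousOn.aesm_mu
    ((hf.pg ha').contg.add (hf.sm.contOn.const_mul _)))

lemma Reg.green' (ha : -1 < a) (ha' : a < 1) {f : E n → ℝ} {T} (hf : Reg a f T) (κ : ℝ) {ζ ζx ζy}
    (hζ : PC n a ζ ζx ζy) {Z : V n → ℝ}
    (hZ : ∀ x, Tendsto (fun y => ζ (x, y)) (𝓝[>] 0) (𝓝 (Z x))) :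
    dir2 a (fun i => Dx i f) (Dy f) ζx ζy = κ / 2 * I₂ a f ζ
      - I₂ a (defect a κ f) ζ + cY a * ∫ x, T x * Z x ∂(gamn n) := by
  have h := hf.green ha ha' hζ hZ
  have e : I₂ a (defect a κ f) ζ = (∫ z, (lapa a f z - 1 / 2 * Zv f z) * ζ z ∂mu a) + κ / 2 * I₂ a f ζ := by
    have i1 := integrable_mul2 (hf.pg ha' |>.memLp ha) (hζ.memLp ha)
    have i2 := (integrable_mul2 (hf.pc.memLp ha) (hζ.memLp ha)).const_mul (κ / 2)
    rw [← integral_const_mul, ← integral_add i1 i2]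
    exact integral_congr_ae (Eventually.of_forall fun z => by unfold defect; ring)
  rw [e, ← h]; ring

lemma Prof.dir_self (ha : -1 < a) (ha' : a < 1) {v : E n → ℝ} {T} (hv : Prof a v T) (κ : ℝ) :
    dirich a (fun i => Dx i v) (Dy v) = κ / 2 * N₂ a v - I₂ a (defect a κ v) v := by
  rw [dirich_eq, hv.toReg.green' ha ha' κ hv.toReg.pc hv.toReg.lim_thin]
  simp only [hv.compl, integral_zero, mul_zero, add_zero, pow_two]

section profiles
variable {s : ℝ} {e : V n}

lemma profile_ineq (hs : 0 < s) (hs' : s < 1) (he : ∑ i, e i ^ 2 = 1) {v : E n → ℝ} {T}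
    (hv : Prof 𝔟 s v T) (κ : ℝ) {C c0 : ℝ} (hC : 0 ≤ C) {k : E n → ℝ}
    (hk : k = fun z => C * lift e (hF s) z + c0 * lift e (uF s) z)
    (hk1 : ∫ z, k z ∂mu 𝔟 s = ∫ z, v z ∂mu 𝔟 s) :
    (1 - κ / 2) * (∫ z, (v z - k z) ^ 2 ∂mu 𝔟 s) ≤ 1 / 4 * (∑ i, (∫ z, v z * z.1 i ∂mu 𝔟 s
        - C * (2 * e i * ∫ z, lift e (hF1 s) z ∂mu 𝔟 s)) ^ 2)
      - (∫ z, defect 𝔟 s κ v z * (v z - k z) ∂mu 𝔟 s)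
      + I₂ 𝔟 s (defect 𝔟 s κ v) k
      - (κ - 1 - s) / 2 * N₂ 𝔟 s k
      - (1 - s) / 2 * (c0 ^ 2 * N₂ 𝔟 s (lift e (uF s))) := by
  set b := 1 - 2 * s with hb
  have ha : -1 < b := by rw [hb]; linarith
  have ha' : b < 1 := by rw [hb]; linarith
  have hpv := hv.toReg.pc
  have hph := (h_pg hs hs' he).pc
  have hpu := (u_pg hs he).pc
  have hpk := (hph.const_mul C).add (hpu.const_mul c0)
  rw [← hk] at hpk
  have hp := hpv.sub hpk
  have := prob_mu n ha
  have Lv := hpv.memLp ha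
  have Lh := hph.memLp ha
  have Lu := hpu.memLp ha
  have Lk := hpk.memLp ha
  have Ld := hv.toReg.memLp_defect ha ha' κ
  have Iv := Lv.integrable one_le_two
  have Ik := Lk.integrable one_le_two
  have hP := (poincare ha ha' hp).2
  have h0 : ∫ z, (v z - k z) ∂mu b = 0 := by rw [integral_sub Iv Ik, hk1, sub_self]
  have Lz : ∀ i, MemLp (fun z : E n => z.1 i) 2 (mu b) := fun i => (coord_pg i).pc.memLp ha
  have h1 : ∀ i, ∫ z, (v z - k z) * z.1 i ∂mu b = ∫ z, v z * z.1 i ∂mu b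
      - C * (2 * e i * ∫ z, lift e (hF1 s) z ∂mu b) := by
    intro i
    have e1 : ∀ z : E n, (v z - k z) * z.1 i = v z * z.1 i
        - (C * (lift e (hF s) z * z.1 i) + c0 * (lift e (uF s) z * z.1 i)) := fun z => by
      rw [hk]; ring
    have i1 := (integrable_mul2 Lh (Lz i)).const_mul C
    have i2 := (integrable_mul2 Lu (Lz i)).const_mul c0
    have i3 : Integrable (fun z => C * (lift e (hF s) z * z.1 i) + c0 * (lift e (uF s) z * z.1 i)) (mu b) := i1.add i2
    simp only [e1]
    rw [integral_sub (integrable_mul2 Lv (Lz i)) i3, integral_add i1 i2, integral_const_mul,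
      integral_const_mul, h_coord hs hs' he, u_coord hs hs' he]
    ring
  simp only [h0, h1] at hP
  have hD := dirich_sub ha ha' hpv hpk
  have hDv := hv.dir_self ha ha' κ
  have hT0 : ∀ x, 0 ≤ T x * (C * hT s (∑ i, e i * x i)) := fun x =>
    mul_nonneg (hv.Tnn x) (mul_nonneg hC (hT_nonneg hs hs' _))
  have hDk := hv.toReg.green' ha ha' κ hpk (Z := fun x => C * hT s (∑ i, e i * x i)) fun x => by
    have := ((hF_tr hs (∑ i, e i * x i)).const_mul C).add ((uF_tr hs).const_mul c0)
    rw [mul_zero, add_zero] at this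
    rw [hk]; exact this
  have hpos : 0 ≤ cY b * ∫ x, T x * (C * hT s (∑ i, e i * x i)) ∂(gamn n) :=
    mul_nonneg (cY_pos ha).le (integral_nonneg hT0)
  have hDkk : dirich b (fun i z => C * (e i * lift e (hF1 s) z) + c0 * (e i * 0))
      (fun z => C * lift e (hF2 s) z + c0 * lift e (uF2 s) z)
      = C ^ 2 * ((1 + s) / 2 * N₂ b (lift e (hF s)))
      + 2 * (C * c0 * ((1 + s) / 2 * I₂ b (lift e (hF s)) (lift e (uF s))))
      + c0 ^ 2 * (s * N₂ b (lift e (uF s))) := by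
    rw [dirich_add ha ha' (hph.const_mul C) (hpu.const_mul c0), dirich_const_mul, dirich_const_mul,
      dir2_const_mul, dir2_comm, dir2_const_mul, dir2_comm, dir_hh hs hs' he, dir_hu hs hs' he,
      dir_uu hs hs' he]
    ring
  have hkk : N₂ b k = C ^ 2 * N₂ b (lift e (hF s)) + 2 * (C * c0 * I₂ b (lift e (hF s)) (lift e (uF s)))
      + c0 ^ 2 * N₂ b (lift e (uF s)) := by
    rw [hk]
    rw [integral_sq_add (Lh.const_mul C) (Lu.const_mul c0)]
    have e1 : ∀ z, C * lift e (hF s) z * (c0 * lift e (uF s) z)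
      = (C * c0) * (lift e (hF s) z * lift e (uF s) z) := fun z => by ring
    simp only [mul_pow, e1, integral_const_mul]
  have hvk := integral_sq_sub Lv Lk
  have hd1 : ∫ z, defect b κ v z * (v z - k z) ∂mu b = I₂ b (defect b κ v) v - I₂ b (defect b κ v) k := by
    rw [← integral_sub (integrable_mul2 Ld Lv) (integrable_mul2 Ld Lk)]
    simp only [mul_sub]
  rw [hD, hDv, hDk, hDkk] at hP
  rw [hd1]
  rw [hkk] at hvk ⊢
  linear_combination hP + 2 * hpos - κ / 2 * hvk

lemma integral_pos_of_ae_pos {f : E n → ℝ} [IsProbabilityMeasure (mu a : Measure (E n))] (hi : Integrable f (mu a))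
    (h : ∀ᵐ z ∂mu a, 0 < f z) : 0 < ∫ z, f z ∂mu a := by
  have h0 := h.mono fun z hz => hz.le
  refine lt_of_le_of_ne (integral_nonneg_of_ae h0) fun h1 => ?_
  have h2 := (integral_eq_zero_iff_of_nonneg_ae h0 hi).1 h1.symm
  obtain ⟨z, hz, hz'⟩ := (h.and h2).exists
  exact hz.ne' hz'

lemma integral_uF_pos (hs : 0 < s) (hs' : s < 1) (he : ∑ i, e i ^ 2 = 1) :
    0 < ∫ z, lift e (uF s) z ∂mu 𝔟 s := by
  have ha : -1 < 1 - 2 * s := by linarith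
  have := prob_mu n ha
  refine integral_pos_of_ae_pos ((u_pg hs he).pc.memLp ha |>.integrable one_le_two) ?_
  filter_upwards [mu_ae_mem n 𝔟 s] with z hz
  exact rpow_pos_of_pos hz _

lemma integral_hF1_pos (hs : 0 < s) (hs' : s < 1) (he : ∑ i, e i ^ 2 = 1) :
    0 < ∫ z, lift e (hF1 s) z ∂mu 𝔟 s := by
  have ha : -1 < 1 - 2 * s := by linarith
  have := prob_mu n ha
  have hi := SG.integrable ha (by linarith) (lift_sg he (hF_td hs hs').b1)
      (ContinuousOn.aesm_mu (lift_cont (hF_td hs hs').c1))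
  refine integral_pos_of_ae_pos hi ?_
  filter_upwards [mu_ae_mem n 𝔟 s] with z hz
  exact mul_pos (by nlinarith) (rpow_pos_of_pos (mm_pos le_rfl hz) _)

lemma exists_direction (hn : 1 ≤ n) (M : V n) :
    ∃ (e : V n) (r : ℝ), ∑ i, e i ^ 2 = 1 ∧ 0 ≤ r ∧ ∀ i, M i = r * e i := by
  by_cases h : ∑ i, M i ^ 2 = 0
  · refine ⟨Pi.single ⟨0, hn⟩ 1, 0, ?_, le_rfl, fun i => ?_⟩
    · rw [sum_eq_single ⟨0, hn⟩] <;> simp +contextual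
    · have := (Finset.sum_eq_zero_iff_of_nonneg fun i _ => sq_nonneg (M i)).1 h i (mem_univ i)
      rw [zero_mul]; exact pow_eq_zero_iff two_ne_zero |>.1 this
  · have hp := lt_of_le_of_ne (by positivity) (Ne.symm h)
    refine ⟨fun i => M i / √(∑ i, M i ^ 2), √(∑ i, M i ^ 2), ?_, sqrt_nonneg _, fun i => ?_⟩
    · simp only [div_pow, ← sum_div, sq_sqrt hp.le]
      exact div_self h
    · grind

lemma sq_split_bound {v k d : E n → ℝ} (hv : MemLp v 2 (mu a)) (hk : MemLp k 2 (mu a))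
    (hd : MemLp d 2 (mu a)) {α m M : ℝ} (hα : 0 < α) (hm : 0 < m)
    (h : α * (∫ z, (v z - k z) ^ 2 ∂mu a) + m * N₂ a k ≤ M - (∫ z, d z * (v z - k z) ∂mu a) + I₂ a d k) :
    N₂ a v ≤ 2 * (2 / α + 2 / m) * (M + (1 / (2 * α) + 1 / (2 * m)) * N₂ a d) := by
  have y1 := young hd (hv.sub hk) hα
  have y2 := young hd hk hm
  simp only [Pi.sub_apply] at y1
  have y1' := (abs_le.1 y1).1
  have y2' := (abs_le.1 y2).2
  have hA : 0 ≤ ∫ z, (v z - k z) ^ 2 ∂mu a := integral_sq _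
  have hK := integral_sq (m := mu a) k
  have hV : N₂ a v ≤ 2 * (∫ z, (v z - k z) ^ 2 ∂mu a) + 2 * N₂ a k := by
    rw [← integral_const_mul, ← integral_const_mul, ← integral_add
      ((show Integrable (fun z => (v z - k z) ^ 2) (mu a) from (hv.sub hk).integrable_sq).const_mul 2)
      (hk.integrable_sq.const_mul 2)]
    refine integral_mono hv.integrable_sq ?_ fun z => ?_
    · exact ((show Integrable (fun z => (v z - k z) ^ 2) (mu a) from (hv.sub hk).integrable_sq).const_mul 2).add
        (hk.integrable_sq.const_mul 2)
    · simp only []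
      nlinarith [sq_nonneg (v z - 2 * k z)]
  generalize ∫ z, (v z - k z) ^ 2 ∂mu a = A at *
  generalize N₂ a k = K at *
  have hR : α / 2 * A + m / 2 * K ≤ M + (1 / (2 * α) + 1 / (2 * m)) * N₂ a d := by
    linarith
  generalize M + (1 / (2 * α) + 1 / (2 * m)) * N₂ a d = R at *
  have hA' : A ≤ 2 / α * R := by
    rw [div_mul_eq_mul_div, le_div_iff₀ hα]; nlinarith
  have hK' : K ≤ 2 / m * R := by
    rw [div_mul_eq_mul_div, le_div_iff₀ hm]; nlinarith
  calc _ ≤ 2 * A + 2 * K := hV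
    _ ≤ 2 * (2 / α * R) + 2 * (2 / m * R) := by linarith
    _ = _ := by ring

/-- Rigidity for frequencies strictly between `1 + s` and `2`. -/
lemma rigid_above (hn : 1 ≤ n) (hs : 0 < s) (hs' : s < 1) {κ : ℝ} (h1 : 1 + s < κ) (h2 : κ < 2) :
    ∃ K, ∀ (v : E n → ℝ) T, Prof 𝔟 s v T → N₂ 𝔟 s v ≤ K * N₂ 𝔟 s (defect 𝔟 s κ v) := by
  have ha : -1 < 1 - 2 * s := by linarith
  have ha' : 1 - 2 * s < 1 := by linarith
  refine ⟨2 * (2 / (1 - κ / 2) + 2 / ((κ - 1 - s) / 2)) *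
    (1 / (2 * (1 - κ / 2)) + 1 / (2 * ((κ - 1 - s) / 2))), fun v T hv => ?_⟩
  obtain ⟨e, r, he, hr, hM⟩ := exists_direction hn fun i => ∫ z, v z * z.1 i ∂mu 𝔟 s
  have hu := integral_uF_pos hs hs' he
  have hh := integral_hF1_pos hs hs' he
  set P := ∫ z, lift e (hF1 s) z ∂mu 𝔟 s
  set C := r / (2 * P)
  set c0 := ((∫ z, v z ∂mu 𝔟 s) - C * ∫ z, lift e (hF s) z ∂mu 𝔟 s) / ∫ z, lift e (uF s) z ∂mu 𝔟 s
  have := prob_mu n ha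
  have ih := ((h_pg hs hs' he).pc.memLp ha)
  have iu := ((u_pg hs he).pc.memLp ha)
  have hk1 : ∫ z, (C * lift e (hF s) z + c0 * lift e (uF s) z) ∂mu 𝔟 s = ∫ z, v z ∂mu 𝔟 s := by
    rw [integral_add ((ih.integrable one_le_two).const_mul C) ((iu.integrable one_le_two).const_mul c0),
      integral_const_mul, integral_const_mul]
    grind
  have key := profile_ineq hs hs' he hv κ (by positivity) rfl hk1
  have h0 : ∑ i, (∫ z, v z * z.1 i ∂mu 𝔟 s - C * (2 * e i * P)) ^ 2 = 0 := by
    refine Finset.sum_eq_zero fun i _ => ?_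
    rw [hM i]; simp only [C]; field_simp; simp
  rw [h0] at key
  have hU : 0 ≤ N₂ 𝔟 s (lift e (uF s)) := integral_sq _
  have hq : 0 ≤ (1 - s) / 2 * (c0 ^ 2 * N₂ 𝔟 s (lift e (uF s))) := by positivity
  have := sq_split_bound (M := 0) (α := 1 - κ / 2) (m := (κ - 1 - s) / 2) (hv.toReg.pc.memLp ha)
    ((ih.const_mul C).add (iu.const_mul c0)) (hv.toReg.memLp_defect ha ha' κ)
    (by linarith) (by linarith) (by
      simp only [Pi.add_apply]
      linarith)
  grind

/-- Control of the profile by its defect and first moments for frequencies in `(2 * s, 2)`. -/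
lemma rigid_moment (hn : 1 ≤ n) (hs : 0 < s) (hs' : s < 1) {κ : ℝ} (h1 : 2 * s < κ) (h2 : κ < 2) :
    ∃ K, 0 ≤ K ∧ ∀ (v : E n → ℝ) T, Prof 𝔟 s v T → N₂ 𝔟 s v ≤ K * (N₂ 𝔟 s (defect 𝔟 s κ v)
        + ∑ i, (∫ z, v z * z.1 i ∂mu 𝔟 s) ^ 2) := by
  have ha : -1 < 1 - 2 * s := by linarith
  have ha' : 1 - 2 * s < 1 := by linarith
  set A := 2 * (2 / (1 - κ / 2) + 2 / (κ / 2 - s)) with hA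
  set B := 1 / (2 * (1 - κ / 2)) + 1 / (2 * (κ / 2 - s)) with hB
  have p1 : 0 < 1 - κ / 2 := by linarith
  have p2 : 0 < κ / 2 - s := by linarith
  refine ⟨A * (1 / 4 + B), by positivity, fun v T hv => ?_⟩
  obtain ⟨e, r, he, -, -⟩ := exists_direction hn fun i => 0
  have hu := integral_uF_pos hs hs' he
  set c0 := (∫ z, v z ∂mu 𝔟 s) / ∫ z, lift e (uF s) z ∂mu 𝔟 s
  have := prob_mu n ha
  have iu := ((u_pg hs he).pc.memLp ha)
  have hk1 : ∫ z, c0 * lift e (uF s) z ∂mu 𝔟 s = ∫ z, v z ∂mu 𝔟 s := by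
    rw [integral_const_mul]
    grind
  have key := profile_ineq hs hs' he hv κ (c0 := c0) le_rfl (k := fun z => c0 * lift e (uF s) z) (by simp) hk1
  simp only [zero_mul, sub_zero, mul_pow, integral_const_mul (c0 ^ 2)] at key
  have := sq_split_bound (M := 1 / 4 * ∑ i, (∫ z, v z * z.1 i ∂mu 𝔟 s) ^ 2)
    (α := 1 - κ / 2) (m := κ / 2 - s) (hv.toReg.pc.memLp ha)
    (iu.const_mul c0) (hv.toReg.memLp_defect ha ha' κ)
    (by linarith) (by linarith) (by
      simp only [mul_pow, integral_const_mul (c0 ^ 2)]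
      linarith)
  have hA0 : 0 < A := by positivity
  have hB0 : 0 < B := by positivity
  have hm : 0 ≤ ∑ i, (∫ z, v z * z.1 i ∂mu 𝔟 s) ^ 2 := by positivity
  have hd : 0 ≤ N₂ 𝔟 s (defect 𝔟 s κ v) := integral_sq _
  refine this.trans ?_
  rw [mul_assoc A]
  gcongr
  nlinarith

/-- Control of the profile by its defect, first moments and total flux for frequencies in `(0, 2)`. -/
lemma rigid_flux (ha : -1 < a) (ha' : a < 1) {κ : ℝ} (h1 : 0 < κ) (h2 : κ < 2) :
    ∃ K, 0 ≤ K ∧ ∀ (v : E n → ℝ) T, Prof a v T → N₂ a v ≤ K * (N₂ a (defect a κ v) + (∑ i, (∫ z, v z * z.1 i ∂mu a) ^ 2)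
        + (∫ x, T x ∂(gamn n)) ^ 2) := by
  have p1 : 0 < 1 - κ / 2 := by linarith
  set β := 1 - κ / 2 with hβ
  refine ⟨2 / β * (1 / (2 * β) + 8 / κ ^ 2 * (1 + cY a ^ 2) + 1 / 4), by positivity, fun v T hv => ?_⟩
  have := prob_mu n ha
  have hP := (poincare ha ha' hv.toReg.pc).2
  rw [hv.dir_self ha ha' κ] at hP
  have Ld := hv.toReg.memLp_defect ha ha' κ
  have y := (abs_le.1 (young Ld (hv.toReg.pc.memLp ha) p1)).1
  have hg := hv.toReg.green' ha ha' κ (PC.const 1) fun _ => tendsto_const_nhds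
  simp only [dir2, mul_zero, integral_zero, Finset.sum_const_zero, mul_one] at hg
  have hc := cauchy_schwarz Ld (memLp_const 1)
  simp only [mul_one, integral_const, probReal_univ, smul_eq_mul] at hc
  have hm : 0 ≤ ∑ i, (∫ z, v z * z.1 i ∂mu a) ^ 2 := sum_nonneg fun _ _ => sq_nonneg _
  have hW := integral_sq (m := mu a) (defect a κ v)
  generalize ∑ i, (∫ z, v z * z.1 i ∂mu a) ^ 2 = M at *
  generalize N₂ a (defect a κ v) = W at *
  generalize ∫ z, defect a κ v z ∂mu a = w at *
  generalize ∫ z, v z ∂mu a = m at *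
  generalize N₂ a v = V at *
  generalize ∫ x, T x ∂(gamn n) = t at *
  have em : m = 2 / κ * (w - cY a * t) := by
    field_simp; linarith
  have em2 : m ^ 2 ≤ 8 / κ ^ 2 * (W + cY a ^ 2 * t ^ 2) := by
    have : m ^ 2 = 4 / κ ^ 2 * (w - cY a * t) ^ 2 := by rw [em]; ring
    rw [this]
    have e8 : 8 / κ ^ 2 * (W + cY a ^ 2 * t ^ 2) = 4 / κ ^ 2 * (2 * (W + cY a ^ 2 * t ^ 2)) := by ring
    rw [e8]
    gcongr
    nlinarith [sq_nonneg (w + cY a * t)]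
  have hR : β / 2 * V ≤ 1 / (2 * β) * W + 8 / κ ^ 2 * (W + cY a ^ 2 * t ^ 2) + 1 / 4 * M := by grind
  have hV : V = 2 / β * (β / 2 * V) := by field_simp
  rw [hV, mul_assoc (2 / β)]
  refine mulL (hR.trans ?_) (by positivity)
  have q1 : 0 ≤ 1 / (2 * β) := by positivity
  have q2 : 0 ≤ 8 / κ ^ 2 := by positivity
  have q3 : 0 ≤ cY a ^ 2 := sq_nonneg _
  have q4 := sq_nonneg t
  generalize 1 / (2 * β) = x1 at *
  generalize 8 / κ ^ 2 = x2 at *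
  generalize cY a ^ 2 = x3 at *
  generalize t ^ 2 = x4 at *
  have z1 : 0 ≤ x1 * M := by positivity
  have z2 : 0 ≤ x1 * x4 := by positivity
  have z3 : 0 ≤ x2 * x3 * W := by positivity
  have z4 : 0 ≤ x2 * M := by positivity
  have z6 : 0 ≤ x2 * x4 := by positivity
  nlinarith

end profiles

section
/-- Translation in a thin direction. -/
def tr (d : V n) (f : E n → ℝ) (z : E n) : ℝ := f (z + (d, 0))
/-- Derivative in a thin direction. -/
def dd (d : V n) (f : E n → ℝ) (z : E n) : ℝ := fderiv ℝ f z (d, 0)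

variable {f : E n → ℝ} {d : V n}

lemma Dx_tr (i : Fin n) : Dx i (tr d f) = tr d (Dx i f) := by
  funext z; unfold Dx tr; rw [fderiv_comp_add_right]

lemma Dy_tr : Dy (tr d f) = tr d (Dy f) := by
  funext z; unfold Dy tr; rw [fderiv_comp_add_right]

lemma lapa_tr (z : E n) : lapa a (tr d f) z = tr d (lapa a f) z := by
  unfold lapa
  simp only [Dx_tr, Dy_tr]
  simp only [tr, Prod.snd_add, add_zero]

lemma Zv_tr (z : E n) : Zv (tr d f) z = tr d (Zv f) z - tr d (dd d f) z := by
  have h : fderiv ℝ (tr d f) z = fderiv ℝ f (z + (d, 0)) := by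
    unfold tr; rw [fderiv_comp_add_right]
  rw [Zv_eq, h]
  simp only [tr, Zv_eq, dd]
  rw [← map_sub, add_sub_cancel_right]

lemma defect_tr (κ : ℝ) (z : E n) :
    defect a κ (tr d f) z = tr d (defect a κ f) z + 1 / 2 * tr d (dd d f) z := by
  unfold defect
  rw [lapa_tr, Zv_tr]
  simp only [tr]
  ring

lemma dd_eq (z : E n) : dd d f z = ∑ i, d i * Dx i f z := by
  unfold dd; rw [fderiv_eq_sum]; simp

lemma tr_mem {z : E n} (hz : z ∈ Hs n) : z + (d, 0) ∈ Hs n := by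
  simpa [Hs] using hz

lemma nq_le_tr (z : E n) (d : V n) : nq z ≤ 2 * nq (z + (d, 0)) + 2 * nq ((d, 0) : E n) := by
  have h : ∑ i, z.1 i ^ 2 ≤ ∑ i, (2 * (z.1 i + d i) ^ 2 + 2 * d i ^ 2) :=
    sum_le_sum fun i _ => by nlinarith [sq_nonneg (z.1 i + 2 * d i)]
  rw [sum_add_distrib, ← mul_sum, ← mul_sum] at h
  simp only [nq, nsq, Prod.fst_add, Prod.snd_add, Pi.add_apply]
  nlinarith

lemma Reg.tr {T} (hf : Reg a f T) (d : V n) : Reg a (tr d f) fun x => T (x + d) where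
  sm z hz := (hf.sm _ (tr_mem hz)).comp z (contDiffAt_id.add contDiffAt_const)
  cont := hf.cont.comp (by fun_prop) fun z hz => by simpa using hz
  supp := by
    obtain ⟨R, hR⟩ := hf.supp
    refine ⟨2 * R + 2 * nq ((d, 0) : E n), fun z hz => hR _ ?_⟩
    linarith [nq_le_tr z d]
  bx := by
    obtain ⟨C, hC⟩ := hf.bx
    exact ⟨C, fun i z hz => by rw [Dx_tr]; exact hC i _ (tr_mem hz)⟩
  bY := by
    obtain ⟨C, hC⟩ := hf.bY
    refine ⟨C, fun z hz => ?_⟩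
    have := hC _ (tr_mem (d := d) hz)
    rw [Dy_tr]; simpa [FG.tr] using this
  blap := by
    obtain ⟨C, hC⟩ := hf.blap
    exact ⟨C, fun z hz => by rw [lapa_tr]; exact hC _ (tr_mem hz)⟩
  flux x := by
    have := hf.flux (x + d)
    rw [Dy_tr]; simpa [FG.tr] using this

lemma Prof.tr {T} (hf : Prof a f T) (d : V n) : Prof a (FG.tr d f) fun x => T (x + d) where
  toReg := hf.toReg.tr d
  Tnn x := hf.Tnn _
  fnn x := by simpa [FG.tr] using hf.fnn (x + d)
  compl x := by simpa [FG.tr] using hf.compl (x + d)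

lemma Sm.dd (hf : Sm f) (d : V n) : Sm (dd d f) := hf.fderiv_apply _

lemma Sm.hasDerivAt_line (hf : Sm f) {z : E n} (hz : z ∈ Hs n) (d : V n) (τ : ℝ) :
    HasDerivAt (fun τ => f (z + (τ • d, 0))) (FG.dd d f (z + (τ • d, 0))) τ := by
  have h1 : HasDerivAt (fun τ => z + ((τ • d, 0) : E n)) (d, 0) τ := by
    have h0 : HasDerivAt (fun τ => τ • d) d τ := by
      simpa using (hasDerivAt_id τ).smul_const d
    exact (h0.prodMk (hasDerivAt_const _ _)).const_add z
  exact (hf.differentiableAt (tr_mem hz)).hasFDerivAt.comp_hasDerivAt τ h1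

lemma Reg.bdd_dd {T} (hf : Reg a f T) (d : V n) : ∃ C, 0 ≤ C ∧ ∀ z ∈ Hs n, |dd d f z| ≤ C := by
  obtain ⟨C, hC⟩ := hf.bx
  refine ⟨∑ i, |d i| * |C|, by positivity, fun z hz => ?_⟩
  rw [dd_eq]
  refine (abs_sum_le_sum_abs _ _).trans (sum_le_sum fun i _ => ?_)
  rw [abs_mul]
  exact mulL ((hC i z hz).trans (le_abs_self C)) (abs_nonneg _)

/-- Difference quotient in a thin direction. -/
def dq (d : V n) (ε : ℝ) (f : E n → ℝ) (z : E n) : ℝ := ε⁻¹ * (tr (ε • d) f z - f z)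

lemma dq_bdd (hf : Sm f) {C : ℝ} (hC : ∀ z ∈ Hs n, |dd d f z| ≤ C) (hC0 : 0 ≤ C) (ε : ℝ) {z : E n}
    (hz : z ∈ Hs n) : |dq d ε f z| ≤ C := by
  have h := Convex.norm_image_sub_le_of_norm_hasDerivWithin_le
    (f := fun τ => f (z + (τ • d, 0))) (f' := fun τ => dd d f (z + (τ • d, 0))) (x := 0) (y := ε)
    (fun τ _ => (hf.hasDerivAt_line hz d τ).hasDerivWithinAt)
    (fun τ _ => hC _ (tr_mem hz)) convex_univ (Set.mem_univ _) (Set.mem_univ _)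
  simp only [zero_smul, sub_zero, norm_eq_abs] at h
  have h0 : z + ((0, 0) : E n) = z := by simp
  rw [h0] at h
  unfold dq tr
  rw [abs_mul, abs_inv]
  rcases eq_or_ne ε 0 with rfl | hε
  · linarith
  · rw [inv_mul_le_iff₀ (abs_pos.2 hε)]
    linarith

lemma dq_tendsto (hf : Sm f) {z : E n} (hz : z ∈ Hs n) :
    Tendsto (fun ε => dq d ε f z) (𝓝[≠] 0) (𝓝 (dd d f z)) := by
  have h := hf.hasDerivAt_line hz d 0
  rw [hasDerivAt_iff_tendsto_slope] at h
  have h0 : z + (((0:ℝ) • d, 0) : E n) = z := by simp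
  rw [h0] at h
  refine h.congr fun ε => ?_
  simp only [slope, dq, tr, sub_zero, vsub_eq_sub, smul_eq_mul, h0]

lemma tr_tendsto {g : E n → ℝ} (hg : ContinuousOn g (Hs n)) {z : E n} (hz : z ∈ Hs n) :
    Tendsto (fun ε : ℝ => tr (ε • d) g z) (𝓝[≠] 0) (𝓝 (g z)) := by
  have h1 : ContinuousAt g (z + (((0:ℝ) • d, 0) : E n)) := by
    have h0 : z + (((0:ℝ) • d, 0) : E n) = z := by simp
    rw [h0]; exact hg.continuousAt ((isOpen_Hs n).mem_nhds hz)
  have h2 : Continuous fun ε : ℝ => z + ((ε • d, 0) : E n) := by fun_prop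
  have := (ContinuousAt.comp (f := fun ε => z + ((ε • d, 0) : E n)) h1 h2.continuousAt).tendsto
  simp only [Function.comp_def, zero_smul] at this
  have h0 : z + ((0, 0) : E n) = z := by simp
  rw [h0] at this
  exact this.mono_left nhdsWithin_le_nhds

lemma dq_pc {T} (hf : Reg a f T) (d : V n) (ε : ℝ) :
    PC n a (dq d ε f) (fun i z => ε⁻¹ * (Dx i (tr (ε • d) f) z - Dx i f z))
      (fun z => ε⁻¹ * (Dy (tr (ε • d) f) z - Dy f z)) :=
  ((hf.tr (ε • d)).pc.sub hf.pc).const_mul ε⁻¹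

/-- Energy inequality for difference quotients of a Signorini profile. -/
lemma Prof.dq_energy (ha : -1 < a) (ha' : a < 1) {T} (hf : Prof a f T) (κ : ℝ) (d : V n) {ε : ℝ} (hε : 0 < ε) :
    dirich a (fun i z => ε⁻¹ * (Dx i (FG.tr (ε • d) f) z - Dx i f z))
      (fun z => ε⁻¹ * (Dy (FG.tr (ε • d) f) z - Dy f z)) ≤
    κ / 2 * N₂ a (dq d ε f) - ε⁻¹ * (∫ z, (FG.tr (ε • d) (defect a κ f) z - defect a κ f z) * dq d ε f z ∂mu a)
      - 1 / 2 * ∫ z, FG.tr (ε • d) (FG.dd d f) z * dq d ε f z ∂mu a := by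
  have hft := hf.tr (ε • d)
  have hp1 := hf.toReg.pc
  have hp2 := hft.toReg.pc
  have hq := dq_pc hf.toReg d ε
  have htr : ∀ x, Tendsto (fun y => dq d ε f (x, y)) (𝓝[>] 0)
      (𝓝 (ε⁻¹ * (FG.tr (ε • d) f (x, 0) - f (x, 0)))) := fun x =>
    ((hft.toReg.lim_thin x).sub (hf.toReg.lim_thin x)).const_mul _
  have g1 := hf.toReg.green' ha ha' κ hq htr
  have g2 := hft.toReg.green' ha ha' κ hq htr
  rw [dirich_eq, dir2_const_mul, dir2_sub ha ha' hp2 hp1 hq, g1, g2]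
  have Lq := hq.memLp ha
  have L1 := hp1.memLp ha
  have L2 := hp2.memLp ha
  have Ld1 := hf.toReg.memLp_defect ha ha' κ
  have Ld2 := hft.toReg.memLp_defect ha ha' κ
  have Lw : MemLp (FG.tr (ε • d) (FG.dd d f)) 2 (mu a) := by
    obtain ⟨C, hC0, hC⟩ := hf.toReg.bdd_dd d
    refine SG.memLp ha (by linarith) (SG.of_bdd fun z hz => hC _ (tr_mem hz)) ?_
    exact ContinuousOn.aesm_mu ((hf.sm.dd d).contOn.comp (by fun_prop) fun z hz => tr_mem hz)
  have e1 : N₂ a (dq d ε f) = ε⁻¹ * ((∫ z, FG.tr (ε • d) f z * dq d ε f z ∂mu a) - I₂ a f (dq d ε f)) := by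
    rw [← integral_sub (integrable_mul2 L2 Lq) (integrable_mul2 L1 Lq), ← integral_const_mul]
    refine integral_congr_ae (Eventually.of_forall fun z => ?_)
    simp only [dq]; ring
  have hdd : ∀ z, FG.dd (ε • d) f z = ε * FG.dd d f z := fun z => by
    unfold FG.dd
    rw [← smul_eq_mul, ← map_smul]; simp
  have e2 : I₂ a (defect a κ (FG.tr (ε • d) f)) (dq d ε f) = (∫ z, FG.tr (ε • d) (defect a κ f) z * dq d ε f z ∂mu a)
      + ε / 2 * ∫ z, FG.tr (ε • d) (FG.dd d f) z * dq d ε f z ∂mu a := by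
    have i1 := (integrable_mul2 Lw Lq).const_mul (ε / 2)
    have i2 := (integrable_mul2 Ld2 Lq).sub i1
    have e3 : (fun z => FG.tr (ε • d) (defect a κ f) z * dq d ε f z) = fun z =>
        defect a κ (FG.tr (ε • d) f) z * dq d ε f z
        - ε / 2 * (FG.tr (ε • d) (FG.dd d f) z * dq d ε f z) := by
      funext z
      rw [defect_tr]
      simp only [FG.tr, hdd]
      ring
    rw [e3, integral_sub (integrable_mul2 Ld2 Lq) i1, integral_const_mul]
    ring
  have e4 : ∫ z, (FG.tr (ε • d) (defect a κ f) z - defect a κ f z) * dq d ε f z ∂mu a =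
      (∫ z, FG.tr (ε • d) (defect a κ f) z * dq d ε f z ∂mu a)
      - I₂ a (defect a κ f) (dq d ε f) := by
    have i1 : Integrable (fun z => FG.tr (ε • d) (defect a κ f) z * dq d ε f z) (mu a) := by
      have i1 := (integrable_mul2 Lw Lq).const_mul (ε / 2)
      refine ((integrable_mul2 Ld2 Lq).sub i1).congr (Eventually.of_forall fun z => ?_)
      simp only [Pi.sub_apply]
      rw [defect_tr]
      simp only [FG.tr, hdd]
      ring
    rw [← integral_sub i1 (integrable_mul2 Ld1 Lq)]
    simp only [sub_mul]
  have e5 : (cY a * ∫ x, T (x + ε • d) * (ε⁻¹ * (FG.tr (ε • d) f (x, 0) - f (x, 0))) ∂(gamn n)) ≤ 0 := by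
    refine mul_nonpos_of_nonneg_of_nonpos (cY_pos ha).le (integral_nonpos fun x => ?_)
    have h1 := hft.compl x
    have h2 := mul_nonneg (hft.Tnn x) (hf.fnn x)
    have e : T (x + ε • d) * (ε⁻¹ * (FG.tr (ε • d) f (x, 0) - f (x, 0)))
      = ε⁻¹ * (T (x + ε • d) * FG.tr (ε • d) f (x, 0) - T (x + ε • d) * f (x, 0)) := by ring
    simp only [e, h1]
    exact mul_nonpos_of_nonneg_of_nonpos (by positivity) (by simpa using h2)
  have e6 : 0 ≤ (cY a * ∫ x, T x * (ε⁻¹ * (FG.tr (ε • d) f (x, 0) - f (x, 0))) ∂(gamn n)) := by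
    refine mul_nonneg (cY_pos ha).le (integral_nonneg fun x => ?_)
    have h1 := hf.compl x
    have h2 := mul_nonneg (hf.Tnn x) (hft.fnn x)
    have e : T x * (ε⁻¹ * (FG.tr (ε • d) f (x, 0) - f (x, 0)))
      = ε⁻¹ * (T x * FG.tr (ε • d) f (x, 0) - T x * f (x, 0)) := by ring
    simp only [e, h1, sub_zero]
    exact mul_nonneg (by positivity) h2
  rw [e1, e2, e4]
  have hi : ε⁻¹ * (ε / 2) = 1 / 2 := by field_simp
  have hε' := inv_pos.2 hε
  generalize (∫ z, FG.tr (ε • d) (FG.dd d f) z * dq d ε f z ∂mu a) = J at *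
  have := mulL e5 hε'.le
  have := mul_nonneg hε'.le e6
  have hJ : ε⁻¹ * (ε / 2 * J) = 1 / 2 * J := by rw [← mul_assoc, hi]
  rw [← hJ]
  linarith
end

section
variable {d : V n}

/-- The linear function `x ↦ x · d`. -/
def xd (d : V n) (z : E n) : ℝ := ∑ i, d i * z.1 i

lemma continuous_xd (d : V n) : Continuous (xd d) := by unfold xd; fun_prop

lemma sg_xd (d : V n) : SG 0 (xd d) := SG.sum _ fun i _ => SG.const_mul (SG.coord i) _

lemma nq_tr (z : E n) (d : V n) (τ : ℝ) :
    nq (z + (τ • d, 0)) = nq z + 2 * τ * xd d z + τ ^ 2 * ∑ i, d i ^ 2 := by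
  have h : ∑ i, (z.1 i + τ * d i) ^ 2 = (∑ i, z.1 i ^ 2) + 2 * τ * (∑ i, d i * z.1 i) + τ ^ 2 * ∑ i, d i ^ 2 := by
    rw [mul_sum, mul_sum, ← sum_add_distrib, ← sum_add_distrib]
    exact sum_congr rfl fun i _ => by ring
  simp only [nq, nsq, Prod.fst_add, Prod.snd_add, Pi.add_apply, Pi.smul_apply, smul_eq_mul, xd, h]
  ring

lemma xd_tr (z : E n) (τ : ℝ) : xd d (z + (τ • d, 0)) = xd d z + τ * ∑ i, d i ^ 2 := by
  simp only [xd, Prod.fst_add, Pi.add_apply, Pi.smul_apply]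
  rw [mul_sum, ← sum_add_distrib]
  exact sum_congr rfl fun i _ => by ring

lemma xd_abs_le (z : E n) : |xd d z| ≤ (nq z + ∑ i, d i ^ 2) / 2 := by
  have h : ∀ i, |d i * z.1 i| ≤ (z.1 i ^ 2 + d i ^ 2) / 2 := fun i => by
    rw [abs_le]; constructor <;> nlinarith [sq_nonneg (z.1 i + d i), sq_nonneg (z.1 i - d i)]
  have h2 : |xd d z| ≤ ∑ i, (z.1 i ^ 2 + d i ^ 2) / 2 := (abs_sum_le_sum_abs _ _).trans (sum_le_sum fun i _ => h i)
  rw [← sum_div, sum_add_distrib] at h2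
  have : (∑ i, z.1 i ^ 2) ≤ nq z := by unfold nq nsq; nlinarith
  linarith

lemma hasDerivAt_dens_line (z : E n) (τ : ℝ) :
    HasDerivAt (fun τ : ℝ => dens a (z + (τ • d, 0))) (-(xd d (z + (τ • d, 0)) / 2 * dens a (z + (τ • d, 0)))) τ := by
  have h : HasDerivAt (fun τ => -nq (z + (τ • d, 0)) / 4) (-(xd d (z + (τ • d, 0)) / 2)) τ := by
    simp only [nq_tr, xd_tr]
    have := ((((((hasDerivAt_id τ).const_mul 2).mul_const (xd d z)).const_add (nq z)).add
      ((hasDerivAt_pow 2 τ).mul_const (∑ i, d i ^ 2))).neg).div_const 4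
    refine this.congr_deriv ?_
    simp; ring
  have := (h.exp.const_mul (z.2 ^ a)).const_mul (cG ^ n * cY a)
  have e : (fun τ : ℝ => dens a (z + (τ • d, 0))) = fun τ =>
      cG ^ n * cY a * (z.2 ^ a * exp (-nq (z + (τ • d, 0)) / 4)) := by
    funext τ; simp [dens]
  rw [e]
  refine this.congr_deriv ?_
  simp [dens]; ring

lemma setIntegral_tr (f : E n → ℝ) (d : V n) :
    ∫ z in Hs n, f (z + (d, 0)) = ∫ z in Hs n, f z := by
  have : (volume : Measure (E n)).IsAddHaarMeasure := by
    rw [Measure.volume_eq_prod]; infer_instance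
  rw [← integral_indicator (measurableSet_Hs n), ← integral_indicator (measurableSet_Hs n)]
  rw [← integral_add_right_eq_self ((Hs n).indicator f) ((d, 0) : E n)]
  refine integral_congr_ae (Eventually.of_forall fun z => ?_)
  have h : z + (d, 0) ∈ Hs n ↔ z ∈ Hs n := by simp [Hs]
  by_cases hz : z ∈ Hs n
  · exact (indicator_of_mem hz _).trans (indicator_of_mem (h.2 hz) f).symm
  · exact (indicator_of_notMem hz _).trans (indicator_of_notMem (fun h' => hz (h.1 h')) f).symm

lemma integral_mu_tr (ha : -1 < a) (f : E n → ℝ) (d : V n) (g : E n → ℝ) :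
    I₂ a (tr (-d) f) g = ∫ z in Hs n, f z * (g (z + (d, 0)) * dens a (z + (d, 0))) := by
  rw [integral_mu ha, ← setIntegral_tr _ d]
  refine integral_congr_ae (Eventually.of_forall fun z => ?_)
  have : z + (d, 0) + (-d, 0) = z := by ext <;> simp
  simp only [tr, this]; ring

lemma continuousOn_tr {f : E n → ℝ} (hf : ContinuousOn f (Hs n)) (d : V n) :
    ContinuousOn (fun z : E n => f (z + (d, 0))) (Hs n) :=
  hf.comp (by fun_prop) fun z hz => tr_mem hz

/-- Pairing a translation increment with a differentiable function. -/
lemma transl_pair (ha : -1 < a) {e ψ ψ' : E n → ℝ} (hec : ContinuousOn e (Hs n)) (hes : SG 0 e)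
    {R : ℝ} (hR : ∀ z ∈ Hs n, R ≤ nq z → e z = 0) (hc : ContinuousOn ψ (Hs n)) (hs : SG 0 ψ)
    (hc' : ContinuousOn ψ' (Hs n)) (hs' : SG 0 ψ')
    (hd : ∀ z ∈ Hs n, ∀ τ : ℝ, HasDerivAt (fun τ : ℝ => ψ (z + (τ • d, 0))) (ψ' (z + (τ • d, 0))) τ)
    {ε : ℝ} (hε : 0 ≤ ε)
    (hεR : ∀ z ∈ Hs n, nq z ≤ R → ∀ τ ∈ Icc (-ε) 0, dens a (z + (τ • d, 0)) ≤ 2 * dens a z) :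
    (∫ z, (tr (ε • d) e z - e z) * ψ z ∂mu a) ^ 2 ≤
      ε ^ 2 * (2 * N₂ a e * ∫ z, (ψ' z - 1 / 2 * xd d z * ψ z) ^ 2 ∂mu a) := by
  have hprob := prob_mu n ha
  set g : E n → ℝ := fun z => ψ' z - 1 / 2 * xd d z * ψ z with hg
  have hgs : SG 0 g := SG.sub hs' (SG.mul0 (SG.const_mul (sg_xd d) _) hs)
  have hgc := hc'.sub ((((continuous_xd d).const_mul (1 / 2)).continuousOn).mul hc)
  obtain ⟨Ce, hCe0, hCe⟩ := GR.bound (SG.to_GR hes) (θ := 1 / 4) (by norm_num)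
  obtain ⟨B, hB0, hB⟩ : ∃ B, 0 ≤ B ∧ ∀ z ∈ Hs n, |e z| ≤ B * exp (-nq z / 4) := by
    refine ⟨Ce * exp (R / 2), by positivity, fun z hz => ?_⟩
    by_cases h : R ≤ nq z
    · rw [hR z hz h, abs_zero]; positivity
    · refine (hCe z hz).trans ?_
      rw [mul_assoc, ← exp_add]
      have : 1 / 4 * nq z ≤ R / 2 + -nq z / 4 := by linarith
      gcongr
  have bd : ∀ f : E n → ℝ, SG 0 f → ∃ C, 0 ≤ C ∧ ∀ z ∈ Hs n, ∀ τ : ℝ,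
      |e z * (f (z + (τ • d, 0)) * dens a (z + (τ • d, 0)))| ≤ C * dens a z := by
    intro f hf
    obtain ⟨C, hC0, hC⟩ := GR.bound (SG.to_GR hf) (θ := 1 / 4) (by norm_num)
    refine ⟨B * C, by positivity, fun z hz τ => ?_⟩
    have h1 := hB z hz
    have h2 := hC _ (tr_mem (d := τ • d) hz)
    have h3 : 0 < z.2 ^ a := rpow_pos_of_pos hz _
    have h4 := cY_pos ha
    have h5 := cG_pos
    have h6 : |dens a (z + (τ • d, 0))| = cG ^ n * cY a * (z.2 ^ a * exp (-nq (z + (τ • d, 0)) / 4)) := by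
      rw [abs_of_pos (dens_pos ha (tr_mem hz))]; simp [dens]
    rw [abs_mul, abs_mul, h6]
    have h7 : exp (1 / 4 * nq (z + (τ • d, 0))) * exp (-nq (z + (τ • d, 0)) / 4) = 1 := by
      rw [← exp_add]; ring_nf; exact exp_zero
    calc |e z| * (|f (z + (τ • d, 0))| * (cG ^ n * cY a * (z.2 ^ a * exp (-nq (z + (τ • d, 0)) / 4))))
        ≤ (B * exp (-nq z / 4)) * ((C * exp (1 / 4 * nq (z + (τ • d, 0)))) *
          (cG ^ n * cY a * (z.2 ^ a * exp (-nq (z + (τ • d, 0)) / 4)))) := by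
          gcongr
      _ = B * C * (cG ^ n * cY a * (z.2 ^ a * exp (-nq z / 4))) *
          (exp (1 / 4 * nq (z + (τ • d, 0))) * exp (-nq (z + (τ • d, 0)) / 4)) := by ring
      _ = B * C * dens a z := by rw [h7, mul_one]; rfl
  obtain ⟨C1, hC10, hC1⟩ := bd ψ hs
  obtain ⟨C2, hC20, hC2⟩ := bd g hgs
  have hdint : IntegrableOn (fun z => dens a z) (Hs n) := by
    have := (integrable_mu (n := n) ha).1 (integrable_const 1)
    simpa using this
  have hdm : ∀ τ : ℝ, Measurable fun z => dens a (z + (τ • d, 0)) := fun τ =>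
    (measurable_dens a).comp (by fun_prop)
  have hm : ∀ f : E n → ℝ, ContinuousOn f (Hs n) → ∀ τ : ℝ, AEStronglyMeasurable
      (fun z => e z * (f (z + (τ • d, 0)) * dens a (z + (τ • d, 0)))) (volume.restrict (Hs n)) := by
    intro f hf τ
    refine (hec.aestronglyMeasurable (measurableSet_Hs n)).mul
      (AEStronglyMeasurable.mul ?_ (hdm τ).aestronglyMeasurable)
    exact (continuousOn_tr hf (τ • d)).aestronglyMeasurable (measurableSet_Hs n)
  set F : ℝ → ℝ := fun τ => ∫ z in Hs n, e z * (ψ (z + (τ • d, 0)) * dens a (z + (τ • d, 0))) with hF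
  set F' : ℝ → ℝ := fun τ => ∫ z in Hs n, e z * (g (z + (τ • d, 0)) * dens a (z + (τ • d, 0))) with hF'
  have hder : ∀ τ, HasDerivAt F (F' τ) τ := by
    intro τ
    refine (hasDerivAt_integral_of_dominated_loc_of_deriv_le
      (F' := fun τ z => e z * (g (z + (τ • d, 0)) * dens a (z + (τ • d, 0))))
      univ_mem
      (Eventually.of_forall fun τ => hm ψ hc τ) ?_ (hm g hgc τ) ?_ (hdint.const_mul C2) ?_).2
    · refine (hdint.const_mul C1).mono' (hm ψ hc τ) ?_
      filter_upwards [ae_restrict_mem (measurableSet_Hs n)] with z hz using hC1 z hz τ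
    · filter_upwards [ae_restrict_mem (measurableSet_Hs n)] with z hz τ _ using hC2 z hz τ
    · filter_upwards [ae_restrict_mem (measurableSet_Hs n)] with z hz τ _
      refine (((hd z hz τ).mul (hasDerivAt_dens_line z τ)).const_mul (e z)).congr_deriv ?_
      simp only [hg]; ring
  set A := N₂ a e with hA
  set G := N₂ a g with hG
  have hA0 : 0 ≤ A := integral_sq _
  have hG0 : 0 ≤ G := integral_sq _
  have Lg := SG.memLp ha (by linarith) hgs hgc.aesm_mu
  have Le := SG.memLp ha (by linarith) hes hec.aesm_mu
  have hF'b : ∀ τ ∈ Icc (-ε) 0, |F' τ| ≤ sqrt (2 * A * G) := by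
    intro τ hτ
    refine abs_le_sqrt ?_
    have e1 : F' τ = I₂ a (tr (-(τ • d)) e) g := (integral_mu_tr ha e (τ • d) g).symm
    have Lt : MemLp (tr (-(τ • d)) e) 2 (mu a) := by
      refine SG.memLp ha (by linarith) (SG.of_bdd (C := B) fun z hz => ?_) (continuousOn_tr hec _).aesm_mu
      refine (hB _ (tr_mem hz)).trans ?_
      have : exp (-nq (z + (-(τ • d), 0)) / 4) ≤ 1 := by
        rw [exp_le_one_iff]; linarith [nq_nonneg (z + (-(τ • d), 0))]
      nlinarith
    rw [e1]
    refine (cauchy_schwarz Lt Lg).trans (mulR ?_ hG0)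
    have e2 : N₂ a (tr (-(τ • d)) e) = ∫ z, tr (-(τ • d)) (fun z => e z ^ 2) z * 1 ∂mu a := by
      simp only [tr, mul_one]
    rw [e2, integral_mu_tr ha, hA, integral_mu ha, ← integral_const_mul]
    have i1 := ((integrable_mu ha).1 Le.integrable_sq).const_mul 2
    refine integral_mono_of_nonneg ?_ i1 ?_
    · filter_upwards [ae_restrict_mem (measurableSet_Hs n)] with z hz
      have := (dens_pos ha (tr_mem (d := τ • d) hz)).le
      simp only [Pi.zero_apply]; positivity
    · filter_upwards [ae_restrict_mem (measurableSet_Hs n)] with z hz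
      by_cases h : nq z ≤ R
      · have := hεR z hz h τ hτ
        nlinarith [sq_nonneg (e z)]
      · simp [hR z hz (le_of_not_ge h)]
  have hmv := Convex.norm_image_sub_le_of_norm_hasDerivWithin_le (s := Icc (-ε) 0)
    (fun τ _ => (hder τ).hasDerivWithinAt) hF'b (convex_Icc _ _)
    (right_mem_Icc.2 (by linarith)) (left_mem_Icc.2 (by linarith))
  have e3 : ∫ z, (tr (ε • d) e z - e z) * ψ z ∂mu a = F (-ε) - F 0 := by
    have e4 : F (-ε) = I₂ a (tr (ε • d) e) ψ := by
      simp only [hF]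
      rw [← integral_mu_tr ha e ((-ε) • d) ψ]
      simp
    have e5 : F 0 = I₂ a e ψ := by
      simp only [hF]
      rw [← integral_mu_tr ha e (0 • d) ψ]
      have h0 : ∀ z : E n, z + (-((0:ℝ) • d), 0) = z := fun z => by simp
      simp only [tr, h0]
    have Lt : MemLp (tr (ε • d) e) 2 (mu a) := by
      refine SG.memLp ha (by linarith) (SG.of_bdd (C := B) fun z hz => ?_) (continuousOn_tr hec _).aesm_mu
      refine (hB _ (tr_mem hz)).trans ?_
      have : exp (-nq (z + ((ε • d), 0)) / 4) ≤ 1 := by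
        rw [exp_le_one_iff]; linarith [nq_nonneg (z + ((ε • d), 0))]
      nlinarith
    have Lp := SG.memLp ha (by linarith) hs hc.aesm_mu
    rw [e4, e5, ← integral_sub (integrable_mul2 Lt Lp) (integrable_mul2 Le Lp)]
    simp only [sub_mul]
  rw [e3]
  simp only [norm_eq_abs, sub_zero, abs_neg, abs_of_nonneg hε] at hmv
  rw [← sq_abs]
  calc |F (-ε) - F 0| ^ 2 ≤ (sqrt (2 * A * G) * ε) ^ 2 := by gcongr
    _ = _ := by rw [mul_pow, sq_sqrt (by positivity)]; ring
end

section
variable {d : V n}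

lemma PC.integral_coord_sq (ha : -1 < a) {ψ : E n → ℝ} {ψx ψy} (h : PC n a ψ ψx ψy) (i : Fin n) :
    ∫ z, (z.1 i * ψ z) ^ 2 ∂mu a ≤ 4 * N₂ a ψ + 16 * N₂ a (ψx i) := by
  have hx : HasDx i (fun z => z.1 i) fun _ => 1 := fun z _ => by
    simp only [Function.update_self]; exact hasDerivAt_id' (z.1 i)
  have hcc : ContinuousOn (fun z => z.1 i) (Hs n) := by fun_prop
  have hd := (hx.mul (h.dx i)).mul (h.dx i)
  have hi : ∀ {f : E n → ℝ}, SG 0 f → ContinuousOn f (Hs n) → Integrable f (mu a) := fun hs hc =>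
    SG.integrable ha (by linarith) hs hc.aesm_mu
  have s1 : SG 0 fun z => z.1 i * ψ z := SG.mul0 (SG.coord i) h.sg
  have c1 : ContinuousOn (fun z => z.1 i * ψ z) (Hs n) := hcc.mul h.cont
  have s2 : SG 0 fun z => 1 * ψ z + z.1 i * ψx i z := SG.add (SG.const_mul h.sg _) (SG.mul0 (SG.coord i) (h.sgx i))
  have c2 : ContinuousOn (fun z => 1 * ψ z + z.1 i * ψx i z) (Hs n) := (h.cont.const_mul 1).add (hcc.mul (h.contx i))
  have key := ibp_x ha hd (hi (SG.mul0 s1 h.sg) (c1.mul h.cont))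
    (hi (SG.add (SG.mul0 s2 h.sg) (SG.mul0 s1 (h.sgx i))) ((c2.mul h.cont).add (c1.mul (h.contx i))))
    (hi (SG.mul0 (SG.coord i) (SG.mul0 s1 h.sg)) (hcc.mul (c1.mul h.cont)))
  have L1 : MemLp (fun z => z.1 i * ψ z) 2 (mu a) := SG.memLp ha (by linarith) s1 c1.aesm_mu
  have L2 := h.memLpx ha i
  have L0 := h.memLp ha
  have e1 : ∫ z, z.1 i * (z.1 i * ψ z * ψ z) ∂mu a = ∫ z, (z.1 i * ψ z) ^ 2 ∂mu a := by ring
  have i1 := L0.integrable_sq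
  have i2 := (integrable_mul2 L1 L2).const_mul 2
  have e2 : ∫ z, ((1 * ψ z + z.1 i * ψx i z) * ψ z + z.1 i * ψ z * ψx i z) ∂mu a
      = N₂ a ψ + 2 * ∫ z, z.1 i * ψ z * ψx i z ∂mu a := by
    rw [← integral_const_mul, ← integral_add i1 i2]
    exact integral_congr_ae (Eventually.of_forall fun z => by simp only; ring)
  have hy := (abs_le.1 (young L1 L2 (c := 4) (by norm_num))).2
  grind

/-- Energy inequality for difference quotients with the right-hand side integrated by parts. -/
lemma Prof.dq_energy_le (ha : -1 < a) (ha' : a < 1) {f : E n → ℝ} {T} (hf : Prof a f T) (κ : ℝ)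
    (hd : ∑ i, d i ^ 2 ≤ 1) {θ : ℝ} (hθ : 0 < θ) : ∃ ε₀ > 0, ∀ ε, 0 < ε → ε < ε₀ →
    (1 - θ) * dirich a (fun i z => ε⁻¹ * (Dx i (FG.tr (ε • d) f) z - Dx i f z))
      (fun z => ε⁻¹ * (Dy (FG.tr (ε • d) f) z - Dy f z)) ≤
    (κ / 2 + θ) * N₂ a (dq d ε f) - 1 / 2 * (∫ z, FG.tr (ε • d) (FG.dd d f) z * dq d ε f z ∂mu a)
      + (10 + 2 * n) / (2 * θ) * N₂ a (defect a κ f) := by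
  obtain ⟨R, hR0, hR⟩ := hf.toReg.supp_ev
  refine ⟨1 / (R + 2), by positivity, fun ε hε hε0 => ?_⟩
  rw [lt_div_iff₀ (by positivity)] at hε0
  have hq := dq_pc hf.toReg d ε
  have en := hf.dq_energy ha ha' κ d hε
  set ψx : Fin n → E n → ℝ := fun i z => ε⁻¹ * (Dx i (FG.tr (ε • d) f) z - Dx i f z) with hψx
  set ψy : E n → ℝ := fun z => ε⁻¹ * (Dy (FG.tr (ε • d) f) z - Dy f z) with hψy
  set ψ' : E n → ℝ := fun z => ∑ i, d i * ψx i z with hψ'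
  have hER : ∀ z ∈ Hs n, R ≤ nq z → defect a κ f z = 0 := by
    intro z hz h
    have hfz := hR z h
    have hDx : ∀ i, Dx i f =ᶠ[𝓝 z] 0 := fun i => by
      filter_upwards [hfz.fderiv (𝕜 := ℝ)] with w hw
      simp [Dx, hw]
    have hDy : Dy f =ᶠ[𝓝 z] 0 := by
      filter_upwards [hfz.fderiv (𝕜 := ℝ)] with w hw
      simp [Dy, hw]
    have e1 : ∀ i, Dx i (Dx i f) z = 0 := fun i => by
      have := (hDx i).fderiv_eq (𝕜 := ℝ)
      unfold Dx at this ⊢; rw [this]; simp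
    have e2 : Dy (Dy f) z = 0 := by
      have := hDy.fderiv_eq (𝕜 := ℝ)
      unfold Dy at this ⊢; rw [this]; simp
    have e3 : ∀ i, Dx i f z = 0 := fun i => by simpa using (hDx i).eq_of_nhds
    have e4 : Dy f z = 0 := by simpa using hDy.eq_of_nhds
    have e5 : f z = 0 := by simpa using hfz.eq_of_nhds
    simp [defect, lapa, Zv, e1, e2, e3, e4, e5]
  have hEc : ContinuousOn (defect a κ f) (Hs n) := (hf.toReg.pg ha').contg.add (hf.toReg.sm.contOn.const_mul _)
  have hc' : ContinuousOn ψ' (Hs n) := continuousOn_finsetSum _ fun i _ => (hq.contx i).const_mul _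
  have hs' : SG 0 ψ' := SG.sum _ fun i _ => SG.const_mul (hq.sgx i) _
  have hder : ∀ z ∈ Hs n, ∀ τ : ℝ, HasDerivAt (fun τ => dq d ε f (z + (τ • d, 0))) (ψ' (z + (τ • d, 0))) τ := by
    intro z hz τ
    have h1 := (hf.toReg.tr (ε • d)).sm.hasDerivAt_line hz d τ
    have h2 := hf.toReg.sm.hasDerivAt_line hz d τ
    refine ((h1.sub h2).const_mul ε⁻¹).congr_deriv ?_
    rw [dd_eq, dd_eq, ← sum_sub_distrib, mul_sum]
    exact sum_congr rfl fun i _ => by simp only [hψx]; ring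
  have hratio : ∀ z ∈ Hs n, nq z ≤ R → ∀ τ ∈ Icc (-ε) 0, dens a (z + (τ • d, 0)) ≤ 2 * dens a z := by
    intro z hz hzR τ hτ
    have hx := xd_abs_le (d := d) z
    have h0 : -nq (z + (τ • d, 0)) / 4 ≤ 1 / 2 + -nq z / 4 := by
      rw [nq_tr]
      have h1 : |τ * xd d z| ≤ ε * ((R + 1) / 2) := by
        rw [abs_mul]
        have := abs_le.2 ⟨hτ.1, hτ.2.trans hε.le⟩
        have : |xd d z| ≤ (R + 1) / 2 := by linarith
        gcongr
      have h2 := (abs_le.1 h1).1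
      have h3 : 0 ≤ τ ^ 2 * ∑ i, d i ^ 2 := by positivity
      nlinarith
    have h2 : exp (1 / 2) ≤ 2 := by
      have := exp_one_lt_d9
      have h3 : exp (1 / 2) ^ 2 = exp 1 := by rw [← exp_nat_mul]; norm_num
      nlinarith [exp_pos (1 / 2)]
    have h3 : 0 < z.2 ^ a := rpow_pos_of_pos hz _
    have h4 := cY_pos ha
    have h5 := cG_pos
    have h6 : dens a (z + (τ • d, 0)) = cG ^ n * cY a * (z.2 ^ a * exp (-nq (z + (τ • d, 0)) / 4)) := by
      simp [dens]
    rw [h6]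
    calc cG ^ n * cY a * (z.2 ^ a * exp (-nq (z + (τ • d, 0)) / 4))
        ≤ cG ^ n * cY a * (z.2 ^ a * (2 * exp (-nq z / 4))) := by
          gcongr
          refine (exp_le_exp.2 h0).trans ?_
          rw [exp_add]; gcongr
      _ = 2 * dens a z := by unfold dens; ring
  have tp := transl_pair ha hEc (hf.toReg.sg_defect ha' κ) hER hq.cont hq.sg hc' hs' hder hε.le hratio
  have L0 := hq.memLp ha
  have Lx := fun i => hq.memLpx ha i
  set P := N₂ a (dq d ε f) with hP
  set D := dirich a ψx ψy with hD
  set A := N₂ a (defect a κ f) with hA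
  set S := ∫ z, (FG.tr (ε • d) (defect a κ f) z - defect a κ f z) * dq d ε f z ∂mu a with hS
  have hP0 : 0 ≤ P := integral_sq _
  have hA0 : 0 ≤ A := integral_sq _
  have hDy0 : 0 ≤ N₂ a ψy := integral_sq _
  have hDD : D = (∑ i, N₂ a (ψx i)) + N₂ a ψy := rfl
  have hG : ∫ z, (ψ' z - 1 / 2 * xd d z * dq d ε f z) ^ 2 ∂mu a ≤ (10 + 2 * n) * (D + P) := by
    have hLz : ∀ i, MemLp (fun z => z.1 i * dq d ε f z) 2 (mu a) := fun i =>
      SG.memLp ha (by linarith) (SG.mul0 (SG.coord i) hq.sg)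
        (ContinuousOn.aesm_mu ((by fun_prop : Continuous fun z => z.1 i).continuousOn.mul hq.cont))
    have hia : ∀ i ∈ Finset.univ,
        Integrable (fun z => 2 * ψx i z ^ 2 + 1 / 2 * (z.1 i * dq d ε f z) ^ 2) (mu a) := fun i _ =>
      ((Lx i).integrable_sq.const_mul 2).add ((hLz i).integrable_sq.const_mul (1 / 2))
    have ii := integrable_finsetSum _ hia
    have Lg := SG.memLp ha (by linarith) (SG.sub hs' (SG.mul0 (SG.const_mul (sg_xd d) _) hq.sg))
        (ContinuousOn.aesm_mu (hc'.sub ((((continuous_xd d).const_mul (1 / 2)).continuousOn).mul hq.cont)))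
    have hm := integral_mono_mu Lg.integrable_sq ii fun z hz => by
      have e1 : ψ' z - 1 / 2 * xd d z * dq d ε f z = ∑ i, d i * (ψx i z - 1 / 2 * (z.1 i * dq d ε f z)) := by
        simp only [ xd]
        rw [mul_sum, sum_mul, ← sum_sub_distrib]
        exact sum_congr rfl fun i _ => by ring
      rw [e1]
      refine (Finset.sum_mul_sq_le_sq_mul_sq _ _ _).trans ?_
      have h0 : 0 ≤ ∑ i, (ψx i z - 1 / 2 * (z.1 i * dq d ε f z)) ^ 2 := sum_nonneg fun i _ => sq_nonneg _
      refine (mul_le_of_le_one_left h0 hd).trans (sum_le_sum fun i _ => ?_)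
      nlinarith [sq_nonneg (ψx i z + 1 / 2 * (z.1 i * dq d ε f z))]
    refine hm.trans ?_
    rw [integral_finsetSum _ hia]
    have hb : ∀ i ∈ Finset.univ, ∫ z, (2 * ψx i z ^ 2 + 1 / 2 * (z.1 i * dq d ε f z) ^ 2) ∂mu a ≤
        10 * N₂ a (ψx i) + 2 * P := fun i _ => by
      rw [integral_add ((Lx i).integrable_sq.const_mul 2) ((hLz i).integrable_sq.const_mul (1 / 2)),
        integral_const_mul, integral_const_mul]
      have := hq.integral_coord_sq ha i
      linarith
    refine (sum_le_sum hb).trans ?_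
    rw [sum_add_distrib, ← mul_sum]
    simp only [Finset.sum_const, card_univ, Fintype.card_fin]
    have hX : (∑ i, N₂ a (ψx i)) ≤ D := by rw [hDD]; linarith
    have hX0 : 0 ≤ ∑ i, N₂ a (ψx i) := sum_nonneg fun i _ => integral_sq _
    have : 0 ≤ (n : ℝ) * D := mul_nonneg (Nat.cast_nonneg n) (hX0.trans hX)
    linear_combination 10 * hX + 2 * this + 10 * hP0
  have hDP : 0 ≤ D + P := by
    have : 0 ≤ ∑ i, N₂ a (ψx i) := sum_nonneg fun i _ => integral_sq _
    rw [hDD]; linarith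
  set m : ℝ := 10 + 2 * n with hm
  have hm0 : 0 < m := by positivity
  have hSb : |ε⁻¹ * S| ≤ θ * (D + P) + m / (2 * θ) * A := by
    refine abs_le_of_sq_le_sq ?_ (by positivity)
    have h1 : (ε⁻¹ * S) ^ 2 ≤ 2 * A * (m * (D + P)) := by
      rw [mul_pow, inv_pow, inv_mul_le_iff₀ (by positivity)]
      refine tp.trans ?_
      gcongr
    have h2 : 2 * A * (m * (D + P)) = 4 * (θ * (D + P)) * (m / (2 * θ) * A) := by field_simp; ring
    rw [h2] at h1
    nlinarith [sq_nonneg (θ * (D + P) - m / (2 * θ) * A)]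
  have := (abs_le.1 hSb).1
  linarith
end

section
variable {d : V n}

/-- Weight concentrating at the thin space. -/
def kk (a τ y : ℝ) : ℝ := y ^ (-a) * exp (-(y / τ))

/-- The weight `kk` multiplied by its logarithmic rate of decay. -/
def mt (a τ y : ℝ) : ℝ := (1 / τ + y / 2) * kk a τ y

section weights
variable {τ : ℝ} (hτ : 0 < τ)
include hτ

lemma kk_sg : SG a fun z : E n => kk a τ z.2 := by
  refine GR.of_bdd nq_nonneg_on (C := 1) fun z hz => ?_
  have hz := hz
  have : z.2 ^ (-a) * z.2 ^ a = 1 := by rw [← rpow_add hz]; simp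
  have e : kk a τ z.2 * z.2 ^ a = exp (-(z.2 / τ)) := by
    unfold kk; linear_combination exp (-(z.2 / τ)) * this
  rw [e, abs_of_pos (exp_pos _), exp_le_one_iff]
  have := div_pos hz hτ
  linarith

omit hτ in
lemma kk_cont : ContinuousOn (fun z : E n => kk a τ z.2) (Hs n) := by
  refine ContinuousOn.mul (fun z hz => ?_) (by fun_prop)
  exact ((continuous_snd.continuousAt).rpow_const (Or.inl (ne_of_gt hz))).continuousWithinAt

lemma mt_sg : SG a fun z : E n => mt a τ z.2 := by
  have : SG 0 fun z : E n => 1 / τ + z.2 / 2 :=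
    SG.add (SG.const _) ((SG.const_mul SG.snd (1 / 2)).congr fun z _ => by ring)
  have h := this.mul (kk_sg (a := a) hτ)
  rw [zero_add] at h
  exact h

omit hτ in
lemma mt_cont : ContinuousOn (fun z : E n => mt a τ z.2) (Hs n) := ContinuousOn.mul (by fun_prop) (kk_cont)

/-- One-dimensional trace formula. -/
lemma trace_line {f f' : ℝ → ℝ} {Z C : ℝ} (hd : ∀ y > 0, HasDerivAt f (f' y) y)
    (hZ : Tendsto f (𝓝[>] 0) (𝓝 Z)) (hb : ∀ y > 0, |f y| ≤ C * exp (1 / 8 * y ^ 2))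
    (hi : IntegrableOn (fun y => (f y * mt a τ y - f' y * kk a τ y) * wY a y) (Ioi 0)) :
    ∫ y in Ioi 0, (f y * mt a τ y - f' y * kk a τ y) * wY a y = Z := by
  set G : ℝ → ℝ := fun y => f y * (exp (-(y / τ)) * gE y) with hG
  have hGd : ∀ y ∈ Ioi 0, HasDerivAt G (-((f y * mt a τ y - f' y * kk a τ y) * wY a y)) y := by
    intro y hy
    have hy := hy
    have he : HasDerivAt (fun y => exp (-(y / τ))) (exp (-(y / τ)) * -(1 / τ)) y :=
      ((hasDerivAt_id y).div_const τ).neg.exp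
    refine ((hd y hy).mul (he.mul (hasDerivAt_gE y))).congr_deriv ?_
    have h1 : kk a τ y * wY a y = exp (-(y / τ)) * gE y := by
      unfold kk wY gE
      have : y ^ (-a) * y ^ a = 1 := by rw [← rpow_add hy]; simp
      linear_combination exp (-(y / τ)) * exp (-y ^ 2 / 4) * this
    have h2 : (f y * mt a τ y - f' y * kk a τ y) * wY a y
        = (f y * (1 / τ + y / 2) - f' y) * (kk a τ y * wY a y) := by unfold mt; ring
    rw [h2, h1]
    simp only [Pi.mul_apply]
    ring
  have h0 : Tendsto G (𝓝[>] 0) (𝓝 Z) := by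
    have : Tendsto (fun y => exp (-(y / τ)) * gE y) (𝓝[>] 0) (𝓝 (exp (-(0 / τ)) * gE 0)) := by
      refine Tendsto.mono_left (Continuous.tendsto ?_ 0) nhdsWithin_le_nhds
      exact (by fun_prop : Continuous fun y => exp (-(y / τ))).mul continuous_gE
    have e : exp (-(0 / τ)) * gE 0 = 1 := by simp [gE]
    rw [e] at this
    have h := hZ.mul this
    rw [mul_one] at h
    exact h
  have hinf : Tendsto G atTop (𝓝 0) := by
    have hC : Tendsto (fun y => |C| * exp (-(y / τ))) atTop (𝓝 0) := by
      have : Tendsto (fun y => exp (-(y / τ))) atTop (𝓝 0) :=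
        tendsto_exp_neg_atTop_nhds_zero.comp (tendsto_id.atTop_div_const hτ)
      simpa using this.const_mul |C|
    refine squeeze_zero_norm' ?_ hC
    filter_upwards [eventually_gt_atTop 0] with y hy
    have h1 : exp (1 / 8 * y ^ 2) * gE y ≤ 1 := by
      unfold gE; rw [← exp_add, exp_le_one_iff]; nlinarith [sq_nonneg y]
    have h2 : |f y| ≤ |C| * exp (1 / 8 * y ^ 2) := (hb y hy).trans (by gcongr; exact le_abs_self C)
    have hp : 0 < exp (-(y / τ)) * gE y := mul_pos (exp_pos _) (gE_pos y)
    rw [norm_eq_abs, hG, abs_mul, abs_of_pos hp]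
    calc |f y| * (exp (-(y / τ)) * gE y) ≤ |C| * exp (1 / 8 * y ^ 2) * (exp (-(y / τ)) * gE y) := by gcongr
      _ = |C| * exp (-(y / τ)) * (exp (1 / 8 * y ^ 2) * gE y) := by ring
      _ ≤ |C| * exp (-(y / τ)) * 1 := by gcongr
      _ = _ := mul_one _
  have key := integral_Ioi_of_hasDerivAt_of_tendsto (m := 0) (f := Function.update G 0 Z)
    (f' := fun y => -((f y * mt a τ y - f' y * kk a τ y) * wY a y)) ?_ ?_ hi.neg ?_
  · rw [integral_neg, Function.update_self] at key
    linarith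
  · rw [continuousWithinAt_update_same, Set.Ici_sdiff_left]
    exact h0
  · intro y hy
    refine (hGd y hy).congr_of_eventuallyEq ?_
    filter_upwards [Ioi_mem_nhds hy] with w hw
    exact Function.update_of_ne (ne_of_gt hw) _ _
  · refine hinf.congr' ?_
    filter_upwards [eventually_gt_atTop 0] with w hw
    exact (Function.update_of_ne (ne_of_gt hw) _ _).symm

/-- Thin trace formula: a boundary integral as a solid integral. -/
lemma PC.trace (ha : -1 < a) (ha' : a < 1) {f : E n → ℝ} {fx fy} (hf : PC n a f fx fy)
    {Z φ : V n → ℝ} (hZ : ∀ x, Tendsto (fun y => f (x, y)) (𝓝[>] 0) (𝓝 (Z x)))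
    (hφ : Continuous φ) {B : ℝ} (hB : ∀ x, |φ x| ≤ B) :
    cY a * ∫ x, φ x * Z x ∂(gamn n) = (∫ z, φ z.1 * f z * mt a τ z.2 ∂mu a) - ∫ z, φ z.1 * kk a τ z.2 * fy z ∂mu a := by
  have sφ : SG 0 fun z => φ z.1 := SG.of_bdd fun z _ => hB z.1
  have cφ : ContinuousOn (fun z => φ z.1) (Hs n) := by fun_prop
  have s1 : SG a fun z => f z * mt a τ z.2 := by simpa using hf.sg.mul (mt_sg hτ)
  have s2 : SG (a + a) fun z => fy z * kk a τ z.2 := hf.sgy.mul (kk_sg hτ)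
  have c1 : ContinuousOn (fun z => f z * mt a τ z.2) (Hs n) := hf.cont.mul (mt_cont)
  have c2 : ContinuousOn (fun z => fy z * kk a τ z.2) (Hs n) := hf.conty.mul (kk_cont)
  have I : Integrable (fun z => f z * mt a τ z.2 - fy z * kk a τ z.2) (mu a) :=
    (SG.integrable ha (by linarith) s1 c1.aesm_mu).sub (SG.integrable ha (by linarith) s2 c2.aesm_mu)
  have J1 : Integrable (fun z => φ z.1 * f z * mt a τ z.2) (mu a) := SG.integrable ha (by linarith)
      (by simpa [mul_assoc] using sφ.mul s1) ((cφ.mul c1).congr fun z _ => by simp only [Pi.mul_apply]; ring).aesm_mu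
  have J2 : Integrable (fun z => φ z.1 * kk a τ z.2 * fy z) (mu a) := SG.integrable ha (b := a + a) (by linarith)
      (by simpa [mul_assoc, mul_comm, mul_left_comm] using sφ.mul s2) ((cφ.mul c2).congr fun z _ => by simp only [Pi.mul_apply]; ring).aesm_mu
  have hcomb : (fun z => φ z.1 * f z * mt a τ z.2 - φ z.1 * kk a τ z.2 * fy z)
      = fun z => φ z.1 * (f z * mt a τ z.2 - fy z * kk a τ z.2) := by grind
  have J : Integrable (fun z => φ z.1 * (f z * mt a τ z.2 - fy z * kk a τ z.2)) (mu a) := by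
    rw [← hcomb]; exact J1.sub J2
  rw [← integral_sub J1 J2, hcomb, ← integral_const_mul]
  rw [mu] at J I ⊢
  rw [integral_prod _ J]
  obtain ⟨C, hC0, hC⟩ := GR.bound hf.sg (θ := 1 / 8) (by norm_num)
  refine integral_congr_ae ?_
  filter_upwards [I.prod_right_ae] with x hx
  have hx' := (integrable_nu ha).1 hx
  rw [integral_const_mul, integral_nu ha]
  rw [trace_line hτ (f := fun y => f (x, y)) (f' := fun y => fy (x, y))
    (C := C * exp (1 / 8 * ∑ i, x i ^ 2)) (fun y hy => hf.dy (x, y) hy) (hZ x) ?_ hx']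
  · ring
  · intro y hy
    have := hC (x, y) hy
    simp only [rpow_zero, mul_one] at this
    refine this.trans (le_of_eq ?_)
    rw [mul_assoc, ← exp_add]
    simp only [nq, nsq]; ring_nf

end weights
end

section
variable {d : V n}

lemma tendsto_integral_mu {l : Filter ℝ} [l.IsCountablyGenerated] {F : ℝ → E n → ℝ} {F0 h : E n → ℝ} {C : ℝ}
    (hc : ∀ ε, ContinuousOn (F ε) (Hs n)) (hC : ∀ ε, ∀ z ∈ Hs n, |F ε z| ≤ C)
    (ht : ∀ z ∈ Hs n, Tendsto (fun ε => F ε z) l (𝓝 (F0 z))) (hh : Integrable h (mu a)) :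
    Tendsto (fun ε => I₂ a (F ε) h) l (𝓝 I₂ a F0 h) := by
  refine tendsto_integral_filter_of_dominated_convergence (fun z => C * |h z|)
    (Eventually.of_forall fun ε => (hc ε).aesm_mu.mul hh.1) (Eventually.of_forall fun ε => ?_)
    (hh.abs.const_mul C) ?_
  · filter_upwards [mu_ae_mem n a] with z hz
    rw [norm_eq_abs, abs_mul]
    exact mulR (hC ε z hz) (abs_nonneg _)
  · filter_upwards [mu_ae_mem n a] with z hz
    exact (ht z hz).mul_const _

lemma PG.dir2_thin (ha : -1 < a) (ha' : a < 1) {τ : ℝ} (hτ : 0 < τ) {P : E n → ℝ} {Px Py g}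
    (hP : PG n a P Px Py g) {φ : V n → ℝ} (hφ : Continuous φ) {B : ℝ} (hB : ∀ x, |φ x| ≤ B)
    (hflux : ∀ x, Tendsto (fun y => y ^ a * Py (x, y)) (𝓝[>] 0) (𝓝 (φ x)))
    {f : E n → ℝ} {fx fy} (hf : PC n a f fx fy) {Z : V n → ℝ}
    (hZ : ∀ x, Tendsto (fun y => f (x, y)) (𝓝[>] 0) (𝓝 (Z x))) :
    dir2 a Px Py fx fy = -I₂ a g f - (∫ z, φ z.1 * f z * mt a τ z.2 ∂mu a) + ∫ z, φ z.1 * kk a τ z.2 * fy z ∂mu a := by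
  have h1 := FG.green ha ha' hP hf fun x => (hflux x).mul (hZ x)
  have h2 := hf.trace hτ ha ha' hZ hφ hB
  linarith

lemma memLp_kk (ha : -1 < a) (ha' : a < 1) {τ : ℝ} (hτ : 0 < τ) {φ : V n → ℝ}
    (hφ : Continuous φ) {B : ℝ} (hB : ∀ x, |φ x| ≤ B) :
    MemLp (fun z : E n => φ z.1 * kk a τ z.2) 2 (mu a) := by
  have h : SG (0 + a) fun z => φ z.1 * kk a τ z.2 := SG.mul (SG.of_bdd fun z _ => hB z.1) (kk_sg hτ)
  exact SG.memLp ha (by linarith) h (ContinuousOn.aesm_mu ((hφ.comp continuous_fst).continuousOn.mul kk_cont))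

lemma integrable_mt (ha : -1 < a) {τ : ℝ} (hτ : 0 < τ) {φ : V n → ℝ} (hφ : Continuous φ) {B : ℝ} (hB : ∀ x, |φ x| ≤ B) :
    Integrable (fun z : E n => φ z.1 * mt a τ z.2) (mu a) := by
  have h : SG (0 + a) fun z => φ z.1 * mt a τ z.2 := SG.mul (SG.of_bdd fun z _ => hB z.1) (mt_sg hτ)
  exact SG.integrable ha (by linarith) h (ContinuousOn.aesm_mu ((hφ.comp continuous_fst).continuousOn.mul mt_cont))

/-- Differentiated energy inequality tested against the Poincaré inequality for `dd d v - C P`. -/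
lemma Prof.core (ha : -1 < a) (ha' : a < 1) {v : E n → ℝ} {T} (hv : Prof a v T) (κ : ℝ)
    (hd : ∑ i, d i ^ 2 ≤ 1) {θ : ℝ} (hθ : 0 < θ) (hθ' : θ < 1) {τ : ℝ} (hτ : 0 < τ) {P : E n → ℝ} {Px Py g}
    (hP : PG n a P Px Py g) {φ : V n → ℝ} (hφ : Continuous φ) {B : ℝ} (hB : ∀ x, |φ x| ≤ B)
    (hflux : ∀ x, Tendsto (fun y => y ^ a * Py (x, y)) (𝓝[>] 0) (𝓝 (φ x))) (C : ℝ) :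
    1 / 2 * (N₂ a (dd d v) - 2 * C * I₂ a (dd d v) P + C ^ 2 * N₂ a P
        - ((∫ z, dd d v z ∂mu a) - C * ∫ z, P z ∂mu a) ^ 2) ≤
      (1 + θ) / (1 - θ) * (((κ - 1) / 2 + θ) * N₂ a (dd d v) + (10 + 2 * n) / (2 * θ) * N₂ a (defect a κ v))
      + 2 * C * I₂ a (dd d v) g
      + 2 * C * (∫ z, dd d v z * (φ z.1 * mt a τ z.2) ∂mu a)
      + C ^ 2 / θ * (∫ z, (φ z.1 * kk a τ z.2) ^ 2 ∂mu a) + C ^ 2 * dirich a Px Py := by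
  have hprob := prob_mu n ha
  obtain ⟨W, hW0, hW⟩ := hv.toReg.bdd_dd d
  have hne : (𝓝[>] (0:ℝ)) ≤ 𝓝[≠] 0 := nhdsWithin_mono _ fun x hx => ne_of_gt hx
  have hcd : ∀ ε, ContinuousOn (dq d ε v) (Hs n) := fun ε => (dq_pc hv.toReg d ε).cont
  have hcw := (hv.toReg.sm.dd d).contOn
  have hdt : ∀ z ∈ Hs n, Tendsto (fun ε => dq d ε v z) (𝓝[>] 0) (𝓝 (dd d v z)) := fun z hz =>
    (dq_tendsto hv.toReg.sm hz).mono_left hne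
  have htt : ∀ z ∈ Hs n, Tendsto (fun ε : ℝ => FG.tr (ε • d) (FG.dd d v) z) (𝓝[>] 0) (𝓝 (dd d v z)) :=
    fun z hz => (tr_tendsto hcw hz).mono_left hne
  have hdb : ∀ ε, ∀ z ∈ Hs n, |dq d ε v z| ≤ W := fun ε z hz => dq_bdd hv.toReg.sm hW hW0 ε hz
  have lim : ∀ h : E n → ℝ, Integrable h (mu a) → Tendsto (fun ε => I₂ a (dq d ε v) h) (𝓝[>] 0)
        (𝓝 I₂ a (dd d v) h) := fun h hh =>
    tendsto_integral_mu hcd hdb hdt hh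
  have hPi := hP.pc.memLp ha
  have hgi := SG.integrable ha (by linarith) hP.sgg hP.contg.aesm_mu
  have l1 : Tendsto (fun ε => N₂ a (dq d ε v)) (𝓝[>] 0) (𝓝 N₂ a (dd d v)) := by
    have := tendsto_integral_mu (a := a) (l := 𝓝[>] 0) (F := fun ε z => dq d ε v z ^ 2)
      (fun ε => (hcd ε).pow 2) (fun ε z hz => by
        rw [abs_pow]; exact pow_le_pow_left₀ (abs_nonneg _) (hdb ε z hz) 2)
      (fun z hz => (hdt z hz).pow 2) (integrable_const 1)
    simpa using this
  have l2 := lim P (hPi.integrable one_le_two)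
  have l3 : Tendsto (fun ε => ∫ z, dq d ε v z ∂mu a) (𝓝[>] 0) (𝓝 (∫ z, dd d v z ∂mu a)) := by
    simpa using lim (fun _ => 1) (integrable_const 1)
  have l4 : Tendsto (fun ε => ∫ z, FG.tr (ε • d) (FG.dd d v) z * dq d ε v z ∂mu a) (𝓝[>] 0) (𝓝 N₂ a (dd d v)) := by
    have := tendsto_integral_mu (a := a) (l := 𝓝[>] 0) (F := fun ε z => FG.tr (ε • d) (FG.dd d v) z * dq d ε v z)
     
      (fun ε => (continuousOn_tr hcw _).mul (hcd ε)) (fun ε z hz => by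
        rw [abs_mul]
        exact mul_le_mul (hW _ (tr_mem hz)) (hdb ε z hz) (abs_nonneg _) hW0)
      (fun z hz => (htt z hz).mul (hdt z hz)) (integrable_const 1)
    simpa [pow_two] using this
  have l5 := lim g hgi
  have l6 := lim _ (integrable_mt ha hτ hφ hB)
  obtain ⟨ε₀, hε₀, hen⟩ := hv.dq_energy_le ha ha' κ hd hθ
  have hL := ((((l1.sub (l2.const_mul (2 * C))).add_const (C ^ 2 * N₂ a P)).sub
    ((l3.sub_const (C * ∫ z, P z ∂mu a)).pow 2)).const_mul (1 / 2))
  have hR := (((((l1.const_mul (κ / 2 + θ)).sub (l4.const_mul (1 / 2))).add_const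
    ((10 + 2 * n) / (2 * θ) * N₂ a (defect a κ v))).const_mul ((1 + θ) / (1 - θ))).add
    (l5.const_mul (2 * C))).add (l6.const_mul (2 * C))
  have hR2 := (hR.add_const (C ^ 2 / θ * (∫ z, (φ z.1 * kk a τ z.2) ^ 2 ∂mu a))).add_const (C ^ 2 * dirich a Px Py)
  have hfin := le_of_tendsto_of_tendsto hL hR2 ?_
  · refine hfin.trans (le_of_eq ?_)
    ring
  filter_upwards [Ioo_mem_nhdsGT hε₀] with ε hε
  have hE := hen ε hε.1 hε.2
  have hq := dq_pc hv.toReg d ε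
  have hZ : ∀ x, Tendsto (fun y => dq d ε v (x, y)) (𝓝[>] 0) (𝓝 (dq d ε v (x, 0))) := by
    have hvz : ∀ x, Tendsto (fun y => v (x, y)) (𝓝[>] 0) (𝓝 (v (x, 0))) := fun x => by
      have h1 : ContinuousWithinAt v {z : E n | 0 ≤ z.2} (x, 0) := hv.toReg.cont _ (le_refl (0:ℝ))
      refine Tendsto.comp h1 (tendsto_nhdsWithin_iff.2 ⟨?_, ?_⟩)
      · exact ((by fun_prop : Continuous fun y => ((x, y) : E n)).tendsto 0).mono_left nhdsWithin_le_nhds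
      · filter_upwards [self_mem_nhdsWithin] with y hy
        exact le_of_lt hy
    intro x
    have := ((hvz (x + ε • d)).sub (hvz x)).const_mul ε⁻¹
    simpa [dq, FG.tr] using this
  set ψy : E n → ℝ := fun z => ε⁻¹ * (Dy (FG.tr (ε • d) v) z - Dy v z) with hψy
  set ψx : Fin n → E n → ℝ := fun i z => ε⁻¹ * (Dx i (FG.tr (ε • d) v) z - Dx i v z) with hψx
  have hsub := (poincare ha ha' (hq.sub (hP.pc.const_mul C))).1
  rw [dirich_sub ha ha' hq (hP.pc.const_mul C), dir2_comm, dir2_const_mul C, dirich_const_mul C,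
    hP.dir2_thin ha ha' hτ hφ hB hflux hq hZ] at hsub
  have Lq := hq.memLp ha
  have Ly := hq.memLpy ha ha'
  have e1 : ∫ z, (dq d ε v z - C * P z) ^ 2 ∂mu a = N₂ a (dq d ε v) - 2 * C * I₂ a (dq d ε v) P + C ^ 2 * N₂ a P := by
    have j1 := Lq.integrable_sq
    have j2 : Integrable (fun z => 2 * C * (dq d ε v z * P z)) (mu a) := (integrable_mul2 Lq hPi).const_mul _
    have j12 : Integrable (fun z => dq d ε v z ^ 2 - 2 * C * (dq d ε v z * P z)) (mu a) := j1.sub j2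
    have j3 : Integrable (fun z => C ^ 2 * P z ^ 2) (mu a) := hPi.integrable_sq.const_mul _
    rw [← integral_const_mul (2 * C), ← integral_const_mul (C ^ 2), ← integral_sub j1 j2, ← integral_add j12 j3]
    exact integral_congr_ae (Eventually.of_forall fun z => by simp only; ring)
  have e2 : ∫ z, (dq d ε v z - C * P z) ∂mu a = (∫ z, dq d ε v z ∂mu a) - C * ∫ z, P z ∂mu a := by
    rw [integral_sub (Lq.integrable one_le_two) ((hPi.integrable one_le_two).const_mul C), integral_const_mul]
  have e3 : ∫ z, φ z.1 * dq d ε v z * mt a τ z.2 ∂mu a = ∫ z, dq d ε v z * (φ z.1 * mt a τ z.2) ∂mu a :=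
    integral_congr_ae (Eventually.of_forall fun z => by simp only; ring)
  have e4 : I₂ a g (dq d ε v) = I₂ a (dq d ε v) g := by simp only [mul_comm]
  rw [e1, e2, e3, e4] at hsub
  have hDD : N₂ a ψy ≤ dirich a ψx ψy := by
    have : 0 ≤ ∑ i, N₂ a (ψx i) := sum_nonneg fun i _ => integral_sq _
    unfold dirich; linarith
  have hk : -(2 * C * ∫ z, φ z.1 * kk a τ z.2 * ψy z ∂mu a) ≤
      C ^ 2 / θ * (∫ z, (φ z.1 * kk a τ z.2) ^ 2 ∂mu a) + θ * N₂ a ψy := by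
    have hy := (abs_le.1 (young ((memLp_kk ha ha' hτ hφ hB).const_mul C) Ly hθ)).1
    have f1 : ∫ z, (C * (φ z.1 * kk a τ z.2)) * ψy z ∂mu a = C * ∫ z, φ z.1 * kk a τ z.2 * ψy z ∂mu a := by
      simp only [mul_assoc, integral_const_mul]
    have f2 : ∫ z, (C * (φ z.1 * kk a τ z.2)) ^ 2 ∂mu a = C ^ 2 * ∫ z, (φ z.1 * kk a τ z.2) ^ 2 ∂mu a := by
      simp only [mul_pow, integral_const_mul]
    rw [f1, f2] at hy
    have f3 : 1 / (2 * θ) * (C ^ 2 * ∫ z, (φ z.1 * kk a τ z.2) ^ 2 ∂mu a) * 2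
      = C ^ 2 / θ * (∫ z, (φ z.1 * kk a τ z.2) ^ 2 ∂mu a) := by field_simp
    linarith
  have hD1 : dirich a ψx ψy ≤ 1 / (1 - θ) * ((κ / 2 + θ) * N₂ a (dq d ε v)
      - 1 / 2 * (∫ z, FG.tr (ε • d) (FG.dd d v) z * dq d ε v z ∂mu a)
      + (10 + 2 * n) / (2 * θ) * N₂ a (defect a κ v)) := by
    rw [div_mul_eq_mul_div, one_mul, le_div_iff₀ (by linarith), mul_comm]
    exact hE
  have hD2 := mulL hD1 (by linarith : 0 ≤ 1 + θ)
  rw [← mul_assoc, mul_one_div] at hD2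
  have hD3 := mulL hDD hθ.le
  linarith
end

lemma PB.add {F G : ℝ → ℝ → ℝ} (hF : PB F) (hG : PB G) : PB fun ξ y => F ξ y + G ξ y := by
  obtain ⟨C, p, hC, h⟩ := hF
  obtain ⟨C', p', hC', h'⟩ := hG
  refine ⟨C + C', max p p', by positivity, fun ξ y hy => (abs_add_le _ _).trans ?_⟩
  have h1 : 1 ≤ 1 + (ξ ^ 2 + y ^ 2) := by bound
  rw [add_mul]
  exact add_le_add ((h ξ y hy).trans (mulL (rpow_le_rpow_of_exponent_le h1 (by grind)) hC))
    ((h' ξ y hy).trans (mulL (rpow_le_rpow_of_exponent_le h1 (by grind)) hC'))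

lemma PB.const_mul {F : ℝ → ℝ → ℝ} (hF : PB F) (c : ℝ) : PB fun ξ y => c * F ξ y := by
  obtain ⟨C, p, hC, h⟩ := hF
  refine ⟨|c| * C, p, by positivity, fun ξ y hy => ?_⟩
  rw [abs_mul, mul_assoc]
  exact mulL (h ξ y hy) (abs_nonneg c)

lemma PB.shift {F : ℝ → ℝ → ℝ} (hF : PB F) (t : ℝ) : PB fun ξ y => F (ξ + t) y := by
  obtain ⟨C, p, hC, h⟩ := hF
  refine ⟨C * (2 + 2 * t ^ 2) ^ |p|, |p|, by positivity, fun ξ y hy => (h _ y hy).trans ?_⟩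
  rw [mul_assoc, ← mul_rpow (by positivity) (by positivity)]
  gcongr
  refine (rpow_le_rpow_of_exponent_le (by nlinarith) (le_abs_self p)).trans ?_
  refine rpow_le_rpow (by positivity) ?_ (abs_nonneg p)
  nlinarith [sq_nonneg (ξ - t), sq_nonneg y]

section TD
variable {F F1 F2 F11 F22 G F' F1' F2' F11' F22' G' : ℝ → ℝ → ℝ}

lemma TD.sub (h : TD a F F1 F2 F11 F22 G) (k : TD a F' F1' F2' F11' F22' G') (c : ℝ) :
    TD a (fun ξ y => c * (F ξ y - F' ξ y)) (fun ξ y => c * (F1 ξ y - F1' ξ y))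
      (fun ξ y => c * (F2 ξ y - F2' ξ y)) (fun ξ y => c * (F11 ξ y - F11' ξ y))
      (fun ξ y => c * (F22 ξ y - F22' ξ y)) (fun ξ y => c * (G ξ y - G' ξ y)) := by
  have key : ∀ {A B : ℝ → ℝ → ℝ}, PB A → PB B → PB fun ξ y => c * (A ξ y - B ξ y) := fun hA hB => by
    have := (hA.add (hB.const_mul (-1))).const_mul c
    simpa only [neg_mul, one_mul, ← sub_eq_add_neg] using this
  exact
  { d1 := fun ξ y hy => ((h.d1 ξ y hy).sub (k.d1 ξ y hy)).const_mul c
    d2 := fun ξ y hy => ((h.d2 ξ y hy).sub (k.d2 ξ y hy)).const_mul c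
    d11 := fun ξ y hy => ((h.d11 ξ y hy).sub (k.d11 ξ y hy)).const_mul c
    d22 := fun ξ y hy => ((h.d22 ξ y hy).sub (k.d22 ξ y hy)).const_mul c
    c := (h.c.sub k.c).const_mul c
    c1 := (h.c1.sub k.c1).const_mul c
    c2 := (h.c2.sub k.c2).const_mul c
    c11 := (h.c11.sub k.c11).const_mul c
    c22 := (h.c22.sub k.c22).const_mul c
    b := key h.b k.b
    b1 := key h.b1 k.b1
    b2 := by
      have := key h.b2 k.b2
      simpa only [← sub_mul, ← mul_assoc] using this
    bg := key h.bg k.bg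
    eq := fun ξ y hy => by
      linear_combination c * (h.eq ξ y hy) - c * (k.eq ξ y hy) }

lemma TD.shift (h : TD a F F1 F2 F11 F22 G) (t : ℝ) :
    TD a (fun ξ y => F (ξ + t) y) (fun ξ y => F1 (ξ + t) y) (fun ξ y => F2 (ξ + t) y)
      (fun ξ y => F11 (ξ + t) y) (fun ξ y => F22 (ξ + t) y)
      (fun ξ y => G (ξ + t) y + t / 2 * F1 (ξ + t) y) := by
  have key : ∀ {A : ℝ → ℝ → ℝ}, ContinuousOn (fun w : ℝ × ℝ => A w.1 w.2) {w | 0 < w.2} →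
      ContinuousOn (fun w : ℝ × ℝ => A (w.1 + t) w.2) {w | 0 < w.2} := fun hA =>
    hA.comp (f := fun w : ℝ × ℝ => (w.1 + t, w.2)) (by fun_prop) fun w hw => hw
  exact
  { d1 := fun ξ y hy => (h.d1 (ξ + t) y hy).comp_add_const ξ t
    d2 := fun ξ y hy => h.d2 (ξ + t) y hy
    d11 := fun ξ y hy => (h.d11 (ξ + t) y hy).comp_add_const ξ t
    d22 := fun ξ y hy => h.d22 (ξ + t) y hy
    c := key h.c
    c1 := key h.c1
    c2 := key h.c2
    c11 := key h.c11
    c22 := key h.c22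
    b := h.b.shift t
    b1 := h.b1.shift t
    b2 := h.b2.shift t
    bg := (h.bg.shift t).add ((h.b1.shift t).const_mul _)
    eq := fun ξ y hy => by linear_combination h.eq (ξ + t) y hy }

end TD

lemma rho_lip {ξ ξ' y : ℝ} (h : ξ ≤ ξ') : |rho 0 ξ y - rho 0 ξ' y| ≤ ξ' - ξ := by
  have key : ∀ p q : ℝ, rho 0 p y ≤ rho 0 q y + |p - q| := fun p q => by
    refine sqrt_le_iff.2 ⟨add_nonneg rho_nonneg (abs_nonneg _), ?_⟩
    have h1 := rho_sq (ξ := q) (y := y) (le_refl 0)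
    have h2 : |q| ≤ rho 0 q y := abs_le_sqrt (by nlinarith)
    have h3 : (p - q) * q ≤ |p - q| * |q| := (le_abs_self _).trans (abs_mul _ _).le
    have h4 : |p - q| ^ 2 = (p - q) ^ 2 := sq_abs _
    nlinarith [ mulL h2 (abs_nonneg (p - q))]
  have h1 := key ξ ξ'
  have h2 := key ξ' ξ
  grind

lemma mm_mono {ξ ξ' y : ℝ} (h : ξ ≤ ξ') : mm 0 ξ y ≤ mm 0 ξ' y := by
  have := abs_le.1 (rho_lip (y := y) h)
  unfold mm; linarith

section profile
variable {s t : ℝ}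

/-- Difference quotient of `hF`. -/
def PF (s t ξ y : ℝ) : ℝ := 1 / ((1 - s ^ 2) * t) * (hF s (ξ + 2 * t) y - hF s (ξ + t) y)

lemma PF_eq (hs' : s < 1) (hs : 0 < s) (ht : 0 < t) {y : ℝ} (hy : 0 < y) (ξ : ℝ) :
    ∃ c ∈ Ioo (ξ + t) (ξ + 2 * t), PF s t ξ y = mm 0 c y ^ s := by
  obtain ⟨c, hc, h⟩ := exists_hasDerivAt_eq_slope (fun τ => hF s τ y)
    (fun τ => (1 - s ^ 2) * mm 0 τ y ^ s) (by linarith : ξ + t < ξ + 2 * t)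
    (fun τ _ => (hF_d1 s τ y hy).continuousAt.continuousWithinAt) fun τ _ => hF_d1 s τ y hy
  refine ⟨c, hc, ?_⟩
  have h1 : 0 < 1 - s ^ 2 := by nlinarith
  unfold PF
  rw [eq_div_iff (by linarith)] at h
  rw [← h]
  field_simp
  ring

lemma mmp_add_le (hs : 0 < s) (hs' : s < 1) (ht : 0 < t) {y : ℝ} (hy : 0 < y) (ξ : ℝ) :
    mm 0 (ξ + 2 * t) y ^ s ≤ mm 0 (ξ + t) y ^ s + (2 * t) ^ s := by
  refine le_trans (rpow_le_rpow (mm_pos le_rfl hy).le ?_ hs.le)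
    (rpow_add_le_add_rpow (mm_pos le_rfl hy).le (by linarith) hs.le hs'.le)
  have := abs_le.1 (rho_lip (y := y) (by linarith : ξ + t ≤ ξ + 2 * t))
  unfold mm; linarith

/-- Weighted thin flux of `PF`. -/
def fl (s t ξ : ℝ) : ℝ := s * (1 + s) / ((1 - s ^ 2) * t) *
  ((|ξ + t| - (ξ + t)) ^ (1 - s) - (|ξ + 2 * t| - (ξ + 2 * t)) ^ (1 - s))

lemma fl_spec (hs : 0 < s) (hs' : s < 1) (ht : 0 < t) (ξ : ℝ) :
    0 ≤ fl s t ξ ∧ fl s t ξ ≤ s * (1 + s) / ((1 - s ^ 2) * t) * (2 * t) ^ (1 - s) ∧ (-t ≤ ξ → fl s t ξ = 0) := by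
  have h1 : 0 < 1 - s ^ 2 := by nlinarith
  have h2 : 0 ≤ |ξ + 2 * t| - (ξ + 2 * t) := by grind
  have h3 : |ξ + 2 * t| ≤ |ξ + t| + t := by grind
  have h4 : |ξ + t| ≤ |ξ + 2 * t| + t := by grind
  have h5 := rpow_le_rpow h2 (by linarith : _ ≤ |ξ + t| - (ξ + t)) (by linarith : 0 ≤ 1 - s)
  have h6 := (rpow_le_rpow (by linarith) (by linarith : |ξ + t| - (ξ + t) ≤ (|ξ + 2 * t| - (ξ + 2 * t)) + 2 * t)
      (by linarith : 0 ≤ 1 - s)).trans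
    (rpow_add_le_add_rpow h2 (by linarith) (by linarith) (by linarith))
  refine ⟨mul_nonneg (by positivity) (by linarith), mulL (by linarith) (by positivity), fun h => ?_⟩
  unfold fl
  rw [abs_of_nonneg (by linarith), abs_of_nonneg (by linarith)]
  simp

lemma continuous_fl (hs' : s < 1) : Continuous (fl s t) := by
  have h : 0 ≤ 1 - s := by linarith
  refine continuous_const.mul (Continuous.sub ?_ ?_)
  · fun_prop
  · fun_prop

/-- Uniform lower bound for the mass of the profiles. -/
def cP (n : ℕ) (s : ℝ) : ℝ := ∫ z : E n, (z.2 ^ 2 / (2 * √(nq z))) ^ s ∂mu 𝔟 s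

lemma nq_pos {z : E n} (hz : z ∈ Hs n) : 0 < nq z := lt_of_lt_of_le (pow_pos (show 0 < z.2 from hz) 2) (snd_sq_le_nq z)

lemma integrable_cP (hs : 0 < s) (hs' : s < 1) :
    Integrable (fun z : E n => (z.2 ^ 2 / (2 * √(nq z))) ^ s) (mu 𝔟 s) := by
  refine SG.integrable (by linarith) (by linarith) (SG.of_GR (GR.of_rpow nq_nonneg_on zero_le_one s fun z hz => ?_))
    (ContinuousOn.aesm_mu ?_)
  · have h0 := nq_pos hz
    have h1 := sqrt_pos.2 h0
    have h2 := sq_sqrt h0.le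
    rw [abs_of_nonneg (by positivity), one_mul]
    refine rpow_le_rpow (by positivity) ?_ hs.le
    rw [div_le_iff₀ (by positivity)]
    have := snd_sq_le_nq z
    nlinarith [sq_nonneg (√(nq z) - 1)]
  · refine ContinuousOn.rpow_const (ContinuousOn.div (by fun_prop)
      ((continuous_sqrt.comp continuous_nq).continuousOn.const_mul 2) fun z hz => ?_) fun _ _ => Or.inr hs.le
    have := sqrt_pos.2 (nq_pos hz)
    positivity

lemma cP_pos (hs : 0 < s) (hs' : s < 1) : 0 < cP n s := by
  have := prob_mu n (by linarith : -1 < 1 - 2 * s)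
  refine integral_pos_of_ae_pos (integrable_cP hs hs') ?_
  filter_upwards [mu_ae_mem n 𝔟 s] with z hz
  have h1 := sqrt_pos.2 (nq_pos hz)
  have h2 : 0 < z.2 := hz
  positivity

lemma exists_profile (hs : 0 < s) (hs' : s < 1) (ht : 0 < t) : ∃ B, 0 ≤ B ∧
    ∀ e : Fin n → ℝ, ∑ i, e i ^ 2 = 1 → ∃ P Px Py g φ Φ, PG n 𝔟 s P Px Py g ∧ Continuous φ ∧ Continuous Φ ∧
      (∀ x, |φ x| ≤ B ∧ 0 ≤ Φ x ∧ Φ x ≤ B ∧ φ x = -(Φ x * ∑ i, e i * x i)) ∧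
      (∀ x, Tendsto (fun y => y ^ 𝔟 s * Py (x, y)) (𝓝[>] 0) (𝓝 (φ x))) ∧
      (∀ z ∈ Hs n, 0 ≤ P z ∧ 0 ≤ g z + s / 2 * P z ∧ g z + s / 2 * P z ≤ (2 * t) ^ s) ∧
      cP n s ≤ ∫ z, P z ∂mu 𝔟 s ∧
      dirich 𝔟 s Px Py ≤ s / 2 * N₂ 𝔟 s P := by
  have ha : -1 < 1 - 2 * s := by linarith
  have ha' : 1 - 2 * s < 1 := by linarith
  have h1 : 0 < 1 - s ^ 2 := by nlinarith
  have hprob := prob_mu n ha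
  set B := s * (1 + s) / ((1 - s ^ 2) * t) * (2 * t) ^ (1 - s) with hB
  have hB0 : 0 ≤ B := by positivity
  refine ⟨B + B / t, by positivity, fun e he => ?_⟩
  have hpg := (((hF_td hs hs').shift (2 * t)).sub ((hF_td hs hs').shift t) (1 / ((1 - s ^ 2) * t))).pg he
  have hflux : ∀ x : Fin n → ℝ, Tendsto (fun y => y ^ 𝔟 s * lift e (fun ξ y =>
      1 / ((1 - s ^ 2) * t) * (-(s * (1 + s)) * (y * mm 0 (ξ + 2 * t) y ^ (s - 1))
        - -(s * (1 + s)) * (y * mm 0 (ξ + t) y ^ (s - 1)))) (x, y)) (𝓝[>] 0)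
      (𝓝 (fl s t (∑ i, e i * x i))) := fun x => by
    have := ((hF_flux_tr hs' ((∑ i, e i * x i) + 2 * t)).sub
      (hF_flux_tr hs' ((∑ i, e i * x i) + t))).const_mul (1 / ((1 - s ^ 2) * t))
    convert this using 2
    · simp only [lift]; ring
    · unfold fl; ring
  have hpt : ∀ z ∈ Hs n, mm 0 ((∑ i, e i * z.1 i) + t) z.2 ^ s ≤ lift e (PF s t) z ∧
      lift e (PF s t) z ≤ mm 0 ((∑ i, e i * z.1 i) + 2 * t) z.2 ^ s := fun z hz => by
    have hz := hz
    obtain ⟨c, hc, h⟩ := PF_eq hs' hs ht hz (∑ i, e i * z.1 i)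
    unfold lift
    rw [h]
    exact ⟨rpow_le_rpow (mm_pos le_rfl hz).le (mm_mono hc.1.le) hs.le,
      rpow_le_rpow (mm_pos le_rfl hz).le (mm_mono hc.2.le) hs.le⟩
  have hP0 : ∀ z ∈ Hs n, 0 ≤ lift e (PF s t) z := fun z hz =>
    (rpow_nonneg (mm_pos le_rfl hz).le _).trans (hpt z hz).1
  have hφc : Continuous fun x : Fin n → ℝ => fl s t (∑ i, e i * x i) := (continuous_fl hs').comp (by fun_prop)
  have hmax : ∀ ξ : ℝ, 0 < max t (-ξ) := fun ξ => lt_max_of_lt_left ht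
  obtain ⟨g, hg⟩ : ∃ g, g = lift e (fun ξ y => 1 / ((1 - s ^ 2) * t) *
    (-((1 + s) / 2) * hF s (ξ + 2 * t) y + 2 * t / 2 * ((1 - s ^ 2) * mm 0 (ξ + 2 * t) y ^ s)
      - (-((1 + s) / 2) * hF s (ξ + t) y + t / 2 * ((1 - s ^ 2) * mm 0 (ξ + t) y ^ s)))) := ⟨_, rfl⟩
  rw [← hg] at hpg
  have hge : ∀ z, g z + s / 2 * lift e (PF s t) z = mm 0 ((∑ i, e i * z.1 i) + 2 * t) z.2 ^ s
      - 1 / 2 * mm 0 ((∑ i, e i * z.1 i) + t) z.2 ^ s - 1 / 2 * lift e (PF s t) z := fun z => by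
    rw [hg]; unfold lift PF; field_simp; ring
  have herr : ∀ z ∈ Hs n, 0 ≤ g z + s / 2 * lift e (PF s t) z ∧
      g z + s / 2 * lift e (PF s t) z ≤ (2 * t) ^ s := fun z hz => by
    have h2 := hpt z hz
    have h3 := mmp_add_le hs hs' ht (show 0 < z.2 from hz) (∑ i, e i * z.1 i)
    rw [hge]
    constructor <;> linarith [ h2.2]
  have hPm := hpg.pc.memLp ha
  have hgm := hpg.memLp ha
  change PG n 𝔟 s (lift e (PF s t)) _ _ _ at hpg
  change MemLp (lift e (PF s t)) 2 _ at hPm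
  obtain ⟨Px, Py, hpg, hflux⟩ : ∃ Px Py, PG n 𝔟 s (lift e (PF s t)) Px Py g ∧
    ∀ x, Tendsto (fun y => y ^ 𝔟 s * Py (x, y)) (𝓝[>] 0) (𝓝 (fl s t (∑ i, e i * x i))) :=
    ⟨_, _, hpg, hflux⟩
  refine ⟨lift e (PF s t), Px, Py, g, fun x => fl s t (∑ i, e i * x i),
    fun x => fl s t (∑ i, e i * x i) / max t (-∑ i, e i * x i), hpg, hφc,
    hφc.div (by fun_prop) fun x => (hmax _).ne', fun x => ?_, hflux,
    fun z hz => ⟨hP0 z hz, herr z hz⟩, ?_, ?_⟩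
  · obtain ⟨k1, k2, k3⟩ := fl_spec hs hs' ht (∑ i, e i * x i)
    refine ⟨?_, div_nonneg k1 (hmax _).le, ?_, ?_⟩
    · rw [abs_of_nonneg k1]
      exact k2.trans (le_add_of_nonneg_right (by positivity))
    · exact (div_le_div₀ hB0 k2 ht (le_max_left _ _)).trans (le_add_of_nonneg_left hB0)
    · rcases le_total (-t) (∑ i, e i * x i) with h | h
      · simp only []; rw [k3 h]; simp
      · simp only []
        rw [max_eq_right (by linarith), div_neg]
        field_simp [(by linarith : ∑ i, e i * x i < 0).ne]
  · refine integral_mono_ae (integrable_cP hs hs') (hPm.integrable one_le_two) ?_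
    filter_upwards [mu_ae_mem n 𝔟 s] with z hz
    have hz2 := hz
    refine le_trans (rpow_le_rpow (by positivity) ?_ hs.le) (hpt z hz).1
    refine le_trans ?_ (mm_mono (le_add_of_nonneg_right ht.le))
    have h0 := nq_pos hz
    have h2 := mm_mul (ξ := ∑ i, e i * z.1 i) (y := z.2) (le_refl 0)
    have h3 := abs_lt.1 (abs_lt_rho (ξ := ∑ i, e i * z.1 i) le_rfl hz2)
    have h4 : rho 0 (∑ i, e i * z.1 i) z.2 ≤ √(nq z) := sqrt_le_sqrt (by
      have := dot_sq_le e z.1 he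
      unfold nq nsq; linarith)
    have h5 := mm_pos (ξ := ∑ i, e i * z.1 i) le_rfl hz2
    rw [div_le_iff₀ (by have := sqrt_pos.2 h0; positivity)]
    nlinarith
  · obtain ⟨Z, htr⟩ : ∃ Z : V n → ℝ, ∀ x, Tendsto (fun y => lift e (PF s t) (x, y)) (𝓝[>] 0) (𝓝 (Z x)) := by
      refine ⟨fun x => 1 / ((1 - s ^ 2) * t) * (hT s ((∑ i, e i * x i) + 2 * t) - hT s ((∑ i, e i * x i) + t)),
        fun x => ?_⟩
      have h := ((hF_tr hs ((∑ i, e i * x i) + 2 * t)).sub (hF_tr hs ((∑ i, e i * x i) + t))).const_mul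
        (1 / ((1 - s ^ 2) * t))
      unfold lift PF
      exact h
    have hgr := FG.green ha ha' hpg hpg.pc fun x => (hflux x).mul (htr x)
    rw [← dirich_eq] at hgr
    have hZ := fun x => ge_of_tendsto (b := 0) (htr x) (eventually_nhdsWithin_of_forall fun y hy => hP0 (x, y) hy)
    have h2 : 0 ≤ cY 𝔟 s * ∫ x, fl s t (∑ i, e i * x i) * Z x ∂(gamn n) := by
      refine mul_nonneg (cY_pos ha).le (integral_nonneg fun x => ?_)
      exact mul_nonneg (fl_spec hs hs' ht _).1 (hZ x)
    have h3 : -(s / 2) * N₂ 𝔟 s (lift e (PF s t)) ≤ I₂ 𝔟 s g (lift e (PF s t)) := by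
      rw [← integral_const_mul]
      refine integral_mono_ae (hPm.integrable_sq.const_mul _) (integrable_mul2 hgm hPm) ?_
      filter_upwards [mu_ae_mem n 𝔟 s] with z hz
      have := mul_nonneg (herr z hz).1 (hP0 z hz)
      nlinarith
    linarith

end profile

lemma memLp_weighted {φ : V n → ℝ} (hφ : Continuous φ) {B : ℝ} (hB : ∀ x, |φ x| ≤ B)
    {u : E n → ℝ} (hu : MemLp u 2 (mu a)) : MemLp (fun z => φ z.1 * u z) 2 (mu a) := by
  refine hu.of_le_mul (c := B) (((hφ.comp continuous_fst).aestronglyMeasurable).mul hu.1)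
    (Eventually.of_forall fun z => ?_)
  rw [norm_mul]
  exact mulR (hB _) (norm_nonneg _)

lemma integral_weighted_sq_le {φ : V n → ℝ} (hφ : Continuous φ) {B : ℝ} (hB : ∀ x, |φ x| ≤ B)
    {u : E n → ℝ} (hu : MemLp u 2 (mu a)) :
    ∫ z, (φ z.1 * u z) ^ 2 ∂mu a ≤ B ^ 2 * N₂ a u := by
  rw [← integral_const_mul]
  refine integral_mono (memLp_weighted hφ hB hu).integrable_sq (hu.integrable_sq.const_mul _) fun z => ?_
  simp only [mul_pow]
  refine mulR ?_ (sq_nonneg _)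
  rw [← sq_abs (φ z.1)]
  exact pow_le_pow_left₀ (abs_nonneg _) (hB _) 2

lemma cauchy_schwarz_weighted {φ : V n → ℝ} (hφ : Continuous φ) {B : ℝ} (hB : ∀ x, |φ x| ≤ B)
    {u h : E n → ℝ} (hu : MemLp u 2 (mu a)) (hh : MemLp h 2 (mu a)) :
    (∫ z, φ z.1 * u z * h z ∂mu a) ^ 2 ≤ B ^ 2 * N₂ a u * N₂ a h :=
  (cauchy_schwarz (memLp_weighted hφ hB hu) hh).trans (mulR (integral_weighted_sq_le hφ hB hu) (integral_sq _))

section weights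

lemma ymt_le {τ y : ℝ} (hτ : 0 < τ) (hy : 0 < y) : |y * mt a τ y| ≤ (1 + y ^ 2) * y ^ (-a) := by
  have h1 : 0 < y ^ (-a) := by positivity
  have h2 := add_one_le_exp (y / τ)
  have h3 := exp_pos (-(y / τ))
  have h4 : exp (y / τ) * exp (-(y / τ)) = 1 := by rw [← exp_add]; simp
  have h5 : 0 < y / τ := by positivity
  have e : y * mt a τ y = ((y / τ + y ^ 2 / 2) * exp (-(y / τ))) * y ^ (-a) := by
    unfold mt kk; ring
  rw [e, abs_of_pos (by positivity)]
  gcongr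
  have h6 : exp (-(y / τ)) ≤ 1 := exp_le_one_iff.2 (by linarith)
  nlinarith

lemma tendsto_div_atTop {y : ℝ} (hy : 0 < y) : Tendsto (fun τ : ℝ => y / τ) (𝓝[>] 0) atTop := by
  exact tendsto_inv_nhdsGT_zero.const_mul_atTop hy

lemma tendsto_kk {y : ℝ} (hy : 0 < y) : Tendsto (fun τ => kk a τ y) (𝓝[>] 0) (𝓝 0) := by
  have h := (tendsto_exp_neg_atTop_nhds_zero.comp (tendsto_div_atTop hy)).const_mul (y ^ (-a))
  rw [mul_zero] at h
  exact h

lemma tendsto_ymt {y : ℝ} (hy : 0 < y) : Tendsto (fun τ => y * mt a τ y) (𝓝[>] 0) (𝓝 0) := by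
  have h1 := ((tendsto_pow_mul_exp_neg_atTop_nhds_zero 1).comp (tendsto_div_atTop hy)).const_mul (y ^ (-a))
  have h2 := (tendsto_kk (a := a) hy).const_mul (y ^ 2 / 2)
  have h := h1.add h2
  rw [mul_zero, mul_zero, add_zero] at h
  refine h.congr fun τ => ?_
  unfold mt kk
  grind

lemma memLp_dom (ha : -1 < a) (ha' : a < 1) :
    MemLp (fun z : E n => (1 + z.2 ^ 2) * z.2 ^ (-a)) 2 (mu a) := by
  have h : SG a fun z : E n => z.2 ^ (-a) :=
    GR.of_bdd nq_nonneg_on (C := 1) fun z (hz : 0 < z.2) => by rw [← rpow_add hz]; simp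
  have h2 : SG 0 fun z : E n => 1 + z.2 ^ 2 := SG.add (SG.const 1) (by simpa using SG.pow2 SG.snd)
  have h3 := SG.mul h2 h
  exact SG.memLp ha (by linarith) h3 (ContinuousOn.aesm_mu (ContinuousOn.mul (by fun_prop) fun z hz =>
    ((continuous_snd.continuousAt).rpow_const (Or.inl (ne_of_gt hz))).continuousWithinAt))

lemma memLp_ymt (ha : -1 < a) (ha' : a < 1) {τ : ℝ} (hτ : 0 < τ) :
    MemLp (fun z : E n => z.2 * mt a τ z.2) 2 (mu a) := by
  refine (memLp_dom ha ha').mono (ContinuousOn.aesm_mu (continuousOn_snd.mul mt_cont)) ?_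
  filter_upwards [mu_ae_mem n a] with z hz
  exact (ymt_le hτ hz).trans (le_abs_self _)

lemma exists_small_weight (n : ℕ) (ha : -1 < a) (ha' : a < 1) {ε : ℝ} (hε : 0 < ε) : ∃ τ > 0,
    ∫ z : E n, kk a τ z.2 ^ 2 ∂mu a ≤ ε ∧ ∫ z : E n, (z.2 * mt a τ z.2) ^ 2 ∂mu a ≤ ε := by
  have key : ∀ f : ℝ → ℝ → ℝ, (∀ τ > 0, ∀ y > 0, |f τ y| ≤ (1 + y ^ 2) * y ^ (-a)) →
      (∀ y > 0, Tendsto (fun τ => f τ y) (𝓝[>] 0) (𝓝 0)) →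
      (∀ τ, ContinuousOn (fun z => f τ z.2) (Hs n)) →
      Tendsto (fun τ => ∫ z : E n, f τ z.2 ^ 2 ∂mu a) (𝓝[>] 0) (𝓝 0) := fun f hb ht hc => by
    have := tendsto_integral_filter_of_dominated_convergence (l := 𝓝[>] 0) (μ := mu a)
      (F := fun τ z => f τ z.2 ^ 2) (f := fun _ => 0) (fun z => ((1 + z.2 ^ 2) * z.2 ^ (-a)) ^ 2)
      (Eventually.of_forall fun τ => ((hc τ).pow 2).aesm_mu) ?_ (memLp_dom ha ha').integrable_sq ?_
    · simpa using this
    · filter_upwards [self_mem_nhdsWithin] with τ hτ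
      filter_upwards [mu_ae_mem n a] with z hz
      rw [norm_eq_abs, abs_pow]
      exact pow_le_pow_left₀ (abs_nonneg _) (hb τ hτ z.2 hz) 2
    · filter_upwards [mu_ae_mem n a] with z hz
      simpa using (ht z.2 hz).pow 2
  have h1 := key (fun τ y => kk a τ y) (fun τ hτ y hy => ?_) (fun y hy => tendsto_kk hy) fun τ => kk_cont
  · have h2 := key (fun τ y => y * mt a τ y) (fun τ hτ y hy => ymt_le hτ hy) (fun y hy => tendsto_ymt hy)
      fun τ => continuousOn_snd.mul mt_cont
    obtain ⟨τ, hτ⟩ := ((h1.eventually_le_const hε).and ((h2.eventually_le_const hε).and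
      self_mem_nhdsWithin)).exists
    exact ⟨τ, hτ.2.2, hτ.1, hτ.2.1⟩
  · have h1 : 0 < y ^ (-a) := rpow_pos_of_pos hy _
    have h5 := div_pos hy hτ
    have h6 : exp (-(y / τ)) ≤ 1 := exp_le_one_iff.2 (by linarith)
    unfold kk
    rw [abs_of_pos (mul_pos h1 (exp_pos _)), mul_comm]
    exact mulR (h6.trans (by nlinarith [sq_nonneg y])) h1.le

end weights

lemma PC.integral_dx (ha : -1 < a) (ha' : a < 1) {f : E n → ℝ} {fx fy} (hf : PC n a f fx fy) (j : Fin n) :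
    ∫ z, fx j z ∂mu a = 1 / 2 * ∫ z, f z * z.1 j ∂mu a := by
  have := FG.green ha ha' (coord_pg j) hf (L := fun _ => 0) fun x => by simp
  simp only [dir2, ite_mul, one_mul, zero_mul, integral_zero, mul_assoc, integral_const_mul] at this
  have e1 : ∑ i, ∫ z, (if i = j then fx i z else 0) ∂mu a = ∫ z, fx j z ∂mu a := by
    rw [sum_eq_single j]
    · simp
    · intro b _ hb; simp [hb]
    · simp
  grind

lemma Reg.memLp_dd (ha : -1 < a) {v : E n → ℝ} {T} (hv : Reg a v T) (d : V n) :
    MemLp (dd d v) 2 (mu a) := by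
  have : dd d v = fun z => ∑ i, d i * Dx i v z := funext fun z => dd_eq z
  rw [this]
  exact memLp_finsetSum _ fun i _ => (hv.pc.memLpx ha i).const_mul _

lemma Reg.integral_dd (ha : -1 < a) (ha' : a < 1) {v : E n → ℝ} {T} (hv : Reg a v T) (d : V n) :
    ∫ z, dd d v z ∂mu a = 1 / 2 * ∑ i, d i * ∫ z, v z * z.1 i ∂mu a := by
  have hprob := prob_mu n ha
  simp only [dd_eq]
  rw [integral_finsetSum _ fun i _ => ((hv.pc.memLpx ha i).integrable one_le_two).const_mul _, mul_sum]
  refine sum_congr rfl fun i _ => ?_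
  rw [integral_const_mul, hv.pc.integral_dx ha ha' i]
  ring

lemma fdd_decomp {v : E n → ℝ} (e : V n) (i : Fin n) (z : E n) :
    dd (Pi.single i 1 - e i • e) v z = Dx i v z - e i * dd e v z := by
  have h : ((Pi.single i 1 - e i • e : V n), 0) = ((Pi.single i 1, 0) : E n) - e i • ((e, 0) : E n) := by simp
  have h2 : Dx i v z = fderiv ℝ v z ((Pi.single i 1, 0) : E n) := rfl
  rw [h2]
  unfold dd
  rw [h, map_sub, map_smul, smul_eq_mul]

lemma Prof.flux_le (ha : -1 < a) (ha' : a < 1) {v : E n → ℝ} {T} (hv : Prof a v T) {κ : ℝ} (hκ : 0 ≤ κ)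
    {τ : ℝ} (hτ : 0 < τ) (e : V n) {φ Φ : V n → ℝ} (hΦ : Continuous Φ) {B : ℝ}
    (hB : ∀ x, 0 ≤ Φ x ∧ Φ x ≤ B ∧ φ x = -(Φ x * ∑ i, e i * x i))
    (hX : 0 ≤ ∫ z, dd e v z * (φ z.1 * mt a τ z.2) ∂mu a) :
    (∫ z, dd e v z * (φ z.1 * mt a τ z.2) ∂mu a) ^ 2 ≤ 4 * B ^ 2 * ((κ ^ 2 * (∫ z : E n, kk a τ z.2 ^ 2 ∂mu a)
          + ∫ z : E n, (z.2 * mt a τ z.2) ^ 2 ∂mu a) * N₂ a (Dy v)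
        + (∫ z : E n, mt a τ z.2 ^ 2 ∂mu a) * (∫ z, (κ * v z - Zv v z) ^ 2 ∂mu a)
        + n * ∑ i, (∫ z : E n, (z.1 i * mt a τ z.2) ^ 2 ∂mu a) * N₂ a (dd (Pi.single i 1 - e i • e) v)) := by
  have hprob := prob_mu n ha
  have hΦB : ∀ x, |Φ x| ≤ B := fun x => by rw [abs_of_nonneg (hB x).1]; exact (hB x).2.1
  have smt := mt_sg (n := n) (a := a) hτ
  have Lm : MemLp (fun z => mt a τ z.2) 2 (mu a) := SG.memLp ha (by linarith) smt (ContinuousOn.aesm_mu mt_cont)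
  have Lxm : ∀ i, MemLp (fun z => z.1 i * mt a τ z.2) 2 (mu a) := fun i => by
    have h := SG.mul (SG.coord i) smt
    rw [zero_add] at h
    exact SG.memLp ha (by linarith) h (ContinuousOn.aesm_mu (ContinuousOn.mul (by fun_prop) mt_cont))
  have Lk : MemLp (fun z : E n => kk a τ z.2) 2 (mu a) :=
    SG.memLp ha (by linarith) (kk_sg hτ) (ContinuousOn.aesm_mu kk_cont)
  have Lym := memLp_ymt (n := n) ha ha' hτ
  have Lv := hv.toReg.pc.memLp ha
  have Ly := hv.toReg.pc.memLpy ha ha'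
  have Lz := SG.memLp ha (by linarith) (hv.toReg.sgZ ha') hv.toReg.sm.contOn_Zv.aesm_mu
  have Lq : MemLp (fun z => κ * v z - Zv v z) 2 (mu a) := (Lv.const_mul κ).sub Lz
  have Lω : ∀ i, MemLp (dd (Pi.single i 1 - e i • e) v) 2 (mu a) := fun i => hv.toReg.memLp_dd ha _
  have I0 := integrable_mul2 (memLp_weighted hΦ hΦB Lm) Lv
  have I1 := integrable_mul2 (memLp_weighted hΦ hΦB Lm) Lq
  have I2 := integrable_mul2 (memLp_weighted hΦ hΦB Lym) Ly
  have I3 : ∀ i, Integrable (fun z => Φ z.1 * (z.1 i * mt a τ z.2) * dd (Pi.single i 1 - e i • e) v z) (mu a) :=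
    fun i => integrable_mul2 (memLp_weighted hΦ hΦB (Lxm i)) (Lω i)
  have J0 := cauchy_schwarz_weighted hΦ hΦB Lk Ly
  have J1 := cauchy_schwarz_weighted hΦ hΦB Lm Lq
  have J2 := cauchy_schwarz_weighted hΦ hΦB Lym Ly
  have J3 := fun i => cauchy_schwarz_weighted hΦ hΦB (Lxm i) (Lω i)
  have hX_eq : ∫ z, dd e v z * (φ z.1 * mt a τ z.2) ∂mu a = (-κ * ∫ z, Φ z.1 * mt a τ z.2 * v z ∂mu a)
      + (∫ z, Φ z.1 * mt a τ z.2 * (κ * v z - Zv v z) ∂mu a)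
      + (∫ z, Φ z.1 * (z.2 * mt a τ z.2) * Dy v z ∂mu a)
      + ∑ i, ∫ z, Φ z.1 * (z.1 i * mt a τ z.2) * dd (Pi.single i 1 - e i • e) v z ∂mu a := by
    have I01 : Integrable (fun z => -κ * (Φ z.1 * mt a τ z.2 * v z) + Φ z.1 * mt a τ z.2 * (κ * v z - Zv v z)) (mu a) :=
      (I0.const_mul (-κ)).add I1
    have I012 : Integrable (fun z => -κ * (Φ z.1 * mt a τ z.2 * v z) + Φ z.1 * mt a τ z.2 * (κ * v z - Zv v z)
        + Φ z.1 * (z.2 * mt a τ z.2) * Dy v z) (mu a) := I01.add I2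
    rw [← integral_const_mul, ← integral_finsetSum _ fun i _ => I3 i, ← integral_add (I0.const_mul (-κ)) I1,
      ← integral_add I01 I2, ← integral_add I012 (integrable_finsetSum _ fun i _ => I3 i)]
    congr 1; ext z
    have h1 : ∑ i, Φ z.1 * (z.1 i * mt a τ z.2) * dd (Pi.single i 1 - e i • e) v z =
        Φ z.1 * mt a τ z.2 * ((∑ i, z.1 i * Dx i v z) - (∑ i, e i * z.1 i) * dd e v z) := by
      rw [sum_mul, ← sum_sub_distrib, mul_sum]
      refine sum_congr rfl fun i _ => ?_
      rw [fdd_decomp]; ring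
    rw [h1, (hB z.1).2.2]
    unfold Zv; ring
  have htr := hv.toReg.pc.trace hτ ha ha' hv.toReg.lim_thin hΦ hΦB
  have hpos : 0 ≤ cY a * ∫ x, Φ x * v (x, 0) ∂(gamn n) :=
    mul_nonneg (cY_pos ha).le (integral_nonneg fun x => mul_nonneg (hB x).1 (hv.fnn x))
  rw [htr] at hpos
  have hcomm : ∫ z, Φ z.1 * v z * mt a τ z.2 ∂mu a = ∫ z, Φ z.1 * mt a τ z.2 * v z ∂mu a :=
    integral_congr_ae (Eventually.of_forall fun z => by ring)
  rw [hcomm] at hpos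
  have hsum := sq_sum_le_card_mul_sum_sq (s := Finset.univ)
    (f := fun i => ∫ z, Φ z.1 * (z.1 i * mt a τ z.2) * dd (Pi.single i 1 - e i • e) v z ∂mu a)
  rw [card_univ, Fintype.card_fin] at hsum
  have hsum2 := hsum.trans (mulL (sum_le_sum fun i _ => J3 i) (Nat.cast_nonneg n))
  simp only [mul_assoc, ← mul_sum] at hsum2
  rw [hX_eq] at hX ⊢
  simp only [mul_assoc] at hX J0 J1 J2 hpos ⊢
  generalize ∑ i, ∫ z, Φ z.1 * (z.1 i * (mt a τ z.2 * dd (Pi.single i 1 - e i • e) v z)) ∂mu a = S at *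
  generalize ∑ i, (∫ z : E n, (z.1 i * mt a τ z.2) ^ 2 ∂mu a) * N₂ a (dd (Pi.single i 1 - e i • e) v) = SS at *
  generalize ∫ z, Φ z.1 * (mt a τ z.2 * v z) ∂mu a = V at *
  generalize ∫ z, Φ z.1 * (mt a τ z.2 * (κ * v z - Zv v z)) ∂mu a = Q at *
  generalize ∫ z, Φ z.1 * (z.2 * (mt a τ z.2 * Dy v z)) ∂mu a = Y at *
  generalize ∫ z, Φ z.1 * (kk a τ z.2 * Dy v z) ∂mu a = K at *
  have hle : -κ * V + (Q + (Y + S)) ≤ -κ * K + Q + Y + S := by nlinarith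
  have h4 : (-κ * K + Q + Y + S) ^ 2 ≤ 4 * (κ ^ 2 * K ^ 2 + Q ^ 2 + Y ^ 2 + S ^ 2) := by
    nlinarith [ sq_nonneg (-κ * K - S), sq_nonneg (Q - Y), sq_nonneg (Q - S), sq_nonneg (Y - S)]
  have h5 := pow_le_pow_left₀ (by linarith) hle 2
  have h6 := mulL J0 (sq_nonneg κ)
  have e1 : -κ * V + (Q + (Y + S)) = -κ * V + Q + Y + S := by ring
  nlinarith

set_option maxHeartbeats 1000000 in
lemma Prof.moment_le (ha : -1 < a) (ha' : a < 1) {v : E n → ℝ} {T} (hv : Prof a v T) {κ s θ μ γ δ B c ε τ : ℝ}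
    (hκ : 0 ≤ κ) (hκ2 : κ < 2) (hs1 : s ≤ 1) (hθ : 0 < θ) (hθ' : θ < 1) (hτ : 0 < τ)
    (hμ : (1 + θ) / (1 - θ) * ((κ - 1) / 2 + θ) ≤ μ) (hμ2 : μ < 1 / 2) (hγ : 0 < γ) (hγμ : 2 * γ = s / 2 - μ) (hc : 0 < c)
    (hδ : 0 ≤ δ) (hδc : 2 * δ ≤ γ * c) (hε : B ^ 2 * ε ≤ γ / 4 * (c ^ 2 * θ))
    (hk : ∫ z : E n, kk a τ z.2 ^ 2 ∂mu a ≤ ε) (hm : ∫ z : E n, (z.2 * mt a τ z.2) ^ 2 ∂mu a ≤ ε)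
    {e : V n} {r : ℝ} (he : ∑ i, e i ^ 2 = 1) (hr : 0 ≤ r) (hM : ∀ i, ∫ z, v z * z.1 i ∂mu a = r * e i)
    {P Py g : E n → ℝ} {Px : Fin n → E n → ℝ} {φ Φ : V n → ℝ} (hP : PG n a P Px Py g)
    (hφ : Continuous φ) (hΦ : Continuous Φ)
    (hB : ∀ x, |φ x| ≤ B ∧ 0 ≤ Φ x ∧ Φ x ≤ B ∧ φ x = -(Φ x * ∑ i, e i * x i))
    (hflux : ∀ x, Tendsto (fun y => y ^ a * Py (x, y)) (𝓝[>] 0) (𝓝 (φ x)))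
    (hg : ∀ z ∈ Hs n, 0 ≤ g z + s / 2 * P z ∧ g z + s / 2 * P z ≤ δ)
    (hcP : c ≤ ∫ z, P z ∂mu a) (hdir : dirich a Px Py ≤ s / 2 * N₂ a P) {L M R : ℝ}
    (hL : L = (1 + θ) / (1 - θ) * ((10 + 2 * n) / (2 * θ))) (hSG : M = ∑ i, ∫ z : E n, (z.1 i * mt a τ z.2) ^ 2 ∂mu a)
    (hR : 5 * ε * (2 * N₂ a v + N₂ a (defect a κ v)) + (∫ z : E n, mt a τ z.2 ^ 2 ∂mu a) *
      (∫ z, (κ * v z - Zv v z) ^ 2 ∂mu a) + n * (M * (L / (1 / 2 - μ) * N₂ a (defect a κ v))) = R) :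
    r ^ 2 ≤ 8 / γ * (L * N₂ a (defect a κ v) + 16 * B ^ 2 / (γ * c ^ 2) * R) := by
  have hprob := prob_mu n ha
  have hΛ : 0 < (1 + θ) / (1 - θ) := div_pos (by linarith) (by linarith)
  have hL0 : 0 ≤ L := by rw [hL]; positivity
  have hA0 := integral_sq (m := mu a) (defect a κ v)
  have hV0 := integral_sq (m := mu a) v
  have hQ0 : 0 ≤ ∫ z, (κ * v z - Zv v z) ^ 2 ∂mu a := integral_sq _
  have hG0 : 0 ≤ ∫ z : E n, mt a τ z.2 ^ 2 ∂mu a := integral_sq _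
  have hε0 := le_trans (integral_sq _) hk
  have hΩ : ∀ i, N₂ a (dd (Pi.single i 1 - e i • e) v) ≤ L / (1 / 2 - μ) * N₂ a (defect a κ v) := by
    intro i
    have hd : ∀ f : V n, ∑ j, (Pi.single i 1 - e i • e : V n) j * f j = f i - e i * ∑ j, e j * f j := fun f => by
      simp [sub_mul, mul_assoc, ← mul_sum, Pi.single_apply]
    have hde : ∑ j, (Pi.single i 1 - e i • e : V n) j * e j = 0 := by rw [hd]; simp [← sq, he]
    have hone : ∑ j, (Pi.single i 1 - e i • e : V n) j ^ 2 ≤ 1 := by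
      simp only [sq]
      rw [hd, sum_congr rfl fun j _ => mul_comm (e j) _, hde]
      simp [mul_self_nonneg]
    have hz : ∫ z, dd (Pi.single i 1 - e i • e) v z ∂mu a = 0 := by
      rw [hv.toReg.integral_dd ha ha']
      simp_rw [hM, mul_left_comm _ r, ← mul_sum, hde, mul_zero]
    have h := hv.core ha ha' κ hone hθ hθ' hτ hP hφ (fun x => (hB x).1) hflux 0
    rw [hz] at h
    have hΩ0 := integral_sq (m := mu a) (dd (Pi.single i 1 - e i • e) v)
    generalize N₂ a (dd (Pi.single i 1 - e i • e) v) = Ω at *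
    have h3 := mulR hμ hΩ0
    rw [div_mul_eq_mul_div, le_div_iff₀ (by linarith), hL]
    linear_combination h + h3
  have hm2 : ∫ z, dd e v z ∂mu a = r / 2 := by
    rw [hv.toReg.integral_dd ha ha']
    simp_rw [hM, mul_left_comm _ r, ← mul_sum, ← sq, he]
    ring
  have Lw := hv.toReg.memLp_dd ha e
  have LP := hP.pc.memLp ha
  have Lg := hP.memLp ha
  set p := ∫ z, P z ∂mu a with hp
  have hp0 := hc.trans_le hcP
  have hcore := hv.core ha ha' κ he.le hθ hθ' hτ hP hφ (fun x => (hB x).1) hflux (r / 2 / p)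
  rw [← hp, hm2, div_mul_cancel₀ _ hp0.ne', sub_self] at hcore
  have hmW : (r / 2) ^ 2 ≤ N₂ a (dd e v) := by
    have h := cauchy_schwarz Lw (memLp_const 1)
    simpa [hm2] using h
  have hX2 := fun h => hv.flux_le ha ha' hκ hτ e hΦ (fun x => (hB x).2) h
  have hDy : N₂ a (Dy v) ≤ 2 * N₂ a v + N₂ a (defect a κ v) := by
    have h1 := hv.dir_self ha ha' κ
    have h2 := young (hv.toReg.memLp_defect ha ha' κ) (hv.toReg.pc.memLp ha) one_pos
    have h3 : N₂ a (Dy v) ≤ dirich a (fun i => Dx i v) (Dy v) := by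
      unfold dirich
      have : 0 ≤ ∑ i, N₂ a (Dx i v) := sum_nonneg fun i _ => integral_sq _
      linarith
    have := (abs_le.1 h2).1
    have := mulR hκ2.le hV0
    linarith
  have Lk : MemLp (fun z : E n => kk a τ z.2) 2 (mu a) :=
    SG.memLp ha (by linarith) (kk_sg hτ) (ContinuousOn.aesm_mu kk_cont)
  have hkφ := integral_weighted_sq_le hφ (fun x => (hB x).1) Lk
  have hkφ' := hkφ.trans (mulL hk (sq_nonneg B))
  have Lerr : MemLp (fun z => g z + s / 2 * P z) 2 (mu a) := Lg.add (LP.const_mul _)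
  have herr1 : ∫ z, dd e v z * (g z + s / 2 * P z) ∂mu a = I₂ a (dd e v) g + s / 2 * I₂ a (dd e v) P := by
    rw [← integral_const_mul, ← integral_add (integrable_mul2 Lw Lg) ((integrable_mul2 Lw LP).const_mul _)]
    congr 1; ext z; ring
  have herr2 := cauchy_schwarz Lw Lerr
  have herr3 : ∫ z, (g z + s / 2 * P z) ^ 2 ∂mu a ≤ δ ^ 2 := by
    have h := integral_mono_ae Lerr.integrable_sq (integrable_const (δ ^ 2)) (by
      filter_upwards [mu_ae_mem n a] with z hz
      exact pow_le_pow_left₀ (hg z hz).1 (hg z hz).2 2)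
    simpa using h
  have hsqP := integral_sq_sub Lw (LP.const_mul (r / 2 / p))
  have hsqP0 : 0 ≤ ∫ z, (dd e v z - r / 2 / p * P z) ^ 2 ∂mu a := integral_sq _
  rw [hsqP] at hsqP0
  have h_a : ∫ z, dd e v z * (r / 2 / p * P z) ∂mu a = r / 2 / p * I₂ a (dd e v) P := by
    rw [← integral_const_mul]; congr 1; ext z; ring
  have h_b : ∫ z, (r / 2 / p * P z) ^ 2 ∂mu a = (r / 2 / p) ^ 2 * N₂ a P := by
    rw [← integral_const_mul]; congr 1; ext z; ring
  rw [h_a, h_b] at hsqP0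
  have hC0 : 0 ≤ r / 2 / p := by positivity
  have hCW : (r / 2 / p) ^ 2 * c ^ 2 ≤ N₂ a (dd e v) := by
    refine le_trans ?_ hmW
    rw [← mul_pow]
    refine pow_le_pow_left₀ (by positivity) ?_ 2
    rw [div_mul_eq_mul_div, div_le_iff₀ hp0]
    exact mulL hcP (by linarith)
  have hSM : ∑ i, (∫ z : E n, (z.1 i * mt a τ z.2) ^ 2 ∂mu a) * N₂ a (dd (Pi.single i 1 - e i • e) v) ≤
      M * (L / (1 / 2 - μ) * N₂ a (defect a κ v)) := by
    rw [hSG, sum_mul]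
    exact sum_le_sum fun i _ => mulL (hΩ i) (integral_sq _)
  have hSG0 : 0 ≤ M * (L / (1 / 2 - μ) * N₂ a (defect a κ v)) :=
    mul_nonneg (hSG ▸ sum_nonneg fun i _ => integral_sq _) (mul_nonneg (div_nonneg hL0 (by linarith)) hA0)
  have hDy0 := integral_sq (m := mu a) (Dy v)
  have hW0 := integral_sq (m := mu a) (dd e v)
  rw [herr1] at herr2
  have hk2 : κ ^ 2 * (∫ z : E n, kk a τ z.2 ^ 2 ∂mu a) + ∫ z : E n, (z.2 * mt a τ z.2) ^ 2 ∂mu a ≤ 5 * ε := by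
    have hκ4 : κ ^ 2 ≤ 4 := (pow_le_pow_left₀ hκ hκ2.le 2).trans (by norm_num)
    have := mul_le_mul hκ4 hk (integral_sq _) (by norm_num)
    linarith
  have hX3 : 0 ≤ ∫ z, dd e v z * (φ z.1 * mt a τ z.2) ∂mu a →
      (∫ z, dd e v z * (φ z.1 * mt a τ z.2) ∂mu a) ^ 2 ≤ 4 * B ^ 2 * R := fun h => by
    rw [← hR]
    exact (hX2 h).trans (mulL (add_le_add (add_le_add (mul_le_mul hk2 hDy hDy0 (by positivity)) le_rfl)
      (mulL hSM (Nat.cast_nonneg n))) (by positivity))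
  have hR0 : 0 ≤ R := by rw [← hR]; positivity
  have hcore2 : (1 + θ) / (1 - θ) * (((κ - 1) / 2 + θ) * N₂ a (dd e v) + (10 + 2 * n) / (2 * θ) * N₂ a (defect a κ v)) ≤
      μ * N₂ a (dd e v) + L * N₂ a (defect a κ v) := by
    rw [hL]
    linear_combination mulR hμ hW0
  have hcore3 := hcore.trans (add_le_add (add_le_add (add_le_add (add_le_add hcore2 le_rfl) le_rfl)
    (mulL hkφ' (by positivity))) (mulL hdir (by positivity)))
  have herr4 := herr2.trans (mulL herr3 hW0)
  clear hcore hcore2 hX2 hkφ hkφ' herr2 herr3 hSM hSG0 hdir hk2 hDy hDy0 hΩ hg hB hR hSG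
  generalize ∫ z, dd e v z * (φ z.1 * mt a τ z.2) ∂mu a = X at *
  generalize N₂ a (dd e v) = W at *
  generalize I₂ a (dd e v) P = wP at *
  generalize I₂ a (dd e v) g = wg at *
  generalize N₂ a P = P2 at *
  generalize N₂ a (defect a κ v) = A at *
  generalize r / 2 / p = C at *
  have hLA := mul_nonneg hL0 hA0
  have h1 : C * (wg + s / 2 * wP) ≤ W * δ / c := by
    refine abs_le_of_sq_le_sq' ?_ (by positivity) |>.2
    rw [div_pow, le_div_iff₀ (by positivity)]
    have := mul_le_mul hCW herr4 (sq_nonneg _) hW0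
    linear_combination this
  have h2 : W * δ / c ≤ W * (γ / 2) := by
    rw [mul_div_assoc]
    refine mulL ?_ hW0
    rw [div_le_iff₀ hc]; linarith
  have h3 : C ^ 2 / θ * (B ^ 2 * ε) ≤ γ / 4 * W := by
    rw [div_mul_eq_mul_div, div_le_iff₀ hθ]
    have h31 := mulL hε (sq_nonneg C)
    have h32 := mulL hCW (show 0 ≤ γ / 4 * θ by positivity)
    linear_combination h31 + h32
  have h4 : (s / 2) * W ≤ μ * W + L * A + 2 * (C * (wg + s / 2 * wP)) + 2 * (C * X) + C ^ 2 / θ * (B ^ 2 * ε) := by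
    linear_combination hcore3 + (1 - s) / 2 * hsqP0
  have h5 : 2 * (C * X) ≤ γ / 4 * W + 16 * B ^ 2 / (γ * c ^ 2) * R := by
    rcases le_total X 0 with hx | hx
    · have := mul_nonneg hC0 (neg_nonneg.2 hx)
      have : 0 ≤ γ / 4 * W + 16 * B ^ 2 / (γ * c ^ 2) * R := by positivity
      linarith
    · have h51 := hX3 hx
      have h52 : 2 * (C * X) ≤ γ / 4 * (C ^ 2 * c ^ 2) + 4 / (γ * c ^ 2) * X ^ 2 := by
        have h53 : γ / 4 * (C ^ 2 * c ^ 2) + 4 / (γ * c ^ 2) * X ^ 2 - 2 * (C * X) =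
            (γ * c ^ 2 * C - 4 * X) ^ 2 / (4 * γ * c ^ 2) := by field_simp; ring
        have : 0 ≤ (γ * c ^ 2 * C - 4 * X) ^ 2 / (4 * γ * c ^ 2) := by positivity
        linarith
      have h54 := mulL h51 (show 0 ≤ 4 / (γ * c ^ 2) by positivity)
      have h55 := mulL hCW (show 0 ≤ γ / 4 by positivity)
      have h56 : 16 * B ^ 2 / (γ * c ^ 2) * R = 4 / (γ * c ^ 2) * (4 * B ^ 2 * R) := by ring
      linarith
  have h6 : γ / 2 * W ≤ L * A + 16 * B ^ 2 / (γ * c ^ 2) * R := by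
    have : 2 * γ * W = (s / 2 - μ) * W := by rw [hγμ]
    linarith
  calc r ^ 2 ≤ 4 * W := by linarith
    _ = 8 / γ * (γ / 2 * W) := by field_simp; ring
    _ ≤ _ := mulL h6 (by positivity)

lemma moment_small (hn : 1 ≤ n) {s : ℝ} (hs : 0 < s) (hs' : s < 1) {κ : ℝ} (h1 : 1 < κ) (h2 : κ < 1 + s) {η : ℝ}
    (hη : 0 < η) : ∃ K, 0 ≤ K ∧ ∀ v T, Prof (n := n) 𝔟 s v T → ∑ i, (∫ z, v z * z.1 i ∂mu 𝔟 s) ^ 2 ≤ η * N₂ 𝔟 s v +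
        K * (N₂ 𝔟 s (defect 𝔟 s κ v) + ∫ z, (κ * v z - Zv v z) ^ 2 ∂mu 𝔟 s) := by
  have ha : -1 < 1 - 2 * s := by linarith
  have ha' : 1 - 2 * s < 1 := by linarith
  set μ := ((κ - 1) / 2 + s / 2) / 2 with hμ
  obtain ⟨θ, hθ, hθ', hθμ⟩ : ∃ θ : ℝ, 0 < θ ∧ θ < 1 ∧ (1 + θ) / (1 - θ) * ((κ - 1) / 2 + θ) ≤ μ := by
    have hc : ContinuousAt (fun θ => (1 + θ) / (1 - θ) * ((κ - 1) / 2 + θ)) 0 := by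
      refine ContinuousAt.mul (ContinuousAt.div (by fun_prop) (by fun_prop) (by norm_num)) (by fun_prop)
    have hl : (fun θ => (1 + θ) / (1 - θ) * ((κ - 1) / 2 + θ)) 0 < μ := by simp [hμ]; linarith
    obtain ⟨θ, h3, h4⟩ := (((hc.eventually_lt continuousAt_const hl).filter_mono nhdsWithin_le_nhds).and
      (Ioo_mem_nhdsGT (zero_lt_one' ℝ))).exists
    exact ⟨θ, h4.1, h4.2, h3.le⟩
  set γ := (s / 2 - μ) / 2 with hγ
  have hγ0 : 0 < γ := by rw [hγ, hμ]; linarith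
  have hc := cP_pos (n := n) hs hs'
  set c := cP n s
  obtain ⟨t, ht, htδ⟩ : ∃ t : ℝ, 0 < t ∧ 2 * (2 * t) ^ s ≤ γ * c := by
    refine ⟨(γ * c / 2) ^ s⁻¹ / 2, by positivity, ?_⟩
    rw [mul_div_cancel₀ _ (by norm_num), ← rpow_mul (by positivity), inv_mul_cancel₀ hs.ne', rpow_one]
    linarith
  obtain ⟨B, hB0, hprofile⟩ := exists_profile hs hs' ht
  obtain ⟨ε, hε, hε1, hε2⟩ : ∃ ε : ℝ, 0 < ε ∧ B ^ 2 * ε ≤ γ / 4 * (c ^ 2 * θ) ∧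
      8 / γ * (16 * B ^ 2 / (γ * c ^ 2) * (5 * ε * 2)) ≤ η := by
    have hc2 : ContinuousAt (fun ε => 8 / γ * (16 * B ^ 2 / (γ * c ^ 2) * (5 * ε * 2))) 0 := by fun_prop
    have hc1 : ContinuousAt (fun ε => B ^ 2 * ε) 0 := by fun_prop
    obtain ⟨ε, ⟨h3, h4⟩, h5⟩ := ((((hc1.eventually_lt continuousAt_const (by simp; positivity :
      B ^ 2 * 0 < γ / 4 * (c ^ 2 * θ))).and (hc2.eventually_lt continuousAt_const (by simpa using hη))).filter_mono
        nhdsWithin_le_nhds).and self_mem_nhdsWithin : ∀ᶠ ε in 𝓝[>] (0:ℝ), _).exists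
    exact ⟨ε, h5, h3.le, h4.le⟩
  obtain ⟨τ, hτ, hk, hm⟩ := exists_small_weight n ha ha' hε
  set L := (1 + θ) / (1 - θ) * ((10 + 2 * n) / (2 * θ)) with hL
  have hL0 : 0 ≤ L := mul_nonneg (div_nonneg (by linarith) (by linarith)) (by positivity)
  set G := ∫ z : E n, mt 𝔟 s τ z.2 ^ 2 ∂mu 𝔟 s with hG
  set SG := ∑ i, ∫ z : E n, (z.1 i * mt 𝔟 s τ z.2) ^ 2 ∂mu 𝔟 s with hSG
  have hG0 : 0 ≤ G := integral_sq _
  have hSG0 : 0 ≤ SG := sum_nonneg fun i _ => integral_sq _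
  have hμ2 : μ < 1 / 2 := by rw [hμ]; linarith
  have hμ3 : 0 < 1 / 2 - μ := by linarith
  refine ⟨8 / γ * (L + 16 * B ^ 2 / (γ * c ^ 2) * (5 * ε + G + n * (SG * (L / (1 / 2 - μ))))), by positivity,
    fun v T hv => ?_⟩
  obtain ⟨e, r, he, hr, hM⟩ := exists_direction hn fun i => ∫ z, v z * z.1 i ∂mu 𝔟 s
  obtain ⟨P, Px, Py, g, φ, Φ, hP, hφ, hΦ, hφB, hflux, hPg, hcP, hdir⟩ := hprofile e he
  have h := hv.moment_le ha ha' (by linarith) (by linarith) hs'.le hθ hθ' hτ hθμ hμ2 hγ0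
    (by rw [hγ]; ring) hc (by positivity) htδ hε1 hk hm he hr hM hP hφ hΦ hφB hflux (fun z hz => (hPg z hz).2) hcP hdir hL hSG rfl
  have hsum : ∑ i, (∫ z, v z * z.1 i ∂mu 𝔟 s) ^ 2 = r ^ 2 := by
    simp only [hM, mul_pow, ← mul_sum, he, mul_one]
  rw [← hG] at h
  rw [hsum]
  refine h.trans ?_
  have hA0 : 0 ≤ N₂ 𝔟 s (defect 𝔟 s κ v) := integral_sq _
  have hV0 : 0 ≤ N₂ 𝔟 s v := integral_sq _
  have hQ0 : 0 ≤ ∫ z, (κ * v z - Zv v z) ^ 2 ∂mu 𝔟 s := integral_sq _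
  generalize N₂ 𝔟 s (defect 𝔟 s κ v) = A at *
  generalize N₂ 𝔟 s v = V at *
  generalize ∫ z, (κ * v z - Zv v z) ^ 2 ∂mu 𝔟 s = Q at *
  have h3 := mulR hε2 hV0
  have h4 : 0 ≤ 8 / γ * (L * Q + 16 * B ^ 2 / (γ * c ^ 2) * (5 * ε * Q + G * A + n * (SG * (L / (1 / 2 - μ))) * Q)) := by
    positivity
  linear_combination h3 + h4

lemma tendsto_exp_mul_atBot {c : ℝ} (hc : 0 < c) (C : ℝ) : Tendsto (fun t => C * exp (c * t)) atBot (𝓝 0) := by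
  have h := (tendsto_exp_atBot.comp (tendsto_id.const_mul_atBot hc)).const_mul C
  simpa using h

lemma eventually_abs_sub_le {p p' : ℝ → ℝ} {L : ℝ} (hp : ∀ᶠ t in atBot, HasDerivAt p (p' t) t)
    (hL : Tendsto p' atBot (𝓝 L)) {δ : ℝ} (hδ : 0 < δ) : ∀ᶠ t in atBot, |p t - L * t| ≤ δ * |t| := by
  obtain ⟨t₀, h⟩ := eventually_atBot.1 ((hp.and (hL.eventually (Metric.ball_mem_nhds L (half_pos hδ)))).and
    (eventually_le_atBot 0))
  filter_upwards [eventually_le_atBot t₀, eventually_le_atBot (-(|p t₀ - L * t₀| / (δ / 2)))] with t ht ht'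
  have h0 := (h t ht).2
  have hm := (convex_Iic t₀).norm_image_sub_le_of_norm_hasDerivWithin_le (f := fun t => p t - L * t)
    (f' := fun t => p' t - L * 1) (fun x hx => ((h x hx).1.1.sub ((hasDerivAt_id' x).const_mul L)).hasDerivWithinAt)
    (fun x hx => by have := (h x hx).1.2; simpa [← dist_eq] using (show dist (p' x) L < δ / 2 from this).le)
    (Set.self_mem_Iic) (Set.mem_Iic.2 ht)
  simp only [norm_eq_abs] at hm
  have h1 : |p t₀ - L * t₀| ≤ δ / 2 * |t| := by
    rw [abs_of_nonpos h0, ← div_le_iff₀' (half_pos hδ)]; linarith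
  have h2 : |t - t₀| ≤ |t| := by
    rw [abs_of_nonpos h0, abs_of_nonpos (by linarith)]; linarith [(h t₀ le_rfl).2]
  have h3 := mulL h2 (half_pos hδ).le
  grind

lemma exists_slow {N N' φ φ' W : ℝ → ℝ} {t₀ C c κ : ℝ} (hc : 0 < c) (hC : 0 ≤ C)
    (hN : ∀ t < t₀, HasDerivAt N (N' t) t) (hN' : ∀ t < t₀, 1 / 2 * W t - C * exp (c * t) ≤ N' t)
    (hW : ∀ t, 0 ≤ W t) (hN0 : ∀ t, 0 ≤ N t) (hφ : ∀ t < t₀, HasDerivAt φ (φ' t) t)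
    (hφ' : ∀ t < t₀, |φ' t - 4 * N t| ≤ C * exp (c * t))
    (hgrow : ∀ δ > 0, ∀ᶠ t in atBot, |φ t - 2 * κ * t| ≤ δ * |t|) {ε : ℝ} (hε : 0 < ε) :
    ∃ᶠ t in atBot, W t ≤ ε ∧ |2 * N t - κ| ≤ ε := by
  have hexp := tendsto_exp_mul_atBot hc (C / c)
  have hexp' := tendsto_exp_mul_atBot hc C
  set M : ℝ → ℝ := fun t => N t + C / c * exp (c * t) with hM
  have hMd : ∀ t < t₀, HasDerivAt M (N' t + C * exp (c * t)) t := fun t ht => by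
    refine ((hN t ht).add ((((hasDerivAt_id t).const_mul c).exp).const_mul (C / c))).congr_deriv ?_
    simp only [id]; field_simp
  have hM0 : ∀ t, 0 ≤ M t := fun t => add_nonneg (hN0 t) (by positivity)
  have hslope : ∀ {η t₁ : ℝ}, t₁ < t₀ → (∀ t < t₁, η ≤ W t) → ∀ t < t₁, η / 2 * (t₁ - t) ≤ M t₁ - M t := by
    intro η t₁ h1 h2 t ht
    obtain ⟨ξ, hξ, hξ'⟩ := exists_hasDerivAt_eq_slope M (fun t => N' t + C * exp (c * t)) ht
      (fun x hx => (hMd x (hx.2.trans_lt h1)).continuousAt.continuousWithinAt) (fun x hx => hMd x (hx.2.trans h1))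
    rw [eq_div_iff (by linarith)] at hξ'
    rw [← hξ']
    gcongr
    linarith [hN' ξ (hξ.2.trans h1), h2 ξ hξ.2]
  obtain ⟨N₀, hN₀⟩ : ∃ N₀, Tendsto N atBot (𝓝 N₀) := by
    have hmono : Monotone fun t => M (min t (t₀ - 1)) := fun x y hxy => by
      rcases (min_le_min_right (t₀ - 1) hxy).lt_or_eq with h | h
      · have := hslope (η := 0) (t₁ := min y (t₀ - 1)) ((min_le_right _ _).trans_lt (by linarith)) (fun t _ => hW t) _ h
        simp only; linarith
      · simp only [h]; exact le_rfl
    have h1 := tendsto_atBot_ciInf hmono ⟨0, by rintro _ ⟨x, rfl⟩; exact hM0 _⟩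
    have h2 := h1.sub hexp
    refine ⟨_, h2.congr' ?_⟩
    filter_upwards [Iio_mem_atBot (t₀ - 1)] with t ht
    rw [min_eq_left (le_of_lt ht)]
    simp only [hM]; ring
  have h2N : 2 * N₀ = κ := by
    by_contra hne
    have hpos : 0 < |4 * N₀ - 2 * κ| := abs_pos.2 fun h => hne (by linarith)
    set δ := |4 * N₀ - 2 * κ| / 4 with hδ
    have hδ0 : 0 < δ := by positivity
    have hlim : Tendsto φ' atBot (𝓝 (4 * N₀)) := by
      have h1 : Tendsto (fun t => φ' t - 4 * N t) atBot (𝓝 0) :=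
        squeeze_zero_norm' (by filter_upwards [Iio_mem_atBot t₀] with t ht using hφ' t ht) hexp'
      have h2 := h1.add (hN₀.const_mul 4)
      simpa using h2
    obtain ⟨t, ⟨hg, h1⟩, ht⟩ := (((hgrow δ hδ0).and (eventually_abs_sub_le ((eventually_lt_atBot t₀).mono hφ) hlim hδ0)).and
      (eventually_lt_atBot 0)).exists
    have h2 : |(4 * N₀ - 2 * κ) * t| ≤ |φ t - 2 * κ * t| + |φ t - 4 * N₀ * t| := by
      rw [show (4 * N₀ - 2 * κ) * t = (φ t - 2 * κ * t) - (φ t - 4 * N₀ * t) by ring]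
      exact abs_sub _ _
    rw [abs_mul, show |4 * N₀ - 2 * κ| = 4 * δ by rw [hδ]; ring] at h2
    have h3 := mul_pos hδ0 (abs_pos.2 ht.ne)
    linarith
  intro hcon
  have hev : ∀ᶠ t in atBot, |2 * N t - κ| ≤ ε := by
    have h1 : Tendsto (fun t => |2 * N t - κ|) atBot (𝓝 0) := by
      have := ((hN₀.const_mul 2).sub_const κ).abs
      rwa [h2N, sub_self, abs_zero] at this
    exact h1.eventually_le_const hε
  obtain ⟨t₁, ht₁⟩ := eventually_atBot.1 ((hcon.and hev).and (eventually_lt_atBot t₀))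
  have h1 := hslope (η := ε) (ht₁ t₁ le_rfl).2 (fun t ht => by
    by_contra h
    exact (ht₁ t ht.le).1.1 ⟨(not_le.1 h).le, (ht₁ t ht.le).1.2⟩)
  have h2 := h1 (t₁ - (2 * M t₁ / ε + 1)) (by have := hM0 t₁; have : 0 ≤ 2 * M t₁ / ε := by positivity
                                              linarith)
  have h3 : ε / 2 * (t₁ - (t₁ - (2 * M t₁ / ε + 1))) = M t₁ + ε / 2 := by field_simp; ring
  linarith [hM0 (t₁ - (2 * M t₁ / ε + 1))]

lemma Reg.abs_Zv_le (ha' : a < 1) {f : E n → ℝ} {T} (hf : Reg a f T) :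
    ∃ C, 0 ≤ C ∧ ∀ z ∈ Hs n, |Zv f z| ≤ C * (√(nq z) + √(nq z) ^ (1 - a)) := by
  obtain ⟨C, hC⟩ := hf.bx
  obtain ⟨D, hD⟩ := hf.bY
  refine ⟨n * |C| + |D|, by positivity, fun z hz => ?_⟩
  have hz0 : 0 < z.2 := hz
  have h1 : |∑ i, z.1 i * Dx i f z| ≤ ∑ _i : Fin n, √(nq z) * |C| :=
    (abs_sum_le_sum_abs _ _).trans (sum_le_sum fun i _ => by
      rw [abs_mul]
      exact mul_le_mul (abs_le_sqrt (sq_le_nq z i)) ((hC i z hz).trans (le_abs_self C)) (abs_nonneg _) (sqrt_nonneg _))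
  have h2 : |z.2 * Dy f z| ≤ √(nq z) ^ (1 - a) * |D| := by
    have e : z.2 * Dy f z = z.2 ^ (1 - a) * (z.2 ^ a * Dy f z) := by
      rw [← mul_assoc, ← rpow_add hz0]; simp
    rw [e, abs_mul, abs_of_pos (rpow_pos_of_pos hz0 _)]
    exact mul_le_mul (rpow_le_rpow hz0.le ((le_abs_self _).trans (abs_le_sqrt (snd_sq_le_nq z)))
      (by linarith)) ((hD z hz).trans (le_abs_self _)) (abs_nonneg _) (by positivity)
  rw [Finset.sum_const, card_univ, Fintype.card_fin, nsmul_eq_mul] at h1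
  have h3 : 0 ≤ √(nq z) ^ (1 - a) := by positivity
  refine (abs_add_le _ _).trans ((add_le_add h1 h2).trans ?_)
  have := mul_nonneg (sqrt_nonneg (nq z)) (abs_nonneg D)
  have := mul_nonneg h3 (mul_nonneg n.cast_nonneg (abs_nonneg C))
  linarith

lemma Reg.bdd_Zv (ha' : a < 1) {f : E n → ℝ} {T} (hf : Reg a f T) : ∃ C, 0 ≤ C ∧ ∀ z ∈ Hs n, |Zv f z| ≤ C := by
  obtain ⟨R, -, hR⟩ := hf.supp_ev
  obtain ⟨C, hC0, hC⟩ := hf.abs_Zv_le ha'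
  refine ⟨C * (√R + √R ^ (1 - a)), by positivity, fun z hz => ?_⟩
  rcases le_total R (nq z) with h | h
  · rw [Zv_eq, (hR z h).fderiv_eq]; simp; positivity
  · have := sub_nonneg.2 ha'.le
    exact (hC z hz).trans (by gcongr)

/-- The backward Ornstein-Uhlenbeck operator. -/
abbrev ou (a : ℝ) (f : E n → ℝ) (z : E n) : ℝ := lapa a f z - 1 / 2 * Zv f z

lemma Prof.energy_le (ha : -1 < a) (ha' : a < 1) {v w : E n → ℝ} {T S} (hv : Prof a v T) (hw : Prof a w S) :
    -2 * ∫ z, ou a v z * (w z - v z) ∂mu a ≤ dirich a (fun i => Dx i w) (Dy w) - dirich a (fun i => Dx i v) (Dy v) := by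
  have h1 := hv.toReg.green ha ha' hw.toReg.pc hw.toReg.lim_thin
  have h2 := hv.toReg.green ha ha' hv.toReg.pc hv.toReg.lim_thin
  simp only [hv.compl, integral_zero, mul_zero] at h2
  rw [← dirich_eq] at h2
  have h3 := dirich_sub ha ha' hw.toReg.pc hv.toReg.pc
  rw [dir2_comm] at h3
  have h4 : 0 ≤ dirich a (fun i z => Dx i w z - Dx i v z) (fun z => Dy w z - Dy v z) := by
    unfold dirich
    exact add_nonneg (sum_nonneg fun i _ => integral_sq _) (integral_sq _)
  have h5 : 0 ≤ cY a * ∫ x, T x * w (x, 0) ∂(gamn n) :=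
    mul_nonneg (cY_pos ha).le (integral_nonneg fun x => mul_nonneg (hv.Tnn x) (hw.fnn x))
  have hA := (hv.toReg.pg ha').memLp ha
  have h6 : ∫ z, ou a v z * (w z - v z) ∂mu a = (∫ z, ou a v z * w z ∂mu a) - ∫ z, ou a v z * v z ∂mu a := by
    rw [← integral_sub (integrable_mul2 hA (hw.toReg.pc.memLp ha)) (integrable_mul2 hA (hv.toReg.pc.memLp ha))]
    congr 1; ext z; ring
  rw [h6]; linarith

/-- Dilations in logarithmic scale. -/
def dl (u : E n → ℝ) (t : ℝ) : E n → ℝ := scl (exp t) u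

lemma Sm.hasDerivAt_dl {u : E n → ℝ} (hu : Sm u) {z : E n} (hz : z ∈ Hs n) (t : ℝ) :
    HasDerivAt (fun t => dl u t z) (Zv (dl u t) z) t := by
  have h1 : HasDerivAt (fun t => exp t • z) (exp t • z) t := (hasDerivAt_exp t).smul_const z
  have h2 := (hu.differentiableAt (smul_mem_Hs (exp_pos t) hz)).hasFDerivAt.comp_hasDerivAt t h1
  unfold dl
  rw [Zv_scl, Zv_eq]
  exact h2

section dynamics
variable {u : E n → ℝ} {T : V n → ℝ}

lemma Prof.dil (hu : Prof a u T) (t : ℝ) :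
    Prof a (dl u t) fun x => exp t ^ (1 - a) * T (exp t • x) := hu.scl (exp_pos t)

lemma Prof.hasDerivAt_sq (ha : -1 < a) (ha' : a < 1) (hu : Prof a u T) (t : ℝ) :
    HasDerivAt (fun t => N₂ a (dl u t)) (2 * I₂ a (dl u t) (Zv (dl u t))) t := by
  have hprob := prob_mu n ha
  obtain ⟨C, hC0, hC⟩ := hu.toReg.bdd_Zv ha'
  obtain ⟨B, hB⟩ := hu.toReg.bdd
  rw [← integral_const_mul]
  refine (hasDerivAt_integral_of_dominated_loc_of_deriv_le (μ := mu a) (F := fun t z => dl u t z ^ 2)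
    (F' := fun t z => 2 * (dl u t z * Zv (dl u t) z)) (x₀ := t) (s := univ) (bound := fun z => 2 * (B * C)) univ_mem ?_ ?_ ?_ ?_ ?_ ?_).2
  · exact Eventually.of_forall fun t => ((hu.dil t).toReg.pc.memLp ha).1.pow 2
  · exact ((hu.dil t).toReg.pc.memLp ha).integrable_sq
  · exact (((hu.dil t).toReg.pc.memLp ha).1.mul (hu.dil t).toReg.sm.contOn_Zv.aesm_mu).const_mul 2
  · filter_upwards [mu_ae_mem n a] with z hz x _
    rw [norm_eq_abs, abs_mul, abs_mul, abs_two]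
    have h1 := smul_mem_Hs (exp_pos x) hz
    refine mulL (mul_le_mul (hB _ (le_of_lt h1)) ?_ (abs_nonneg _)
      ((abs_nonneg _).trans (hB _ (le_of_lt h1)))) zero_le_two
    unfold dl; rw [Zv_scl]; exact hC _ h1
  · exact integrable_const _
  · filter_upwards [mu_ae_mem n a] with z hz x _
    refine ((hu.toReg.sm.hasDerivAt_dl hz x).pow 2).congr_deriv ?_
    norm_num; ring

lemma Prof.hasDerivAt_dirich (ha : -1 < a) (ha' : a < 1) (hu : Prof a u T) (t : ℝ) :
    HasDerivAt (fun t => dirich a (fun i => Dx i (dl u t)) (Dy (dl u t)))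
      (-2 * ∫ z, ou a (dl u t) z * Zv (dl u t) z ∂mu a) t := by
  have hprob := prob_mu n ha
  obtain ⟨C, hC0, hC⟩ := hu.toReg.bdd_Zv ha'
  obtain ⟨G, hG⟩ := hu.toReg.blap
  have hev : ∀ t, ∀ z ∈ Hs n, |Zv (dl u t) z| ≤ C := fun t z hz => by
    unfold dl; rw [Zv_scl]; exact hC _ (smul_mem_Hs (exp_pos _) hz)
  have hA : ∀ t, MemLp (ou a (dl u t)) 2 (mu a) := fun t => ((hu.dil t).toReg.pg ha').memLp ha
  have hlip : ∀ t t', ∀ z ∈ Hs n, |dl u t' z - dl u t z| ≤ C * |t' - t| := fun t t' z hz =>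
    Convex.norm_image_sub_le_of_norm_hasDerivWithin_le (s := univ) (f := fun t => dl u t z)
      (fun x _ => (hu.toReg.sm.hasDerivAt_dl hz x).hasDerivWithinAt) (fun x _ => hev x z hz) convex_univ trivial trivial
  set q : ℝ → ℝ := fun t' => ∫ z, ou a (dl u t) z * ((dl u t' z - dl u t z) / (t' - t)) ∂mu a with hq
  set p : ℝ → ℝ := fun t' => ∫ z, ou a (dl u t') z * ((dl u t' z - dl u t z) / (t' - t)) ∂mu a with hp
  set L := ∫ z, ou a (dl u t) z * Zv (dl u t) z ∂mu a with hL
  have hsl : ∀ z ∈ Hs n, Tendsto (fun t' => (dl u t' z - dl u t z) / (t' - t)) (𝓝[≠] t) (𝓝 (Zv (dl u t) z)) :=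
    fun z hz => (hasDerivAt_iff_tendsto_slope.1 (hu.toReg.sm.hasDerivAt_dl hz t)).congr fun x => slope_def_field _ _ _
  have hslb : ∀ t' ≠ t, ∀ z ∈ Hs n, |(dl u t' z - dl u t z) / (t' - t)| ≤ C := fun t' h z hz => by
    rw [abs_div, div_le_iff₀ (abs_pos.2 (sub_ne_zero.2 h))]; exact hlip t t' z hz
  have hAb : ∀ t' < t + 1, ∀ z ∈ Hs n, |ou a (dl u t') z| ≤ exp (t + 1) ^ 2 * |G| + C := fun t' h z hz => by
    refine (abs_sub _ _).trans (add_le_add ?_ ?_)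
    · unfold dl
      rw [lapa_scl (exp_pos _), abs_mul, abs_of_pos (by positivity)]
      exact mul_le_mul (pow_le_pow_left₀ (exp_pos _).le (exp_le_exp.2 h.le) 2)
        ((hG _ (smul_mem_Hs (exp_pos _) hz)).trans (le_abs_self _)) (abs_nonneg _) (by positivity)
    · rw [abs_mul, abs_of_pos (by norm_num : (0:ℝ) < 1 / 2)]
      linarith [hev t' z hz]
  have hAc : ∀ z ∈ Hs n, Tendsto (fun t' => ou a (dl u t') z) (𝓝[≠] t) (𝓝 (ou a (dl u t) z)) := fun z hz => by
    have h1 : ContinuousAt (fun t' => exp t' • z) t := by fun_prop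
    have h0 := (isOpen_Hs n).mem_nhds (smul_mem_Hs (exp_pos t) hz)
    have h2 : ContinuousAt (fun t' => lapa a u (exp t' • z)) t :=
      ContinuousAt.comp (f := fun t' => exp t' • z) (hu.toReg.sm.contOn_lapa.continuousAt h0) h1
    have h3 : ContinuousAt (fun t' => Zv u (exp t' • z)) t :=
      ContinuousAt.comp (f := fun t' => exp t' • z) (hu.toReg.sm.contOn_Zv.continuousAt h0) h1
    have h4 : ContinuousAt (fun t' => exp t' ^ 2 * lapa a u (exp t' • z) - 1 / 2 * Zv u (exp t' • z)) t :=
      ((by fun_prop : ContinuousAt (fun t' => exp t' ^ 2) t).mul h2).sub (h3.const_mul _)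
    unfold dl
    simp only [ou, lapa_scl (exp_pos _), Zv_scl]
    exact h4.tendsto.mono_left nhdsWithin_le_nhds
  have hslm : ∀ t', AEStronglyMeasurable (fun z => (dl u t' z - dl u t z) / (t' - t)) (mu a) := fun t' => by
    simp only [div_eq_mul_inv]
    exact (((hu.dil t').toReg.pc.memLp ha).1.sub ((hu.dil t).toReg.pc.memLp ha).1).mul_const _
  have hnear : ∀ᶠ t' in 𝓝[≠] t, t' < t + 1 := nhdsWithin_le_nhds (eventually_lt_nhds (by linarith))
  have gen : ∀ k : ℝ → ℝ, (∀ᶠ t' in 𝓝[≠] t, k t' < t + 1) →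
      (∀ z ∈ Hs n, Tendsto (fun t' => ou a (dl u (k t')) z) (𝓝[≠] t) (𝓝 (ou a (dl u t) z))) →
      Tendsto (fun t' => ∫ z, ou a (dl u (k t')) z * ((dl u t' z - dl u t z) / (t' - t)) ∂mu a) (𝓝[≠] t) (𝓝 L) := fun k hk hkc => by
    refine tendsto_integral_filter_of_dominated_convergence (fun _ => (exp (t + 1) ^ 2 * |G| + C) * C)
      (Eventually.of_forall fun t' => (hA _).1.mul (hslm t')) ?_ (integrable_const _) ?_
    · filter_upwards [hk, self_mem_nhdsWithin] with t' h1 h2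
      filter_upwards [mu_ae_mem n a] with z hz
      rw [norm_eq_abs, abs_mul]
      exact mul_le_mul (hAb _ h1 z hz) (hslb t' h2 z hz) (abs_nonneg _) (by positivity)
    · filter_upwards [mu_ae_mem n a] with z hz using (hkc z hz).mul (hsl z hz)
  have hpL : Tendsto p (𝓝[≠] t) (𝓝 L) := gen id hnear hAc
  have hqL : Tendsto q (𝓝[≠] t) (𝓝 L) :=
    gen (fun _ => t) (Eventually.of_forall fun _ => by linarith) fun _ _ => tendsto_const_nhds
  rw [hasDerivAt_iff_tendsto_slope]
  have hlim : Tendsto (fun t' => -2 * q t' + 2 * |p t' - q t'|) (𝓝[≠] t) (𝓝 (-2 * L)) := by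
    have := (hqL.const_mul (-2)).add ((hpL.sub hqL).abs.const_mul 2)
    simpa using this
  have hlim' : Tendsto (fun t' => -2 * q t' - 2 * |p t' - q t'|) (𝓝[≠] t) (𝓝 (-2 * L)) := by
    have := (hqL.const_mul (-2)).sub ((hpL.sub hqL).abs.const_mul 2)
    simpa using this
  have key : ∀ᶠ t' in 𝓝[≠] t, |slope (fun t => dirich a (fun i => Dx i (dl u t)) (Dy (dl u t))) t t' + 2 * q t'| ≤
      2 * |p t' - q t'| := by
    filter_upwards [self_mem_nhdsWithin] with t' ht'
    have hne : t' - t ≠ 0 := sub_ne_zero.2 ht'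
    have h1 := (hu.dil t).energy_le ha ha' (hu.dil t')
    have h2 := (hu.dil t').energy_le ha ha' (hu.dil t)
    have e1 : ∫ z, ou a (dl u t) z * (dl u t' z - dl u t z) ∂mu a = (t' - t) * q t' := by
      rw [hq, ← integral_const_mul]; congr 1; ext z; field_simp
    have e2 : ∫ z, ou a (dl u t') z * (dl u t z - dl u t' z) ∂mu a = -((t' - t) * p t') := by
      rw [hp, ← integral_const_mul, ← integral_neg]; congr 1; ext z; field_simp; ring
    rw [e1] at h1
    rw [e2] at h2
    rw [slope_def_field]
    generalize dirich a (fun i => Dx i (dl u t)) (Dy (dl u t)) = D1 at *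
    generalize dirich a (fun i => Dx i (dl u t')) (Dy (dl u t')) = D2 at *
    have e3 : (D2 - D1) / (t' - t) + 2 * q t' = (D2 - D1 + 2 * ((t' - t) * q t')) / (t' - t) := by field_simp
    rw [e3, abs_div, div_le_iff₀ (abs_pos.2 hne), abs_of_nonneg (by linarith), mul_assoc, ← abs_mul]
    have := neg_abs_le ((p t' - q t') * (t' - t))
    linarith
  refine tendsto_of_tendsto_of_tendsto_of_le_of_le' hlim' hlim ?_ ?_
  · filter_upwards [key] with t' h; linarith [(abs_le.1 h).1]
  · filter_upwards [key] with t' h; linarith [(abs_le.1 h).2]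

end dynamics

lemma Prof.exists_homogeneous (ha : -1 < a) (ha' : a < 1) {u : E n → ℝ} {T} (hu : Prof a u T) {κ : ℝ} (hκ : κ < 2)
    (hpos : ∀ᶠ t in atBot, 0 < N₂ a (dl u t))
    (hgrow : ∀ δ > 0, ∀ᶠ t in atBot, |log N₂ a (dl u t) - 2 * κ * t| ≤ δ * |t|)
    {ε : ℝ} (hε : 0 < ε) :
    ∃ᶠ t in atBot, ∫ z, (κ * dl u t z - Zv (dl u t) z) ^ 2 ∂mu a ≤ ε * N₂ a (dl u t) ∧
      N₂ a (defect a κ (dl u t)) ≤ ε * N₂ a (dl u t) := by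
  have hprob := prob_mu n ha
  obtain ⟨G, hG⟩ := hu.toReg.blap
  set c := 1 - κ / 2 with hc
  have hc0 : 0 < c := by rw [hc]; linarith
  obtain ⟨t₀, ht₀⟩ := eventually_atBot.1 ((hpos.and (hgrow (2 * c) (by linarith))).and (eventually_lt_atBot 0))
  have Lv : ∀ t, MemLp (dl u t) 2 (mu a) := fun t => (hu.dil t).toReg.pc.memLp ha
  have LZ : ∀ t, MemLp (Zv (dl u t)) 2 (mu a) := fun t =>
    SG.memLp ha (by linarith) ((hu.dil t).toReg.sgZ ha') (hu.dil t).toReg.sm.contOn_Zv.aesm_mu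
  have Lg : ∀ t, MemLp (lapa a (dl u t)) 2 (mu a) := fun t => by
    obtain ⟨C, hC⟩ := (hu.dil t).toReg.blap
    exact SG.memLp ha (by linarith) (SG.of_bdd hC) (hu.dil t).toReg.sm.contOn_lapa.aesm_mu
  have hgb : ∀ t, N₂ a (lapa a (dl u t)) ≤ exp (4 * t) * G ^ 2 := fun t => by
    have h := integral_mono_ae (Lg t).integrable_sq (integrable_const (exp (4 * t) * G ^ 2)) (by
      filter_upwards [mu_ae_mem n a] with z hz
      unfold dl
      rw [lapa_scl (exp_pos _), mul_pow, ← pow_mul, ← exp_nat_mul]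
      push_cast
      refine mulL ?_ (exp_pos _).le
      rw [← sq_abs]
      exact pow_le_pow_left₀ (abs_nonneg _) (hG _ (smul_mem_Hs (exp_pos _) hz)) 2)
    simpa using h
  set h := fun t => N₂ a (dl u t) with hh
  set D := fun t => dirich a (fun i => Dx i (dl u t)) (Dy (dl u t)) with hD
  set vZ := fun t => I₂ a (dl u t) (Zv (dl u t)) with hvZ
  set gv := fun t => I₂ a (lapa a (dl u t)) (dl u t) with hgv
  set gZ := fun t => I₂ a (lapa a (dl u t)) (Zv (dl u t)) with hgZ
  set ZZ := fun t => N₂ a (Zv (dl u t)) with hZZ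
  set gg := fun t => N₂ a (lapa a (dl u t)) with hgg
  set N := fun t => D t / h t with hN
  have hh0 : ∀ t, 0 ≤ h t := fun t => integral_sq _
  have hD0 : ∀ t, 0 ≤ D t := fun t =>
    add_nonneg (sum_nonneg fun i _ => integral_sq _) (integral_sq _)
  have hid : ∀ t, vZ t = 2 * D t + 2 * gv t := fun t => by
    have h1 := (hu.dil t).toReg.green ha ha' (hu.dil t).toReg.pc (hu.dil t).toReg.lim_thin
    simp only [(hu.dil t).compl, integral_zero, mul_zero] at h1
    rw [← dirich_eq] at h1
    have h2 : ∫ z, (lapa a (dl u t) z - 1 / 2 * Zv (dl u t) z) * dl u t z ∂mu a = gv t - 1 / 2 * vZ t := by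
      simp only [hgv, hvZ]
      rw [← integral_const_mul, ← integral_sub (integrable_mul2 (Lg t) (Lv t)) ((integrable_mul2 (Lv t) (LZ t)).const_mul _)]
      congr 1; ext z; ring
    rw [h2] at h1
    linarith
  have hDd : ∀ t, HasDerivAt D (ZZ t - 2 * gZ t) t := fun t => by
    refine (hu.hasDerivAt_dirich ha ha' t).congr_deriv ?_
    have h2 : ∫ z, (lapa a (dl u t) z - 1 / 2 * Zv (dl u t) z) * Zv (dl u t) z ∂mu a = gZ t - 1 / 2 * ZZ t := by
      simp only [hgZ, hZZ]
      rw [← integral_const_mul, ← integral_sub (integrable_mul2 (Lg t) (LZ t)) ((LZ t).integrable_sq.const_mul _)]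
      congr 1; ext z; ring
    rw [h2]; ring
  have hhd : ∀ t, HasDerivAt h (2 * vZ t) t := fun t => hu.hasDerivAt_sq ha ha' t
  have hw : ∀ t k, ∫ z, (Zv (dl u t) z - k * dl u t z) ^ 2 ∂mu a = ZZ t - 2 * k * vZ t + k ^ 2 * h t := fun t k => by
    rw [integral_sq_sub (LZ t) ((Lv t).const_mul k)]
    simp only [hZZ, hvZ, hh, mul_pow, mul_left_comm _ k, integral_const_mul, mul_comm (Zv _ _)]
    ring
  set W := fun t => (ZZ t - 2 * (2 * N t) * vZ t + (2 * N t) ^ 2 * h t) / h t with hW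
  have hW0 : ∀ t, 0 ≤ W t := fun t =>
    div_nonneg (by rw [← hw]; exact integral_sq _) (hh0 t)
  have hlow : ∀ t ≤ t₀, exp ((4 - 2 * c) * t) ≤ h t := fun t ht => by
    obtain ⟨⟨h1, h2⟩, h3⟩ := ht₀ t ht
    have h1 : 0 < h t := h1
    have h2 : |log (h t) - 2 * κ * t| ≤ 2 * c * |t| := h2
    rw [← exp_log h1]
    refine exp_le_exp.2 ?_
    rw [abs_of_neg h3] at h2
    have := (abs_le.1 h2).1
    have e : (4 - 2 * c) * t = 2 * κ * t - 2 * c * -t := by rw [hc]; ring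
    rw [e]; linarith
  have hgh : ∀ t ≤ t₀, gg t ≤ G ^ 2 * exp (2 * c * t) * h t := fun t ht => by
    refine (hgb t).trans ?_
    have := mulL (hlow t ht) (by positivity : 0 ≤ G ^ 2 * exp (2 * c * t))
    rw [mul_assoc, ← exp_add] at this
    have e : 2 * c * t + (4 - 2 * c) * t = 4 * t := by ring
    rw [e] at this; linarith
  have hslow := exists_slow (N := N) (φ := fun t => log (h t)) (φ' := fun t => 2 * vZ t / h t) (W := W) (t₀ := t₀)
    (C := 2 * G ^ 2 + 4 * |G|) (c := c) (κ := κ) (N' := fun t => ((ZZ t - 2 * gZ t) * h t - D t * (2 * vZ t)) / h t ^ 2)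
    hc0 (by positivity) (fun t ht => (hDd t).div (hhd t) (ht₀ t ht.le).1.1.ne') ?_ hW0
    (fun t => div_nonneg (hD0 t) (hh0 t)) (fun t ht => (hhd t).log (ht₀ t ht.le).1.1.ne') ?_ hgrow
    (ε := min 1 (ε / 4)) (by positivity)
  · have hsm := (tendsto_exp_mul_atBot (c := 2 * c) (by linarith) (2 * G ^ 2)).eventually_le_const
      (by positivity : 0 < ε / 2)
    refine (hslow.and_eventually (hsm.and (eventually_le_atBot t₀))).mono ?_
    rintro t ⟨⟨h1, h2⟩, h3, ht⟩
    have hp : 0 < h t := (ht₀ t ht).1.1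
    have hq : ∫ z, (κ * dl u t z - Zv (dl u t) z) ^ 2 ∂mu a ≤ ε * h t := by
      have e0 : ∫ z, (κ * dl u t z - Zv (dl u t) z) ^ 2 ∂mu a = ∫ z, (Zv (dl u t) z - κ * dl u t z) ^ 2 ∂mu a := by
        congr 1; ext z; ring
      rw [e0, hw]
      have h4 : 0 ≤ ZZ t - 2 * (4 * N t - κ) * vZ t + (4 * N t - κ) ^ 2 * h t := by
        rw [← hw]; exact integral_sq _
      have h5 : ZZ t - 2 * (2 * N t) * vZ t + (2 * N t) ^ 2 * h t ≤ ε / 4 * h t :=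
        (div_le_iff₀ hp).1 (h1.trans (min_le_right _ _))
      have h6 : (2 * N t - κ) ^ 2 ≤ ε / 4 := by
        rw [← sq_abs]
        have := mul_le_mul h2 h2 (abs_nonneg _) (by positivity)
        have h7 := min_le_left 1 (ε / 4)
        nlinarith [min_le_right 1 (ε / 4), abs_nonneg (2 * N t - κ)]
      have := mulR h6 hp.le
      linarith
    refine ⟨hq, ?_⟩
    have h4 : N₂ a (defect a κ (dl u t)) ≤ 2 * gg t + 1 / 2 * ∫ z, (κ * dl u t z - Zv (dl u t) z) ^ 2 ∂mu a := by
      have i1 : Integrable (fun z => 2 * lapa a (dl u t) z ^ 2) (mu a) := (Lg t).integrable_sq.const_mul 2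
      have i2 : Integrable (fun z => 1 / 2 * (κ * dl u t z - Zv (dl u t) z) ^ 2) (mu a) :=
        ((((Lv t).const_mul κ).sub (LZ t)).integrable_sq).const_mul _
      rw [← integral_const_mul, ← integral_const_mul, ← integral_add i1 i2]
      refine integral_mono ((hu.dil t).toReg.memLp_defect ha ha' κ).integrable_sq (i1.add i2) fun z => ?_
      simp only [defect]
      nlinarith [sq_nonneg (lapa a (dl u t) z - 1 / 2 * (κ * dl u t z - Zv (dl u t) z))]
    have h5 := hgh t ht
    have h6 := mulR h3 hp.le
    linarith
  · intro t ht
    have hp : 0 < h t := (ht₀ t ht.le).1.1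
    have ht1 : t < 0 := (ht₀ t ht.le).2
    have hNh : N t * h t = D t := div_mul_cancel₀ _ hp.ne'
    have hgw : ∫ z, lapa a (dl u t) z * (Zv (dl u t) z - 2 * N t * dl u t z) ∂mu a = gZ t - 2 * N t * gv t := by
      simp only [hgZ, hgv]
      rw [← integral_const_mul, ← integral_sub (integrable_mul2 (Lg t) (LZ t)) ((integrable_mul2 (Lg t) (Lv t)).const_mul _)]
      congr 1; ext z; ring
    have hy := young (Lg t) ((LZ t).sub ((Lv t).const_mul (2 * N t))) (c := 1 / 2) (by norm_num)
    simp only [Pi.sub_apply] at hy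
    rw [hgw, hw] at hy
    have hy1 := (abs_le.1 hy).2
    have h1 := hgh t ht.le
    have he : exp (2 * c * t) ≤ exp (c * t) := exp_le_exp.2 (by nlinarith)
    have h2 : ((ZZ t - 2 * gZ t) * h t - D t * (2 * vZ t)) / h t ^ 2 =
        ((ZZ t - 2 * (2 * N t) * vZ t + (2 * N t) ^ 2 * h t) - 2 * (gZ t - 2 * N t * gv t)) / h t := by
      rw [div_eq_div_iff (by positivity) hp.ne', ← hNh]
      have := hid t
      rw [← hNh] at this
      linear_combination (2 * N t * h t ^ 2) * this
    rw [h2, hW, le_div_iff₀ hp]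
    simp only
    rw [sub_mul, mul_assoc (1 / 2 : ℝ), div_mul_cancel₀ _ hp.ne']
    have h3 : gg t ≤ G ^ 2 * exp (c * t) * h t := h1.trans (by gcongr)
    have h4 : 0 ≤ 4 * |G| * exp (c * t) * h t := by positivity
    have hy2 : gZ t - 2 * N t * gv t ≤ gg t + 1 / 4 * (ZZ t - 2 * (2 * N t) * vZ t + (2 * N t) ^ 2 * h t) := by
      simp only [hgg]; linarith
    linarith
  · intro t ht
    have hp : 0 < h t := (ht₀ t ht.le).1.1
    have h1 : 2 * vZ t / h t - 4 * N t = 4 * gv t / h t := by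
      simp only [hN]; rw [hid t]; field_simp; ring
    rw [h1, abs_div, abs_of_pos hp, div_le_iff₀ hp, abs_mul, abs_of_pos (by norm_num : (0:ℝ) < 4)]
    have h2 := cauchy_schwarz (Lg t) (Lv t)
    have h3 : |gv t| ≤ |G| * exp (c * t) * h t := by
      refine abs_le_of_sq_le_sq ?_ (by positivity)
      refine h2.trans ((mulR (hgh t ht.le) (hh0 t)).trans (le_of_eq ?_))
      have e : exp (2 * c * t) = exp (c * t) ^ 2 := by rw [← exp_nat_mul]; congr 1; push_cast; ring
      rw [e, mul_pow, mul_pow, sq_abs]; ring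
    have h4 : 0 ≤ 2 * G ^ 2 * exp (c * t) * h t := by positivity
    linarith

lemma growth_of_frequency {U : Fn n} {l σ C κ c B γ : ℝ} {N : ℝ → ℝ} (hl : 1 ≤ l)
    (hσ : 0 < σ) (hσ' : σ < 1) (hC : 0 < C) (hc : 0 < c) (hγ : 0 < γ) (hB : 0 < B) (hN : Continuous N) (hN0 : ∀ x, 0 ≤ N x) (hNB : ∀ x ∈ Ioo (0 : ℝ) 1, N x ≤ B * x ^ γ)
    (hH : ∀ r ∈ Ioo (0 : ℝ) (1 / 2), Hfn n a U r = c * ((∫ x in (0 : ℝ)..r ^ 2, N x) / r ^ 2))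
    (hκ : Tendsto (Phi n a U l σ C) (𝓝[diffSet n a U l σ] 0) (𝓝 κ)) (hκl : κ < l - 1 + σ) :
    0 < κ ∧ ∀ δ > 0, ∀ᶠ t in atBot, 0 < N (exp t ^ 2) ∧ |log (N (exp t ^ 2)) - 2 * κ * t| ≤ δ * |t| := by
  set P : ℝ → ℝ := fun x => ∫ y in 0..x, N y with hP
  have hPd : ∀ x, HasDerivAt P (N x) x := fun x => (hN.integral_hasStrictDerivAt 0 x).hasDerivAt
  have hHd : ∀ r ∈ Ioo 0 (1 / 2),
      HasDerivAt (Hfn n a U) (c * ((N (r ^ 2) * (2 * r) * r ^ 2 - P (r ^ 2) * (2 * r)) / (r ^ 2) ^ 2)) r := fun r hr => by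
    have e : Hfn n a U =ᶠ[𝓝 r] fun r => c * (P (r ^ 2) / r ^ 2) :=
      Filter.eventuallyEq_of_mem (isOpen_Ioo.mem_nhds hr) hH
    have h2 : HasDerivAt (fun r => r ^ 2) (2 * r) r := by simpa using hasDerivAt_pow 2 r
    exact (((((hPd (r ^ 2)).comp r h2).div h2 (by have := hr.1; positivity)).const_mul c).congr_of_eventuallyEq e)
  set β := 2 * l - 2 + 2 * σ with hβ
  have hE : ∀ r : ℝ, 0 < r → 1 ≤ exp (C * r ^ (1 - σ)) := fun r hr =>
    one_le_exp (by positivity)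
  have hbig : ∀ᶠ r in 𝓝[>] 0, r ^ β ≤ Hfn n a U r := by
    by_contra hne
    have h1 : ∀ᶠ r in 𝓝[diffSet n a U l σ] 0, Phi n a U l σ C r < β / 2 := hκ.eventually_lt_const (by rw [hβ]; linarith)
    have h2 := eventually_nhdsWithin_iff.1 h1
    obtain ⟨r, hr1, hr2, hr3⟩ := ((not_eventually.1 hne).and_eventually
      ((h2.filter_mono nhdsWithin_le_nhds).and (Ioo_mem_nhdsGT (by norm_num : (0 : ℝ) < 1 / 2)))).exists
    have hr0 : 0 < r := hr3.1
    have e : logMaxH n a U l σ =ᶠ[𝓝 r] fun r => β * log r := by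
      have hcont : ContinuousAt (fun r => Hfn n a U r - r ^ β) r :=
        (hHd r hr3).continuousAt.sub (continuousAt_rpow_const _ _ (Or.inl hr0.ne'))
      filter_upwards [hcont.eventually_lt continuousAt_const (sub_neg.2 (not_le.1 hr1)), lt_mem_nhds hr0] with x hx hx0
      rw [logMaxH, max_eq_right (by linarith), log_rpow hx0]
    have hd : HasDerivAt (logMaxH n a U l σ) (β * r⁻¹) r :=
      ((hasDerivAt_log hr0.ne').const_mul β).congr_of_eventuallyEq e
    have := hr2 ⟨⟨hr0, by linarith [hr3.2]⟩, hd.differentiableAt⟩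
    rw [Phi, hd.deriv] at this
    have e2 : 1 / 2 * r * exp (C * r ^ (1 - σ)) * (β * r⁻¹) = β / 2 * exp (C * r ^ (1 - σ)) := by
      field_simp
    rw [e2] at this
    have h3 := hE r hr0
    have := mulL h3 (by rw [hβ]; linarith : 0 ≤ β / 2)
    linarith
  have hgood : ∀ᶠ r in 𝓝[>] 0, 0 < P (r ^ 2) ∧ r ∈ diffSet n a U l σ ∧
      Phi n a U l σ C r = exp (C * r ^ (1 - σ)) * (r ^ 2 * N (r ^ 2) / P (r ^ 2) - 1) +
        2 * (exp (C * r ^ (1 - σ)) - 1) := by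
    obtain ⟨r₀, h0, h1⟩ := mem_nhdsGT_iff_exists_Ioo_subset.1 hbig
    filter_upwards [Ioo_mem_nhdsGT (lt_min h0 (by norm_num : (0 : ℝ) < 1 / 2))] with r hr
    have hr0 : 0 < r := hr.1
    have hr1 : r ∈ Ioo 0 (1 / 2) := ⟨hr0, hr.2.trans_le (min_le_right _ _)⟩
    have hHp : 0 < Hfn n a U r := (rpow_pos_of_pos hr0 _).trans_le (h1 ⟨hr0, hr.2.trans_le (min_le_left _ _)⟩)
    have hPp : 0 < P (r ^ 2) := by
      have h2 := hHp
      rw [hH r hr1] at h2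
      exact (div_pos_iff_of_pos_right (by positivity)).1 ((mul_pos_iff_of_pos_left hc).1 h2)
    have e : logMaxH n a U l σ =ᶠ[𝓝 r] fun r => log (Hfn n a U r) := by
      filter_upwards [Ioo_mem_nhds hr0 hr.2] with x hx
      rw [logMaxH, max_eq_left (h1 ⟨hx.1, hx.2.trans_le (min_le_left _ _)⟩)]
    have hd := ((hHd r hr1).log hHp.ne').congr_of_eventuallyEq e
    refine ⟨hPp, ⟨⟨hr0, by linarith [hr1.2]⟩, hd.differentiableAt⟩, ?_⟩
    rw [Phi, hd.deriv, hH r hr1]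
    change _ * (_ / (c * (P (r ^ 2) / r ^ 2))) + _ = _
    field_simp
  have hq : Tendsto (fun r => r ^ 2 * N (r ^ 2) / P (r ^ 2)) (𝓝[>] 0) (𝓝 (κ + 1)) := by
    have h1 : Tendsto (Phi n a U l σ C) (𝓝[>] 0) (𝓝 κ) :=
      hκ.mono_left (le_inf nhdsWithin_le_nhds (le_principal_iff.2 (hgood.mono fun r h => h.2.1)))
    have h2 : Tendsto (fun r => exp (C * r ^ (1 - σ))) (𝓝[>] 0) (𝓝 1) := by
      have : ContinuousAt (fun r => exp (C * r ^ (1 - σ))) 0 :=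
        (continuousAt_const.mul (continuousAt_rpow_const _ _ (Or.inr (by linarith)))).rexp
      have h3 := this.tendsto.mono_left (nhdsWithin_le_nhds (s := Ioi 0))
      rwa [zero_rpow (by linarith), mul_zero, exp_zero] at h3
    have h3 := ((h1.sub ((h2.sub_const 1).const_mul 2)).div h2 one_ne_zero).add_const 1
    simp only [sub_self, mul_zero, sub_zero, div_one] at h3
    refine h3.congr' (hgood.mono fun r h => ?_)
    simp only [Pi.div_apply]
    rw [h.2.2]
    have := (exp_pos (C * r ^ (1 - σ))).ne'
    field_simp; ring
  have hexp := tendsto_exp_atBot_nhdsGT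
  set p : ℝ → ℝ := fun t => log (P (exp t ^ 2)) with hp
  have hPpos : ∀ᶠ t in atBot, 0 < P (exp t ^ 2) := hexp.eventually (hgood.mono fun r h => h.1)
  have hpL : ∀ δ > 0, ∀ᶠ t in atBot, |p t - 2 * (κ + 1) * t| ≤ δ * |t| := fun δ hδ => by
    refine eventually_abs_sub_le (p' := fun t => 2 * (exp t ^ 2 * N (exp t ^ 2) / P (exp t ^ 2)))
      (hPpos.mono fun t ht => ?_) ((hq.comp hexp).const_mul 2) hδ
    refine (((hPd _).comp t ((hasDerivAt_exp t).pow 2)).log ht.ne').congr_deriv ?_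
    simp only [Function.comp_apply, Pi.pow_apply]
    push_cast; ring
  have hκ0 : 0 < κ := by
    by_contra hneg
    obtain ⟨t, ⟨⟨h1, h2⟩, h3⟩, h4⟩ := (((hpL γ hγ).and hPpos).and (eventually_lt_atBot 0)).and
      (eventually_lt_atBot (-log B / γ)) |>.exists
    have hx1 : exp t ^ 2 < 1 := pow_lt_one₀ (exp_pos t).le (exp_lt_one_iff.2 h3) two_ne_zero
    have h5 : P (exp t ^ 2) ≤ B * (exp t ^ 2) ^ γ * exp t ^ 2 := by
      have := intervalIntegral.norm_integral_le_of_norm_le_const (b := exp t ^ 2)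
        (C := B * (exp t ^ 2) ^ γ) fun x hx => by
          rw [Set.uIoc_of_le (by positivity)] at hx
          rw [norm_of_nonneg (hN0 x)]
          exact (hNB x ⟨hx.1, hx.2.trans_lt hx1⟩).trans (mulL (rpow_le_rpow hx.1.le hx.2 hγ.le) hB.le)
      rw [sub_zero, abs_of_pos (by positivity)] at this
      exact (le_abs_self _).trans this
    have h6 := log_le_log h2 h5
    rw [log_mul (by positivity) (by positivity), log_mul hB.ne' (by positivity),
      log_rpow (by positivity), log_pow, log_exp] at h6
    push_cast at h6
    rw [abs_of_neg h3] at h1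
    have h7 := (abs_le.1 h1).1
    have h8 := mul_nonneg_of_nonpos_of_nonpos (not_lt.1 hneg) h3.le
    rw [lt_div_iff₀ hγ] at h4
    simp only [hp] at h7
    linarith
  refine ⟨hκ0, fun δ hδ => ?_⟩
  have h1 := hq.comp hexp
  have h2 := ((h1.log (by linarith)).sub_const (log (κ + 1))).abs
  simp only [sub_self, abs_zero] at h2
  filter_upwards [h1.eventually_const_lt (by linarith : 0 < κ + 1), hPpos, hpL (δ / 2) (half_pos hδ),
    h2.eventually_le_const zero_lt_one, eventually_le_atBot 0,
    eventually_le_atBot (-((1 + |log (κ + 1)|) / (δ / 2)))] with t h3 h4 h5 h6 h7 h8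
  simp only [Function.comp_apply] at h3 h6
  have hNp : 0 < N (exp t ^ 2) := (mul_pos_iff_of_pos_left (by positivity)).1 ((div_pos_iff_of_pos_right h4).1 h3)
  refine ⟨hNp, ?_⟩
  rw [log_div (by positivity) h4.ne', log_mul (by positivity) hNp.ne', log_pow, log_exp] at h6
  push_cast at h6
  rw [abs_of_nonpos h7] at h5 ⊢
  rw [le_neg, div_le_iff₀ (half_pos hδ)] at h8
  simp only [hp] at h5
  rw [abs_le] at h5 h6 ⊢
  have h9 := neg_abs_le (log (κ + 1))
  have h10 := le_abs_self (log (κ + 1))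
  constructor <;> linarith [ h6.2]

section slice
variable {F U : Fn n}

/-- The final time slice. -/
def fin (U : Fn n) (z : E n) : ℝ := U z.1 z.2 0

lemma pdx_eq_Dx {V : Fn n} {g : E n → ℝ} {z : E n} (hz : z ∈ Hs n) (hg : DifferentiableAt ℝ g z)
    (h : ∀ w ∈ Hs n, V w.1 w.2 0 = g w) (i : Fin n) : pdx i V z.1 z.2 0 = Dx i g z := by
  have e : (fun x => V x z.2 0) = fun x => g (x, z.2) := funext fun x => h (x, z.2) hz
  rw [pdx, e]
  exact DFunLike.congr_fun (HasFDerivAt.comp (f := fun x => (x, z.2)) z.1 hg.hasFDerivAt (hasFDerivAt_prodMk_left z.1 z.2)).fderiv _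

lemma pdy_eq_Dy {V : Fn n} {g : E n → ℝ} {z : E n} (hz : z ∈ Hs n) (hg : DifferentiableAt ℝ g z)
    (h : ∀ w ∈ Hs n, V w.1 w.2 0 = g w) : pdy V z.1 z.2 0 = Dy g z := by
  have e : (fun y => V z.1 y 0) =ᶠ[𝓝 z.2] fun y => g (z.1, y) := by
    filter_upwards [lt_mem_nhds (show 0 < z.2 from hz)] with y hy using h (z.1, y) hy
  rw [pdy, e.deriv_eq, ← fderiv_apply_one_eq_deriv]
  exact DFunLike.congr_fun (HasFDerivAt.comp (f := fun y => (z.1, y)) z.2 hg.hasFDerivAt (hasFDerivAt_prodMk_right z.1 z.2)).fderiv _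

lemma bdd_of_holder {φ : E n → ℝ} {α C R : ℝ} (hα : 0 < α) (hR : 0 < R)
    (h : ∀ z ∈ Hs n, ∀ w ∈ Hs n, |φ z - φ w| ≤ C * nq (z - w) ^ (α / 2)) (h0 : ∀ z ∈ Hs n, R ^ 2 < nq z → φ z = 0) :
    ∃ C, ∀ z ∈ Hs n, |φ z| ≤ C := by
  refine ⟨|C| * (2 * R ^ 2 + 2 * (R + 1) ^ 2) ^ (α / 2), fun z hz => ?_⟩
  by_cases hz' : R ^ 2 < nq z
  · rw [h0 z hz hz', abs_zero]; positivity
  have hw : ((0, R + 1) : E n) ∈ Hs n := show 0 < R + 1 by linarith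
  have h1 := h z hz _ hw
  rw [h0 _ hw (by simp only [nq, nsq]; simp; nlinarith), sub_zero] at h1
  refine h1.trans ((mulR (le_abs_self C) (rpow_nonneg (nq_nonneg _) _)).trans ?_)
  refine mulL (rpow_le_rpow (nq_nonneg _) ?_ (by positivity)) (abs_nonneg C)
  have h2 := not_lt.1 hz'
  simp only [nq, nsq, Prod.fst_sub, Prod.snd_sub, sub_zero] at h2 ⊢
  nlinarith [ sum_nonneg fun i (_ : i ∈ Finset.univ) => sq_nonneg (z.1 i)]

lemma fin_sm (hU : SignoriniMem n a F U) : Sm (fin U) := fun z hz =>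
  (hU.smooth z.1 z.2 0 hz ⟨by norm_num, le_rfl⟩).comp z (f := fun z => (z.1, z.2, 0))
    (contDiff_fst.prodMk (contDiff_snd.prodMk contDiff_const)).contDiffAt

lemma fin_Dx (hU : SignoriniMem n a F U) {z : E n} (hz : z ∈ Hs n) (i : Fin n) : Dx i (fin U) z = pdx i U z.1 z.2 0 :=
  (pdx_eq_Dx hz ((fin_sm hU).differentiableAt hz) (fun _ _ => rfl) i).symm

lemma fin_Dy (hU : SignoriniMem n a F U) {z : E n} (hz : z ∈ Hs n) : Dy (fin U) z = pdy U z.1 z.2 0 :=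
  (pdy_eq_Dy hz ((fin_sm hU).differentiableAt hz) fun _ _ => rfl).symm

lemma fin_prof (hU : SignoriniMem n a F U) {l Cl : ℝ} (hl : 2 ≤ l) (hCl : 0 < Cl) (hF : FGrowth n F l Cl) :
    ∃ T, Prof a (fin U) T := by
  have h00 : 0 ∈ Ioc (-1 : ℝ) 0 := ⟨by norm_num, le_rfl⟩
  obtain ⟨R, hR, hsupp⟩ := hU.bddSupp
  have hev : ∀ z : E n, R ^ 2 < nq z → fin U =ᶠ[𝓝 z] fun _ => 0 := fun z hz => by
    filter_upwards [continuous_nq.continuousAt.eventually_const_lt hz] with w hw using hsupp _ _ _ hw.le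
  choose L hL0 hL hL1 using fun x => hU.signorini x 0 h00
  have hsm := fin_sm hU
  refine ⟨fun x => -L x, ⟨⟨hsm, ?_, ⟨R ^ 2, fun z hz => hsupp _ _ _ hz⟩, ?_, ?_, ?_, fun x => ?_⟩,
    fun x => by linarith [hL0 x], fun x => hU.nonneg x 0 h00, fun x => by
      have := hL1 x
      simp only [fin]; linarith⟩⟩
  · exact hU.cont.comp (f := fun z : E n => (z.1, z.2, 0)) (by fun_prop) fun z hz => ⟨hz, h00⟩
  · obtain ⟨α, hα, C, h⟩ := hU.holderX
    choose B hB using fun i => bdd_of_holder (φ := Dx i (fin U)) hα hR (fun z hz w hw => by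
      rw [fin_Dx hU hz, fin_Dx hU hw]
      simpa [nq, nsq] using h i z.1 z.2 0 w.1 w.2 0 hz hw h00 h00) fun z _ hz => by simp [Dx, (hev z hz).fderiv_eq]
    refine ⟨∑ i, |B i|, fun i z hz => (hB i z hz).trans ((le_abs_self _).trans ?_)⟩
    exact Finset.single_le_sum (fun i _ => abs_nonneg (B i)) (mem_univ i)
  · obtain ⟨α, hα, C, h⟩ := hU.holderY
    refine bdd_of_holder (φ := fun z => z.2 ^ a * Dy (fin U) z) hα hR (fun z hz w hw => by
      rw [fin_Dy hU hz, fin_Dy hU hw]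
      simpa [nq, nsq] using h z.1 z.2 0 w.1 w.2 0 hz hw h00 h00) fun z _ hz => by simp [Dy, (hev z hz).fderiv_eq]
  · obtain ⟨M, hM⟩ := hU.bddTime
    refine ⟨|M| + Cl * (R ^ 2) ^ ((l - 2) / 2), fun z hz => ?_⟩
    by_cases hz' : R ^ 2 < nq z
    · have h1 : ∀ d : E n, (fun w => fderiv ℝ (fin U) w d) =ᶠ[𝓝 z] fun _ => 0 := fun d => by
        filter_upwards [continuous_nq.continuousAt.eventually_const_lt hz'] with w hw
        simp [(hev w hw).fderiv_eq]
      have : lapa a (fin U) z = 0 := by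
        have h2 : ∀ d e : E n, fderiv ℝ (fun w => fderiv ℝ (fin U) w d) z e = 0 := fun d e => by simp [(h1 d).fderiv_eq]
        have h3 : Dy (fin U) z = 0 := by simp [Dy, (hev z hz').fderiv_eq]
        have h4 : ∀ i, Dx i (Dx i (fin U)) z = 0 := fun i => h2 _ _
        simp [lapa, h3, h4, show Dy (Dy (fin U)) z = 0 from h2 _ _]
      rw [this, abs_zero]; positivity
    · have h1 := hU.pde z.1 z.2 0 hz h00
      have h2 : lapFull U z.1 z.2 0 + a / z.2 * pdy U z.1 z.2 0 = lapa a (fin U) z := by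
        rw [lapFull, lapx, pdyy, lapa, fin_Dy hU hz, pdy_eq_Dy hz ((hsm.Dy).differentiableAt hz) fun w hw => (fin_Dy hU hw).symm]
        congr 2
        exact sum_congr rfl fun i _ =>
          pdx_eq_Dx hz ((hsm.Dx i).differentiableAt hz) (fun w hw => (fin_Dx hU hw i).symm) i
      rw [show lapa a (fin U) z = pdt U z.1 z.2 0 - F z.1 z.2 0 by linarith]
      refine (abs_sub _ _).trans (add_le_add ((hM _ _ _ hz h00).trans (le_abs_self M)) ((hF _ _ _ hz h00).trans ?_))
      refine mulL (rpow_le_rpow ?_ ?_ (by linarith)) hCl.le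
      · exact add_nonneg (nq_nonneg z) (abs_nonneg _)
      · rw [abs_zero, add_zero]; exact not_lt.1 hz'
  · rw [neg_neg]
    refine (hL x).congr' ?_
    filter_upwards [self_mem_nhdsWithin] with y hy
    rw [fin_Dy hU (z := (x, y)) hy]
end slice

section originbounds
variable {F U : Fn n} {T : V n → ℝ}

lemma fin_zero (hU : SignoriniMem n a F U) : fin U 0 = 0 := by
  obtain ⟨q, hq, hq0⟩ := mem_closure_iff_seq_limit.1 hU.originFB.1
  have h1 := (hU.cont (0, 0, 0) ⟨le_rfl, by norm_num, le_rfl⟩).tendsto.comp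
    (tendsto_nhdsWithin_iff.2 ⟨((Continuous.prodMk continuous_fst (continuous_const.prodMk continuous_snd)).tendsto
      ((0 : V n), 0)).comp hq0, Eventually.of_forall fun k => ⟨le_rfl, (hq k).1⟩⟩)
  exact tendsto_nhds_unique h1 (tendsto_const_nhds.congr fun k => (hq k).2.1.symm)

lemma flux_le_rpow (hU : SignoriniMem n a F U) (hT : Prof a (fin U) T) :
    ∃ α > (0 : ℝ), ∃ C : ℝ, ∀ x, T x ≤ C * (∑ i, x i ^ 2) ^ (α / 2) := by
  obtain ⟨q, hq, hq0⟩ := mem_closure_iff_seq_limit.1 hU.originFB.1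
  obtain ⟨α, hα, C, hC⟩ := hU.holderY
  refine ⟨α, hα, C, fun x => ?_⟩
  have h1 : ∀ k, T x ≤ C * ((∑ j, (x j - (q k).1 j) ^ 2) + |0 - (q k).2|) ^ (α / 2) := fun k => by
    have h2 := (((hT.flux x).congr' (by
      filter_upwards [self_mem_nhdsWithin] with y hy
      rw [fin_Dy hU (z := (x, y)) hy])).sub (hq k).2.2).abs
    rw [sub_zero, abs_neg, abs_of_nonneg (hT.Tnn x)] at h2
    refine le_of_tendsto h2 ?_
    filter_upwards [self_mem_nhdsWithin] with y hy
    simpa using hC x y 0 (q k).1 y (q k).2 hy hy ⟨by norm_num, le_rfl⟩ (hq k).1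
  have hc : Continuous fun p : V n × ℝ => C * ((∑ j, (x j - p.1 j) ^ 2) + |0 - p.2|) ^ (α / 2) :=
    continuous_const.mul (Continuous.rpow_const (by fun_prop) fun _ => Or.inr (by positivity))
  have h3 := ge_of_tendsto' ((hc.tendsto _).comp hq0) h1
  simpa using h3

lemma abs_Dx_le_rpow (hU : SignoriniMem n a F U) (hT : Prof a (fin U) T) :
    ∃ α > (0 : ℝ), ∃ C : ℝ, ∀ i, ∀ z ∈ Hs n, |Dx i (fin U) z| ≤ C * nq z ^ (α / 2) := by
  obtain ⟨α, hα, C, hC⟩ := hU.holderX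
  have h00 : 0 ∈ Ioc (-1 : ℝ) 0 := ⟨by norm_num, le_rfl⟩
  refine ⟨α, hα, |C| * 6 ^ (α / 2), fun i z hz => ?_⟩
  have hz0 : 0 < z.2 := hz
  set m := √(nq z) with hm
  have hm2 := sq_sqrt (nq_nonneg z)
  have hm0 := sqrt_pos.2 (by have := snd_sq_le_nq z; nlinarith)
  set ω := |C| * 6 ^ (α / 2) * nq z ^ (α / 2) with hω
  have key : ∀ p ∈ Icc (-m) m, ∀ q ∈ Icc (-m) m, p < q →
      |fin U (Function.update 0 i q, 0) - fin U (Function.update 0 i p, 0) - Dx i (fin U) z * (q - p)| ≤ ω * (q - p) := by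
    intro p hp q hq hpq
    have h1 := (((hT.toReg.lim_thin (Function.update 0 i q)).sub (hT.toReg.lim_thin (Function.update 0 i p))).sub_const
      (Dx i (fin U) z * (q - p))).abs
    refine le_of_tendsto h1 ?_
    filter_upwards [Ioo_mem_nhdsGT hm0] with y hy
    have hd : ∀ x, HasDerivAt (fun h => fin U (Function.update 0 i h, y)) (Dx i (fin U) (Function.update 0 i x, y)) x :=
      fun x => by
        have := (hT.sm.hasDx i) (Function.update 0 i x, y) hy.1
        simpa using this
    obtain ⟨ξ, hξ, e⟩ := exists_hasDerivAt_eq_slope _ _ hpq (fun x _ => (hd x).continuousAt.continuousWithinAt)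
      (fun x _ => hd x)
    rw [eq_div_iff (by linarith)] at e
    rw [← e, ← sub_mul, abs_mul, abs_of_pos (by linarith : 0 < q - p)]
    gcongr
    rw [fin_Dx hU (z := (Function.update 0 i ξ, y)) hy.1, fin_Dx hU hz]
    refine (hC i _ y 0 z.1 z.2 0 hy.1 hz h00 h00).trans ?_
    rw [hω, mul_assoc, ← mul_rpow (by norm_num) (nq_nonneg z)]
    refine (mulR (le_abs_self C) (by positivity)).trans
      (mulL (rpow_le_rpow (by positivity) ?_ (by positivity)) (abs_nonneg C))
    have h2 : ∑ j, (Function.update (0 : V n) i ξ j - z.1 j) ^ 2 ≤ ∑ j, (2 * (if j = i then ξ ^ 2 else 0) + 2 * z.1 j ^ 2) :=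
      sum_le_sum fun j _ => by
        by_cases hj : j = i
        · subst hj; simp only [Function.update_self, if_true]; nlinarith [sq_nonneg (ξ + z.1 j)]
        · simp [hj]; nlinarith [sq_nonneg (z.1 j)]
    rw [sum_add_distrib, ← mul_sum, ← mul_sum, Finset.sum_ite_eq' Finset.univ i, if_pos (mem_univ i)] at h2
    have h3 : ξ ^ 2 ≤ m ^ 2 := sq_le_sq' (by linarith [hξ.1, hp.1]) (by linarith [hξ.2, hq.2])
    have h4 := pow_le_pow_left₀ hy.1.le hy.2.le 2
    have h5 : nq z = (∑ j, z.1 j ^ 2) + z.2 ^ 2 := rfl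
    rw [sub_self, abs_zero]
    nlinarith [sq_nonneg (y + z.2)]
  have hz1 : fin U (Function.update 0 i 0, 0) = 0 := by
    have := fin_zero hU
    rwa [← show ((Function.update 0 i 0, 0) : E n) = 0 by simp] at this
  have k1 := abs_le.1 (key 0 ⟨by linarith, hm0.le⟩ m ⟨by linarith, le_rfl⟩ hm0)
  have k2 := abs_le.1 (key (-m) ⟨le_rfl, by linarith⟩ 0 ⟨by linarith, hm0.le⟩ (by linarith))
  have f1 := hT.fnn (Function.update 0 i m)
  have f2 := hT.fnn (Function.update 0 i (-m))
  rw [hz1] at k1 k2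
  rw [abs_le]
  constructor <;> refine le_of_mul_le_mul_right ?_ hm0 <;> linarith [ k2.2]

lemma abs_sub_fin_le (hU : SignoriniMem n a F U) :
    ∃ M, 0 ≤ M ∧ ∀ z ∈ Hs n, ∀ t ∈ Ioc (-1 : ℝ) 0, |U z.1 z.2 t - fin U z| ≤ M * |t| := by
  obtain ⟨M, hM⟩ := hU.bddTime
  refine ⟨|M|, abs_nonneg M, fun z hz t ht => ?_⟩
  have h := (convex_Icc t 0).norm_image_sub_le_of_norm_hasDerivWithin_le
    (f' := fun t => pdt U z.1 z.2 t) (fun x hx => (DifferentiableAt.hasDerivAt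
      (((hU.smooth z.1 z.2 x hz ⟨ht.1.trans_le hx.1, hx.2⟩).differentiableAt (by simp)).comp x
        (f := fun t => (z.1, z.2, t)) (by fun_prop))).hasDerivWithinAt)
    (fun x hx => (hM _ _ _ hz ⟨ht.1.trans_le hx.1, hx.2⟩).trans (le_abs_self M))
    (right_mem_Icc.2 ht.2) (left_mem_Icc.2 ht.2)
  simpa [fin] using h
end originbounds

section growth
variable {f : E n → ℝ} {T : V n → ℝ}

lemma Reg.abs_dl_le (ha : -1 < a) (ha' : a < 1) (hf : Reg a f T) (h0 : f 0 = 0) :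
    ∃ C, 0 ≤ C ∧ ∀ t ≤ 0, ∀ z ∈ Hs n, |dl f t z| ≤ C * (1 + nq z) * exp (min 1 (1 - a) * t) := by
  obtain ⟨C, hC0, hC⟩ := hf.abs_Zv_le ha'
  set γ := min 1 (1 - a) with hγ
  have hγ0 : 0 < γ := lt_min one_pos (by linarith)
  refine ⟨2 * C / γ, by positivity, fun t ht z hz => ?_⟩
  have hq := nq_nonneg z
  have hexp : ∀ δ, γ ≤ δ → ∀ x ≤ 0, exp (δ * x) ≤ exp (γ * x) := fun δ hδ x hx =>
    exp_le_exp.2 (mul_le_mul_of_nonpos_right hδ hx)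
  have hs1 : √(nq z) ≤ 1 + nq z := sqrt_le_iff.2 ⟨by linarith, by nlinarith⟩
  have hs2 : √(nq z) ^ (1 - a) ≤ 1 + nq z := by
    rcases le_total (√(nq z)) 1 with h | h
    · exact (rpow_le_one (sqrt_nonneg _) h (by linarith)).trans (by linarith)
    · have := rpow_le_rpow_of_exponent_le h (by push_cast; linarith : 1 - a ≤ (2 : ℕ))
      rw [rpow_natCast, sq_sqrt hq] at this
      linarith
  have hb : ∀ x ≤ 0, |Zv (dl f x) z| ≤ 2 * C * (1 + nq z) * exp (γ * x) := fun x hx => by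
    unfold dl
    rw [Zv_scl]
    refine (hC _ (smul_mem_Hs (exp_pos x) hz)).trans ?_
    have e := hexp 1 (min_le_left _ _) x hx
    have e' := hexp (1 - a) (min_le_right _ _) x hx
    rw [one_mul] at e
    rw [nq_smul, sqrt_mul (sq_nonneg _), sqrt_sq (exp_pos x).le, mul_rpow (exp_pos x).le
      (sqrt_nonneg _), ← exp_mul, mul_comm x]
    have := mul_le_mul e hs1 (sqrt_nonneg _) (exp_pos _).le
    have := mul_le_mul e' hs2 (by positivity) (exp_pos _).le
    nlinarith
  have hlim : Tendsto (fun s => |dl f t z - dl f s z|) atBot (𝓝 |dl f t z - 0|) := by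
    refine (tendsto_const_nhds.sub ?_).abs
    rw [← h0]
    refine (hf.cont 0 (Set.mem_ofPred_eq ▸ le_rfl)).tendsto.comp (tendsto_nhdsWithin_iff.2
      ⟨?_, Eventually.of_forall fun s => (show (0 : ℝ) < _ from smul_mem_Hs (exp_pos s) hz).le⟩)
    simpa using tendsto_exp_atBot.smul_const z
  rw [sub_zero] at hlim
  refine le_of_tendsto hlim ?_
  filter_upwards [eventually_le_atBot t] with s hs
  have hB : ∀ x, HasDerivAt (fun x => 2 * C / γ * (1 + nq z) * exp (γ * x)) (2 * C * (1 + nq z) * exp (γ * x)) x :=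
    fun x => ((((hasDerivAt_id' x).const_mul γ).exp).const_mul (2 * C / γ * (1 + nq z))).congr_deriv (by field_simp)
  have hd := fun x => (hf.sm.hasDerivAt_dl hz x).sub_const (dl f s z)
  exact image_norm_le_of_norm_deriv_right_le_deriv_boundary (fun x _ => (hd x).continuousAt.continuousWithinAt)
    (fun x _ => (hd x).hasDerivWithinAt) (by rw [sub_self, norm_zero]; positivity) hB
    (fun x hx => hb x (hx.2.le.trans ht)) (right_mem_Icc.2 hs)

lemma integrable_nq_rpow (ha : -1 < a) (p : ℝ) : Integrable (fun z : E n => (1 + nq z) ^ p) (mu a) := by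
  have hc : Continuous fun z => (1 + nq z) ^ p := Continuous.rpow_const (by have := continuous_nq (n := n); fun_prop)
    fun z => Or.inl (by have := nq_nonneg z; positivity)
  refine SG.integrable ha (by linarith) (SG.of_GR (GR.of_rpow nq_nonneg_on zero_le_one p fun z _ => ?_)) hc.aestronglyMeasurable
  rw [one_mul, abs_of_nonneg (rpow_nonneg (by have := nq_nonneg z; positivity) _)]

lemma Prof.moment_le_exp (ha : -1 < a) (hf : Prof a f T) {α C : ℝ} (hα : 0 < α)
    (h : ∀ i, ∀ z ∈ Hs n, |Dx i f z| ≤ C * nq z ^ (α / 2)) :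
    ∃ K, 0 ≤ K ∧ ∀ t, ∑ i, (∫ z, dl f t z * z.1 i ∂mu a) ^ 2 ≤ K * exp (2 * (1 + α) * t) := by
  have hprob := prob_mu n ha
  set D := ∫ z : E n, |C| * (1 + nq z) ^ (α / 2) ∂mu a with hD
  refine ⟨n * (2 * D) ^ 2, by positivity, fun t => ?_⟩
  have h1 : ∀ i ∈ Finset.univ, (∫ z, dl f t z * z.1 i ∂mu a) ^ 2 ≤ (2 * D) ^ 2 * exp (2 * (1 + α) * t) := fun i _ => by
    have hp := (hf.dil t).toReg.pc
    have e := ibp_x ha (hp.dx i) ((hp.memLp ha).integrable one_le_two) ((hp.memLpx ha i).integrable one_le_two)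
      (SG.integrable ha (by linarith) ((SG.coord i).mul0 hp.sg) ((by fun_prop : Continuous fun z => z.1 i).aestronglyMeasurable.mul hp.cont.aesm_mu))
    have e2 : |∫ z, Dx i (dl f t) z ∂mu a| ≤ exp ((1 + α) * t) * D := by
      rw [hD, ← integral_const_mul, ← norm_eq_abs]
      refine norm_integral_le_of_norm_le (((integrable_nq_rpow ha _).const_mul _).const_mul _) ?_
      filter_upwards [mu_ae_mem n a] with z hz
      unfold dl
      have hq := nq_nonneg z
      rw [Dx_scl, norm_eq_abs, abs_mul, abs_of_pos (exp_pos t)]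
      have h2 := h i _ (smul_mem_Hs (exp_pos t) hz)
      rw [nq_smul, mul_rpow (sq_nonneg _) hq, ← rpow_natCast, ← rpow_mul (exp_pos t).le, ← exp_mul] at h2
      have h3 : exp ((1 + α) * t) = exp t * exp (t * ((2 : ℕ) * (α / 2))) := by
        rw [← exp_add]; congr 1; push_cast; ring
      rw [h3, mul_assoc]
      refine mulL (h2.trans ?_) (exp_pos t).le
      rw [mul_left_comm]
      refine mulL (mul_le_mul (le_abs_self C) (rpow_le_rpow hq (by linarith) (by positivity))
        (by positivity) (abs_nonneg C)) (exp_pos _).le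
    have e3 : ∫ z, dl f t z * z.1 i ∂mu a = 2 * ∫ z, Dx i (dl f t) z ∂mu a := by grind
    rw [e3, show 2 * (1 + α) * t = (1 + α) * t + (1 + α) * t by ring, exp_add]
    have := sq_le_sq' (by linarith [neg_abs_le (∫ z, Dx i (dl f t) z ∂mu a)]) ((le_abs_self _).trans e2)
    linarith
  refine (Finset.sum_le_card_nsmul _ _ _ h1).trans_eq ?_
  rw [card_univ, Fintype.card_fin, nsmul_eq_mul]; ring

lemma flux_le_exp {α C : ℝ} (hα : 0 < α) (hT0 : ∀ x, 0 ≤ T x) (h : ∀ x, T x ≤ C * (∑ i, x i ^ 2) ^ (α / 2)) :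
    ∃ K, 0 ≤ K ∧ ∀ t, (∫ x, exp t ^ (1 - a) * T (exp t • x) ∂(gamn n)) ^ 2 ≤ K * exp (2 * (1 - a + α) * t) := by
  have hq : ∀ x ∈ (univ : Set (V n)), 0 ≤ ∑ i, x i ^ 2 := fun x _ => by positivity
  obtain ⟨D, hD0, hD⟩ := GR.bound (GR.of_rpow (f := fun x : Fin n → ℝ => (∑ i, x i ^ 2) ^ (α / 2)) hq zero_le_one (α / 2) fun x hx => by
    rw [one_mul, abs_of_nonneg (by positivity)]
    exact rpow_le_rpow (hq x hx) (by linarith) (by positivity)) (θ := 1 / 8) (by norm_num)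
  set G := ∫ x : Fin n → ℝ, |C| * D * ∏ i, exp (1 / 8 * x i ^ 2) ∂(gamn n) with hG
  refine ⟨G ^ 2, sq_nonneg _, fun t => ?_⟩
  have h1 : ‖∫ x, exp t ^ (1 - a) * T (exp t • x) ∂(gamn n)‖ ≤ exp ((1 - a + α) * t) * G := by
    rw [hG, ← integral_const_mul]
    refine norm_integral_le_of_norm_le (((integrable_exp_gamn n (by norm_num)).const_mul _).const_mul _) (ae_of_all _ fun x => ?_)
    have h2 := h (exp t • x)
    simp only [Pi.smul_apply, smul_eq_mul, mul_pow] at h2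
    rw [← mul_sum, mul_rpow (sq_nonneg _) (hq x trivial), ← rpow_natCast, ← rpow_mul (exp_pos t).le, ← exp_mul] at h2
    have h3 := hD x trivial
    rw [abs_of_nonneg (by positivity), mul_sum, exp_sum] at h3
    have h4 : exp ((1 - a + α) * t) = exp t ^ (1 - a) * exp (t * ((2 : ℕ) * (α / 2))) := by
      rw [← exp_mul, ← exp_add]; congr 1; push_cast; ring
    rw [norm_eq_abs, abs_of_nonneg (mul_nonneg (by positivity) (hT0 _)), h4, mul_assoc]
    refine mulL (h2.trans ?_) (by positivity)
    rw [mul_left_comm, mul_assoc]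
    exact mulL (mul_le_mul (le_abs_self C) h3 (by positivity) (abs_nonneg C)) (exp_pos _).le
  rw [show 2 * (1 - a + α) * t = (1 - a + α) * t + (1 - a + α) * t by ring, exp_add]
  have := pow_le_pow_left₀ (norm_nonneg _) h1 2
  rw [norm_eq_abs, sq_abs] at this
  linarith
end growth

section height
variable {F U : Fn n}

/-- The rescaled slice at time `-τ`. -/
abbrev rs (U : Fn n) (τ : ℝ) (z : E n) : ℝ := U (√|τ| • z.1) (√|τ| * z.2) (-min |τ| (1 / 2))

def hN (a : ℝ) (U : Fn n) (τ : ℝ) : ℝ := N₂ a (rs U τ)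

/-- The ratio of the normalizing constants of the fundamental solution and of `mu`. -/
def wc (n : ℕ) (a : ℝ) : ℝ := (4 * π) ^ (-(n : ℝ) / 2) / ((2 : ℝ) ^ a * Gamma ((a + 1) / 2)) / (cG ^ n * cY a)

lemma hN_mem (τ : ℝ) : -min |τ| (1 / 2) ∈ Ioc (-1 : ℝ) 0 :=
  ⟨by linarith [min_le_right |τ| (1 / 2)], neg_nonpos.2 (le_min (abs_nonneg τ) (by norm_num))⟩

variable (ha : -1 < a) (hU : SignoriniMem n a F U) {T : V n → ℝ} (hT : Prof a (fin U) T)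
include hU
lemma hN_contOn (τ : ℝ) : ContinuousOn (rs U τ) (Hs n) :=
  hU.cont.comp (f := fun z : E n => (√|τ| • z.1, √|τ| * z.2, -min |τ| (1 / 2))) (by fun_prop)
    fun z hz => ⟨mul_nonneg (sqrt_nonneg _) (le_of_lt hz), hN_mem τ⟩

include hT
lemma hN_bdd : ∃ B, ∀ τ, ∀ z ∈ Hs n, |rs U τ z| ≤ B := by
  obtain ⟨M, hM0, hM⟩ := abs_sub_fin_le hU
  obtain ⟨B, hB⟩ := hT.toReg.bdd
  have hB0 := (abs_nonneg _).trans (hB 0 le_rfl)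
  refine ⟨B + M, fun τ z hz => ?_⟩
  rcases eq_or_ne τ 0 with rfl | h
  · have h0 : U 0 0 0 = 0 := fin_zero hU
    simp [rs, h0]; positivity
  have hw : (√|τ| • z : E n) ∈ Hs n := smul_mem_Hs (sqrt_pos.2 (abs_pos.2 h)) hz
  have h1 : |rs U τ z - _| ≤ _ := hM _ hw _ (hN_mem τ)
  have h2 := hB _ (le_of_lt hw)
  have h3 : M * |-min |τ| (1 / 2)| ≤ M * 1 := mulL
    (abs_le.2 ⟨by linarith [(hN_mem τ).1], by linarith [(hN_mem τ).2]⟩) hM0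
  have h4 := abs_sub_abs_le_abs_sub (rs U τ z) (fin U (√|τ| • z))
  exact (by linarith : |rs U τ z| ≤ B + M)

include ha
lemma hN_memLp (τ : ℝ) : MemLp (rs U τ) 2 (mu a) := by
  obtain ⟨B, hB⟩ := hN_bdd hU hT
  exact SG.memLp ha (b := 0) (by linarith) (SG.of_bdd (hB τ)) (hN_contOn hU τ).aesm_mu

lemma continuous_hN : Continuous (hN a U) := by
  have hprob := prob_mu n ha
  obtain ⟨B, hB⟩ := hN_bdd hU hT
  refine continuous_of_dominated (bound := fun _ => B ^ 2) (fun τ => (hN_contOn hU τ).aesm_mu.pow 2)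
    (fun τ => ?_) (integrable_const _) ?_ <;> filter_upwards [mu_ae_mem n a] with z hz
  · rw [norm_eq_abs, abs_pow]
    exact pow_le_pow_left₀ (abs_nonneg _) (hB τ z hz) 2
  · refine (hU.cont.comp_continuous (f := fun τ : ℝ => (√|τ| • z.1, √|τ| * z.2, -min |τ| (1 / 2))) (by fun_prop) fun τ => ?_).pow 2
    exact ⟨mul_nonneg (sqrt_nonneg _) (le_of_lt hz), hN_mem τ⟩

lemma hN_compare : ∃ M, 0 ≤ M ∧ ∀ t, hN a U (exp t ^ 2) ≤ 2 * N₂ a (dl (fin U) t) + M * exp (4 * t) ∧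
      N₂ a (dl (fin U) t) ≤ 2 * hN a U (exp t ^ 2) + M * exp (4 * t) := by
  have hprob := prob_mu n ha
  obtain ⟨M, hM0, hM⟩ := abs_sub_fin_le hU
  refine ⟨2 * M ^ 2, by positivity, fun t => ?_⟩
  have h1 := (hN_memLp ha hU hT (exp t ^ 2)).integrable_sq
  have h2 := ((hT.dil t).toReg.pc.memLp ha).integrable_sq
  have e : exp (4 * t) = (exp t ^ 2) ^ 2 := by rw [← pow_mul, ← exp_nat_mul]; norm_num
  have key : ∀ᵐ z ∂mu a, |rs U (exp t ^ 2) z - dl (fin U) t z| ≤ M * exp t ^ 2 := by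
    filter_upwards [mu_ae_mem n a] with z hz
    have h := hM _ (smul_mem_Hs (exp_pos t) hz) _ (hN_mem (exp t ^ 2))
    rw [rs, abs_of_pos (pow_pos (exp_pos t) 2), sqrt_sq (exp_pos t).le]
    rw [abs_of_pos (pow_pos (exp_pos t) 2), abs_neg, abs_of_nonneg (le_min (pow_pos (exp_pos t) 2).le (by norm_num : (0 : ℝ) ≤ 1 / 2))] at h
    exact h.trans (mulL (min_le_left _ _) hM0)
  have gen : ∀ f g : E n → ℝ, Integrable (fun z => f z ^ 2) (mu a) → Integrable (fun z => g z ^ 2) (mu a) →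
      (∀ᵐ z ∂mu a, |f z - g z| ≤ M * exp t ^ 2) →
      N₂ a f ≤ 2 * N₂ a g + 2 * M ^ 2 * exp (4 * t) := fun f g hf hg h => by
    have : ∫ z, (2 * g z ^ 2 + 2 * M ^ 2 * exp (4 * t)) ∂mu a = 2 * N₂ a g + 2 * M ^ 2 * exp (4 * t) := by
      rw [integral_add (hg.const_mul 2) (integrable_const _), integral_const_mul]; simp
    rw [← this]
    refine integral_mono_ae hf ((hg.const_mul 2).add (integrable_const _)) ?_
    filter_upwards [h] with z hz
    have := sq_le_sq' (by linarith [neg_abs_le (f z - g z)]) ((le_abs_self _).trans hz)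
    rw [e]
    nlinarith [sq_nonneg (f z - 2 * g z)]
  exact ⟨gen _ _ h1 h2 key, gen _ _ h2 h1 (key.mono fun z h => by rwa [abs_sub_comm])⟩

lemma hN_le (ha' : a < 1) : ∃ B, 0 < B ∧ ∀ x ∈ Ioo (0 : ℝ) 1, hN a U x ≤ B * x ^ min 1 (1 - a) := by
  obtain ⟨M, hM0, hM⟩ := hN_compare ha hU hT
  obtain ⟨C, hC0, hC⟩ := hT.toReg.abs_dl_le ha ha' (fin_zero hU)
  set γ := min 1 (1 - a) with hγ
  set D := ∫ z : E n, C ^ 2 * (1 + nq z) ^ (2 : ℝ) ∂mu a with hD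
  have hD0 : 0 ≤ D := integral_nonneg fun z => by have := nq_nonneg z; positivity
  refine ⟨2 * D + M + 1, by positivity, fun x hx => ?_⟩
  set t := log x / 2 with ht
  have e1 : exp t ^ 2 = x := by rw [← exp_nat_mul, ht]; push_cast; rw [mul_div_cancel₀ _ two_ne_zero, exp_log hx.1]
  have e2 : exp (γ * t) ^ 2 = x ^ γ := by
    rw [← e1, ← exp_nat_mul, ← exp_nat_mul, ← exp_mul]; congr 1; ring
  have e3 : exp (4 * t) ≤ x ^ γ := by
    rw [show (4 : ℝ) * t = (2 : ℕ) * ((2 : ℕ) * t) by push_cast; ring, exp_nat_mul, exp_nat_mul, e1, ← rpow_natCast]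
    exact rpow_le_rpow_of_exponent_ge hx.1 hx.2.le (by push_cast; linarith [min_le_left 1 (1 - a)])
  have ht0 : t ≤ 0 := by have := log_nonpos hx.1.le hx.2.le; linarith
  have h1 : N₂ a (dl (fin U) t) ≤ x ^ γ * D := by
    rw [hD, ← integral_const_mul]
    refine integral_mono_mu ((hT.dil t).toReg.pc.memLp ha).integrable_sq (((integrable_nq_rpow ha 2).const_mul _).const_mul _) fun z hz => ?_
    have := sq_le_sq' (by linarith [neg_abs_le (dl (fin U) t z), hC t ht0 z hz]) ((le_abs_self _).trans (hC t ht0 z hz))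
    refine this.trans_eq ?_
    rw [← e2, rpow_two]; ring
  have h2 := (hM t).1
  rw [e1] at h2
  have h3 : 0 ≤ x ^ γ := rpow_nonneg hx.1.le γ
  nlinarith

lemma integrableOn_slice {τ : ℝ} (hτ : 0 < τ) (hτ' : τ ≤ 1 / 2) :
    IntegrableOn (fun z : E n => U z.1 z.2 (-τ) ^ 2 * wgt n a (z.1, z.2, -τ)) (Hs n) ∧
    ∫ z : E n in Hs n, U z.1 z.2 (-τ) ^ 2 * wgt n a (z.1, z.2, -τ) = wc n a * hN a U τ := by
  set ρ := √τ with hρ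
  have hρ0 : 0 < ρ := sqrt_pos.2 hτ
  have hρ2 : ρ ^ 2 = τ := sq_sqrt hτ.le
  have hc := cG_pos
  have hc' := cY_pos ha
  set f : E n → ℝ := (Hs n).indicator fun z => U z.1 z.2 (-τ) ^ 2 * wgt n a (z.1, z.2, -τ) with hf
  set g : E n → ℝ := fun z => rs U τ z ^ 2 with hg
  have : Measure.IsAddHaarMeasure (volume : Measure (E n)) := by rw [Measure.volume_eq_prod]; infer_instance
  have hfg : (fun z => f (ρ • z)) = fun z => (ρ ^ (n + 1))⁻¹ * wc n a * (Hs n).indicator (fun z => g z * dens a z) z := by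
    funext z
    by_cases hz : z ∈ Hs n
    · have hz0 : 0 < z.2 := hz
      have h3 : nsq (ρ • z).1 (ρ • z).2 = ρ ^ 2 * nq z := nq_smul ρ z
      have h4 : τ ^ (-((n : ℝ) + a + 1) / 2) = (ρ ^ (n + 1))⁻¹ * ρ ^ (-a) := by
        rw [← hρ2, ← rpow_natCast, ← rpow_mul hρ0.le, ← rpow_natCast, ← rpow_neg hρ0.le, ← rpow_add hρ0]
        congr 1; push_cast; ring
      rw [hf, indicator_of_mem hz, indicator_of_mem (smul_mem_Hs hρ0 hz), hg]
      unfold wc wgt Gbar dens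
      simp only [rs, abs_neg, abs_of_pos hτ, min_eq_left hτ', h3, h4, ← hρ]
      rw [hρ2, show -(τ * nq z) / (4 * τ) = -nq z / 4 by field_simp, Prod.smul_snd, Prod.smul_fst, smul_eq_mul,
        mul_rpow hρ0.le hz0.le, rpow_neg hρ0.le]
      have := rpow_pos_of_pos hρ0 a
      field_simp
    · have h : ρ • z ∉ Hs n := fun h => hz (by
        have := smul_mem_Hs (inv_pos.2 hρ0) h
        rwa [inv_smul_smul₀ hρ0.ne'] at this)
      rw [hf, indicator_of_notMem hz, indicator_of_notMem h, mul_zero]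
  have hi : Integrable f := by
    rw [← integrable_comp_smul_iff _ f hρ0.ne', hfg]
    exact ((integrable_indicator_iff (measurableSet_Hs n)).2 ((integrable_mu ha).1 (hN_memLp ha hU hT τ).integrable_sq)).const_mul _
  refine ⟨(integrable_indicator_iff (measurableSet_Hs n)).1 hi, ?_⟩
  have h1 := Measure.integral_comp_smul_of_nonneg volume f ρ (hR := hρ0.le)
  rw [hfg, integral_const_mul, integral_indicator (measurableSet_Hs n), ← integral_mu ha, hf, integral_indicator (measurableSet_Hs n),
    Module.finrank_prod, Module.finrank_fin_fun, Module.finrank_self, smul_eq_mul, mul_assoc] at h1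
  exact (mul_left_cancel₀ (by positivity) h1).symm

lemma Hfn_eq {r : ℝ} (hr : r ∈ Ioo (0 : ℝ) (1 / 2)) : Hfn n a U r = wc n a * ((∫ x in (0 : ℝ)..r ^ 2, hN a U x) / r ^ 2) := by
  set g : Pt n → ℝ := fun p => U p.1 p.2.1 p.2.2 ^ 2 * wgt n a p with hg
  have hr2 : r ^ 2 < 1 / 4 := by nlinarith [hr.1, hr.2]
  have hvp := volume_preserving_prodAssoc (α₁ := V n) (β₁ := ℝ) (γ₁ := ℝ)
  have e1 : ∫ p in Splus n r, g p = ∫ w : E n × ℝ in Hs n ×ˢ Ioo (-r ^ 2) 0, g (w.1.1, w.1.2, w.2) := by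
    rw [← hvp.setIntegral_preimage_emb MeasurableEquiv.prodAssoc.measurableEmbedding]
    refine setIntegral_congr_set ?_
    exact Measure.set_prod_ae_eq (s := Hs n) (s' := Hs n) ae_eq_rfl Ioo_ae_eq_Ioc.symm
  have hm : AEStronglyMeasurable (fun w : E n × ℝ => g (w.1.1, w.1.2, w.2))
      ((volume.restrict (Hs n)).prod (volume.restrict (Ioo (-r ^ 2) 0))) := by
    rw [Measure.prod_restrict]
    refine ContinuousOn.aestronglyMeasurable ?_ ((measurableSet_Hs n).prod measurableSet_Ioo)
    refine ContinuousOn.mul (ContinuousOn.pow (hU.cont.comp (f := fun w : E n × ℝ => (w.1.1, w.1.2, w.2)) (by fun_prop)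
      fun w hw => ⟨le_of_lt hw.1, by linarith [hw.2.1], hw.2.2.le⟩) 2) ?_
    unfold wgt Gbar nsq
    refine ContinuousOn.mul (ContinuousOn.mul (ContinuousOn.mul continuousOn_const ?_) (ContinuousOn.rexp ?_)) ?_
    · exact ContinuousOn.rpow_const (by fun_prop) fun w hw => Or.inl (abs_pos.2 hw.2.2.ne).ne'
    · exact ContinuousOn.div (by fun_prop) (by fun_prop) fun w hw => by have := abs_pos.2 hw.2.2.ne; positivity
    · exact ContinuousOn.rpow_const (by fun_prop) fun w hw => Or.inl (ne_of_gt hw.1)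
  have hs : ∀ t ∈ Ioo (-r ^ 2) 0, IntegrableOn (fun z : E n => g (z.1, z.2, t)) (Hs n) ∧
      ∫ z : E n in Hs n, g (z.1, z.2, t) = wc n a * hN a U (-t) := fun t ht => by
    have := integrableOn_slice ha hU hT (τ := -t) (by linarith [ht.2]) (by linarith [ht.1])
    rwa [neg_neg] at this
  have hw0 : ∀ t, ∀ z ∈ Hs n, 0 ≤ g (z.1, z.2, t) := fun t z hz => by
    have := rpow_nonneg (show (0 : ℝ) < z.2 from hz).le a
    have := Gamma_pos_of_pos (by linarith : 0 < (a + 1) / 2)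
    rw [hg]; unfold wgt Gbar; positivity
  have hNc := continuous_hN ha hU hT
  have hi : Integrable (fun w : E n × ℝ => g (w.1.1, w.1.2, w.2))
      ((volume.restrict (Hs n)).prod (volume.restrict (Ioo (-r ^ 2) 0))) := by
    rw [integrable_prod_iff' hm]
    refine ⟨?_, ?_⟩
    · filter_upwards [ae_restrict_mem measurableSet_Ioo] with t ht using (hs t ht).1
    · have h1 : IntegrableOn (fun t => wc n a * hN a U (-t)) (Ioo (-r ^ 2) 0) :=
        (Continuous.integrableOn_Icc (a := -r ^ 2) (b := 0) (by fun_prop)).mono_set Set.Ioo_subset_Icc_self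
      refine h1.congr ?_
      filter_upwards [ae_restrict_mem measurableSet_Ioo] with t ht
      rw [← (hs t ht).2]
      exact setIntegral_congr_fun (measurableSet_Hs n) fun z hz => (norm_of_nonneg (hw0 t z hz)).symm
  have e2 : ∫ w : E n × ℝ in Hs n ×ˢ Ioo (-r ^ 2) 0, g (w.1.1, w.1.2, w.2) = ∫ t in Ioo (-r ^ 2) 0, wc n a * hN a U (-t) := by
    rw [Measure.volume_eq_prod, ← Measure.prod_restrict, integral_prod_symm _ hi]
    exact setIntegral_congr_fun measurableSet_Ioo fun t ht => (hs t ht).2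
  have e3 : ∫ t in Ioo (-r ^ 2) 0, wc n a * hN a U (-t) = wc n a * ∫ x in (0 : ℝ)..r ^ 2, hN a U x := by
    rw [integral_const_mul, ← integral_Ioc_eq_integral_Ioo, ← intervalIntegral.integral_of_le (by nlinarith),
      intervalIntegral.integral_comp_neg]; simp
  rw [Hfn, show (∫ p in Splus n r, U p.1 p.2.1 p.2.2 ^ 2 * wgt n a p) = _ from e1, e2, e3]
  ring
end height

lemma eventually_exp_le {f : ℝ → ℝ} {κ q : ℝ} (hf : ∀ δ > 0, ∀ᶠ t in atBot, 0 < f t ∧ |log (f t) - 2 * κ * t| ≤ δ * |t|)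
    (hq : 2 * κ < q) (K : ℝ) {η : ℝ} (hη : 0 < η) : ∀ᶠ t in atBot, K * exp (q * t) ≤ η * f t := by
  set δ := (q - 2 * κ) / 2 with hδ
  have hδ0 : 0 < δ := by linarith
  filter_upwards [hf δ hδ0, (tendsto_exp_mul_atBot hδ0 K).eventually_le_const hη, eventually_lt_atBot 0] with t h1 h2 ht
  rw [abs_of_neg ht] at h1
  have h3 : exp ((2 * κ + δ) * t) ≤ f t := by
    rw [← le_log_iff_exp_le h1.1]; linarith [(abs_le.1 h1.2).1]
  rw [show q * t = δ * t + (2 * κ + δ) * t by rw [hδ]; ring, exp_add, ← mul_assoc]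
  exact mul_le_mul h2 h3 (exp_pos _).le hη.le

lemma Prof.no_gap {u : E n → ℝ} {T : V n → ℝ} {s κ α β C D : ℝ} (hn : 1 ≤ n) (hs : 0 < s) (hs' : s < 1)
    (hu : Prof 𝔟 s u T) (hκ0 : 0 < κ) (hκ1 : κ ≠ 1 + s) (hκ2 : κ < 2)
    (hgrow : ∀ δ > 0, ∀ᶠ t in atBot, 0 < N₂ 𝔟 s (dl u t) ∧
      |log N₂ 𝔟 s (dl u t) - 2 * κ * t| ≤ δ * |t|)
    (hα : 0 < α) (hD : ∀ i, ∀ z ∈ Hs n, |Dx i u z| ≤ C * nq z ^ (α / 2))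
    (hβ : 0 < β) (hT : ∀ x, T x ≤ D * (∑ i, x i ^ 2) ^ (β / 2)) : False := by
  have ha : -1 < 1 - 2 * s := by linarith
  have ha' : 1 - 2 * s < 1 := by linarith
  have hd0 : ∀ t, 0 ≤ N₂ 𝔟 s (defect 𝔟 s κ (dl u t)) := fun t => integral_sq _
  have hz0 : ∀ t, 0 ≤ ∫ z, (κ * dl u t z - Zv (dl u t) z) ^ 2 ∂mu 𝔟 s := fun t => integral_sq _
  have hM : κ < 1 + s → ∀ η > 0, ∃ K, 0 ≤ K ∧ ∀ᶠ t in atBot, ∑ i, (∫ z, dl u t z * z.1 i ∂mu 𝔟 s) ^ 2 ≤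
      η * N₂ 𝔟 s (dl u t) + K * (N₂ 𝔟 s (defect 𝔟 s κ (dl u t)) +
          ∫ z, (κ * dl u t z - Zv (dl u t) z) ^ 2 ∂mu 𝔟 s) := fun h η hη => by
    rcases lt_or_ge 1 κ with h1 | h1
    · obtain ⟨K, hK, hK'⟩ := moment_small hn hs hs' h1 h hη
      exact ⟨K, hK, Eventually.of_forall fun t => hK' _ _ (hu.dil t)⟩
    · obtain ⟨K, hK, hK'⟩ := hu.moment_le_exp ha hα hD
      refine ⟨0, le_rfl, ?_⟩
      filter_upwards [eventually_exp_le hgrow (q := 2 * (1 + α)) (by linarith) K hη] with t ht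
      rw [zero_mul, add_zero]
      exact (hK' t).trans ht
  have key : ∃ K, 0 ≤ K ∧ ∀ η > 0, ∃ K', 0 ≤ K' ∧ ∀ᶠ t in atBot, N₂ 𝔟 s (dl u t) ≤
      K * (η * N₂ 𝔟 s (dl u t) + K' * (N₂ 𝔟 s (defect 𝔟 s κ (dl u t)) +
          ∫ z, (κ * dl u t z - Zv (dl u t) z) ^ 2 ∂mu 𝔟 s)) := by
    rcases hκ1.lt_or_gt with h | h
    · rcases lt_or_ge (2 * s) κ with h1 | h1
      · obtain ⟨K, hK, hK'⟩ := rigid_moment hn hs hs' h1 hκ2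
        refine ⟨K, hK, fun η hη => ?_⟩
        obtain ⟨L, hL, hL'⟩ := hM h η hη
        refine ⟨L + 1, by positivity, hL'.mono fun t ht => (hK' _ _ (hu.dil t)).trans (mulL ?_ hK)⟩
        linarith [hz0 t]
      · obtain ⟨K, hK, hK'⟩ := rigid_flux (n := n) ha ha' hκ0 hκ2
        refine ⟨K, hK, fun η hη => ?_⟩
        obtain ⟨L, hL, hL'⟩ := hM h (η / 2) (by positivity)
        obtain ⟨G, hG, hG'⟩ := flux_le_exp (a := 1 - 2 * s) hβ hu.Tnn hT
        refine ⟨L + 1, by positivity, ?_⟩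
        filter_upwards [hL', eventually_exp_le hgrow (q := 2 * (1 - 𝔟 s + β)) (by linarith) G (half_pos hη)] with t ht ht'
        refine (hK' _ _ (hu.dil t)).trans (mulL ?_ hK)
        linarith [hz0 t, hG' t]
    · obtain ⟨K, hK⟩ := rigid_above hn hs hs' h hκ2
      refine ⟨1, zero_le_one, fun η hη => ⟨|K|, abs_nonneg K, (hgrow 1 one_pos).mono fun t ht => ?_⟩⟩
      have := mulR (le_abs_self K) (hd0 t)
      have := mul_nonneg (abs_nonneg K) (hz0 t)
      have := mul_pos hη ht.1
      linarith [hK _ _ (hu.dil t)]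
  obtain ⟨K, hK, hK'⟩ := key
  obtain ⟨L, hL, hL'⟩ := hK' (1 / (4 * (K + 1))) (by positivity)
  have hε : 0 < 1 / (8 * (K + 1) * (L + 1)) := by positivity
  obtain ⟨t, ⟨h1, h2⟩, h3, h4, -⟩ := ((hu.exists_homogeneous ha ha' hκ2 ((hgrow 1 one_pos).mono fun t ht => ht.1)
    (fun δ hδ => (hgrow δ hδ).mono fun t ht => ht.2) hε).and_eventually (hL'.and (hgrow 1 one_pos))).exists
  generalize N₂ 𝔟 s (dl u t) = x at *
  generalize N₂ 𝔟 s (defect 𝔟 s κ (dl u t)) = d at *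
  generalize ∫ z, (κ * dl u t z - Zv (dl u t) z) ^ 2 ∂mu 𝔟 s = y at *
  have e1 : K * (1 / (4 * (K + 1)) * x) ≤ x / 4 := by
    rw [← mul_assoc, mul_one_div]
    calc K / (4 * (K + 1)) * x ≤ 1 / 4 * x := by
          gcongr 1
          rw [div_le_div_iff₀ (by positivity) (by norm_num)]; linarith
      _ = x / 4 := by ring
  have e2 : K * (L * (d + y)) ≤ x / 4 := by
    calc K * (L * (d + y)) ≤ K * (L * (2 * (1 / (8 * (K + 1) * (L + 1)) * x))) := by gcongr; linarith
      _ = K * L / ((K + 1) * (L + 1)) * (x / 4) := by field_simp; ring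
      _ ≤ 1 * (x / 4) := by
          gcongr 1
          rw [div_le_one (by positivity)]; nlinarith
      _ = x / 4 := one_mul _
  linarith [mul_add K (1 / (4 * (K + 1)) * x) (L * (d + y))]

lemma growth_fin {F U : Fn n} {l σ κ C : ℝ} (ha : -1 < a) (ha' : a < 1) (hU : SignoriniMem n a F U) {T}
    (hT : Prof a (fin U) T) (hl : 1 ≤ l) (hσ : σ ∈ Ioo (0 : ℝ) 1) (hC : 0 < C)
    (hκ : Tendsto (Phi n a U l σ C) (𝓝[diffSet n a U l σ] 0) (𝓝 κ)) (hκl : κ < l - 1 + σ) (hκ2 : κ < 2) :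
    0 < κ ∧ ∀ δ > 0, ∀ᶠ t in atBot, 0 < N₂ a (dl (fin U) t) ∧
      |log N₂ a (dl (fin U) t) - 2 * κ * t| ≤ δ * |t| := by
  obtain ⟨B, hB, hB'⟩ := hN_le ha hU hT ha'
  obtain ⟨M, hM, hM'⟩ := hN_compare ha hU hT
  have hc : 0 < wc n a := by
    have := cG_pos
    have := cY_pos ha
    have := Gamma_pos_of_pos (by linarith : 0 < (a + 1) / 2)
    unfold wc; positivity
  obtain ⟨h0, hg⟩ := growth_of_frequency hl hσ.1 hσ.2 hC hc (lt_min one_pos (sub_pos.2 ha')) hB (continuous_hN ha hU hT)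
    (fun x => integral_sq _) hB' (fun r hr => Hfn_eq ha hU hT hr) hκ hκl
  refine ⟨h0, fun δ hδ => ?_⟩
  filter_upwards [hg (δ / 2) (half_pos hδ), eventually_exp_le hg (q := 4) (by linarith) M (by norm_num : (0 : ℝ) < 1 / 2),
    eventually_lt_atBot 0, eventually_le_atBot (-(log 4 / (δ / 2)))] with t h1 h2 h3 h4
  obtain ⟨h5, h6⟩ := hM' t
  generalize N₂ a (dl (fin U) t) = x at *
  generalize hN a U (exp t ^ 2) = y at *
  have hx : y / 4 ≤ x := by linarith
  have hx' : x ≤ 4 * y := by linarith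
  have hx0 : 0 < x := by linarith
  refine ⟨hx0, ?_⟩
  have l1 := log_le_log hx0 hx'
  have l2 := log_le_log h1.1 (by linarith : y ≤ 4 * x)
  rw [log_mul (by norm_num) h1.1.ne'] at l1
  rw [log_mul (by norm_num) hx0.ne'] at l2
  have h7 : log 4 ≤ δ / 2 * -t := by rw [← div_le_iff₀' (half_pos hδ)]; linarith
  have h8 := abs_le.1 h1.2
  rw [abs_of_neg h3] at h8 ⊢
  rw [abs_le]
  constructor <;> linarith

end FG

/-- the frequency gap, κ = 1 + s or κ ≥ 2 (Lemma 7.2). -/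
theorem frequency_gap (n : ℕ) (hn : 1 ≤ n) (a : ℝ) (ha₁ : -1 < a) (ha₂ : a < 1)
    (F U : Fn n) (hU : SignoriniMem n a F U)
    (l Cl : ℝ) (hl : 4 ≤ l) (hCl : 0 < Cl) (hF : FGrowth n F l Cl)
    (hF₁ : FGradGrowth n F l Cl) (hF₂ : FTimeGrowth n F l Cl)
    (σ : ℝ) (hσ : σ ∈ Set.Ioo (0 : ℝ) 1) (C : ℝ) (hC : 0 < C)
    (hmono : ∀ r₁ ∈ diffSet n a U l σ, ∀ r₂ ∈ diffSet n a U l σ, r₁ ≤ r₂ →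
      Phi n a U l σ C r₁ ≤ Phi n a U l σ C r₂)
    (κ : ℝ) (hκ : Tendsto (Phi n a U l σ C) (𝓝[diffSet n a U l σ] 0) (𝓝 κ))
    (hκlt : κ < l - 1 + σ) :
    κ = 1 + (1 - a) / 2 ∨ 2 ≤ κ := by
  obtain ⟨s, rfl⟩ : ∃ s, a = 1 - 2 * s := ⟨(1 - a) / 2, by ring⟩
  rw [show (1 - 𝔟 s) / 2 = s by ring]
  by_contra! h
  obtain ⟨T, hT⟩ := FG.fin_prof hU (by linarith) hCl hF
  obtain ⟨α, hα, A, hA⟩ := FG.abs_Dx_le_rpow hU hT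
  obtain ⟨β, hβ, B, hB⟩ := FG.flux_le_rpow hU hT
  obtain ⟨h0, hg⟩ := FG.growth_fin ha₁ ha₂ hU hT (by linarith) hσ hC hκ hκlt h.2
  exact hT.no_gap hn (by linarith) (by linarith) h0 h.1 h.2 hg hα hA hβ hB
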